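/- Let F(x,y) = ax² + bxy + cy² with a, b, c ∈ ℤ, gcd(a,b,c) = 1, a > 0, and suppose the discriminant D_F = b² − 4ac is positive and not a perfect square. Let A ⊆ F⁻¹(−𝒫) be a set with positive relative upper asymptotic density with respect to F⁻¹(−𝒫) measured by the sup-norm on ℤ², i.e. limsup_{M→∞} #(A ∩ ℤ²(M)) / #(F⁻¹(−𝒫) ∩ ℤ²(M)) > 0. Then for every finite set S ⊆ ℤ² there exist v ∈ ℤ² and a positive integer k with v + k·s ∈ A for all s ∈ S. -/

import Mathlib

/-- The binary quadratic form `F(x, y) = a x² + b x y + c y²` on `ℤ²`. -/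
def binQF (a b c : ℤ) (v : ℤ × ℤ) : ℤ :=
  a * v.1 ^ 2 + b * v.1 * v.2 + c * v.2 ^ 2

/-- The sup-norm box `ℤ²(M)` of radius `M` in `ℤ²`. -/
def supBox (M : ℝ) : Set (ℤ × ℤ) :=
  {v : ℤ × ℤ | |(v.1 : ℝ)| ≤ M ∧ |(v.2 : ℝ)| ≤ M}

set_option linter.unusedSectionVars false

section
open Combinatorics


/-! ### Averages over finite types -/

section Average

variable {X Y K : Type*} [Fintype X] [Fintype Y] [Field K] [CharZero K]

/-- The average of a function over a finite type. -/
def avg (f : X → K) : K := (∑ x, f x) / Fintype.card X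

lemma avg_congr {f g : X → K} (h : ∀ x, f x = g x) : avg f = avg g := by
  rw [funext h]

lemma avg_const [Nonempty X] (c : K) : avg (fun _ : X => c) = c := by
  have : (Fintype.card X : K) ≠ 0 := by simp
  simp [avg, this]

lemma avg_add (f g : X → K) : avg (fun x => f x + g x) = avg f + avg g := by
  simp [avg, Finset.sum_add_distrib, add_div]

lemma avg_sub (f g : X → K) : avg (fun x => f x - g x) = avg f - avg g := by
  simp [avg, Finset.sum_sub_distrib, sub_div]

lemma avg_neg (f : X → K) : avg (fun x => - f x) = - avg f := by
  simp [avg, neg_div]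

lemma avg_mul_left (c : K) (f : X → K) : avg (fun x => c * f x) = c * avg f := by
  simp [avg, ← Finset.mul_sum, mul_div_assoc]

lemma avg_mul_right (c : K) (f : X → K) : avg (fun x => f x * c) = avg f * c := by
  simp_rw [mul_comm _ c, avg_mul_left]

lemma avg_sum {I : Type*} (s : Finset I) (f : I → X → K) :
    avg (fun x => ∑ i ∈ s, f i x) = ∑ i ∈ s, avg (f i) := by
  simp only [avg, ← Finset.sum_div]
  rw [Finset.sum_comm]

lemma avg_equiv (e : X ≃ Y) (f : Y → K) : avg (fun x => f (e x)) = avg f := by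
  simp [avg, e.sum_comp, Fintype.card_congr e]

lemma avg_prod (f : X × Y → K) : avg f = avg (fun x => avg (fun y => f (x, y))) := by
  simp [avg, Fintype.sum_prod_type, ← Finset.sum_div, div_div, mul_comm]

lemma avg_comm (f : X → Y → K) :
    avg (fun x => avg (fun y => f x y)) = avg (fun y => avg (fun x => f x y)) := by
  simp only [avg, ← Finset.sum_div, div_div]
  rw [Finset.sum_comm, mul_comm]

lemma avg_mono {f g : X → ℝ} (h : ∀ x, f x ≤ g x) : avg f ≤ avg g := by
  unfold avg; gcongr with x; exact h x

lemma avg_nonneg {f : X → ℝ} (h : ∀ x, 0 ≤ f x) : 0 ≤ avg f :=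
  div_nonneg (Finset.sum_nonneg fun x _ => h x) (Nat.cast_nonneg _)

lemma avg_le_const [Nonempty X] {f : X → ℝ} {c : ℝ} (h : ∀ x, f x ≤ c) : avg f ≤ c :=
  (avg_mono h).trans_eq (avg_const c)

lemma const_le_avg [Nonempty X] {f : X → ℝ} {c : ℝ} (h : ∀ x, c ≤ f x) : c ≤ avg f :=
  (avg_const c).symm.trans_le (avg_mono h)

lemma exists_le_of_le_avg [Nonempty X] {f : X → ℝ} {c : ℝ} (h : c ≤ avg f) : ∃ x, c ≤ f x := by
  by_contra! hc
  refine absurd h (not_le.mpr ?_)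
  rw [avg, div_lt_iff₀ (by simp [Fintype.card_pos]), mul_comm]
  calc ∑ x, f x < ∑ _x : X, c := Finset.sum_lt_sum_of_nonempty Finset.univ_nonempty fun x _ => hc x
    _ = _ := by simp

lemma norm_avg_le {E : Type*} [Fintype E] (f : E → ℂ) : ‖avg f‖ ≤ avg (fun x => ‖f x‖) := by
  simp only [avg, norm_div, RCLike.norm_natCast]
  gcongr; exact norm_sum_le _ _

lemma abs_avg_le (f : X → ℝ) : |avg f| ≤ avg (fun x => |f x|) := by
  simp only [avg, abs_div, Nat.abs_cast]
  gcongr; exact Finset.abs_sum_le_sum_abs _ _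

lemma avg_single_le {f : X → ℝ} (hf : ∀ x, 0 ≤ f x) (x : X) : f x / Fintype.card X ≤ avg f := by
  unfold avg; gcongr; exact Finset.single_le_sum (fun x _ => hf x) (Finset.mem_univ x)

lemma avg_sq_le (f : X → ℝ) : avg f ^ 2 ≤ avg (fun x => f x ^ 2) := by
  rcases isEmpty_or_nonempty X with h | h
  · simp [avg]
  rw [avg, avg, div_pow, div_le_div_iff₀ (by simp [Fintype.card_pos]) (by simp [Fintype.card_pos])]
  have := sq_sum_le_card_mul_sum_sq (s := (Finset.univ : Finset X)) (f := f)
  simp only [Finset.card_univ] at this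
  nlinarith [Nat.cast_nonneg (α := ℝ) (Fintype.card X)]

lemma avg_mul_sq_le (f g : X → ℝ) :
    avg (fun x => f x * g x) ^ 2 ≤ avg (fun x => f x ^ 2) * avg (fun x => g x ^ 2) := by
  simp only [avg, div_pow, div_mul_div_comm, ← pow_two]
  gcongr
  exact Finset.sum_mul_sq_le_sq_mul_sq _ _ _

open Classical in
/-- The density of a subset of a finite type. -/
noncomputable def dens (A : Set X) : ℝ := avg (fun x => if x ∈ A then (1 : ℝ) else 0)

lemma dens_nonneg (A : Set X) : 0 ≤ dens A := avg_nonneg fun x => by split_ifs <;> norm_num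

lemma dens_le_one (A : Set X) : dens A ≤ 1 := by
  rcases isEmpty_or_nonempty X with h | h
  · simp [dens, avg]
  · exact avg_le_const fun x => by split_ifs <;> norm_num

lemma dens_mono {A B : Set X} (h : A ⊆ B) : dens A ≤ dens B :=
  avg_mono fun x => by
    by_cases hx : x ∈ A
    · simp [hx, h hx]
    · simp only [hx, if_false]; split_ifs <;> norm_num

lemma dens_equiv (e : X ≃ Y) (A : Set Y) : dens (e ⁻¹' A) = dens A :=
  avg_equiv e (fun y => open Classical in if y ∈ A then (1 : ℝ) else 0)

lemma nonempty_of_dens_pos {A : Set X} (h : 0 < dens A) : A.Nonempty := by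
  by_contra hA
  rw [Set.not_nonempty_iff_eq_empty] at hA
  simp [hA, dens, avg] at h

/-- Popularity: if `f ≤ 1` has average at least `2 * δ`, then `δ ≤ f` on a set of density `≥ δ`. -/
lemma popular [Nonempty X] {f : X → ℝ} {δ : ℝ} (hδ : 0 ≤ δ) (h1 : ∀ x, f x ≤ 1)
    (h : 2 * δ ≤ avg f) : δ ≤ dens {x | δ ≤ f x} := by
  have : avg f ≤ avg (fun x => (open Classical in if x ∈ {x | δ ≤ f x} then (1 : ℝ) else 0) + δ) :=
    avg_mono fun x => by
      by_cases hx : δ ≤ f x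
      · simp [hx]; linarith [h1 x]
      · simp [hx]; linarith
  rw [avg_add, avg_const] at this
  unfold dens; linarith

/-- Pigeonhole for densities. -/
lemma exists_dens_ge {L : Type*} [Finite L] [Nonempty X] {A : Set X} {P : L → Set X} {δ : ℝ}
    (hA : δ ≤ dens A) (hδ : 0 < δ) (h : ∀ x ∈ A, ∃ l, x ∈ P l) :
    ∃ l, δ / (Nat.card L + 1) ≤ dens (P l) := by
  classical
  have := Fintype.ofFinite L
  have hle : dens A ≤ ∑ l, dens (P l) := by
    simp only [dens]
    rw [← avg_sum]
    refine avg_mono fun x => ?_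
    by_cases hx : x ∈ A
    · obtain ⟨l, hl⟩ := h x hx
      simp only [hx, if_true]
      exact le_trans (by simp [hl]) (Finset.single_le_sum
        (f := fun l => if x ∈ P l then (1 : ℝ) else 0)
        (fun l _ => by positivity) (Finset.mem_univ l))
    · simp only [hx, if_false]; positivity
  by_contra! hc
  obtain ⟨x, hx⟩ := nonempty_of_dens_pos (hδ.trans_le hA)
  obtain ⟨l₀, -⟩ := h x hx
  have : ∑ l, dens (P l) < ∑ _l : L, δ / (Nat.card L + 1) :=
    Finset.sum_lt_sum_of_nonempty ⟨l₀, Finset.mem_univ _⟩ fun l _ => hc l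
  rw [Finset.sum_const, Finset.card_univ, nsmul_eq_mul, Nat.card_eq_fintype_card] at this
  have h2 : (Fintype.card L : ℝ) * (δ / (Fintype.card L + 1)) ≤ δ := by
    rw [mul_div_left_comm]
    exact mul_le_of_le_one_right hδ.le (div_le_one_of_le₀ (by linarith) (by positivity))
  linarith

lemma dens_prod (A : Set (X × Y)) : dens A = avg (fun y => dens {x | (x, y) ∈ A}) := by
  rw [dens, avg_prod, avg_comm]; rfl

end Average

/-! ### Splitting cubes -/

/-- Words on a disjoint union of coordinate sets. -/
def cubeSplit {I J ι : Type*} (e : I ⊕ J ≃ ι) (α : Type*) : (I → α) × (J → α) ≃ (ι → α) :=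
  (Equiv.sumArrowEquivProdArrow I J α).symm.trans (e.arrowCongr (Equiv.refl α))

lemma cubeSplit_apply {I J ι α : Type*} (e : I ⊕ J ≃ ι) (x : I → α) (y : J → α) (c : ι) :
    cubeSplit e α (x, y) c = Sum.elim x y (e.symm c) := rfl

lemma exists_split (n : ℕ) (ι : Type) [Fintype ι] (h : n ≤ Fintype.card ι) :
    ∃ m, Fintype.card ι = n + m ∧ Nonempty (Fin n ⊕ Fin m ≃ ι) := by
  obtain ⟨m, hm⟩ := Nat.exists_eq_add_of_le h
  exact ⟨m, hm, ⟨finSumFinEquiv.trans (Fintype.equivFinOfCardEq hm).symm⟩⟩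

instance Combinatorics.Subspace.instFinite {η α ι : Type*} [Finite η] [Finite α] [Finite ι] :
    Finite (Subspace η α ι) :=
  Finite.of_injective Subspace.idxFun fun _ _ h => Subspace.ext h

instance Combinatorics.Line.instFinite {α ι : Type*} [Finite α] [Finite ι] :
    Finite (Line α ι) :=
  Finite.of_injective Line.idxFun fun _ _ h => Line.ext h

namespace DHJ

/-- Composition of combinatorial subspaces. -/
def comp {ζ η α ι : Type*} (V : Subspace η α ι) (U : Subspace ζ α η) : Subspace ζ α ι where
  idxFun i := (V.idxFun i).elim Sum.inl U.idxFun
  proper e := by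
    obtain ⟨j, hj⟩ := U.proper e
    obtain ⟨i, hi⟩ := V.proper j
    exact ⟨i, by simp [hi, hj]⟩

lemma comp_apply {ζ η α ι : Type*} (V : Subspace η α ι) (U : Subspace ζ α η) (x : ζ → α) :
    comp V U x = V (U x) := by
  ext i
  simp only [comp, Subspace.coe_apply]
  rcases V.idxFun i with a | j <;> simp [Subspace.coe_apply]

/-- Place a subspace on the first factor, with constant word on the second. -/
def extendLeft {I J ι η α : Type*} (e : I ⊕ J ≃ ι) (V : Subspace η α I) (y : J → α) :
    Subspace η α ι where
  idxFun c := Sum.elim V.idxFun (fun j => Sum.inl (y j)) (e.symm c)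
  proper a := by
    obtain ⟨i, hi⟩ := V.proper a
    exact ⟨e (Sum.inl i), by simp [hi]⟩

lemma extendLeft_apply {I J ι η α : Type*} (e : I ⊕ J ≃ ι) (V : Subspace η α I) (y : J → α)
    (x : η → α) : extendLeft e V y x = cubeSplit e α (V x, y) := by
  ext c
  rw [cubeSplit_apply]
  simp only [extendLeft, Subspace.coe_apply]
  rcases e.symm c with i | j <;> simp [Subspace.coe_apply]

/-- Place a subspace on the second factor, with constant word on the first. -/
def extendRight {I J ι η α : Type*} (e : I ⊕ J ≃ ι) (V : Subspace η α J) (y : I → α) :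
    Subspace η α ι :=
  extendLeft ((Equiv.sumComm J I).trans e) V y

lemma extendRight_apply {I J ι η α : Type*} (e : I ⊕ J ≃ ι) (V : Subspace η α J) (y : I → α)
    (x : η → α) : extendRight e V y x = cubeSplit e α (y, V x) := by
  ext c
  rw [extendRight, extendLeft_apply, cubeSplit_apply, cubeSplit_apply]
  simp only [Equiv.symm_trans_apply, Equiv.sumComm_symm]
  rcases e.symm c with i | j <;> simp

/-- The density Hales–Jewett property for lines above a fixed density. -/
def LineProp (α : Type) [Fintype α] (δ : ℝ) : Prop :=
  ∃ n, ∀ (ι : Type) [Fintype ι] [DecidableEq ι], n ≤ Fintype.card ι → ∀ A : Set (ι → α), δ ≤ dens A →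
    ∃ l : Line α ι, ∀ x, l x ∈ A

/-- The multidimensional density Hales–Jewett property. -/
def SubspaceProp (α : Type) [Fintype α] : Prop :=
  ∀ (m : ℕ) (δ : ℝ), 0 < δ → ∃ n, ∀ (ι : Type) [Fintype ι] [DecidableEq ι], n ≤ Fintype.card ι →
    ∀ A : Set (ι → α), δ ≤ dens A → ∃ V : Subspace (Fin m) α ι, ∀ x, V x ∈ A

end DHJ
end

section
open Combinatorics

namespace DHJ

section
variable {α : Type} [Fintype α] [Nonempty α]

lemma dens_split {I J ι : Type} [Fintype I] [Fintype J] [Fintype ι] [DecidableEq I] [DecidableEq J]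
    [DecidableEq ι] (e : I ⊕ J ≃ ι) (A : Set (ι → α)) :
    dens A = avg (fun y : J → α => dens {x : I → α | cubeSplit e α (x, y) ∈ A}) := by
  rw [← dens_equiv (cubeSplit e α) A, dens_prod]; rfl

lemma avg_split {I J ι : Type} [Fintype I] [Fintype J] [Fintype ι] [DecidableEq I] [DecidableEq J]
    [DecidableEq ι] (e : I ⊕ J ≃ ι) (f : (ι → α) → ℝ) :
    avg f = avg (fun x : I → α => avg (fun y : J → α => f (cubeSplit e α (x, y)))) := by
  rw [← avg_equiv (cubeSplit e α) f, avg_prod]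

/-- A line as a one-dimensional subspace, glued with a subspace on the remaining coordinates. -/
def lineGlue {I J ι : Type} {m : ℕ} (e : I ⊕ J ≃ ι) (l : Line α I) (V : Subspace (Fin m) α J) :
    Subspace (Fin (m + 1)) α ι where
  idxFun c := Sum.elim (fun i => (l.idxFun i).elim (Sum.inr 0) Sum.inl)
    (fun j => (V.idxFun j).map id Fin.succ) (e.symm c)
  proper a := by
    refine Fin.cases ?_ (fun b => ?_) a
    · obtain ⟨i, hi⟩ := l.proper
      exact ⟨e (Sum.inl i), by simp [hi]⟩
    · obtain ⟨i, hi⟩ := V.proper b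
      exact ⟨e (Sum.inr i), by simp [hi]⟩

lemma lineGlue_apply {I J ι : Type} {m : ℕ} (e : I ⊕ J ≃ ι) (l : Line α I)
    (V : Subspace (Fin m) α J) (x : Fin (m + 1) → α) :
    lineGlue e l V x = cubeSplit e α (l (x 0), V (fun i => x i.succ)) := by
  ext c
  rw [cubeSplit_apply]
  simp only [lineGlue, Subspace.coe_apply]
  rcases e.symm c with i | j
  · rcases h : l.idxFun i with _ | a <;> simp [h, Line.coe_apply]
  · rcases h : V.idxFun j with a | b <;> simp [h, Subspace.coe_apply]

lemma subspaceProp_of_lineProp (h : ∀ δ > 0, LineProp α δ) : SubspaceProp α := by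
  intro m
  induction m with
  | zero =>
    intro δ hδ
    refine ⟨0, fun ι _ _ _ A hA => ?_⟩
    obtain ⟨x, hx⟩ := nonempty_of_dens_pos (hδ.trans_le hA)
    exact ⟨⟨fun i => Sum.inl (x i), fun e => e.elim0⟩, fun y => hx⟩
  | succ m ih =>
    intro δ hδ
    obtain ⟨n₀, hn₀⟩ := h (δ / 2) (by positivity)
    obtain ⟨n₁, hn₁⟩ := ih (δ / 2 / (Nat.card (Line α (Fin n₀)) + 1)) (by positivity)
    refine ⟨n₀ + n₁, fun ι _ _ hι A hA => ?_⟩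
    obtain ⟨k, hk, ⟨e⟩⟩ := exists_split n₀ ι (by omega)
    rw [dens_split e] at hA
    have hpop := popular (δ := δ / 2) (by positivity) (fun y => dens_le_one _)
      ((mul_div_cancel₀ δ two_ne_zero).trans_le hA)
    obtain ⟨l, hl⟩ := exists_dens_ge (L := Line α (Fin n₀))
      (P := fun l => {y | ∀ a, cubeSplit e α (l a, y) ∈ A}) hpop (by positivity)
      (fun y hy => hn₀ _ (by simp) _ hy)
    obtain ⟨V, hV⟩ := hn₁ (Fin k) (by simp; omega) _ hl
    refine ⟨lineGlue e l V, fun x => ?_⟩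
    rw [lineGlue_apply]
    exact hV _ _

end

/-! ### Insensitive sets -/

section
variable {β : Type} [Fintype β]

/-- `E` is insensitive to exchanging the letters `none` and `some b`. -/
def Insens {ι : Type} (b : β) (E : Set (ι → Option β)) : Prop :=
  ∀ x y : ι → Option β, (∀ c, (x c).getD b = (y c).getD b) → x ∈ E → y ∈ E

lemma Insens.subspace {ι η : Type} {b : β} {E : Set (ι → Option β)} (h : Insens b E)
    (V : Subspace η (Option β) ι) : Insens b {x | V x ∈ E} := by
  intro x y hxy hx
  refine h _ _ (fun c => ?_) hx
  simp only [Subspace.coe_apply]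
  rcases V.idxFun c with a | j
  · rfl
  · exact hxy j

lemma Insens.left {I J ι : Type} {b : β} {E : Set (ι → Option β)} (h : Insens b E)
    (e : I ⊕ J ≃ ι) (y : J → Option β) : Insens b {x | cubeSplit e _ (x, y) ∈ E} := by
  intro x x' hx hE
  refine h _ _ (fun c => ?_) hE
  simp only [cubeSplit_apply]
  rcases e.symm c with i | j
  · exact hx i
  · rfl

lemma Insens.right {I J ι : Type} {b : β} {E : Set (ι → Option β)} (h : Insens b E)
    (e : I ⊕ J ≃ ι) (x : I → Option β) : Insens b {y | cubeSplit e _ (x, y) ∈ E} := by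
  intro y y' hy hE
  refine h _ _ (fun c => ?_) hE
  simp only [cubeSplit_apply]
  rcases e.symm c with i | j
  · rfl
  · exact hy j

/-- Rerandomise all letters different from `none`. -/
def mixEquiv (ι : Type) : (ι → Option β) × (ι → β) ≃ (ι → Option β) × (ι → β) where
  toFun p := (fun c => (p.1 c).map fun _ => p.2 c, fun c => (p.1 c).getD (p.2 c))
  invFun p := (fun c => (p.1 c).map fun _ => p.2 c, fun c => (p.1 c).getD (p.2 c))
  left_inv p := by
    ext c : 2 <;> simp only <;> rcases h : p.1 c with _ | a <;> simp
  right_inv p := by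
    ext c : 2 <;> simp only <;> rcases h : p.1 c with _ | a <;> simp

variable [Nonempty β]

lemma avg_mix {ι : Type} [Fintype ι] [DecidableEq ι] (f : (ι → Option β) → ℝ) :
    avg f = avg (fun x : ι → Option β => avg (fun u : ι → β => f (fun c => (x c).map fun _ => u c))) := by
  have h := avg_equiv (mixEquiv (β := β) ι) (fun p => f p.1)
  rw [avg_prod, avg_prod] at h
  simp only [avg_const] at h
  exact h.symm

/-- Few words have few letters different from `none`. -/
lemma dens_few {ι : Type} [Fintype ι] [DecidableEq ι] (n : ℕ) :
    dens {x : ι → Option β | Fintype.card {c // x c ≠ none} < n} ≤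
      2 ^ n * (3 / 4 : ℝ) ^ Fintype.card ι := by
  classical
  let w : Option β → ℝ := fun a => if a = none then 1 else 1 / 2
  have h1 : avg (fun x : ι → Option β => ∏ c, w (x c)) ≤ (3 / 4 : ℝ) ^ Fintype.card ι := by
    have hs : ∑ x : ι → Option β, ∏ c, w (x c) = (∑ a, w a) ^ Fintype.card ι := by
      rw [← Finset.card_univ (α := ι), ← Finset.prod_const, Finset.prod_univ_sum]
      simp
    have hb : (1 : ℝ) ≤ Fintype.card β := by exact_mod_cast Fintype.card_pos
    rw [avg, hs, Fintype.card_fun, Nat.cast_pow, ← div_pow]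
    refine pow_le_pow_left₀ ?_ ?_ _
    · have : ∀ a, 0 ≤ w a := fun a => by simp only [w]; split_ifs <;> norm_num
      exact div_nonneg (Finset.sum_nonneg fun a _ => this a) (by positivity)
    · rw [div_le_iff₀ (by positivity)]
      simp [w, Fintype.sum_option]
      linarith
  have h2 : dens {x : ι → Option β | Fintype.card {c // x c ≠ none} < n} ≤
      avg (fun x : ι → Option β => 2 ^ n * ∏ c, w (x c)) := by
    refine avg_mono fun x => ?_
    have hw : ∏ c, w (x c) = (1 / 2) ^ Fintype.card {c // x c ≠ none} := by
      simp only [w]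
      rw [Finset.prod_ite, Fintype.card_subtype]
      simp
    rw [hw]
    split_ifs with hx
    · have : (1 / 2 : ℝ) ^ n ≤ (1 / 2) ^ Fintype.card {c // x c ≠ none} :=
        pow_le_pow_of_le_one (by norm_num) (by norm_num) (le_of_lt hx)
      calc (1 : ℝ) = 2 ^ n * (1 / 2) ^ n := by rw [← mul_pow]; norm_num
        _ ≤ _ := by gcongr
    · positivity
  rw [avg_mul_left] at h2
  exact h2.trans (by gcongr)

/-- A dense insensitive set contains a subspace. -/
lemma exists_subspace_of_insens (hβ : SubspaceProp β) (m : ℕ) {κ : ℝ} (hκ : 0 < κ) :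
    ∃ n, ∀ (ι : Type) [Fintype ι] [DecidableEq ι], n ≤ Fintype.card ι →
      ∀ (b : β) (E : Set (ι → Option β)), Insens b E → κ ≤ dens E →
        ∃ V : Subspace (Fin m) (Option β) ι, ∀ x, V x ∈ E := by
  classical
  obtain ⟨n₀, hn₀⟩ := hβ m (κ / 2) (by positivity)
  obtain ⟨n, hn⟩ := exists_pow_lt_of_lt_one (show 0 < κ / 2 / 2 ^ n₀ by positivity)
    (show (3 / 4 : ℝ) < 1 by norm_num)
  refine ⟨n, fun ι _ _ hι b E hE hd => ?_⟩
  have hfew := dens_few (β := β) (ι := ι) n₀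
  have hsmall : 2 ^ n₀ * (3 / 4 : ℝ) ^ Fintype.card ι < κ / 2 := by
    have : (3 / 4 : ℝ) ^ Fintype.card ι ≤ (3 / 4) ^ n :=
      pow_le_pow_of_le_one (by norm_num) (by norm_num) hι
    rw [← lt_div_iff₀' (by positivity)]
    exact this.trans_lt hn
  obtain ⟨x, hxP, hxE⟩ : ∃ x : ι → Option β, n₀ ≤ Fintype.card {c // x c ≠ none} ∧
      κ / 2 ≤ dens {u : ι → β | (fun c => (x c).map fun _ => u c) ∈ E} := by
    by_contra! hcon
    have : dens E ≤ κ / 2 + dens {x : ι → Option β | Fintype.card {c // x c ≠ none} < n₀} := by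
      rw [dens, avg_mix, dens, ← avg_const (X := ι → Option β) (κ / 2), ← avg_add]
      refine avg_mono fun x => ?_
      by_cases hx : Fintype.card {c // x c ≠ none} < n₀
      · simp only [Set.mem_ofPred_eq, hx, if_true]
        have := dens_le_one {u : ι → β | (fun c => (x c).map fun _ => u c) ∈ E}
        simp only [dens, Set.mem_ofPred_eq] at this
        linarith
      · simp only [Set.mem_ofPred_eq, hx, if_false, add_zero]
        exact (hcon x (not_lt.mp hx)).le
    linarith
  let P := {c // x c ≠ none}
  let Q := {c // ¬ x c ≠ none}
  let e : P ⊕ Q ≃ ι := Equiv.sumCompl _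
  rw [dens_split e] at hxE
  obtain ⟨v, hv⟩ := exists_le_of_le_avg hxE
  obtain ⟨U, hU⟩ := hn₀ P hxP _ hv
  let V : Subspace (Fin m) (Option β) ι :=
    { idxFun := fun c => if h : x c ≠ none then (U.idxFun ⟨c, h⟩).map some id else Sum.inl none
      proper := fun a => by
        obtain ⟨i, hi⟩ := U.proper a
        exact ⟨i.1, by rw [dif_pos i.2]; simp [hi]⟩ }
  refine ⟨V, fun z => hE _ _ (fun c => ?_) (hU fun j => (z j).getD b)⟩
  rw [cubeSplit_apply]
  simp only [V, Subspace.coe_apply]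
  by_cases h : x c ≠ none
  · obtain ⟨d, hd⟩ := Option.ne_none_iff_exists'.mp h
    have hec : e.symm c = Sum.inl ⟨c, h⟩ := by
      rw [Equiv.symm_apply_eq]; rfl
    rw [dif_pos h, hec]
    rcases hU' : U.idxFun ⟨c, h⟩ with a | j <;> simp [hd, hU', Subspace.coe_apply]
  · rw [dif_neg h]
    simp [not_not.mp h]

end

end DHJ
end

section
open Combinatorics

namespace DHJ

lemma subspace_injective {η α ι : Type} (V : Subspace η α ι) : Function.Injective V := by
  intro x y h
  ext e
  obtain ⟨i, hi⟩ := V.proper e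
  have := congrFun h i
  rwa [Subspace.apply_inr hi, Subspace.apply_inr hi] at this

section
variable {β : Type} [Fintype β] [Nonempty β]

lemma avg_range {X Y : Type} [Fintype X] [Fintype Y] [Nonempty X] {V : X → Y}
    [∀ t, Decidable (t ∈ Set.range V)] (hV : Function.Injective V) (h : Y → ℝ) :
    avg (fun t => if t ∈ Set.range V then h t else 0) =
      (Fintype.card X : ℝ) / Fintype.card Y * avg (fun x => h (V x)) := by
  have : ∑ t, (if t ∈ Set.range V then h t else 0) = ∑ x, h (V x) := by
    classical
    rw [← Finset.sum_filter, ← Finset.sum_image (s := Finset.univ) (g := V) (fun _ _ _ _ h => hV h)]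
    congr 1; ext t; simp
  have hX : (Fintype.card X : ℝ) ≠ 0 := by simp
  rw [avg, this, avg]; field_simp

set_option maxHeartbeats 1000000 in
open Classical in
lemma avg_insens_le (hβ : SubspaceProp β) (m : ℕ) {γ : ℝ} (hγ : 0 < γ) :
    ∃ n, ∀ (ι : Type) [Fintype ι] [DecidableEq ι], n ≤ Fintype.card ι →
      ∀ (b : β) (E : Set (ι → Option β)), Insens b E → ∀ (g : (ι → Option β) → ℝ) (c : ℝ),
        (∀ x, g x ≤ 1) → 0 ≤ c →
        (∀ V : Subspace (Fin m) (Option β) ι, avg (fun x => g (V x)) ≤ c) →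
        avg (fun x => if x ∈ E then g x else 0) ≤ c + γ := by
  set q := min (γ / 2) 1 with hq
  have hq0 : 0 < q := by positivity
  obtain ⟨m₁, hm₁⟩ := exists_subspace_of_insens hβ m (κ := q / 2) (by positivity)
  set p : ℝ := (Fintype.card (Fin m → Option β) : ℝ) / Fintype.card (Fin m₁ → Option β) with hp
  set κ₀ : ℝ := q / 2 / (Nat.card (Subspace (Fin m) (Option β) (Fin m₁)) + 1) with hκ₀
  have hp0 : 0 < p := by positivity
  have hκ0 : 0 < κ₀ := by positivity
  set κ := min (p * κ₀) 1 with hκ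
  have hκpos : 0 < κ := by positivity
  have hκ1 : 0 ≤ 1 - κ := by simp [hκ]
  have key : ∀ r : ℕ, ∀ (ι : Type) [Fintype ι] [DecidableEq ι], r * m₁ ≤ Fintype.card ι →
      ∀ (b : β) (E : Set (ι → Option β)), Insens b E → ∀ (g : (ι → Option β) → ℝ) (c : ℝ),
        (∀ x, g x ≤ 1) → 0 ≤ c →
        (∀ V : Subspace (Fin m) (Option β) ι, avg (fun x => g (V x)) ≤ c) →
        avg (fun x => if x ∈ E then g x else 0) ≤ c * dens E + q + (1 - κ) ^ r * dens E := by
    intro r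
    induction r with
    | zero =>
      intro ι _ _ _ b E _ g c hg hc _
      have : avg (fun x => if x ∈ E then g x else 0) ≤ dens E :=
        avg_mono fun x => by split_ifs <;> simp [hg]
      have := mul_nonneg hc (dens_nonneg E)
      simp; linarith
    | succ r ih =>
      intro ι _ _ hι b E hE g c hg hc hV
      have htriv : avg (fun x => if x ∈ E then g x else 0) ≤ dens E :=
        avg_mono fun x => by split_ifs <;> simp [hg]
      have hcE := mul_nonneg hc (dens_nonneg E)
      by_cases hd : dens E ≤ q
      · have := mul_nonneg (pow_nonneg hκ1 (r + 1)) (dens_nonneg E)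
        linarith
      obtain ⟨k, hk, ⟨e⟩⟩ := exists_split m₁ ι (by nlinarith)
      have hd' := (not_le.mp hd).le
      rw [dens_split e] at hd'
      have hpop := popular (δ := q / 2) (by positivity) (fun y => dens_le_one _)
        ((mul_div_cancel₀ q two_ne_zero).trans_le hd')
      obtain ⟨U, hU⟩ := exists_dens_ge (L := Subspace (Fin m) (Option β) (Fin m₁))
        (P := fun U => {y | ∀ a, cubeSplit e _ (U a, y) ∈ E}) hpop (by positivity)
        (fun y hy => hm₁ _ (by simp) b _ (hE.left e y) hy)
      set Y : Set (Fin k → Option β) := {y | ∀ a, cubeSplit e _ (U a, y) ∈ E} with hY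
      obtain ⟨E', hE'def⟩ : ∃ E' : (Fin m₁ → Option β) → Set (Fin k → Option β), ∀ t y,
          y ∈ E' t ↔ cubeSplit e _ (t, y) ∈ E ∧ ¬ (t ∈ Set.range U ∧ y ∈ Y) :=
        ⟨fun t => {y | cubeSplit e _ (t, y) ∈ E ∧ ¬ (t ∈ Set.range U ∧ y ∈ Y)},
          fun _ _ => Iff.rfl⟩
      have hE' : ∀ t, Insens b (E' t) := by
        intro t y y' hyy hy
        rw [hE'def] at hy ⊢
        refine ⟨hE.right e t y y' hyy hy.1, fun h => hy.2 ⟨h.1, fun a => ?_⟩⟩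
        exact hE.right e (U a) y' y (fun c => (hyy c).symm) (h.2 a)
      have hdec : ∀ h : (ι → Option β) → ℝ, avg (fun x => if x ∈ E then h x else 0) =
          avg (fun t => avg fun y => if y ∈ E' t then h (cubeSplit e _ (t, y)) else 0) +
          avg (fun y => if y ∈ Y then p * avg (fun a => h (cubeSplit e _ (U a, y))) else 0) := by
        intro h
        have h2 : ∀ y, (if y ∈ Y then p * avg (fun a => h (cubeSplit e _ (U a, y))) else 0) =
            avg (fun t => if t ∈ Set.range U ∧ y ∈ Y then h (cubeSplit e _ (t, y)) else 0) := by
          intro y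
          by_cases hy : y ∈ Y
          · simp only [hy, if_true, and_true]
            exact (avg_range (subspace_injective U) fun t => h (cubeSplit e _ (t, y))).symm
          · simp [hy, avg]
        simp_rw [h2]
        rw [avg_split e, avg_comm (fun (y : Fin k → Option β) (t : Fin m₁ → Option β) => ite _ _ _),
          ← avg_add]
        refine avg_congr fun t => ?_
        rw [← avg_add]
        refine avg_congr fun y => ?_
        by_cases h1 : t ∈ Set.range U ∧ y ∈ Y
        · obtain ⟨⟨a, rfl⟩, hy⟩ := h1
          have : cubeSplit e _ (U a, y) ∈ E := hy a
          simp [hE'def, this, hy]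
        · have : y ∈ E' t ↔ cubeSplit e _ (t, y) ∈ E := by
            rw [hE'def]
            exact ⟨fun h => h.1, fun h => ⟨h, h1⟩⟩
          simp only [this, h1, if_false, add_zero]
      have hdens : dens E = avg (fun t => dens (E' t)) + p * dens Y := by
        have := hdec fun _ => 1
        simp only [avg_const] at this
        rw [dens, this, dens, ← avg_mul_left]
        simp [dens]
      rw [hdec g]
      have h1 : avg (fun y => if y ∈ Y then p * avg (fun a => g (cubeSplit e _ (U a, y))) else 0)
          ≤ p * c * dens Y := by
        rw [dens, ← avg_mul_left]
        refine avg_mono fun y => ?_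
        split_ifs
        · have := hV (extendLeft e U y)
          simp only [extendLeft_apply] at this
          rw [mul_one]; gcongr
        · simp
      have h2 : avg (fun t => avg fun y => if y ∈ E' t then g (cubeSplit e _ (t, y)) else 0) ≤
          avg (fun t => (c + (1 - κ) ^ r) * dens (E' t) + q) := by
        refine avg_mono fun t => ?_
        have := ih (Fin k) (by simp; nlinarith) b (E' t) (hE' t)
          (fun y => g (cubeSplit e _ (t, y))) c (fun y => hg _) hc (fun V => by
            have := hV (extendRight e V t)
            simpa only [extendRight_apply] using this)
        linarith
      rw [avg_add, avg_mul_left, avg_const] at h2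
      have h3 : κ * dens E ≤ p * dens Y := by
        calc κ * dens E ≤ (p * κ₀) * 1 := by
              refine mul_le_mul (min_le_left _ _) (dens_le_one E) (dens_nonneg E) (by positivity)
          _ ≤ _ := by rw [mul_one]; gcongr
      have h4 : (1 - κ) ^ r * avg (fun t => dens (E' t)) ≤ (1 - κ) ^ (r + 1) * dens E := by
        rw [pow_succ, mul_assoc]
        gcongr
        linarith
      rw [hdens] at *
      nlinarith
  obtain ⟨r, hr⟩ := exists_pow_lt_of_lt_one (show 0 < γ / 2 by positivity)
    (show 1 - κ < 1 by linarith)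
  refine ⟨r * m₁, fun ι _ _ hι b E hE g c hg hc hV => ?_⟩
  have h := key r ι hι b E hE g c hg hc hV
  have h1 : c * dens E ≤ c := mul_le_of_le_one_right hc (dens_le_one E)
  have h2 : (1 - κ) ^ r * dens E ≤ (1 - κ) ^ r :=
    mul_le_of_le_one_right (by positivity) (dens_le_one E)
  have h3 : q ≤ γ / 2 := min_le_left _ _
  linarith

open Classical in
/-- On an intersection of insensitive sets, a function has almost no density increment, if it has
none on subspaces. -/
lemma avg_inter_insens_le (hβ : SubspaceProp β) (s : Finset β) : ∀ (m : ℕ) {γ : ℝ}, 0 < γ →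
    ∃ n, ∀ (ι : Type) [Fintype ι] [DecidableEq ι], n ≤ Fintype.card ι →
      ∀ (E : β → Set (ι → Option β)), (∀ b, Insens b (E b)) →
      ∀ (f : (ι → Option β) → ℝ) (d : ℝ), (∀ x, f x ≤ 1) → 0 ≤ d →
        (∀ V : Subspace (Fin m) (Option β) ι, avg (fun x => f (V x)) ≤ d) →
        avg (fun x => if ∀ b ∈ s, x ∈ E b then f x - d else 0) ≤ γ := by
  induction s using Finset.induction_on with
  | empty =>
    intro m γ hγ
    refine ⟨m, fun ι _ _ hι E hE f d hf hd hV => ?_⟩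
    obtain ⟨k, hk, ⟨e⟩⟩ := exists_split m ι hι
    simp only [Finset.notMem_empty, IsEmpty.forall_iff, implies_true, if_true]
    rw [avg_sub, avg_const, avg_split e, avg_comm]
    have : avg (fun y => avg fun x => f (cubeSplit e _ (x, y))) ≤ d := by
      refine avg_le_const fun y => ?_
      have := hV (extendLeft e default y)
      simp only [extendLeft_apply] at this
      exact this
    linarith
  | insert b s _ ih =>
    intro m γ hγ
    obtain ⟨m', hm'⟩ := ih m (γ := γ / 2) (by positivity)
    obtain ⟨n, hn⟩ := avg_insens_le hβ m' (γ := γ / 2) (by positivity)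
    refine ⟨n, fun ι _ _ hι E hE f d hf hd hV => ?_⟩
    have := hn ι hι b (E b) (hE b) (fun x => if ∀ b ∈ s, x ∈ E b then f x - d else 0) (γ / 2)
      (fun x => by split_ifs <;> linarith [hf x]) (by positivity) (fun V => by
        refine hm' (Fin m') (by simp) (fun b => {x | V x ∈ E b}) (fun b => (hE b).subspace V)
          (fun x => f (V x)) d (fun x => hf _) hd fun U => ?_
        have := hV (comp V U)
        simpa only [comp_apply] using this)
    rw [add_halves] at this
    refine le_of_eq_of_le (avg_congr fun x => ?_) this
    by_cases h1 : x ∈ E b <;> simp [h1]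

end

end DHJ
end

section
open Combinatorics

namespace DHJ

section
variable {α : Type} [Fintype α] [Nonempty α]

/-- The image of a line in a subspace. -/
def lineComp {η ι : Type} (V : Subspace η α ι) (l : Line α η) : Line α ι where
  idxFun i := (V.idxFun i).elim some l.idxFun
  proper := by
    obtain ⟨j, hj⟩ := l.proper
    obtain ⟨i, hi⟩ := V.proper j
    exact ⟨i, by simp [hi, hj]⟩

lemma lineComp_apply {η ι : Type} (V : Subspace η α ι) (l : Line α η) (a : α) :
    lineComp V l a = V (l a) := by
  ext i
  simp only [lineComp, Subspace.coe_apply, Line.coe_apply]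
  rcases V.idxFun i with b | j <;> simp [Line.coe_apply]

lemma LineProp.mono {δ δ' : ℝ} (h : LineProp α δ) (hδ : δ ≤ δ') : LineProp α δ' := by
  obtain ⟨n, hn⟩ := h
  exact ⟨n, fun ι _ _ hι A hA => hn ι hι A (hδ.trans hA)⟩

lemma dens_split' {I J ι : Type} [Fintype I] [Fintype J] [Fintype ι] [DecidableEq I]
    [DecidableEq J] [DecidableEq ι] (e : I ⊕ J ≃ ι) (A : Set (ι → α)) :
    dens A = avg (fun x : I → α => dens {y : J → α | cubeSplit e α (x, y) ∈ A}) := by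
  rw [dens, avg_split e]; rfl

lemma avg_dens_comm {X Y : Type} [Fintype X] [Fintype Y] (P : X → Y → Prop) :
    avg (fun y => dens {x | P x y}) = avg (fun x => dens {y | P x y}) := by
  simp only [dens]; rw [avg_comm]; rfl

end

variable {β : Type} [Fintype β] [Nonempty β]

/-- The pulled-back subspace used in the density increment: variables sent to a letter of the
line `l` are made constant. -/
def pull {M : Type} {m k : ℕ} (W : Subspace (Option (Fin k)) (β ⊕ Fin m) M)
    (l : Subspace (Fin 1) β (Fin m)) : Subspace (Fin k) (Option β) M where
  idxFun c := (W.idxFun c).elim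
    (Sum.elim (fun b => Sum.inl (some b))
      fun i => (l.idxFun i).elim (fun b => Sum.inl (some b)) fun _ => Sum.inl none)
    (fun e => e.elim (Sum.inl none) Sum.inr)
  proper e := by
    obtain ⟨c, hc⟩ := W.proper (some e)
    exact ⟨c, by simp [hc]⟩

lemma pull_none {M : Type} {m k : ℕ} (W : Subspace (Option (Fin k)) (β ⊕ Fin m) M)
    (l : Subspace (Fin 1) β (Fin m)) (x : Fin k → Option β) : ∃ c, pull W l x c = none := by
  obtain ⟨c, hc⟩ := W.proper none
  exact ⟨c, by simp [pull, Subspace.coe_apply, hc]⟩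

lemma pull_getD {M : Type} {m k : ℕ} (W : Subspace (Option (Fin k)) (β ⊕ Fin m) M)
    (l : Subspace (Fin 1) β (Fin m)) (x : Fin k → Option β) :
    ∃ u : Option (Fin k) → β ⊕ Fin m, ∀ b c,
      (pull W l x c).getD b = (W u c).elim id (l fun _ => b) := by
  obtain ⟨i₀, hi₀⟩ := l.proper 0
  refine ⟨fun e => e.elim (Sum.inr i₀) fun j => (x j).elim (Sum.inr i₀) Sum.inl, fun b c => ?_⟩
  simp only [pull, Subspace.coe_apply]
  rcases W.idxFun c with (b' | i) | (_ | j)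
  · simp
  · rcases h : l.idxFun i with b' | j <;> simp [h, Subspace.coe_apply]
  · simp [hi₀, Subspace.coe_apply]
  · rcases h : x j with _ | b' <;> simp [h, hi₀, Subspace.coe_apply]

open Classical in
/-- An intersection of insensitive sets of positive density, disjoint from a set of density
almost `d`, forces a density increment on a subspace. -/
lemma increment (hβ : SubspaceProp β) (n₂ : ℕ) {d θ : ℝ} (hd : 0 < d) (hθ : 0 < θ) :
    ∃ n, ∀ m, n ≤ m → ∀ (C : β → Set (Fin m → Option β)) (B : Set (Fin m → Option β)),
      (∀ b, Insens b (C b)) → θ / 2 ≤ dens {x | ∀ b, x ∈ C b} →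
      (∀ x ∈ B, ∃ b, x ∉ C b) → d - d * θ / 8 ≤ dens B →
      ∃ V : Subspace (Fin n₂) (Option β) (Fin m), d + d * θ / 8 ≤ dens {x | V x ∈ B} := by
  set γ := d * θ / 8 with hγ
  have hγ0 : 0 < γ := by positivity
  obtain ⟨n, hn⟩ := avg_inter_insens_le hβ Finset.univ n₂
    (γ := γ / (Fintype.card β)) (by positivity)
  refine ⟨n, fun m hm C B hC hdC hB hdB => ?_⟩
  by_contra! hV
  obtain ⟨E, hE⟩ : ∃ E : β → β → Set (Fin m → Option β), ∀ i b x, x ∈ E i b ↔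
      ((Fintype.equivFin β b < Fintype.equivFin β i → x ∈ C b) ∧ (b = i → x ∉ C b)) :=
    ⟨fun i b => {x | _}, fun _ _ _ => Iff.rfl⟩
  have hEI : ∀ i b, Insens b (E i b) := by
    intro i b x y hxy hx
    rw [hE] at hx ⊢
    exact ⟨fun h => hC b x y hxy (hx.1 h),
      fun h h' => hx.2 h (hC b y x (fun c => (hxy c).symm) h')⟩
  have h1 : ∀ i, avg (fun x => if ∀ b ∈ Finset.univ, x ∈ E i b then
      (if x ∈ B then (1 : ℝ) else 0) - (d + γ) else 0) ≤ γ / Fintype.card β := fun i =>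
    hn (Fin m) (by simpa using hm) (E i) (hEI i) _ _ (fun x => by split_ifs <;> norm_num)
      (by positivity) fun V => (hV V).le
  obtain ⟨D, hDm⟩ : ∃ D : Set (Fin m → Option β), ∀ x, x ∈ D ↔ ∀ b, x ∈ C b :=
    ⟨{x | ∀ b, x ∈ C b}, fun _ => Iff.rfl⟩
  have hDeq : {x | ∀ b, x ∈ C b} = D := Set.ext fun x => (hDm x).symm
  rw [hDeq] at hdC
  have h2 : dens B - (d + γ) * (1 - dens D) ≤
      ∑ i : β, avg (fun x => if ∀ b ∈ Finset.univ, x ∈ E i b then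
      (if x ∈ B then (1 : ℝ) else 0) - (d + γ) else 0) := by
    rw [← avg_sum]
    have h3 : (1 : ℝ) - dens D =
        avg (fun x : Fin m → Option β => 1 - if x ∈ D then (1 : ℝ) else 0) := by
      rw [avg_sub, avg_const]; simp [dens]
    rw [h3, ← avg_mul_left, dens, ← avg_sub]
    refine avg_mono fun x => ?_
    by_cases hx : ∀ b, x ∈ C b
    · have hxB : x ∉ B := fun h => by obtain ⟨b, hb⟩ := hB x h; exact hb (hx b)
      rw [Finset.sum_eq_zero]
      · simp [(hDm x).mpr hx, hxB]
      · intro i _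
        rw [if_neg]
        intro h
        exact ((hE i i x).mp (h i (Finset.mem_univ _))).2 rfl (hx i)
    · push Not at hx
      obtain ⟨i, hi, hmin⟩ := Finset.exists_min_image (Finset.univ.filter fun b => x ∉ C b)
        (Fintype.equivFin β) (by obtain ⟨b, hb⟩ := hx; exact ⟨b, by simp [hb]⟩)
      simp only [Finset.mem_filter, Finset.mem_univ, true_and] at hi hmin
      have hxD : x ∉ D := fun h => hi ((hDm x).mp h i)
      have hEi : ∀ b ∈ Finset.univ, x ∈ E i b := by
        intro b _
        rw [hE]
        exact ⟨fun h => by by_contra h'; exact absurd (hmin b h') (not_le.mpr h),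
          fun h => h ▸ hi⟩
      rw [Finset.sum_eq_single i]
      · simp only [if_pos hEi, if_neg hxD]; simp
      · intro j _ hj
        rw [if_neg]
        intro h
        have hj' : x ∉ C j := ((hE j j x).mp (h j (Finset.mem_univ _))).2 rfl
        have hlt : Fintype.equivFin β i < Fintype.equivFin β j :=
          lt_of_le_of_ne (hmin j hj') fun h => hj ((Fintype.equivFin β).injective h).symm
        exact hi (((hE j i x).mp (h i (Finset.mem_univ _))).1 hlt)
      · simp
  have h4 : ∑ i : β, avg (fun x => if ∀ b ∈ Finset.univ, x ∈ E i b then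
      (if x ∈ B then (1 : ℝ) else 0) - (d + γ) else 0) ≤ γ := by
    refine (Finset.sum_le_sum fun i _ => h1 i).trans_eq ?_
    rw [Finset.sum_const, Finset.card_univ, nsmul_eq_mul]
    field_simp
  have h5 : (d + γ) * (1 - dens D) ≤ (d + γ) * (1 - θ / 2) := by gcongr
  nlinarith

lemma exists_sub_lineProp (hβ : SubspaceProp β) {d : ℝ} (hd : 0 < d)
    (h : ∀ δ > d, LineProp (Option β) δ) : ∃ η > 0, LineProp (Option β) (d - η) := by
  classical
  obtain ⟨m₀, hm₀⟩ := hβ 1 (d / 4) (by positivity)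
  set θ := d / 4 / (Nat.card (Subspace (Fin 1) β (Fin m₀)) + 1) with hθ
  have hθ0 : 0 < θ := by positivity
  set γ := d * θ / 8 with hγ
  have hγ0 : 0 < γ := by positivity
  obtain ⟨n₂, hn₂⟩ := h (d + γ) (by linarith)
  obtain ⟨n₃, hn₃⟩ := increment hβ n₂ hd hθ0
  set η₂ := γ * θ / 8 with hη₂
  have hη₂0 : 0 < η₂ := by positivity
  obtain ⟨n₄, hn₄⟩ := h (d + η₂) (by linarith)
  set m := n₃ + n₄
  obtain ⟨M, _, hM⟩ := Subspace.exists_mono_in_high_dimension (β ⊕ Fin m₀)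
    (Subspace (Fin 1) β (Fin m₀)) (Option (Fin m))
  set ε := min η₂ (d / 2) with hε
  have hε0 : 0 < ε := by positivity
  set N : ℝ := ((Fintype.card (M → Option β) : ℕ) : ℝ) with hN
  have hN0 : 0 < N := by simp only [hN]; exact_mod_cast Fintype.card_pos
  set η := ε / (2 * N) with hη
  have hη0 : 0 < η := by positivity
  obtain ⟨n₁, hn₁⟩ := h (d + η) (by linarith)
  refine ⟨η, hη0, Fintype.card M + n₁, fun ι _ _ hι A hA => ?_⟩
  by_contra hno
  obtain ⟨k, hk, ⟨e'⟩⟩ := exists_split (Fintype.card M) ι (by omega)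
  let e : M ⊕ Fin k ≃ ι := (Equiv.sumCongr (Fintype.equivFin M) (Equiv.refl _)).trans e'
  have hsub : ∀ {r : ℕ} {δ : ℝ} {n : ℕ}, (∀ (ι : Type) [Fintype ι] [DecidableEq ι],
      n ≤ Fintype.card ι → ∀ A : Set (ι → Option β), δ ≤ dens A → ∃ l : Line (Option β) ι,
        ∀ x, l x ∈ A) → n ≤ r → ∀ V : Subspace (Fin r) (Option β) ι, dens {x | V x ∈ A} < δ := by
    intro r δ n hn hr V
    by_contra! hV
    obtain ⟨l, hl⟩ := hn (Fin r) (by simpa using hr) _ hV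
    exact hno ⟨lineComp V l, fun x => by rw [lineComp_apply]; exact hl x⟩
  have hupper : ∀ t : M → Option β, dens {y | cubeSplit e _ (t, y) ∈ A} ≤ d + η := by
    intro t
    have := hsub hn₁ (by omega : n₁ ≤ k) (extendRight e default t)
    simp only [extendRight_apply] at this
    exact this.le
  have hsec : ∀ t : M → Option β, d - ε ≤ dens {y | cubeSplit e _ (t, y) ∈ A} := by
    intro t
    have h1 : avg (fun t : M → Option β => d + η - dens {y | cubeSplit e _ (t, y) ∈ A}) ≤
        2 * η := by
      rw [avg_sub, avg_const, ← dens_split' e]; linarith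
    have h2 := (avg_single_le (fun t => sub_nonneg.mpr (hupper t)) t).trans h1
    rw [div_le_iff₀ hN0] at h2
    have : 2 * η * N = ε := by rw [hη]; field_simp
    linarith
  have hcol : ∀ U : M → β ⊕ Fin m₀, ∃ l : Subspace (Fin 1) β (Fin m₀), θ ≤
      dens {y : Fin k → Option β | ∀ z, cubeSplit e _ (fun c => some ((U c).elim id (l z)), y) ∈ A} := by
    intro U
    have h1 : d / 2 ≤ avg (fun y : Fin k → Option β => dens {t : Fin m₀ → β |
        cubeSplit e _ (fun c => some ((U c).elim id t), y) ∈ A}) := by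
      rw [avg_dens_comm]
      refine const_le_avg fun t => le_trans ?_ (hsec _)
      have : ε ≤ d / 2 := min_le_right _ _
      linarith
    have hpop := popular (δ := d / 4) (by positivity) (fun y => dens_le_one _)
      (le_trans (by linarith) h1)
    exact exists_dens_ge (L := Subspace (Fin 1) β (Fin m₀))
      (P := fun l => {y | ∀ z, cubeSplit e _ (fun c => some ((U c).elim id (l z)), y) ∈ A})
      hpop (by positivity) fun y hy => hm₀ _ (by simp) _ hy
  choose col hcol using hcol
  obtain ⟨W, l, hW⟩ := hM col
  set V := pull W l with hV
  have hC : ∀ x, θ ≤ dens {y : Fin k → Option β |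
      ∀ b, cubeSplit e _ (fun c => some ((V x c).getD b), y) ∈ A} := by
    intro x
    obtain ⟨u, hu⟩ := pull_getD W l x
    have := hcol (W u)
    rw [hW] at this
    refine this.trans (dens_mono fun y hy b => ?_)
    simp only [hV, hu]
    exact hy _
  have hCavg : 2 * (θ / 2) ≤ avg (fun y : Fin k → Option β => dens {x : Fin m → Option β |
      ∀ b, cubeSplit e _ (fun c => some ((V x c).getD b), y) ∈ A}) := by
    rw [avg_dens_comm, mul_div_cancel₀ _ two_ne_zero]
    exact const_le_avg hC
  have hpop := popular (δ := θ / 2) (by positivity) (fun y => dens_le_one _) hCavg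
  have hBavg : d - ε ≤ avg (fun y : Fin k → Option β => dens {x : Fin m → Option β |
      cubeSplit e _ (V x, y) ∈ A}) := by
    rw [avg_dens_comm]
    exact const_le_avg fun x => hsec _
  obtain ⟨y, hy1, hy2⟩ : ∃ y : Fin k → Option β, θ / 2 ≤ dens {x : Fin m → Option β |
      ∀ b, cubeSplit e _ (fun c => some ((V x c).getD b), y) ∈ A} ∧
      d - γ ≤ dens {x : Fin m → Option β | cubeSplit e _ (V x, y) ∈ A} := by
    by_contra! hcon
    have h1 := hBavg.trans (avg_mono (g := fun y : Fin k → Option β => d + η₂ - (γ + η₂) *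
      if y ∈ {y : Fin k → Option β | θ / 2 ≤ dens {x : Fin m → Option β |
      ∀ b, cubeSplit e _ (fun c => some ((V x c).getD b), y) ∈ A}} then (1 : ℝ) else 0) fun y => by
        split_ifs with hy
        · have := hcon y hy
          linarith
        · have := hsub hn₄ (by omega : n₄ ≤ m) (extendLeft e V y)
          simp only [extendLeft_apply] at this
          linarith)
    rw [avg_sub, avg_const, avg_mul_left] at h1
    have h2 := mul_le_mul_of_nonneg_left hpop (show 0 ≤ γ + η₂ by positivity)
    have h3 : ε ≤ η₂ := min_le_left _ _
    have h4 : 0 < η₂ * θ := by positivity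
    simp only [dens] at h1 h2
    nlinarith
  obtain ⟨U, hU⟩ := hn₃ m (by omega) (fun b => {x | cubeSplit e _ (fun c => some ((V x c).getD b), y) ∈ A})
    {x | cubeSplit e _ (V x, y) ∈ A} (fun b x x' hx hxE => by
      have : (fun c => some ((V x c).getD b)) = fun c => some ((V x' c).getD b) := by
        funext c
        simp only [Subspace.coe_apply]
        rcases V.idxFun c with a | j
        · rfl
        · simp [hx j]
      simpa [this] using hxE) hy1 (fun x hx => by
      by_contra! hcon
      obtain ⟨c₀, hc₀⟩ := pull_none W l x
      let l' : Line (Option β) ι :=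
        { idxFun := fun c => Sum.elim (fun c => (V x c).map some) (fun j => some (y j)) (e.symm c)
          proper := ⟨e (Sum.inl c₀), by simp [hV, hc₀]⟩ }
      refine hno ⟨l', fun a => ?_⟩
      rcases a with _ | b
      · refine (congrArg (· ∈ A) (?_ : l' none = cubeSplit e (Option β) (V x, y))).mpr hx
        funext c
        rw [cubeSplit_apply]
        simp only [l', Line.coe_apply]
        rcases e.symm c with i | j
        · rcases h : V x i with _ | a <;> simp [h]
        · simp
      · refine (congrArg (· ∈ A) (?_ : l' (some b) =
          cubeSplit e (Option β) (fun c => some ((V x c).getD b), y))).mpr (hcon b)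
        funext c
        rw [cubeSplit_apply]
        simp only [l', Line.coe_apply]
        rcases e.symm c with i | j
        · rcases h : V x i with _ | a <;> simp [h]
        · simp) hy2
  have := hsub hn₂ le_rfl (comp (extendLeft e V y) U)
  simp only [comp_apply, extendLeft_apply] at this
  exact absurd hU (not_le.mpr this)

lemma lineProp_option (hβ : SubspaceProp β) (δ : ℝ) (hδ : 0 < δ) : LineProp (Option β) δ := by
  by_contra hno
  set T := {δ : ℝ | LineProp (Option β) δ} with hT
  have hlb : ∀ t ∈ T, δ ≤ t := fun t ht => by
    by_contra! h
    exact hno (LineProp.mono ht h.le)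
  have hne : T.Nonempty := ⟨2, 0, fun ι _ _ _ A hA => by linarith [dens_le_one A]⟩
  have hd : δ ≤ sInf T := le_csInf hne hlb
  obtain ⟨η, hη, h⟩ := exists_sub_lineProp hβ (hδ.trans_le hd) (fun δ' hδ' => by
    obtain ⟨t, ht, htδ⟩ := exists_lt_of_csInf_lt hne hδ'
    exact LineProp.mono ht htδ.le)
  have := csInf_le ⟨δ, hlb⟩ h
  linarith

/-- The density Hales–Jewett theorem. -/
theorem density_hales_jewett (r : ℕ) {δ : ℝ} (hδ : 0 < δ) : LineProp (Fin (r + 1)) δ := by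
  have key : ∀ r : ℕ, ∃ (α : Type) (_ : Fintype α) (_ : Nonempty α), Fintype.card α = r + 1 ∧
      ∀ δ > 0, LineProp α δ := by
    intro r
    induction r with
    | zero =>
      refine ⟨Unit, inferInstance, inferInstance, rfl, fun δ hδ => ⟨1, fun ι _ _ hι A hA => ?_⟩⟩
      obtain ⟨x, hx⟩ := nonempty_of_dens_pos (hδ.trans_le hA)
      have : Nonempty ι := Fintype.card_pos_iff.mp (by omega)
      exact ⟨⟨fun _ => none, ⟨Classical.arbitrary ι, rfl⟩⟩, fun _ => by convert hx⟩
    | succ r ih =>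
      obtain ⟨α, _, _, hα, h⟩ := ih
      exact ⟨Option α, inferInstance, inferInstance, by simp [hα],
        lineProp_option (subspaceProp_of_lineProp h)⟩
  obtain ⟨α, _, _, hα, h⟩ := key r
  let e : α ≃ Fin (r + 1) := Fintype.equivFinOfCardEq hα
  obtain ⟨n, hn⟩ := h δ hδ
  refine ⟨n, fun ι _ _ hι A hA => ?_⟩
  obtain ⟨l, hl⟩ := hn ι hι ((Equiv.arrowCongr (Equiv.refl ι) e) ⁻¹' A) (by rwa [dens_equiv])
  refine ⟨⟨fun i => (l.idxFun i).map e, by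
    obtain ⟨i, hi⟩ := l.proper; exact ⟨i, by simp [hi]⟩⟩, fun x => ?_⟩
  refine (congrArg (· ∈ A) (?_ : _ = Equiv.arrowCongr (Equiv.refl ι) e (l (e.symm x)))).mpr
    (hl (e.symm x))
  funext i
  rcases h : l.idxFun i with _ | a <;> simp [h, Line.coe_apply]

end DHJ
end

section
open Combinatorics

/-! ### The counting form of the multidimensional Szemerédi theorem -/

/-- A combinatorial line is sent to a dilate of the configuration. -/
lemma Combinatorics.Line.sum_apply_eq {ι J V : Type*} [Fintype ι] [DecidableEq ι]
    [AddCommGroup V] (l : Line J ι) (s : J → V) (x : J) :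
    ∑ i, s (l x i) = ∑ i, (l.idxFun i).elim 0 s +
      (Finset.univ.filter fun i => l.idxFun i = none).card • s x := by
  rw [← Finset.sum_const, Finset.sum_filter, ← Finset.sum_add_distrib]
  refine Finset.sum_congr rfl fun i _ => ?_
  rw [Line.coe_apply]
  cases h : l.idxFun i <;> simp

theorem szemeredi_counting (r : ℕ) {δ : ℝ} (hδ : 0 < δ) :
    ∃ c > 0, ∃ n : ℕ, ∀ (K V : Type) [Field K] [Fintype K] [AddCommGroup V] [Module K V] [Fintype V]
      (_ : ∀ m : ℕ, 0 < m → m ≤ n → (m : K) ≠ 0) (s : Fin (r + 1) → V) (g : V → ℝ),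
      (∀ v, 0 ≤ g v) → (∀ v, g v ≤ 1) → δ ≤ avg g →
      c ≤ avg (fun p : V × K => ∏ j, g (p.1 + p.2 • s j)) := by
  classical
  obtain ⟨n, hn⟩ := DHJ.density_hales_jewett r (δ := δ / 4) (by positivity)
  set c₀ := δ / 4 / (Nat.card (Line (Fin (r + 1)) (Fin n)) + 1) with hc₀
  have hc₀0 : 0 < c₀ := by positivity
  refine ⟨c₀ * (δ / 2) ^ (r + 1), by positivity, n, ?_⟩
  intro K V _ _ _ _ _ hK s g hg0 hg1 hg
  set A : Set V := {v | δ / 2 ≤ g v} with hA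
  have hdA : δ / 2 ≤ dens A := popular (by positivity) hg1 (by linarith)
  set W : V × K → Set (Fin n → Fin (r + 1)) := fun p => {w | p.1 + p.2 • ∑ i, s (w i) ∈ A} with hW
  have hW1 : avg (fun p => dens (W p)) = dens A := by
    simp only [dens]
    rw [avg_comm]
    have : ∀ w : Fin n → Fin (r + 1), avg (fun p : V × K => if w ∈ W p then (1 : ℝ) else 0)
        = dens A := by
      intro w
      rw [avg_prod, avg_comm]
      refine (avg_congr (g := fun _ => dens A) fun d => ?_).trans (avg_const _)
      exact avg_equiv (Equiv.addRight (d • ∑ i, s (w i))) (fun v => if v ∈ A then (1 : ℝ) else 0)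
    rw [avg_congr this, avg_const]
    rfl
  have hpop := popular (δ := δ / 4) (f := fun p => dens (W p)) (by positivity)
    (fun p => dens_le_one _) (by rw [hW1]; linarith)
  obtain ⟨l, hl⟩ := exists_dens_ge (L := Line (Fin (r + 1)) (Fin n))
    (P := fun l => {p | ∀ x, l x ∈ W p}) hpop (by positivity)
    (fun p hp => hn (Fin n) (by simp) (W p) hp)
  set m := (Finset.univ.filter fun i => l.idxFun i = none).card with hm
  have hm0 : 0 < m := by
    obtain ⟨i, hi⟩ := l.proper
    exact Finset.card_pos.mpr ⟨i, by simp [hi]⟩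
  have hmK : (m : K) ≠ 0 := hK m hm0 ((Finset.card_filter_le _ _).trans (by simp))
  set b := ∑ i, (l.idxFun i).elim 0 s with hb
  let e : V × K ≃ V × K :=
    { toFun := fun p => (p.1 + p.2 • b, p.2 * m)
      invFun := fun p => (p.1 - (p.2 / m) • b, p.2 / m)
      left_inv := fun p => by
        ext <;> simp [hmK]
      right_inv := fun p => by
        ext <;> simp [hmK] }
  have hB : c₀ ≤ dens {p : V × K | ∀ j, p.1 + p.2 • s j ∈ A} := by
    rw [← dens_equiv e]
    refine hl.trans (dens_mono fun p hp j => ?_)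
    have := hp j
    simp only [hW] at this
    change p.1 + p.2 • ∑ i, s (l j i) ∈ A at this
    rw [l.sum_apply_eq] at this
    change p.1 + p.2 • b + (p.2 * m) • s j ∈ A
    convert this using 1
    rw [smul_add, add_assoc, mul_smul, Nat.cast_smul_eq_nsmul]
  calc c₀ * (δ / 2) ^ (r + 1) ≤ dens {p : V × K | ∀ j, p.1 + p.2 • s j ∈ A} * (δ / 2) ^ (r + 1) := by
        gcongr
    _ ≤ _ := by
        rw [dens, ← avg_mul_right]
        refine avg_mono fun p => ?_
        split_ifs with hp
        · rw [one_mul]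
          calc (δ / 2) ^ (r + 1) = ∏ _j : Fin (r + 1), δ / 2 := by rw [Finset.prod_const, Finset.card_fin]
            _ ≤ _ := Finset.prod_le_prod (fun _ _ => by positivity) fun j _ => hp j
        · rw [zero_mul]
          exact Finset.prod_nonneg fun j _ => hg0 _
end

/-! ### The weighted box Cauchy–Schwarz inequality -/

section BoxCauchySchwarz

variable {I X P Y : Type*} [Fintype I] [DecidableEq I] [Fintype X] [Nonempty X] [Fintype P]
  [Nonempty P] [Fintype Y]

lemma avg_update {K : Type*} [Field K] [CharZero K] (i : I) (G : (I → P) → K) :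
    avg G = avg (fun z => avg (fun p => G (Function.update z i p))) := by
  let e : (I → P) × P ≃ (I → P) × P :=
    { toFun := fun q => (Function.update q.1 i q.2, q.1 i)
      invFun := fun q => (Function.update q.1 i q.2, q.1 i)
      left_inv := fun q => by simp
      right_inv := fun q => by simp }
  rw [← avg_prod (fun q : (I → P) × P => G (Function.update q.1 i q.2)),
    show avg (fun q : (I → P) × P => G (Function.update q.1 i q.2)) =
      avg (fun q => (fun q : (I → P) × P => G q.1) (e q)) from rfl,
    avg_equiv e fun q : (I → P) × P => G q.1, avg_prod]
  exact avg_congr fun z => (avg_const _).symm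

lemma avg_bool_fun {K : Type*} [Field K] [CharZero K] (f g : X → K) :
    avg (fun p : Bool → X => f (p false) * g (p true)) = avg f * avg g := by
  rw [← avg_equiv (Equiv.boolArrowEquivProd X).symm, avg_prod, ← avg_mul_right]
  refine avg_congr fun x => ?_
  rw [← avg_mul_left]
  rfl

/-- One application of the Cauchy–Schwarz inequality, doubling the coordinate `i`. -/
lemma cauchySchwarz_swap (i : I) (B β H : Y → (I → Bool → X) → ℝ)
    (hB : ∀ y z w, B y (Function.update z i w) = B y z)
    (hβ : ∀ y z w, β y (Function.update z i w) = β y z)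
    (hH : ∀ y z w, H y (Function.update z i w) = H y (Function.update z i fun _ => w false))
    (hle : ∀ y z, |B y z| ≤ β y z) :
    avg (fun q : Y × (I → Bool → X) => B q.1 q.2 * H q.1 q.2) ^ 2 ≤
      avg (fun q : Y × (I → Bool → X) => β q.1 q.2) *
        avg (fun q : Y × (I → Bool → X) => β q.1 q.2 *
          (H q.1 q.2 * H q.1 (Function.update q.2 i fun b => q.2 i (!b)))) := by
  set h : Y × (I → Bool → X) → X → ℝ := fun q p => H q.1 (Function.update q.2 i fun _ => p) with hh
  have hβ0 : ∀ y z, 0 ≤ β y z := fun y z => (abs_nonneg _).trans (hle y z)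
  have h1 : avg (fun q : Y × (I → Bool → X) => B q.1 q.2 * H q.1 q.2) =
      avg (fun q : Y × (I → Bool → X) => B q.1 q.2 * avg (h q)) := by
    rw [avg_prod, avg_prod]
    refine avg_congr fun y => ?_
    simp only
    rw [avg_update i]
    refine avg_congr fun z => ?_
    simp only [hB, hh]
    rw [avg_mul_left]
    congr 1
    rw [avg_congr fun p => hH y z p]
    have := avg_bool_fun (fun x => H y (Function.update z i fun _ => x)) (fun _ : X => (1 : ℝ))
    simpa [avg_const] using this
  have h2 : avg (fun q : Y × (I → Bool → X) => β q.1 q.2 *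
      (H q.1 q.2 * H q.1 (Function.update q.2 i fun b => q.2 i (!b)))) =
      avg (fun q : Y × (I → Bool → X) => β q.1 q.2 * avg (h q) ^ 2) := by
    rw [avg_prod, avg_prod]
    refine avg_congr fun y => ?_
    simp only
    rw [avg_update i]
    refine avg_congr fun z => ?_
    simp only [hβ, hh, Function.update_idem, Function.update_self]
    rw [avg_mul_left, sq, ← avg_bool_fun]
    congr 1
    refine avg_congr fun p => ?_
    rw [hH y z p, hH y z fun b => p (!b)]
    rfl
  rw [h1, h2]
  calc _ ≤ avg (fun q : Y × (I → Bool → X) =>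
        √(β q.1 q.2) * (√(β q.1 q.2) * |avg (h q)|)) ^ 2 := by
        rw [← sq_abs]
        refine pow_le_pow_left₀ (abs_nonneg _) ((abs_avg_le _).trans (avg_mono fun q => ?_)) 2
        rw [abs_mul, ← mul_assoc, Real.mul_self_sqrt (hβ0 _ _)]
        exact mul_le_mul_of_nonneg_right (hle _ _) (abs_nonneg _)
    _ ≤ _ := by
        refine (avg_mul_sq_le _ _).trans_eq ?_
        simp only [mul_pow, sq_abs, Real.sq_sqrt (hβ0 _ _)]

/-- Choose, for every coordinate, one of two values according to membership in `a`. -/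
def selectCopy (z : I → Bool → X) (a : Finset I) : I → X := fun i => z i (decide (i ∈ a))

lemma selectCopy_update (z : I → Bool → X) (a : Finset I) (i : I) (w : Bool → X) :
    selectCopy (Function.update z i w) a = Function.update (selectCopy z a) i (w (decide (i ∈ a))) := by
  funext j
  rcases eq_or_ne j i with rfl | h <;> simp [selectCopy, *]

lemma selectCopy_swap (z : I → Bool → X) {a : Finset I} {i : I} (h : i ∉ a) :
    selectCopy (Function.update z i fun b => z i (!b)) a = selectCopy z (insert i a) := by
  funext j
  rcases eq_or_ne j i with rfl | hj <;> simp [selectCopy, *]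

/-- The weighted box Cauchy–Schwarz inequality. -/
theorem box_cauchySchwarz (h : Y → (I → X) → ℝ) (B β : I → Y → (I → X) → ℝ)
    (hB : ∀ i y x t, B i y (Function.update x i t) = B i y x)
    (hβ : ∀ i y x t, β i y (Function.update x i t) = β i y x)
    (hle : ∀ i y x, |B i y x| ≤ β i y x)
    (hβ2 : ∀ i, ∀ a : Finset I, i ∉ a → avg (fun q : Y × (I → Bool → X) =>
      ∏ b ∈ a.powerset, β i q.1 (selectCopy q.2 b)) ≤ 2)
    {η : ℝ} (hη : 0 ≤ η)
    (hmain : |avg (fun q : Y × (I → Bool → X) => (∏ b, h q.1 (selectCopy q.2 b)) *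
      ∏ i, ∏ b ∈ (Finset.univ.erase i).powerset, β i q.1 (selectCopy q.2 b))| ≤
        η ^ 2 ^ Fintype.card I) :
    |avg (fun q : Y × (I → X) => h q.1 q.2 * ∏ i, B i q.1 q.2)| ≤ 2 * η := by
  set t : Finset I → I → Y → (I → Bool → X) → ℝ := fun A j y z =>
    if j ∈ A then ∏ b ∈ (A.erase j).powerset, β j y (selectCopy z b)
      else ∏ b ∈ A.powerset, B j y (selectCopy z b) with ht
  set Q : Finset I → ℝ := fun A => avg (fun q : Y × (I → Bool → X) =>
    (∏ b ∈ A.powerset, h q.1 (selectCopy q.2 b)) * ∏ j, t A j q.1 q.2) with hQ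
  have hstep : ∀ A i, i ∉ A → Q A ^ 2 ≤ 2 * |Q (insert i A)| := by
    intro A i hi
    have hsub : ∀ {b}, b ∈ A.powerset → i ∉ b := fun hb h => hi (Finset.mem_powerset.mp hb h)
    have key := cauchySchwarz_swap (X := X) i (fun y z => ∏ b ∈ A.powerset, B i y (selectCopy z b))
      (fun y z => ∏ b ∈ A.powerset, β i y (selectCopy z b))
      (fun y z => (∏ b ∈ A.powerset, h y (selectCopy z b)) * ∏ j ∈ Finset.univ.erase i, t A j y z)
      (fun y z w => by simp only [selectCopy_update, hB])
      (fun y z w => by simp only [selectCopy_update, hβ])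
      (fun y z w => by
        congr 1
        · refine Finset.prod_congr rfl fun b hb => ?_
          simp [selectCopy_update, hsub hb]
        · refine Finset.prod_congr rfl fun j hj => ?_
          simp only [ht]
          split_ifs
          · refine Finset.prod_congr rfl fun b hb => ?_
            have hb' : i ∉ b := fun h => hi (Finset.mem_of_mem_erase (Finset.mem_powerset.mp hb h))
            simp [selectCopy_update, hb']
          · refine Finset.prod_congr rfl fun b hb => ?_
            simp [selectCopy_update, hsub hb])
      (fun y z => by
        rw [Finset.abs_prod]
        exact Finset.prod_le_prod (fun _ _ => abs_nonneg _) fun b _ => hle _ _ _)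
    have e1 : avg (fun q : Y × (I → Bool → X) => (∏ b ∈ A.powerset, B i q.1 (selectCopy q.2 b)) *
        ((∏ b ∈ A.powerset, h q.1 (selectCopy q.2 b)) *
          ∏ j ∈ Finset.univ.erase i, t A j q.1 q.2)) = Q A := by
      refine avg_congr fun q => ?_
      rw [← Finset.mul_prod_erase Finset.univ _ (Finset.mem_univ i)]
      simp only [ht, hi, if_false]
      ring
    have e2 : avg (fun q : Y × (I → Bool → X) => (∏ b ∈ A.powerset, β i q.1 (selectCopy q.2 b)) *
        (((∏ b ∈ A.powerset, h q.1 (selectCopy q.2 b)) *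
          ∏ j ∈ Finset.univ.erase i, t A j q.1 q.2) *
         ((∏ b ∈ A.powerset, h q.1 (selectCopy (Function.update q.2 i fun b => q.2 i (!b)) b)) *
          ∏ j ∈ Finset.univ.erase i, t A j q.1 (Function.update q.2 i fun b => q.2 i (!b))))) =
        Q (insert i A) := by
      refine avg_congr fun q => ?_
      rw [← Finset.mul_prod_erase Finset.univ _ (Finset.mem_univ i), Finset.prod_powerset_insert hi]
      have e3 : ∀ f : (I → X) → ℝ, ∏ b ∈ A.powerset,
          f (selectCopy (Function.update q.2 i fun b => q.2 i (!b)) b) =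
          ∏ b ∈ A.powerset, f (selectCopy q.2 (insert i b)) := fun f =>
        Finset.prod_congr rfl fun b hb => by rw [selectCopy_swap _ (hsub hb)]
      have e4 : ∏ j ∈ Finset.univ.erase i, t (insert i A) j q.1 q.2 =
          (∏ j ∈ Finset.univ.erase i, t A j q.1 q.2) *
          ∏ j ∈ Finset.univ.erase i, t A j q.1 (Function.update q.2 i fun b => q.2 i (!b)) := by
        rw [← Finset.prod_mul_distrib]
        refine Finset.prod_congr rfl fun j hj => ?_
        have hji : j ≠ i := Finset.ne_of_mem_erase hj
        simp only [ht, Finset.mem_insert, hji, false_or]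
        split_ifs with hjA
        · rw [Finset.erase_insert_of_ne hji.symm, Finset.prod_powerset_insert (by simp [hi])]
          congr 1
          refine Finset.prod_congr rfl fun b hb => ?_
          rw [selectCopy_swap]
          exact fun h => hi (Finset.mem_of_mem_erase (Finset.mem_powerset.mp hb h))
        · rw [Finset.prod_powerset_insert hi, e3 (B j q.1)]
      rw [e3 (h q.1), e4]
      simp only [ht, Finset.mem_insert_self, if_true, Finset.erase_insert hi]
      ring
    rw [e1, e2] at key
    refine key.trans ((le_abs_self _).trans ?_)
    rw [abs_mul]
    refine mul_le_mul_of_nonneg_right ?_ (abs_nonneg _)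
    rw [abs_of_nonneg]
    · exact hβ2 i A hi
    · exact avg_nonneg fun q => Finset.prod_nonneg fun b _ => (abs_nonneg _).trans (hle _ _ _)
  have hdown : ∀ n : ℕ, ∀ A : Finset I, Fintype.card I = A.card + n →
      |Q A| ≤ 2 * η ^ 2 ^ A.card := by
    intro n
    induction n with
    | zero =>
      intro A hA
      obtain rfl : A = Finset.univ := Finset.card_eq_iff_eq_univ A |>.mp (by simpa using hA.symm)
      have : |Q Finset.univ| ≤ η ^ 2 ^ Fintype.card I := by
        simpa [hQ, ht] using hmain
      rw [Finset.card_univ]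
      have := pow_nonneg hη (2 ^ Fintype.card I)
      linarith
    | succ n ih =>
      intro A hA
      obtain ⟨i, hi⟩ : ∃ i, i ∉ A := by
        by_contra! hall
        have : A = Finset.univ := Finset.eq_univ_iff_forall.mpr hall
        rw [this, Finset.card_univ] at hA
        omega
      have h1 := ih (insert i A) (by rw [Finset.card_insert_of_notMem hi]; omega)
      rw [Finset.card_insert_of_notMem hi, pow_succ 2, pow_mul] at h1
      refine abs_le_of_sq_le_sq ?_ (by positivity)
      calc Q A ^ 2 ≤ 2 * |Q (insert i A)| := hstep A i hi
        _ ≤ 2 * (2 * (η ^ 2 ^ A.card) ^ 2) := by gcongr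
        _ = _ := by ring
  have h0 := hdown (Fintype.card I) ∅ (by simp)
  have e : Q ∅ = avg (fun q : Y × (I → X) => h q.1 q.2 * ∏ i, B i q.1 q.2) := by
    rw [hQ]
    simp only [ht, Finset.powerset_empty, Finset.prod_singleton, Finset.notMem_empty, if_false]
    rw [avg_prod, avg_prod]
    refine avg_congr fun y => ?_
    have e1 := avg_bool_fun (fun x : I → X => h y x * ∏ i, B i y x) (fun _ => 1)
    rw [avg_const, mul_one] at e1
    rw [← e1, ← avg_equiv (Equiv.piComm fun (_ : I) (_ : Bool) => X)]
    refine avg_congr fun z => ?_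
    rw [mul_one]
    rfl
  rwa [e, Finset.card_empty, pow_zero, pow_one] at h0

end BoxCauchySchwarz

/-! ### The linear forms condition -/

/-- `ν` has almost average one along every system of pairwise distinct linear forms with at most
`D` scalar variables and coefficients in `Ω`. -/
def LinForms (K : Type) {V : Type} [Field K] [Fintype K] [AddCommGroup V] [Module K V] [Fintype V]
    (ν : V → ℝ) (D : ℕ) (Ω : Set V) (ε : ℝ) : Prop :=
  ∀ (ι : Type) [Fintype ι] [DecidableEq ι], Fintype.card ι ≤ D → ∀ T : Finset (ι → V), (∀ t ∈ T, ∀ i, t i ∈ Ω) →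
    |avg (fun p : V × (ι → K) => ∏ t ∈ T, ν (p.1 + ∑ i, p.2 i • t i)) - 1| ≤ ε

section LinForms

variable {K V : Type} [Field K] [Fintype K] [AddCommGroup V] [Module K V] [Fintype V]
  {ν : V → ℝ} {D : ℕ} {Ω : Set V} {ε : ℝ}

lemma LinForms.family (hν : LinForms K ν D Ω ε) {ι : Type} [Fintype ι] [DecidableEq ι] (hι : Fintype.card ι ≤ D)
    {τ : Type*} (S : Finset τ) (w : τ → ι → V) (hw : Set.InjOn w S) (hΩ : ∀ t ∈ S, ∀ i, w t i ∈ Ω) :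
    |avg (fun p : V × (ι → K) => ∏ t ∈ S, ν (p.1 + ∑ i, p.2 i • w t i)) - 1| ≤ ε := by
  classical
  have := hν ι hι (S.image w) (fun t ht => by
    obtain ⟨s, hs, rfl⟩ := Finset.mem_image.mp ht
    exact hΩ s hs)
  simpa only [Finset.prod_image hw] using this

lemma LinForms.mixed (hν : LinForms K ν D Ω ε) {ι : Type} [Fintype ι] [DecidableEq ι] (hι : Fintype.card ι ≤ D)
    {τ : Type*} [DecidableEq τ] (S₁ : Finset τ) (w : τ → ι → V) : ∀ S₂ : Finset τ, Disjoint S₁ S₂ →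
    Set.InjOn w ↑(S₁ ∪ S₂) → (∀ t ∈ S₁ ∪ S₂, ∀ i, w t i ∈ Ω) →
    |avg (fun p : V × (ι → K) => (∏ t ∈ S₁, (ν (p.1 + ∑ i, p.2 i • w t i) - 1)) *
      ∏ t ∈ S₂, ν (p.1 + ∑ i, p.2 i • w t i)) - if S₁ = ∅ then 1 else 0| ≤ 2 ^ S₁.card * ε := by
  induction S₁ using Finset.induction with
  | empty =>
    intro S₂ _ hw hΩ
    simpa using hν.family hι S₂ w (by simpa using hw) (by simpa using hΩ)
  | insert s S₁ hs ih =>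
    intro S₂ hd hw hΩ
    rw [Finset.disjoint_insert_left] at hd
    have h1 := ih (insert s S₂) (by simp [Finset.disjoint_insert_right, hs, hd.2])
      (by rw [Finset.union_insert, ← Finset.insert_union]; exact hw)
      (by rw [Finset.union_insert, ← Finset.insert_union]; exact hΩ)
    have h2 := ih S₂ hd.2 (hw.mono (by gcongr; exact Finset.subset_insert _ _))
      (fun t ht => hΩ t (by rw [Finset.insert_union]; exact Finset.mem_insert_of_mem ht))
    rw [if_neg (Finset.insert_ne_empty _ _), Finset.card_insert_of_notMem hs, pow_succ, sub_zero]
    have e : avg (fun p : V × (ι → K) => (∏ t ∈ insert s S₁, (ν (p.1 + ∑ i, p.2 i • w t i) - 1)) *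
        ∏ t ∈ S₂, ν (p.1 + ∑ i, p.2 i • w t i)) =
        avg (fun p : V × (ι → K) => (∏ t ∈ S₁, (ν (p.1 + ∑ i, p.2 i • w t i) - 1)) *
        ∏ t ∈ insert s S₂, ν (p.1 + ∑ i, p.2 i • w t i)) -
        avg (fun p : V × (ι → K) => (∏ t ∈ S₁, (ν (p.1 + ∑ i, p.2 i • w t i) - 1)) *
        ∏ t ∈ S₂, ν (p.1 + ∑ i, p.2 i • w t i)) := by
      rw [← avg_sub]
      refine avg_congr fun p => ?_
      rw [Finset.prod_insert hs, Finset.prod_insert hd.1]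
      ring
    rw [e]
    rw [abs_le] at h1 h2 ⊢
    constructor <;> linarith

end LinForms

/-! ### The dense model theorem -/

lemma avg_pos_part_le {V : Type*} [Fintype V] [Nonempty V] (P : Polynomial ℝ) {η ε : ℝ}
    (hP : ∀ x ∈ Set.Icc (-1 : ℝ) 1, |P.eval x - max x 0| ≤ η) (hε : 0 ≤ ε) (ν f φ : V → ℝ)
    (hf : ∀ v, 0 ≤ f v) (hfν : ∀ v, f v ≤ ν v) (hφ : ∀ v, |φ v| ≤ 1)
    (hν : ∀ n : ℕ, |avg (fun v => (ν v - 1) * φ v ^ n)| ≤ ε) :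
    avg (fun v => f v * φ v) ≤ avg (fun v => max (φ v) 0) + η + η * (1 + ε) +
      ε * ∑ i ∈ P.support, |P.coeff i| := by
  have hP' : ∀ v, |P.eval (φ v) - max (φ v) 0| ≤ η := fun v => hP _ (by
    rw [Set.mem_Icc, ← abs_le]; exact hφ v)
  have h1 : avg (fun v => f v * φ v) ≤ avg (fun v => (ν v - 1) * P.eval (φ v) +
      (max (φ v) 0 + η) + η * ((ν v - 1) * φ v ^ 0 + 1)) := by
    refine avg_mono fun v => ?_
    have := abs_le.mp (hP' v)
    have h0 : 0 ≤ ν v := (hf v).trans (hfν v)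
    have h2 : f v * φ v ≤ ν v * max (φ v) 0 :=
      (mul_le_mul_of_nonneg_left (le_max_left _ _) (hf v)).trans
        (mul_le_mul_of_nonneg_right (hfν v) (le_max_right _ _))
    nlinarith
  have h2 : avg (fun v => (ν v - 1) * P.eval (φ v)) ≤ ε * ∑ i ∈ P.support, |P.coeff i| := by
    have : (fun v => (ν v - 1) * P.eval (φ v)) =
        fun v => ∑ i ∈ P.support, P.coeff i * ((ν v - 1) * φ v ^ i) := by
      funext v
      rw [Polynomial.eval_eq_sum, Polynomial.sum, Finset.mul_sum]
      exact Finset.sum_congr rfl fun i _ => by ring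
    rw [this, avg_sum, Finset.mul_sum]
    refine Finset.sum_le_sum fun i _ => ?_
    rw [avg_mul_left]
    refine (le_abs_self _).trans ?_
    rw [abs_mul, mul_comm]
    exact mul_le_mul_of_nonneg_right (hν i) (abs_nonneg _)
  rw [avg_add, avg_add, avg_add, avg_mul_left, avg_add, avg_const, avg_const] at h1
  have h3 := (abs_le.mp (hν 0)).2
  have hη : 0 ≤ η := (abs_nonneg _).trans (hP' (Classical.arbitrary V))
  nlinarith

theorem dense_model {η : ℝ} (hη : 0 < η) : ∃ ε > 0, ∀ (V : Type) [Fintype V] [Nonempty V]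
    (ν f : V → ℝ) (Y : Set (V → ℝ)), Convex ℝ Y → IsCompact Y → Y.Nonempty →
    (∀ φ ∈ Y, ∀ v, |φ v| ≤ 1) → (∀ φ ∈ Y, ∀ n : ℕ, |avg (fun v => (ν v - 1) * φ v ^ n)| ≤ ε) →
    (∀ v, 0 ≤ f v) → (∀ v, f v ≤ ν v) →
    ∃ g : V → ℝ, (∀ v, 0 ≤ g v) ∧ (∀ v, g v ≤ 1) ∧
      ∀ φ ∈ Y, avg (fun v => (f v - g v) * φ v) ≤ η := by
  obtain ⟨P, hP⟩ := exists_polynomial_near_of_continuousOn (-1) 1 (fun x => max x 0)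
    (by fun_prop) (η / 4) (by positivity)
  set C := ∑ i ∈ P.support, |P.coeff i| with hC
  have hC0 : 0 ≤ C := Finset.sum_nonneg fun _ _ => abs_nonneg _
  refine ⟨min 1 (η / 4 / (C + 1)), by positivity, ?_⟩
  intro V _ _ ν f Y hYc hYk hYn hY1 hYν hf hfν
  set X : Set (V → ℝ) := Set.Icc 0 1 with hX
  have hcont : Continuous fun p : (V → ℝ) × (V → ℝ) => avg (fun v => (f v - p.1 v) * p.2 v) := by
    unfold avg; fun_prop
  obtain ⟨g, hg, φ, hφ, hs⟩ := Sion.exists_isSaddlePointOn (X := X) (Y := Y)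
    (f := fun g φ => avg (fun v => (f v - g v) * φ v)) ⟨0, by simp [hX]⟩ (convex_Icc 0 1)
    isCompact_Icc
    (fun y _ => (hcont.comp (by fun_prop : Continuous fun x => (x, y))).lowerSemicontinuous.lowerSemicontinuousOn _)
    (fun y _ => (ConvexOn.quasiconvexOn ⟨convex_Icc 0 1, fun g _ g' _ a b _ _ hab => by
      refine le_of_eq ?_
      simp only [smul_eq_mul, ← avg_mul_left, ← avg_add]
      refine avg_congr fun v => ?_
      simp only [Pi.add_apply, Pi.smul_apply, smul_eq_mul]
      linear_combination -(f v * y v) * hab⟩))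
    hYc hYn hYk
    (fun x _ => (hcont.comp (by fun_prop : Continuous fun y => (x, y))).upperSemicontinuous.upperSemicontinuousOn _)
    (fun x _ => (ConcaveOn.quasiconcaveOn ⟨hYc, fun φ _ φ' _ a b _ _ hab => by
      refine le_of_eq ?_
      simp only [smul_eq_mul, ← avg_mul_left, ← avg_add]
      refine avg_congr fun v => ?_
      simp only [Pi.add_apply, Pi.smul_apply, smul_eq_mul]
      ring⟩))
  refine ⟨g, fun v => hg.1 v, fun v => hg.2 v, fun ψ hψ => ?_⟩
  set x : V → ℝ := fun v => if 0 < φ v then 1 else 0 with hx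
  have h1 := hs x ⟨fun v => by simp only [hx]; split_ifs <;> simp,
    fun v => by simp only [hx]; split_ifs <;> simp⟩ ψ hψ
  refine h1.trans ?_
  have h2 := avg_pos_part_le P (fun x hx => (hP x hx).le) (by positivity) ν f φ hf hfν (hY1 φ hφ)
    (hYν φ hφ)
  have h3 : avg (fun v => (f v - x v) * φ v) = avg (fun v => f v * φ v) -
      avg (fun v => max (φ v) 0) := by
    rw [← avg_sub]
    refine avg_congr fun v => ?_
    simp only [hx]
    split_ifs with h
    · rw [max_eq_left h.le]; ring
    · rw [max_eq_right (not_lt.mp h)]; ring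
  simp only
  rw [h3]
  have h4 : min 1 (η / 4 / (C + 1)) * C ≤ η / 4 := by
    calc _ ≤ η / 4 / (C + 1) * (C + 1) := by gcongr; exacts [min_le_right _ _, by linarith]
      _ = η / 4 := by field_simp
  have h5 : min 1 (η / 4 / (C + 1)) ≤ 1 := min_le_left _ _
  rw [← hC] at h2
  nlinarith

/-! ### Test functions -/

section TestFn

variable (K : Type) {V A : Type} [Field K] [Fintype K] [AddCommGroup V] [Module K V] [Fintype V]
  [Fintype A] [DecidableEq A] (e : A → V)

/-- Averages of products of bounded functions, each invariant in one direction. -/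
def TestFn (φ : V → ℝ) : Prop :=
  ∃ (u : A → V → (A → K) → ℝ) (c : ℝ), (∀ a v t, |u a v t| ≤ 1) ∧
    (∀ a v t s, u a (v + s • e a) (Function.update t a (t a + s)) = u a v t) ∧ |c| ≤ 1 ∧
    ∀ v, φ v = c * avg (fun t => ∏ a, u a v t)

/-- The closed convex hull of the test functions. -/
def testHull : Set (V → ℝ) := closure (convexHull ℝ {φ | TestFn K e φ})

variable {K e}

lemma TestFn.abs_le_one {φ : V → ℝ} (h : TestFn K e φ) (v : V) : |φ v| ≤ 1 := by
  obtain ⟨u, c, hu, _, hc, h⟩ := h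
  rw [h, abs_mul]
  have : |avg fun t => ∏ a, u a v t| ≤ 1 := (abs_avg_le _).trans (avg_le_const fun t => by
    rw [Finset.abs_prod]
    exact Finset.prod_le_one (fun _ _ => abs_nonneg _) fun a _ => hu a v t)
  nlinarith [abs_nonneg c, abs_nonneg (avg fun t => ∏ a, u a v t)]

lemma convex_testHull : Convex ℝ (testHull K e) := (convex_convexHull ℝ _).closure

lemma TestFn.mem_testHull {φ : V → ℝ} (h : TestFn K e φ) : φ ∈ testHull K e :=
  subset_closure (subset_convexHull ℝ _ h)

lemma testHull_subset {C : Set (V → ℝ)} (hC : Convex ℝ C) (hcl : IsClosed C)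
    (h : ∀ φ, TestFn K e φ → φ ∈ C) : testHull K e ⊆ C :=
  closure_minimal (convexHull_min h hC) hcl

lemma testHull_subset_Icc : testHull K e ⊆ Set.Icc (fun _ => -1) (fun _ => 1) :=
  testHull_subset (convex_Icc _ _) isClosed_Icc fun φ h =>
    ⟨fun v => (abs_le.mp (h.abs_le_one v)).1, fun v => (abs_le.mp (h.abs_le_one v)).2⟩

lemma isCompact_testHull : IsCompact (testHull K e) :=
  isCompact_Icc.of_isClosed_subset isClosed_closure testHull_subset_Icc

lemma abs_le_one_of_mem_testHull {φ : V → ℝ} (h : φ ∈ testHull K e) (v : V) : |φ v| ≤ 1 :=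
  abs_le.mpr ⟨(testHull_subset_Icc h).1 v, (testHull_subset_Icc h).2 v⟩

lemma one_mem_testHull : (1 : V → ℝ) ∈ testHull K e :=
  TestFn.mem_testHull ⟨fun _ _ _ => 1, 1, by simp, by simp, by simp, fun v => by
    simp [avg_const]⟩

lemma neg_mem_testHull {φ : V → ℝ} (h : φ ∈ testHull K e) : -φ ∈ testHull K e := by
  have : testHull K e ⊆ {φ | -φ ∈ testHull K e} := by
    refine testHull_subset ?_ ?_ ?_
    · exact convex_testHull.neg
    · exact isClosed_closure.preimage continuous_neg
    · rintro φ ⟨u, c, hu, hinv, hc, h⟩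
      exact TestFn.mem_testHull ⟨u, -c, hu, hinv, by rwa [abs_neg], fun v => by simp [h]⟩
  exact this h

lemma avg_mem_testHull {X : Type*} [Fintype X] [Nonempty X] {φ : X → V → ℝ}
    (h : ∀ x, φ x ∈ testHull K e) : (fun v => avg fun x => φ x v) ∈ testHull K e := by
  have := convex_testHull.sum_mem (t := Finset.univ) (w := fun _ : X => (Fintype.card X : ℝ)⁻¹)
    (z := φ) (fun _ _ => by positivity) (by simp) (fun x _ => h x)
  convert this using 1
  funext v
  simp [avg, Finset.sum_apply, div_eq_inv_mul, Finset.mul_sum]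

lemma TestFn.mul {φ ψ : V → ℝ} (hφ : TestFn K e φ) (hψ : TestFn K e ψ) :
    φ * ψ ∈ testHull K e := by
  obtain ⟨u, c, hu, hui, hc, hφ⟩ := hφ
  obtain ⟨u', c', hu', hui', hc', hψ⟩ := hψ
  have key : φ * ψ = fun v => avg fun r : A → K =>
      (c * c') * avg fun t => ∏ a, (u a v t * u' a v (t + r)) := by
    funext v
    rw [Pi.mul_apply, hφ, hψ, avg_mul_left, avg_comm]
    have : ∀ t : A → K, avg (fun r : A → K => ∏ a, (u a v t * u' a v (t + r))) =
        (∏ a, u a v t) * avg (fun t => ∏ a, u' a v t) := by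
      intro t
      rw [← avg_equiv (Equiv.addLeft t) (fun t => ∏ a, u' a _ t), ← avg_mul_left]
      exact avg_congr fun r => Finset.prod_mul_distrib
    rw [avg_congr this, avg_mul_right]
    ring
  rw [key]
  refine avg_mem_testHull fun r => TestFn.mem_testHull
    ⟨fun a v t => u a v t * u' a v (t + r), c * c', fun a v t => ?_, fun a v t s => ?_, ?_, fun v => rfl⟩
  · rw [abs_mul]
    exact mul_le_one₀ (hu _ _ _) (abs_nonneg _) (hu' _ _ _)
  · simp only
    rw [hui]
    congr 1
    rw [← hui' a v (t + r) s]
    congr 1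
    funext b
    rcases eq_or_ne b a with rfl | hb
    · simp; ring
    · simp [hb]
  · rw [abs_mul]
    exact mul_le_one₀ hc (abs_nonneg _) hc'

lemma mul_mem_testHull {φ ψ : V → ℝ} (hφ : φ ∈ testHull K e) (hψ : ψ ∈ testHull K e) :
    φ * ψ ∈ testHull K e := by
  have h1 : ∀ φ, TestFn K e φ → testHull K e ⊆ {ψ | φ * ψ ∈ testHull K e} := fun φ hφ =>
    testHull_subset (convex_testHull.linear_preimage (LinearMap.mulLeft ℝ φ))
      (isClosed_closure.preimage (continuous_const.mul continuous_id)) fun ψ hψ => hφ.mul hψ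
  have h2 : testHull K e ⊆ {φ | φ * ψ ∈ testHull K e} :=
    testHull_subset (convex_testHull.linear_preimage (LinearMap.mulRight ℝ ψ))
      (isClosed_closure.preimage (continuous_id.mul continuous_const)) fun φ hφ => h1 φ hφ hψ
  exact h2 hφ

lemma pow_mem_testHull {φ : V → ℝ} (hφ : φ ∈ testHull K e) (n : ℕ) : φ ^ n ∈ testHull K e := by
  induction n with
  | zero => rw [pow_zero]; exact one_mem_testHull
  | succ n ih => rw [pow_succ]; exact mul_mem_testHull ih hφ

/-- Pairs of copies of the scalar variables. -/
def copyEquiv (A K : Type) : (A → Bool → K) ≃ (A × Bool → K) := (Equiv.curry A Bool K).symm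

lemma TestFn.abs_avg_le {ν : V → ℝ} {D : ℕ} {Ω : Set V} {ε η : ℝ} (hν : LinForms K ν D Ω ε)
    (hD : 2 * Fintype.card A ≤ D) (h0 : (0 : V) ∈ Ω) (heΩ : ∀ a, e a ∈ Ω) (he : ∀ a, e a ≠ 0)
    (hη : 0 ≤ η) (hηε : 2 ^ 2 ^ Fintype.card A * ε ≤ η ^ 2 ^ Fintype.card A) {φ : V → ℝ}
    (hφ : TestFn K e φ) : |avg (fun v => (ν v - 1) * φ v)| ≤ 2 * η := by
  obtain ⟨u, c, hu, hui, hc, hφ⟩ := hφ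
  set sh : V → (A → K) → V := fun v t => v + ∑ a, t a • e a with hsh
  have h1 : avg (fun v => (ν v - 1) * φ v) = c * avg (fun q : V × (A → K) =>
      (ν (sh q.1 q.2) - 1) * ∏ a, u a (sh q.1 q.2) q.2) := by
    rw [avg_prod, avg_comm, ← avg_mul_left]
    have : ∀ t : A → K, avg (fun v => (ν (sh v t) - 1) * ∏ a, u a (sh v t) t) =
        avg (fun v => (ν v - 1) * ∏ a, u a v t) := fun t =>
      avg_equiv (Equiv.addRight (∑ a, t a • e a)) (fun v => (ν v - 1) * ∏ a, u a v t)
    simp only [this]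
    rw [avg_mul_left, avg_comm, ← avg_mul_left]
    refine avg_congr fun v => ?_
    rw [hφ, avg_mul_left]
    ring
  have hshu : ∀ v t a (s : K), sh v (Function.update t a s) = sh v t + (s - t a) • e a := by
    intro v t a s
    simp only [hsh]
    rw [← Finset.add_sum_erase Finset.univ _ (Finset.mem_univ a),
      ← Finset.add_sum_erase Finset.univ (fun a => t a • e a) (Finset.mem_univ a),
      Finset.sum_congr rfl fun b hb => by
        rw [Function.update_of_ne (Finset.ne_of_mem_erase hb)]]
    simp only [Function.update_self, sub_smul]
    abel
  have h2 := box_cauchySchwarz (Y := V) (X := K) (I := A) (fun v t => ν (sh v t) - 1)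
    (fun a v t => u a (sh v t) t) (fun _ _ _ => 1)
    (fun a v t s => by
      rw [hshu, ← hui a (sh v t) t (s - t a)]
      simp) (fun _ _ _ _ => rfl) (fun a v t => hu a _ _)
    (fun i a _ => by simp only [Finset.prod_const_one, avg_const]; norm_num) hη (by
      set w : Finset A → A × Bool → V := fun b p =>
        if p.2 = decide (p.1 ∈ b) then e p.1 else 0 with hw
      have := hν.mixed (ι := A × Bool) (by simpa [mul_comm] using hD) (Finset.univ : Finset (Finset A))
        w ∅ (by simp) (by
          intro b _ b' _ hbb
          ext a
          have := congrFun hbb (a, decide (a ∈ b))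
          simp only [hw, if_true] at this
          by_contra hne
          rw [if_neg] at this
          · exact he a this
          · by_cases h1 : a ∈ b <;> by_cases h2 : a ∈ b' <;> simp_all) (by
          intro b _ p
          simp only [hw]; split_ifs
          exacts [heΩ _, h0])
      rw [if_neg Finset.univ_nonempty.ne_empty, Finset.card_univ, Fintype.card_finset, sub_zero] at this
      refine (le_of_eq ?_).trans (this.trans hηε)
      congr 1
      rw [avg_prod, avg_prod]
      refine avg_congr fun v => ?_
      rw [← avg_equiv (copyEquiv A K)]
      refine avg_congr fun z => ?_
      simp only [Finset.prod_const_one, Finset.prod_empty]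
      congr 1
      refine Finset.prod_congr rfl fun b _ => ?_
      congr 2
      simp only [hsh]
      congr 1
      rw [Fintype.sum_prod_type]
      refine Finset.sum_congr rfl fun a _ => ?_
      simp only [hw, copyEquiv, selectCopy, Fintype.sum_bool, Equiv.curry_symm_apply,
        Function.uncurry]
      by_cases h : a ∈ b <;> simp [h])
  rw [h1, abs_mul]
  calc _ ≤ 1 * (2 * η) := by gcongr
    _ = _ := one_mul _

lemma abs_avg_le_of_mem_testHull {ν : V → ℝ} {D : ℕ} {Ω : Set V} {ε η : ℝ}
    (hν : LinForms K ν D Ω ε)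
    (hD : 2 * Fintype.card A ≤ D) (h0 : (0 : V) ∈ Ω) (heΩ : ∀ a, e a ∈ Ω) (he : ∀ a, e a ≠ 0)
    (hη : 0 ≤ η) (hηε : 2 ^ 2 ^ Fintype.card A * ε ≤ η ^ 2 ^ Fintype.card A) {φ : V → ℝ}
    (hφ : φ ∈ testHull K e) : |avg (fun v => (ν v - 1) * φ v)| ≤ 2 * η := by
  let ℓ : (V → ℝ) →ₗ[ℝ] ℝ :=
    { toFun := fun φ => avg fun v => (ν v - 1) * φ v
      map_add' := fun φ ψ => by rw [← avg_add]; exact avg_congr fun v => by simp; ring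
      map_smul' := fun c φ => by
        rw [RingHom.id_apply, smul_eq_mul, ← avg_mul_left]; exact avg_congr fun v => by simp; ring }
  have hsub : testHull K e ⊆ ℓ ⁻¹' Set.Icc (-(2 * η)) (2 * η) :=
    testHull_subset ((convex_Icc _ _).linear_preimage ℓ)
      (isClosed_Icc.preimage (LinearMap.continuous_of_finiteDimensional ℓ)) fun φ h =>
        abs_le.mp (h.abs_avg_le hν hD h0 heΩ he hη hηε)
  exact abs_le.mpr (hsub hφ)

end TestFn

/-- A function majorised by a pseudorandom `ν` is close to a bounded one, with respect to test
functions. -/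
theorem exists_dense_model (d : ℕ) {η : ℝ} (hη : 0 < η) : ∃ ε > 0, ∀ (K V A : Type) [Field K]
    [Fintype K] [AddCommGroup V] [Module K V] [Fintype V] [Fintype A] [DecidableEq A] (e : A → V)
    (ν f : V → ℝ) (D : ℕ) (Ω : Set V), Fintype.card A = d → 2 * d ≤ D → LinForms K ν D Ω ε →
    (0 : V) ∈ Ω → (∀ a, e a ∈ Ω) → (∀ a, e a ≠ 0) → (∀ v, 0 ≤ f v) → (∀ v, f v ≤ ν v) →
    ∃ g : V → ℝ, (∀ v, 0 ≤ g v) ∧ (∀ v, g v ≤ 1) ∧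
      ∀ φ ∈ testHull K e, |avg (fun v => (f v - g v) * φ v)| ≤ η := by
  obtain ⟨ε₁, hε₁, h⟩ := dense_model hη
  refine ⟨(ε₁ / 2) ^ 2 ^ d / 2 ^ 2 ^ d, by positivity, ?_⟩
  intro K V A _ _ _ _ _ _ _ e ν f D Ω hA hD hν h0 heΩ he hf hfν
  obtain ⟨g, hg0, hg1, hg⟩ := h V ν f (testHull K e) convex_testHull isCompact_testHull
    ⟨1, one_mem_testHull⟩ (fun φ h => abs_le_one_of_mem_testHull h)
    (fun φ hφ n => by
      have := abs_avg_le_of_mem_testHull hν (by rwa [hA]) h0 heΩ he (η := ε₁ / 2) (by positivity)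
        (by rw [hA]; apply le_of_eq; field_simp) (pow_mem_testHull hφ n)
      simpa [mul_div_cancel₀] using this) hf hfν
  refine ⟨g, hg0, hg1, fun φ hφ => abs_le.mpr ⟨?_, hg φ hφ⟩⟩
  have := hg (-φ) (neg_mem_testHull hφ)
  simp only [Pi.neg_apply, mul_neg, avg_neg] at this
  linarith

/-! ### The relative counting lemma -/

section Counting

variable {K V J : Type} [Field K] [Fintype K] [AddCommGroup V] [Module K V] [Fintype V]
  [Fintype J] [DecidableEq J]

/-- The normalised count of dilates and translates of `s`, weighted by the functions `f j`. -/
noncomputable def patternCount (K : Type) [Field K] [Fintype K] [Module K V] (s : J → V)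
    (f : J → V → ℝ) : ℝ :=
  avg (fun p : V × K => ∏ j, f j (p.1 + p.2 • s j))

/-- The dual function at position `j₀`. -/
noncomputable def dualFn (K : Type) [Field K] [Fintype K] [Module K V] (s : J → V) (f : J → V → ℝ)
    (j₀ : J) (v : V) : ℝ :=
  avg (fun k : K => ∏ j : {j // j ≠ j₀}, f j (v + k • (s j - s j₀)))

lemma prod_ne_eq {M : Type*} [CommMonoid M] (h : J → M) (j₀ : J) :
    ∏ j : {j // j ≠ j₀}, h j = ∏ j ∈ Finset.univ.erase j₀, h j :=
  (Finset.prod_subtype (Finset.univ.erase j₀) (fun x => by simp) h).symm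

lemma patternCount_eq (s : J → V) (f : J → V → ℝ) (j₀ : J) :
    patternCount K s f = avg (fun v => f j₀ v * dualFn K s f j₀ v) := by
  unfold patternCount dualFn
  simp only [← avg_mul_left]
  rw [avg_prod, avg_comm, avg_comm (fun (v : V) (k : K) => _ * _)]
  refine avg_congr fun k => ?_
  rw [← avg_equiv (Equiv.addRight (k • s j₀)) (fun v => f j₀ v * _)]
  refine avg_congr fun v => ?_
  simp only [Equiv.coe_addRight]
  rw [prod_ne_eq (fun j => f j (v + k • s j₀ + k • (s j - s j₀))),
    ← Finset.mul_prod_erase Finset.univ _ (Finset.mem_univ j₀)]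
  congr 1
  refine Finset.prod_congr rfl fun j _ => ?_
  rw [smul_sub]
  congr 1
  abel

lemma dualFn_update (s : J → V) (f : J → V → ℝ) (j₀ : J) (x : V → ℝ) :
    dualFn K s (Function.update f j₀ x) j₀ = dualFn K s f j₀ := by
  funext v
  refine avg_congr fun k => Finset.prod_congr rfl fun j _ => ?_
  rw [Function.update_of_ne j.2]

lemma patternCount_update (s : J → V) (f : J → V → ℝ) (j₀ : J) (x : V → ℝ) :
    patternCount K s (Function.update f j₀ x) = avg (fun v => x v * dualFn K s f j₀ v) := by
  rw [patternCount_eq s _ j₀, dualFn_update, Function.update_self]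

lemma dualFn_mono {s : J → V} {f g : J → V → ℝ} {j₀ : J} (hf : ∀ j v, 0 ≤ f j v)
    (h : ∀ j v, f j v ≤ g j v) (v : V) : dualFn K s f j₀ v ≤ dualFn K s g j₀ v :=
  avg_mono fun _ => Finset.prod_le_prod (fun _ _ => hf _ _) fun _ _ => h _ _

lemma dualFn_nonneg {s : J → V} {f : J → V → ℝ} {j₀ : J} (hf : ∀ j v, 0 ≤ f j v) (v : V) :
    0 ≤ dualFn K s f j₀ v :=
  avg_nonneg fun _ => Finset.prod_nonneg fun _ _ => hf _ _

lemma dualFn_le_one {s : J → V} {f : J → V → ℝ} {j₀ : J} (hf : ∀ j v, 0 ≤ f j v)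
    (h : ∀ j v, f j v ≤ 1) (v : V) : dualFn K s f j₀ v ≤ 1 :=
  avg_le_const fun _ => Finset.prod_le_one (fun _ _ => hf _ _) fun _ _ => h _ _

/-- The differences of pairs of distinct points of `s`. -/
def pairDiff (s : J → V) (a : {p : J × J // p.1 ≠ p.2}) : V := s a.1.1 - s a.1.2

lemma dualFn_mem_testHull (s : J → V) {f : J → V → ℝ} (hf : ∀ j v, |f j v| ≤ 1) (j₀ : J) :
    dualFn K s f j₀ ∈ testHull K (pairDiff s) := by
  have key : dualFn K s f j₀ = fun v => avg fun k : K => 1 * avg fun t : {p : J × J // p.1 ≠ p.2} → K =>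
      ∏ a : {p : J × J // p.1 ≠ p.2},
        if a.1.2 = j₀ then f a.1.1 (v + (k - ∑ b, t b) • pairDiff s a) else 1 := by
    funext v
    simp only [one_mul]
    rw [avg_comm]
    have : ∀ t : {p : J × J // p.1 ≠ p.2} → K, avg (fun k : K => ∏ a : {p : J × J // p.1 ≠ p.2},
        if a.1.2 = j₀ then f a.1.1 (v + (k - ∑ b, t b) • pairDiff s a) else 1) =
        dualFn K s f j₀ v := by
      intro t
      unfold dualFn
      rw [← avg_equiv (Equiv.subRight (∑ b, t b))
        (fun k => ∏ j : {j // j ≠ j₀}, f j (v + k • (s j - s j₀)))]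
      refine avg_congr fun k => ?_
      simp only [pairDiff, Equiv.subRight_apply]
      rw [← Finset.prod_subtype (p := fun p : J × J => p.1 ≠ p.2)
        (Finset.univ.filter fun p : J × J => p.1 ≠ p.2) (by simp)
        (fun p : J × J => if p.2 = j₀ then f p.1 (v + (k - ∑ b, t b) • (s p.1 - s p.2)) else 1),
        prod_ne_eq (fun j => f j (v + (k - ∑ b, t b) • (s j - s j₀))), Finset.prod_filter, Fintype.prod_prod_type,
        ← Finset.prod_subset (Finset.subset_univ (Finset.univ.erase j₀))]
      · refine Finset.prod_congr rfl fun j hj => ?_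
        rw [Finset.prod_eq_single j₀]
        · simp [Finset.ne_of_mem_erase hj]
        · intro b _ hb; simp [hb]
        · simp
      · intro j _ hj
        obtain rfl : j = j₀ := by simpa using hj
        refine Finset.prod_eq_one fun b _ => ?_
        by_cases h : b = j <;> simp [h]
    rw [avg_congr this, avg_const]
  rw [key]
  refine avg_mem_testHull fun k => TestFn.mem_testHull ⟨fun a v t =>
    if a.1.2 = j₀ then f a.1.1 (v + (k - ∑ b, t b) • pairDiff s a) else 1, 1, ?_, ?_, by simp,
    fun v => rfl⟩
  · intro a v t
    beta_reduce
    split_ifs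
    exacts [hf _ _, by simp]
  · intro a v t r
    have h1 : ∑ b, Function.update t a (t a + r) b = ∑ b, t b + r := by
      rw [← Finset.add_sum_erase Finset.univ _ (Finset.mem_univ a),
        ← Finset.add_sum_erase Finset.univ t (Finset.mem_univ a),
        Finset.sum_congr rfl fun b hb => by
          rw [Function.update_of_ne (Finset.ne_of_mem_erase hb)]]
      simp only [Function.update_self]
      ring
    beta_reduce
    rw [h1]
    split_ifs
    · congr 1
      rw [add_assoc, ← add_smul]
      congr 2
      ring
    · rfl

/-- The set of all differences of points of `s`. -/
def diffSet (s : J → V) : Set V := Set.range fun p : J × J => s p.1 - s p.2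

lemma sub_mem_diffSet (s : J → V) (i j : J) : s i - s j ∈ diffSet s := ⟨(i, j), rfl⟩

lemma zero_mem_diffSet [Nonempty J] (s : J → V) : (0 : V) ∈ diffSet s :=
  ⟨(Classical.arbitrary J, Classical.arbitrary J), sub_self _⟩

/-- The `i`-th point in the coordinates adapted to Cauchy–Schwarz. -/
def shiftedPoint (s : J → V) (j₀ : J) (i : {j // j ≠ j₀}) (c : Bool) (y : V × (Bool → K))
    (x : {j // j ≠ j₀} → K) : V :=
  y.1 + y.2 c • (s i - s j₀) + ∑ i', x i' • (s i' - s i)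

lemma prod_powerset_eq_ite {I M : Type*} [Fintype I] [DecidableEq I] [CommMonoid M] (a : Finset I)
    (h : Finset I → M) : ∏ b ∈ a.powerset, h b = ∏ b, if b ⊆ a then h b else 1 := by
  rw [← Finset.prod_filter]
  congr 1
  ext b
  simp

/-- The coefficients of the linear forms in the weighted counting estimate. -/
def cubeForm (s : J → V) (j₀ : J) :
    Finset {j // j ≠ j₀} ⊕ ({j // j ≠ j₀} × Bool × Finset {j // j ≠ j₀}) →
      Bool ⊕ ({j // j ≠ j₀} × Bool) → V
  | .inl b => Sum.elim 0 fun q => if q.2 = decide (q.1 ∈ b) then s q.1 - s j₀ else 0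
  | .inr (i, c, b) => Sum.elim (fun c' => if c' = c then s i - s j₀ else 0)
      fun q => if q.2 = decide (q.1 ∈ b) then s q.1 - s i else 0

/-- The variables of `cubeForm`. -/
def cubeVars (K I : Type) : (Bool → K) × (I → Bool → K) ≃ (Bool ⊕ (I × Bool) → K) :=
  (Equiv.prodCongr (Equiv.refl _) (Equiv.curry I Bool K).symm).trans
    (Equiv.sumArrowEquivProdArrow Bool (I × Bool) K).symm

lemma cubeForm_inl (s : J → V) (j₀ : J) (b : Finset {j // j ≠ j₀}) (k : Bool → K)
    (z : {j // j ≠ j₀} → Bool → K) (u : V) :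
    u + ∑ q, cubeVars K _ (k, z) q • cubeForm s j₀ (.inl b) q =
      u + ∑ i, selectCopy z b i • (s i - s j₀) := by
  rw [Fintype.sum_sum_type, Fintype.sum_prod_type]
  simp only [cubeForm, cubeVars, Sum.elim_inl, Pi.zero_apply, smul_zero, Finset.sum_const_zero,
    zero_add]
  congr 1
  refine Finset.sum_congr rfl fun i _ => ?_
  rw [Fintype.sum_bool]
  by_cases h : i ∈ b <;>
    simp [h, selectCopy, Equiv.sumArrowEquivProdArrow, Function.uncurry]

lemma cubeForm_inr (s : J → V) (j₀ : J) (i : {j // j ≠ j₀}) (c : Bool) (b : Finset {j // j ≠ j₀})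
    (k : Bool → K) (z : {j // j ≠ j₀} → Bool → K) (u : V) :
    u + ∑ q, cubeVars K _ (k, z) q • cubeForm s j₀ (.inr (i, c, b)) q =
      shiftedPoint s j₀ i c (u, k) (selectCopy z b) := by
  rw [Fintype.sum_sum_type, Fintype.sum_prod_type, shiftedPoint, ← add_assoc]
  congr 1
  · congr 1
    rw [Fintype.sum_bool]
    cases c <;> simp [cubeForm, cubeVars, Equiv.sumArrowEquivProdArrow]
  · refine Finset.sum_congr rfl fun i _ => ?_
    rw [Fintype.sum_bool]
    by_cases h : i ∈ b <;>
      simp [h, selectCopy, cubeForm, cubeVars, Equiv.sumArrowEquivProdArrow, Function.uncurry]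

lemma decide_pattern_ext {I : Type*} [DecidableEq I] {W : Type*} [Zero W] {b b' : Finset I}
    {v : I → W} (P : I → Prop) (hv : ∀ i, P i → v i ≠ 0)
    (h : ∀ i (c : Bool), (if c = decide (i ∈ b) then v i else 0) =
      if c = decide (i ∈ b') then v i else 0) (i : I) (hi : P i) : i ∈ b ↔ i ∈ b' := by
  have := h i (decide (i ∈ b))
  by_contra hne
  rw [if_pos rfl, if_neg] at this
  · exact hv i hi this
  · intro h'
    exact hne (decide_eq_decide.mp h')

lemma cubeForm_injOn {s : J → V} (hs : Function.Injective s) (j₀ : J) :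
    Set.InjOn (cubeForm s j₀) {t | ∀ i c b, t = .inr (i, c, b) → i ∉ b} := by
  have h0 : ∀ i : {j // j ≠ j₀}, s i - s j₀ ≠ 0 := fun i h => i.2 (hs (sub_eq_zero.mp h))
  have h1 : ∀ i i' : {j // j ≠ j₀}, i' ≠ i → s i' - s i ≠ 0 :=
    fun i i' hne h => hne (Subtype.ext (hs (sub_eq_zero.mp h)))
  rintro (b | ⟨i, c, b⟩) ht (b' | ⟨i', c', b'⟩) ht' h
  · congr 1
    ext i
    exact decide_pattern_ext (v := fun i : {j // j ≠ j₀} => s i - s j₀) (fun _ => True)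
      (fun i _ => h0 i) (fun i c => congrFun h (.inr (i, c))) i trivial
  · have := congrFun h (.inl c')
    simp only [cubeForm, Sum.elim_inl, Pi.zero_apply, if_true] at this
    exact absurd this.symm (h0 i')
  · have := congrFun h (.inl c)
    simp only [cubeForm, Sum.elim_inl, Pi.zero_apply, if_true] at this
    exact absurd this (h0 i)
  · have hc := congrFun h (.inl c)
    simp only [cubeForm, Sum.elim_inl, if_true] at hc
    obtain rfl : c = c' := by
      by_contra hne
      rw [if_neg hne] at hc
      exact h0 i hc
    rw [if_pos rfl, sub_left_inj] at hc
    obtain rfl : i = i' := Subtype.ext (hs hc)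
    have hb := ht i c b rfl
    have hb' := ht' i c b' rfl
    congr 3
    ext i'
    rcases eq_or_ne i' i with rfl | hne
    · simp [hb, hb']
    · exact decide_pattern_ext (v := fun i' : {j // j ≠ j₀} => s i' - s i) (fun i' => i' ≠ i)
        (fun i' hi => h1 i i' hi) (fun i' c => congrFun h (.inr (i', c))) i' hne

lemma cubeForm_mem [Nonempty J] (s : J → V) (j₀ : J) (t q) : cubeForm s j₀ t q ∈ diffSet s := by
  rcases t with b | ⟨i, c, b⟩ <;> rcases q with c' | q <;> simp only [cubeForm, Sum.elim_inl,
    Sum.elim_inr, Pi.zero_apply] <;> try split_ifs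
  all_goals first | exact zero_mem_diffSet s | exact sub_mem_diffSet s _ _

end Counting

section Counting

variable {K V J : Type} [Field K] [Fintype K] [AddCommGroup V] [Module K V] [Fintype V]
  [Fintype J] [DecidableEq J]

lemma shiftedPoint_eq (s : J → V) (j₀ : J) (i : {j // j ≠ j₀}) (c : Bool) (u : V) (k : Bool → K)
    (x : {j // j ≠ j₀} → K) :
    shiftedPoint s j₀ i c (u, k) x =
      (u + ∑ i', x i' • (s i' - s j₀)) + (k c - ∑ i', x i') • (s i - s j₀) := by
  have : ∑ i', x i' • (s i' - s i) = ∑ i', x i' • (s i' - s j₀) - (∑ i', x i') • (s i - s j₀) := by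
    rw [Finset.sum_smul, ← Finset.sum_sub_distrib]
    refine Finset.sum_congr rfl fun i' _ => ?_
    rw [← smul_sub]
    congr 1
    abel
  rw [shiftedPoint, this, sub_smul]
  abel

lemma shiftedPoint_update (s : J → V) (j₀ : J) (i : {j // j ≠ j₀}) (c : Bool) (y : V × (Bool → K))
    (x : {j // j ≠ j₀} → K) (t : K) :
    shiftedPoint s j₀ i c y (Function.update x i t) = shiftedPoint s j₀ i c y x := by
  unfold shiftedPoint
  congr 1
  refine Finset.sum_congr rfl fun i' _ => ?_
  rcases eq_or_ne i' i with rfl | h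
  · simp
  · rw [Function.update_of_ne h]

lemma avg_weighted_dualFn (s : J → V) (j₀ : J) (w : V → ℝ) (Φ : Bool → J → V → ℝ) :
    avg (fun q : (V × (Bool → K)) × ({j // j ≠ j₀} → K) =>
      w (q.1.1 + ∑ i, q.2 i • (s i - s j₀)) *
        ∏ i : {j // j ≠ j₀}, ∏ c, Φ c i (shiftedPoint s j₀ i c q.1 q.2)) =
    avg (fun v => w v * (dualFn K s (Φ false) j₀ v * dualFn K s (Φ true) j₀ v)) := by
  rw [avg_prod, avg_comm]
  rw [show avg (fun v => w v * (dualFn K s (Φ false) j₀ v * dualFn K s (Φ true) j₀ v)) =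
    avg (fun _ : {j // j ≠ j₀} → K =>
      avg (fun v => w v * (dualFn K s (Φ false) j₀ v * dualFn K s (Φ true) j₀ v))) from
      (avg_const _).symm]
  refine avg_congr fun x => ?_
  rw [avg_prod, ← avg_equiv (Equiv.addRight (∑ i : {j // j ≠ j₀}, x i • (s i - s j₀)))
    (fun v => w v * (dualFn K s (Φ false) j₀ v * dualFn K s (Φ true) j₀ v))]
  refine avg_congr fun u => ?_
  simp only [shiftedPoint_eq, Equiv.coe_addRight]
  rw [avg_mul_left]
  congr 1
  unfold dualFn
  rw [← avg_bool_fun, ← avg_equiv (Equiv.subRight (fun _ : Bool => ∑ i, x i)) (fun p : Bool → K =>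
    (∏ i : {j // j ≠ j₀}, Φ false i (u + ∑ i, x i • (s i - s j₀) + p false • (s i - s j₀))) *
     ∏ i : {j // j ≠ j₀}, Φ true i (u + ∑ i, x i • (s i - s j₀) + p true • (s i - s j₀)))]
  refine avg_congr fun k => ?_
  rw [← Finset.prod_mul_distrib]
  refine Finset.prod_congr rfl fun i _ => ?_
  rw [Fintype.prod_bool, mul_comm]
  rfl

variable {ν : V → ℝ} {D : ℕ} {ε : ℝ}

theorem abs_avg_weighted_dualFn_le {s : J → V} (hs : Function.Injective s) (j₀ : J)
    (hν : LinForms K ν D (diffSet s) ε) (hD : 2 + 2 * Fintype.card J ≤ D) (hε : ε ≤ 1)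
    (p : Bool → J → Bool) (Φ : Bool → J → V → ℝ) (h0 : ∀ c j v, 0 ≤ Φ c j v)
    (h1 : ∀ c j v, Φ c j v ≤ if p c j then ν v else 1) {η : ℝ} (hη : 0 ≤ η)
    (hεη : 2 ^ 2 ^ Fintype.card {j // j ≠ j₀} * ε ≤ η ^ 2 ^ Fintype.card {j // j ≠ j₀}) :
    |avg (fun v => (ν v - 1) * (dualFn K s (Φ false) j₀ v * dualFn K s (Φ true) j₀ v))| ≤
      2 * η := by
  have : Nonempty J := ⟨j₀⟩
  have hcard : Fintype.card (Bool ⊕ ({j // j ≠ j₀} × Bool)) ≤ D := by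
    have : Fintype.card {j // j ≠ j₀} ≤ Fintype.card J := Fintype.card_subtype_le _
    simp only [Fintype.card_sum, Fintype.card_prod, Fintype.card_bool]
    omega
  have hconv : ∀ F : V × (Bool ⊕ ({j // j ≠ j₀} × Bool) → K) → ℝ,
      avg (fun q : (V × (Bool → K)) × ({j // j ≠ j₀} → Bool → K) =>
        F (q.1.1, cubeVars K _ (q.1.2, q.2))) = avg F := by
    intro F
    rw [← avg_equiv ((Equiv.prodAssoc _ _ _).trans (Equiv.prodCongr (Equiv.refl V) (cubeVars K _))) F]
    rfl
  rw [← avg_weighted_dualFn]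
  refine box_cauchySchwarz (Y := V × (Bool → K)) (I := {j // j ≠ j₀}) (X := K)
    (fun y x => ν (y.1 + ∑ i, x i • (s i - s j₀)) - 1)
    (fun i y x => ∏ c, Φ c i (shiftedPoint s j₀ i c y x))
    (fun i y x => ∏ c, if p c i then ν (shiftedPoint s j₀ i c y x) else 1)
    (fun i y x t => by simp only [shiftedPoint_update])
    (fun i y x t => by simp only [shiftedPoint_update])
    (fun i y x => ?_) (fun i a hia => ?_) hη ?_
  · rw [Finset.abs_prod]
    refine Finset.prod_le_prod (fun _ _ => abs_nonneg _) fun c _ => ?_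
    rw [abs_of_nonneg (h0 _ _ _)]
    exact h1 _ _ _
  · have hfam := hν.family hcard
      ((Finset.univ.filter fun q : Bool × Finset {j // j ≠ j₀} => q.2 ⊆ a ∧ p q.1 i))
      (fun q => cubeForm s j₀ (.inr (i, q.1, q.2))) ?_ (fun t _ q => cubeForm_mem s j₀ _ q)
    · rw [← hconv] at hfam
      simp only [cubeForm_inr] at hfam
      have := (abs_le.mp hfam).2
      refine le_trans (le_of_eq (avg_congr fun q => ?_)) (by linarith : _ ≤ _)
      · rw [Finset.prod_filter, Fintype.prod_prod_type, prod_powerset_eq_ite, Finset.prod_comm]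
        refine Finset.prod_congr rfl fun b _ => ?_
        by_cases hb : b ⊆ a <;> simp [hb]
    · intro q hq q' hq' h
      simp only [Finset.coe_filter, Finset.mem_univ, true_and, Set.mem_ofPred_eq] at hq hq'
      have := cubeForm_injOn hs j₀ (x₁ := .inr (i, q.1, q.2)) (x₂ := .inr (i, q'.1, q'.2))
        (by rintro i' c b ⟨⟩; exact fun h => hia (hq.1 h))
        (by rintro i' c b ⟨⟩; exact fun h => hia (hq'.1 h)) h
      simp only [Sum.inr.injEq, Prod.mk.injEq, true_and] at this
      exact Prod.ext this.1 this.2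
  · have hmix := hν.mixed hcard (Finset.univ.map .inl) (cubeForm s j₀)
      ((Finset.univ.filter fun q : {j // j ≠ j₀} × Bool × Finset {j // j ≠ j₀} =>
        q.2.2 ⊆ Finset.univ.erase q.1 ∧ p q.2.1 q.1).map .inr)
      (Finset.disjoint_map_inl_map_inr _ _) ?_ (fun t _ q => cubeForm_mem s j₀ t q)
    · rw [← hconv, if_neg (by simp [Finset.univ_nonempty.ne_empty]), sub_zero, Finset.card_map, Finset.card_univ,
        Fintype.card_finset] at hmix
      refine le_trans (le_of_eq ?_) (hmix.trans hεη)
      congr 1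
      refine avg_congr fun q => ?_
      simp only [Finset.prod_map, Function.Embedding.inl_apply, Function.Embedding.inr_apply,
        cubeForm_inl, cubeForm_inr]
      congr 1
      rw [Finset.prod_filter, Fintype.prod_prod_type]
      refine Finset.prod_congr rfl fun i _ => ?_
      rw [Fintype.prod_prod_type, prod_powerset_eq_ite, Finset.prod_comm]
      refine Finset.prod_congr rfl fun b _ => ?_
      by_cases hb : b ⊆ Finset.univ.erase i <;> simp [hb]
    · refine (cubeForm_injOn hs j₀).mono ?_
      intro t ht i c b hib
      subst hib
      simp only [Finset.coe_union, Finset.coe_map, Set.mem_union, Set.mem_image, Finset.mem_coe,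
        Function.Embedding.inl_apply, Function.Embedding.inr_apply, reduceCtorEq, and_false,
        exists_false, false_or, Sum.inr.injEq, exists_eq_right, Finset.mem_filter] at ht
      exact fun h => Finset.notMem_erase i _ (ht.2.1 h)

end Counting

section Counting

variable {K V J : Type} [Field K] [Fintype K] [AddCommGroup V] [Module K V] [Fintype V]
  [Fintype J] [DecidableEq J] {ν : V → ℝ} {D : ℕ} {ε : ℝ}

/-- The majorant which is `ν` on the positions in `U` and `1` elsewhere. -/
def capMajorant (ν : V → ℝ) (U : Finset J) (j : J) (v : V) : ℝ := if j ∈ U then ν v else 1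

lemma capMajorant_nonneg (hν0 : ∀ v, 0 ≤ ν v) (U : Finset J) (j : J) (v : V) :
    0 ≤ capMajorant ν U j v := by
  unfold capMajorant
  split_ifs
  exacts [hν0 v, zero_le_one]

lemma abs_avg_prod_capMajorant_le {s : J → V} (hs : Function.Injective s) (j₀ : J)
    (hν : LinForms K ν D (diffSet s) ε) (hD : 2 ≤ D) (U : Finset J) (C : Finset Bool) :
    |avg (fun q : V × (Bool → K) => ∏ c ∈ C, ∏ j : {j // j ≠ j₀},
      capMajorant ν U j (q.1 + q.2 c • (s j - s j₀))) - 1| ≤ ε := by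
  have : Nonempty J := ⟨j₀⟩
  have hfam := hν.family (ι := Bool) (by simpa using hD)
    (Finset.univ.filter fun q : Bool × {j // j ≠ j₀} => q.1 ∈ C ∧ (q.2 : J) ∈ U)
    (fun q c' => if c' = q.1 then s q.2 - s j₀ else 0) ?_ ?_
  · refine le_trans (le_of_eq ?_) hfam
    congr 2
    refine avg_congr fun q => ?_
    rw [Finset.prod_filter, Fintype.prod_prod_type, ← Finset.prod_subset (Finset.subset_univ C)]
    · refine Finset.prod_congr rfl fun c hc => Finset.prod_congr rfl fun j _ => ?_
      simp [hc, capMajorant]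
    · intro c _ hc
      simp [hc]
  · rintro ⟨c, j⟩ _ ⟨c', j'⟩ _ h
    have h0 : ∀ i : {j // j ≠ j₀}, s i - s j₀ ≠ 0 := fun i h => i.2 (hs (sub_eq_zero.mp h))
    have hc := congrFun h c
    simp only [if_true] at hc
    by_cases hcc : c = c'
    · subst hcc
      rw [if_pos rfl, sub_left_inj] at hc
      rw [Subtype.ext (hs hc)]
    · rw [if_neg hcc] at hc
      exact absurd hc (h0 j)
  · intro t _ i
    beta_reduce
    split_ifs
    exacts [sub_mem_diffSet s _ _, zero_mem_diffSet s]

lemma abs_avg_dualFn_capMajorant_le {s : J → V} (hs : Function.Injective s) (j₀ : J)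
    (hν : LinForms K ν D (diffSet s) ε) (hD : 2 ≤ D) (U : Finset J) :
    |avg (dualFn K s (capMajorant ν U) j₀) - 1| ≤ ε := by
  refine le_trans (le_of_eq ?_) (abs_avg_prod_capMajorant_le hs j₀ hν hD U {false})
  congr 2
  rw [avg_prod]
  refine avg_congr fun v => ?_
  have := avg_bool_fun (fun k : K => ∏ j : {j // j ≠ j₀},
      capMajorant ν U j (v + k • (s j - s j₀))) (fun _ => 1)
  simp only [mul_one, avg_const] at this
  simp only [Finset.prod_singleton, this]
  rfl

lemma abs_avg_dualFn_capMajorant_sq_le {s : J → V} (hs : Function.Injective s) (j₀ : J)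
    (hν : LinForms K ν D (diffSet s) ε) (hD : 2 ≤ D) (U : Finset J) :
    |avg (fun v => dualFn K s (capMajorant ν U) j₀ v ^ 2) - 1| ≤ ε := by
  refine le_trans (le_of_eq ?_) (abs_avg_prod_capMajorant_le hs j₀ hν hD U Finset.univ)
  congr 2
  rw [avg_prod]
  refine avg_congr fun v => ?_
  simp only [Fintype.prod_bool]
  rw [pow_two, dualFn, ← avg_bool_fun]
  refine avg_congr fun k => ?_
  rw [mul_comm]

/-- A truncation error estimate. -/
lemma avg_abs_sub_one_mul_le {V : Type*} [Fintype V] [Nonempty V] {F : V → ℝ} {ε μ : ℝ} (hε : ε ≤ 1)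
    (hμ : 0 < μ) (h1 : |avg F - 1| ≤ ε) (h2 : |avg (fun v => F v ^ 2) - 1| ≤ ε) :
    avg (fun v => |F v - 1| * |F v + 1|) ≤ 3 * ε / (2 * μ) + 4 * μ := by
  have hle : ∀ v, |F v - 1| * |F v + 1| ≤ (F v - 1) ^ 2 * (1 / (2 * μ)) + (F v + 1) ^ 2 * (μ / 2) := by
    intro v
    rw [← sq_abs (F v - 1), ← sq_abs (F v + 1)]
    have : 0 ≤ (|F v - 1| - μ * |F v + 1|) ^ 2 / (2 * μ) := by positivity
    have e : (|F v - 1| - μ * |F v + 1|) ^ 2 / (2 * μ) = |F v - 1| ^ 2 * (1 / (2 * μ)) +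
      |F v + 1| ^ 2 * (μ / 2) - |F v - 1| * |F v + 1| := by field_simp; ring
    linarith
  refine (avg_mono hle).trans ?_
  rw [avg_add, avg_mul_right, avg_mul_right]
  have e1 : avg (fun v => (F v - 1) ^ 2) = avg (fun v => F v ^ 2) - 2 * avg F + 1 := by
    rw [← avg_mul_left, ← avg_sub, ← avg_const (X := V) (1 : ℝ), ← avg_add]
    exact avg_congr fun v => by rw [avg_const]; ring
  have e2 : avg (fun v => (F v + 1) ^ 2) = avg (fun v => F v ^ 2) + 2 * avg F + 1 := by
    rw [← avg_mul_left, ← avg_add, ← avg_const (X := V) (1 : ℝ), ← avg_add]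
    exact avg_congr fun v => by rw [avg_const]; ring
  rw [abs_le] at h1 h2
  have b1 : avg (fun v => (F v - 1) ^ 2) ≤ 3 * ε := by rw [e1]; linarith
  have b2 : avg (fun v => (F v + 1) ^ 2) ≤ 8 := by rw [e2]; linarith
  calc _ ≤ 3 * ε * (1 / (2 * μ)) + 8 * (μ / 2) := by gcongr
    _ = _ := by ring

end Counting

section Counting

variable {K V J : Type} [Field K] [Fintype K] [AddCommGroup V] [Module K V] [Fintype V]
  [Fintype J] [DecidableEq J] {ν : V → ℝ} {D : ℕ} {ε : ℝ}

lemma LinForms.mono {Ω : Set V} {ε' : ℝ} (hν : LinForms K ν D Ω ε) (h : ε ≤ ε') :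
    LinForms K ν D Ω ε' :=
  fun ι _ _ hι T hT => (hν ι hι T hT).trans h

lemma LinForms.abs_avg_sub_one_le {Ω : Set V} (hν : LinForms K ν D Ω ε) : |avg ν - 1| ≤ ε := by
  have := hν.family (ι := Empty) (by simp) {()} (fun _ i => i.elim)
    (fun _ _ _ _ _ => Subsingleton.elim _ _) (fun _ _ i => i.elim)
  rw [avg_prod] at this
  simpa [avg_const] using this

lemma patternCount_sub_update (s : J → V) (f g : J → V → ℝ) (j₀ : J) (x : V → ℝ) :
    patternCount K s (Function.update f j₀ x) - patternCount K s (Function.update g j₀ x) =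
      avg (fun v => x v * (dualFn K s f j₀ v - dualFn K s g j₀ v)) := by
  rw [patternCount_update, patternCount_update, ← avg_sub]
  exact avg_congr fun v => by ring

lemma patternCount_sub_of_bounded {s : J → V} {f g : J → V → ℝ} (hf : ∀ j v, |f j v| ≤ 1)
    (hg : ∀ j v, |g j v| ≤ 1)
    (hfg : ∀ j, ∀ φ ∈ testHull K (pairDiff s), |avg (fun v => (f j v - g j v) * φ v)| ≤ ε)
    (T : Finset J) :
    |patternCount K s f - patternCount K s (fun j => if j ∈ T then g j else f j)| ≤ T.card * ε := by
  induction T using Finset.induction with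
  | empty => simp
  | insert i T hi ih =>
    set h : J → V → ℝ := fun j => if j ∈ T then g j else f j with hh
    have e1 : (fun j => if j ∈ insert i T then g j else f j) = Function.update h i (g i) := by
      funext j
      rcases eq_or_ne j i with rfl | hj
      · simp
      · simp [hj, hh]
    have e2 : h = Function.update h i (f i) := by
      funext j
      rcases eq_or_ne j i with rfl | hj
      · simp [hh, hi]
      · simp [hj]
    have key : patternCount K s h - patternCount K s (Function.update h i (g i)) =
        avg (fun v => (f i v - g i v) * dualFn K s h i v) := by
      conv_lhs => rw [e2]
      rw [Function.update_idem, patternCount_update, patternCount_update, ← avg_sub]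
      exact avg_congr fun v => by ring
    rw [e1, Finset.card_insert_of_notMem hi]
    have := hfg i _ (dualFn_mem_testHull (K := K) s (f := h) (fun j v => by
      simp only [hh]; split_ifs; exacts [hg j v, hf j v]) i)
    rw [← key] at this
    push_cast
    calc _ ≤ _ := abs_sub_le _ (patternCount K s h) _
      _ ≤ T.card * ε + ε := add_le_add ih this
      _ = _ := by ring

lemma sq_sub_le_truncated {x y b : ℝ} (hx : 0 ≤ x) (hxb : x ≤ b) (hy : 0 ≤ y) (hy1 : y ≤ 1) :
    (x - y) ^ 2 ≤ min x 1 * (x - y) - y * (x - y) + |b - 1| * |b + 1| := by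
  rw [abs_of_nonneg (by linarith : 0 ≤ b + 1)]
  rcases le_total x 1 with h | h
  · rw [min_eq_left h]
    nlinarith [mul_nonneg (abs_nonneg (b - 1)) (by linarith : 0 ≤ b + 1)]
  · rw [min_eq_right h, abs_of_nonneg (by linarith)]
    nlinarith [mul_nonneg (by linarith : 0 ≤ x - 1) (by linarith : 0 ≤ b - x),
      mul_nonneg (by linarith : 0 ≤ b - 1) (by linarith : 0 ≤ b + 1 - (x - y))]

theorem counting_lemma (d m : ℕ) : ∀ {η : ℝ}, 0 < η → ∃ ε > 0, ∀ (K V J : Type) [Field K] [Fintype K]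
    [AddCommGroup V] [Module K V] [Fintype V] [Fintype J] [DecidableEq J] (s : J → V)
    (_ : Function.Injective s) (ν : V → ℝ) (D : ℕ), Fintype.card J = d → 2 + 2 * d ≤ D →
    LinForms K ν D (diffSet s) ε → (∀ v, 0 ≤ ν v) → ∀ U : Finset J, U.card = m →
    ∀ f g : J → V → ℝ, (∀ j v, 0 ≤ f j v) → (∀ j v, f j v ≤ capMajorant ν U j v) →
    (∀ j v, 0 ≤ g j v) → (∀ j v, g j v ≤ 1) →
    (∀ j, ∀ φ ∈ testHull K (pairDiff s), |avg (fun v => (f j v - g j v) * φ v)| ≤ ε) →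
    |patternCount K s f - patternCount K s g| ≤ η := by
  induction m with
  | zero =>
    intro η hη
    refine ⟨η / (d + 1), by positivity, ?_⟩
    intro K V J _ _ _ _ _ _ _ s hs ν D hd hD hν hν0 U hU f g hf hfU hg hg1 hfg
    obtain rfl := Finset.card_eq_zero.mp hU
    have := patternCount_sub_of_bounded (K := K)
      (fun j v => abs_le.mpr ⟨by linarith [hf j v], by simpa [capMajorant] using hfU j v⟩)
      (fun j v => abs_le.mpr ⟨by linarith [hg j v], hg1 j v⟩) hfg Finset.univ
    simp only [Finset.mem_univ, if_true, Finset.card_univ, hd] at this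
    refine this.trans ?_
    rw [mul_div_assoc', div_le_iff₀ (by positivity)]
    nlinarith
  | succ m ih =>
    intro η hη
    set κ := η ^ 2 / 4 with hκ
    have hκ0 : 0 < κ := by positivity
    obtain ⟨ε₀, hε₀, IH⟩ := ih (η := κ / 8) (by positivity)
    set η₁ := κ / 32 with hη₁
    set μ := κ / 16 with hμ
    have hη₁0 : 0 < η₁ := by positivity
    have hμ0 : 0 < μ := by positivity
    set ε₁ := η₁ ^ 2 ^ (d - 1) / 2 ^ 2 ^ (d - 1) with hε₁
    refine ⟨min (min ε₀ ε₁) (min 1 (min (η / 4) (μ * κ / 6))), by positivity, ?_⟩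
    intro K V J _ _ _ _ _ _ _ s hs ν D hd hD hν hν0 U hU f g hf hfU hg hg1 hfg
    set ε := min (min ε₀ ε₁) (min 1 (min (η / 4) (μ * κ / 6))) with hε
    have hle0 : ε ≤ ε₀ := (min_le_left _ _).trans (min_le_left _ _)
    have hle1 : ε ≤ ε₁ := (min_le_left _ _).trans (min_le_right _ _)
    have hle2 : ε ≤ 1 := (min_le_right _ _).trans (min_le_left _ _)
    have hle3 : ε ≤ η / 4 := ((min_le_right _ _).trans (min_le_right _ _)).trans (min_le_left _ _)
    have hle4 : ε ≤ μ * κ / 6 :=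
      ((min_le_right _ _).trans (min_le_right _ _)).trans (min_le_right _ _)
    clear_value ε
    obtain ⟨j₀, hj₀⟩ : U.Nonempty := by rw [← Finset.card_pos]; omega
    have hI : Fintype.card {j // j ≠ j₀} = d - 1 := by
      rw [← hd]; simp [Fintype.card_subtype_compl]
    have hU' : (U.erase j₀).card = m := by rw [Finset.card_erase_of_mem hj₀, hU]; rfl
    set x := dualFn K s f j₀ with hx
    set y := dualFn K s g j₀ with hy
    set b := dualFn K s (capMajorant ν U) j₀ with hb
    have hx0 : ∀ v, 0 ≤ x v := dualFn_nonneg hf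
    have hxb : ∀ v, x v ≤ b v := dualFn_mono hf hfU
    have hy0 : ∀ v, 0 ≤ y v := dualFn_nonneg hg
    have hy1 : ∀ v, y v ≤ 1 := dualFn_le_one hg hg1
    have hyT : y ∈ testHull K (pairDiff s) :=
      dualFn_mem_testHull s (fun j v => abs_le.mpr ⟨by linarith [hg j v], hg1 j v⟩) j₀
    -- replacing the unbounded function at `j₀` by a bounded one
    have hrep : ∀ z : V → ℝ, (∀ v, 0 ≤ z v) → (∀ v, z v ≤ 1) →
        |avg (fun v => z v * (x v - y v))| ≤ κ / 8 := by
      intro z hz0 hz1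
      rw [hx, hy, ← patternCount_sub_update]
      refine IH K V J s hs ν D hd hD (hν.mono hle0) hν0 _ hU' _ _ ?_ ?_ ?_ ?_ ?_
      · intro j v
        rcases eq_or_ne j j₀ with rfl | hj
        · simpa using hz0 v
        · simpa [hj] using hf j v
      · intro j v
        rcases eq_or_ne j j₀ with rfl | hj
        · simpa [capMajorant] using hz1 v
        · simpa [hj, capMajorant] using hfU j v
      · intro j v
        rcases eq_or_ne j j₀ with rfl | hj
        · simpa using hz0 v
        · simpa [hj] using hg j v
      · intro j v
        rcases eq_or_ne j j₀ with rfl | hj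
        · simpa using hz1 v
        · simpa [hj] using hg1 j v
      · intro j φ hφ
        rcases eq_or_ne j j₀ with rfl | hj
        · simpa [avg] using hε₀.le
        · simpa [hj] using (hfg j φ hφ).trans hle0
    have hN := avg_abs_sub_one_mul_le hle2 hμ0
      (abs_avg_dualFn_capMajorant_le hs j₀ hν (by omega) U)
      (abs_avg_dualFn_capMajorant_sq_le hs j₀ hν (by omega) U)
    have hsq : avg (fun v => (x v - y v) ^ 2) ≤ κ * (3 / 4) := by
      have h1 := hrep (fun v => min (x v) 1) (fun v => le_min (hx0 v) zero_le_one)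
        (fun v => min_le_right _ _)
      have h2 := hrep y hy0 hy1
      have h3 := avg_mono fun v => sq_sub_le_truncated (hx0 v) (hxb v) (hy0 v) (hy1 v)
      rw [avg_add, avg_sub] at h3
      have h4 : 3 * ε / (2 * μ) ≤ κ / 4 := by
        rw [div_le_iff₀ (by positivity)]; linarith
      have h5 : 4 * μ = κ / 4 := by rw [hμ]; ring
      rw [abs_le] at h1 h2
      linarith
    have hweight : ∀ Φ : Bool → J → V → ℝ, (∀ c, Φ c = f ∨ Φ c = g) →
        |avg (fun v => (ν v - 1) * (dualFn K s (Φ false) j₀ v * dualFn K s (Φ true) j₀ v))| ≤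
          2 * η₁ := by
      classical
      intro Φ hΦ
      refine abs_avg_weighted_dualFn_le hs j₀ hν (by omega) hle2
        (fun c j => decide (Φ c = f ∧ j ∈ U)) Φ ?_ ?_ hη₁0.le ?_
      · intro c j v
        rcases hΦ c with h | h <;> rw [h]
        exacts [hf j v, hg j v]
      · intro c j v
        by_cases h : Φ c = f
        · rw [h]; simpa [capMajorant] using hfU j v
        · have h' := (hΦ c).resolve_left h
          simp only [h, false_and, decide_false, Bool.false_eq_true, if_false]
          rw [h']
          exact hg1 j v
      · rw [hI]
        calc _ ≤ 2 ^ 2 ^ (d - 1) * ε₁ := by gcongr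
          _ = _ := by rw [hε₁]; field_simp
    have hw1 := hweight (fun _ => f) (fun _ => .inl rfl)
    have hw2 := hweight (fun c => if c then f else g) (fun c => by cases c <;> simp)
    have hw3 := hweight (fun _ => g) (fun _ => .inr rfl)
    simp only [if_true, Bool.false_eq_true, if_false, ← hx, ← hy] at hw1 hw2 hw3
    have hνsq : avg (fun v => ν v * (x v - y v) ^ 2) ≤ κ := by
      have e : avg (fun v => ν v * (x v - y v) ^ 2) = avg (fun v => (ν v - 1) * (x v * x v)) -
          2 * avg (fun v => (ν v - 1) * (y v * x v)) + avg (fun v => (ν v - 1) * (y v * y v)) +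
          avg (fun v => (x v - y v) ^ 2) := by
        rw [← avg_mul_left, ← avg_sub, ← avg_add, ← avg_add]
        exact avg_congr fun v => by ring
      rw [e]
      rw [abs_le] at hw1 hw2 hw3
      linarith
    have hν2 : avg ν ≤ 2 := by
      have := hν.abs_avg_sub_one_le
      rw [abs_le] at this
      linarith
    have hfν : ∀ v, f j₀ v ≤ ν v := fun v => by simpa [capMajorant, hj₀] using hfU j₀ v
    have hA : |avg (fun v => f j₀ v * (x v - y v))| ≤ η * (3 / 4) := by
      have hpt : ∀ v, |f j₀ v * (x v - y v)| ≤ ν v * (η / 8) + ν v * (x v - y v) ^ 2 * (2 / η) := by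
        intro v
        rw [abs_mul, abs_of_nonneg (hf j₀ v), mul_assoc, ← mul_add]
        refine mul_le_mul (hfν v) ?_ (abs_nonneg _) (hν0 v)
        rw [← sq_abs (x v - y v)]
        have : 0 ≤ (|x v - y v| - η / 4) ^ 2 * (2 / η) := by positivity
        have e : (|x v - y v| - η / 4) ^ 2 * (2 / η) =
          η / 8 + |x v - y v| ^ 2 * (2 / η) - |x v - y v| := by field_simp; ring
        linarith
      refine (abs_avg_le _).trans ((avg_mono hpt).trans ?_)
      rw [avg_add, avg_mul_right, avg_mul_right]
      calc _ ≤ 2 * (η / 8) + κ * (2 / η) := by gcongr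
        _ = _ := by rw [hκ]; field_simp; ring
    have e : patternCount K s f - patternCount K s g = avg (fun v => f j₀ v * (x v - y v)) +
        avg (fun v => (f j₀ v - g j₀ v) * y v) := by
      rw [patternCount_eq s f j₀, patternCount_eq s g j₀, ← avg_add, ← avg_sub]
      exact avg_congr fun v => by ring
    rw [e]
    refine (abs_add_le _ _).trans ?_
    have := hfg j₀ y hyT
    linarith

/-- **Relative Szemerédi theorem** for pseudorandom majorants. -/
theorem relative_szemeredi (r : ℕ) : ∃ D : ℕ, ∀ {δ : ℝ}, 0 < δ → ∃ c > 0, ∃ ε > 0, ∃ n : ℕ,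
    ∀ (K V : Type) [Field K] [Fintype K] [AddCommGroup V] [Module K V] [Fintype V]
    (_ : ∀ m : ℕ, 0 < m → m ≤ n → (m : K) ≠ 0) (s : Fin (r + 1) → V) (_ : Function.Injective s)
    (ν f : V → ℝ), LinForms K ν D (diffSet s) ε → (∀ v, 0 ≤ f v) → (∀ v, f v ≤ ν v) → δ ≤ avg f →
    c ≤ avg (fun p : V × K => ∏ j, f (p.1 + p.2 • s j)) := by
  set d := Fintype.card {p : Fin (r + 1) × Fin (r + 1) // p.1 ≠ p.2} with hd
  refine ⟨max (2 * d) (2 + 2 * (r + 1)), fun {δ} hδ => ?_⟩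
  obtain ⟨c, hc, n, H⟩ := szemeredi_counting r (half_pos hδ)
  obtain ⟨ε₁, hε₁, H₁⟩ := counting_lemma (r + 1) (r + 1) (half_pos hc)
  set η := min ε₁ (δ / 2) with hη
  have hη0 : 0 < η := by positivity
  obtain ⟨ε₂, hε₂, H₂⟩ := exists_dense_model d hη0
  refine ⟨c / 2, half_pos hc, min ε₁ ε₂, by positivity, n, ?_⟩
  intro K V _ _ _ _ _ hK s hs ν f hν hf hfν havg
  have hpd : ∀ a : {p : Fin (r + 1) × Fin (r + 1) // p.1 ≠ p.2}, pairDiff s a ≠ 0 :=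
    fun a h => a.2 (hs (sub_eq_zero.mp h))
  obtain ⟨g, hg0, hg1, hfg⟩ := H₂ K V _ (pairDiff s) ν f _ _ hd.symm (le_max_left _ _)
    (hν.mono (min_le_right _ _)) (zero_mem_diffSet s) (fun a => sub_mem_diffSet s _ _) hpd hf hfν
  have hgavg : δ / 2 ≤ avg g := by
    have := hfg _ one_mem_testHull
    simp only [Pi.one_apply, mul_one] at this
    rw [avg_sub] at this
    have := (abs_le.mp this).2
    have := min_le_right ε₁ (δ / 2)
    linarith
  have h1 := H K V hK s g hg0 hg1 hgavg
  have h2 := H₁ K V (Fin (r + 1)) s hs ν _ (by simp) (le_max_right _ _)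
    (hν.mono (min_le_left _ _)) (fun v => (hf v).trans (hfν v)) Finset.univ (by simp)
    (fun _ => f) (fun _ => g) (fun _ => hf) (fun j v => by simpa [capMajorant] using hfν v)
    (fun _ => hg0) (fun _ => hg1) (fun _ φ hφ => (hfg φ hφ).trans (min_le_left _ _))
  have := (abs_le.mp h2).1
  unfold patternCount at this
  linarith

end Counting

/-! ### Moments of truncated orthogonal expansions -/

section TruncatedMoments

variable {κ τ : Type*} [DecidableEq κ] [Fintype τ] [DecidableEq τ]

/-- The expected value of the product of two orthogonal functions. -/
def orthoFactor (h : ℝ) (x y : Prop) [Decidable x] [Decidable y] : ℝ :=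
  if (x ↔ y) then (if x then h else 1) else 0

lemma orthoFactor_nonneg {h : ℝ} (hh : 0 ≤ h) (x y : Prop) [Decidable x] [Decidable y] :
    0 ≤ orthoFactor h x y := by
  unfold orthoFactor
  split_ifs <;> positivity

lemma prod_orthoFactor (h : κ → ℝ) (P δ δ' : Finset κ) :
    ∏ p ∈ P, orthoFactor (h p) (p ∈ δ) (p ∈ δ') =
      if P ∩ δ = P ∩ δ' then ∏ p ∈ P ∩ δ, h p else 0 := by
  split_ifs with hδ
  · rw [← Finset.filter_mem_eq_inter, Finset.prod_filter]
    refine Finset.prod_congr rfl fun p hp => ?_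
    have : p ∈ δ ↔ p ∈ δ' := by simpa [hp] using Finset.ext_iff.mp hδ p
    simp [orthoFactor, this]
  · obtain ⟨p, hp⟩ : ∃ p, ¬(p ∈ P ∩ δ ↔ p ∈ P ∩ δ') := by
      by_contra hcon
      exact hδ (Finset.ext fun p => not_not.mp fun h => hcon ⟨p, h⟩)
    have hpP : p ∈ P := by by_contra hpP; simp [hpP] at hp
    refine Finset.prod_eq_zero hpP (if_neg ?_)
    simpa [hpP] using hp

lemma card_filter_inter_eq_le (m η P : Finset κ) (𝓛 : Finset (Finset κ)) (hP : ∀ δ ∈ 𝓛, δ ⊆ P) :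
    (𝓛.filter fun δ => (P \ m) ∩ δ = η).card ≤ 2 ^ m.card := by
  rw [← Finset.card_powerset]
  refine Finset.card_le_card_of_injOn (fun δ => m ∩ δ) (fun δ _ => by simp) ?_
  intro δ hδ δ' hδ' h
  simp only [Finset.coe_filter, Set.mem_ofPred_eq] at hδ hδ'
  ext p
  by_cases hp : p ∈ m
  · simpa [hp] using Finset.ext_iff.mp h p
  · have := Finset.ext_iff.mp (hδ.2.trans hδ'.2.symm) p
    have h1 := @hP _ hδ.1 p
    have h2 := @hP _ hδ'.1 p
    simp only [Finset.mem_inter, Finset.mem_sdiff, hp, not_false_eq_true, and_true] at this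
    tauto

lemma sum_prod_orthoFactor_le {h : κ → ℝ} (hh : ∀ p, 0 ≤ h p) (m P : Finset κ)
    (𝓛 : Finset (Finset κ)) (hP : ∀ δ ∈ 𝓛, δ ⊆ P) (hdown : ∀ δ ∈ 𝓛, ∀ δ' ⊆ δ, δ' ∈ 𝓛) :
    ∑ x ∈ 𝓛 ×ˢ 𝓛, ∏ p ∈ P \ m, orthoFactor (h p) (p ∈ x.1) (p ∈ x.2) ≤
      4 ^ m.card * ∑ δ ∈ 𝓛, ∏ p ∈ δ, h p := by
  simp only [prod_orthoFactor]
  rw [Finset.sum_product]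
  have hH : ∀ η : Finset κ, 0 ≤ ∏ p ∈ η, h p := fun η => Finset.prod_nonneg fun p _ => hh p
  have h1 : ∀ δ ∈ 𝓛, ∑ δ' ∈ 𝓛, (if (P \ m) ∩ δ = (P \ m) ∩ δ' then ∏ p ∈ (P \ m) ∩ δ, h p else 0) ≤
      2 ^ m.card * ∏ p ∈ (P \ m) ∩ δ, h p := by
    intro δ _
    rw [← Finset.sum_filter, Finset.sum_const, nsmul_eq_mul]
    gcongr
    · exact hH _
    · simp only [eq_comm (a := (P \ m) ∩ δ)]
      exact_mod_cast card_filter_inter_eq_le m _ P 𝓛 hP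
  refine (Finset.sum_le_sum h1).trans ?_
  rw [← Finset.mul_sum, ← Finset.sum_fiberwise_of_maps_to (s := 𝓛) (t := 𝓛)
    (g := fun δ => (P \ m) ∩ δ) (fun δ hδ => hdown δ hδ _ Finset.inter_subset_right)]
  have h2 : ∀ η ∈ 𝓛, ∑ δ ∈ 𝓛 with (P \ m) ∩ δ = η, ∏ p ∈ (P \ m) ∩ δ, h p ≤
      2 ^ m.card * ∏ p ∈ η, h p := by
    intro η _
    rw [Finset.sum_congr rfl fun δ hδ => by rw [(Finset.mem_filter.mp hδ).2], Finset.sum_const,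
      nsmul_eq_mul]
    gcongr
    · exact hH _
    · exact_mod_cast card_filter_inter_eq_le m _ P 𝓛 hP
  calc _ ≤ 2 ^ m.card * ∑ η ∈ 𝓛, 2 ^ m.card * ∏ p ∈ η, h p := by
        gcongr with η hη; exact h2 η hη
    _ = _ := by rw [← Finset.mul_sum, ← mul_assoc, ← mul_pow]; norm_num

lemma sum_prod_orthoFactor_eq {h : κ → ℝ} (P : Finset κ) (𝓛 : Finset (Finset κ))
    (hP : ∀ δ ∈ 𝓛, δ ⊆ P) :
    ∑ x ∈ 𝓛 ×ˢ 𝓛, ∏ p ∈ P, orthoFactor (h p) (p ∈ x.1) (p ∈ x.2) = ∑ δ ∈ 𝓛, ∏ p ∈ δ, h p := by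
  simp only [prod_orthoFactor]
  rw [Finset.sum_product]
  refine Finset.sum_congr rfl fun δ hδ => ?_
  rw [Finset.sum_eq_single_of_mem δ hδ, if_pos rfl, Finset.inter_eq_right.mpr (hP δ hδ)]
  intro δ' hδ' hne
  rw [Finset.inter_eq_right.mpr (hP δ hδ), Finset.inter_eq_right.mpr (hP δ' hδ'), if_neg hne.symm]

lemma abs_prod_sub_prod_le {ι : Type*} (s : Finset ι) {c g b : ι → ℝ}
    (hg : ∀ i ∈ s, 0 ≤ g i) (h : ∀ i ∈ s, |c i - g i| ≤ b i) :
    |∏ i ∈ s, c i - ∏ i ∈ s, g i| ≤ ∏ i ∈ s, (g i + b i) - ∏ i ∈ s, g i := by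
  classical
  induction s using Finset.induction with
  | empty => simp
  | insert i s hi ih =>
    simp only [Finset.prod_insert hi]
    have ih := ih (fun j hj => hg j (by simp [hj])) (fun j hj => h j (by simp [hj]))
    have hgi := hg i (by simp)
    have hi' := h i (by simp)
    have hG : 0 ≤ ∏ j ∈ s, g j := Finset.prod_nonneg fun j hj => hg j (by simp [hj])
    have hc : |c i| ≤ g i + b i := by
      calc |c i| = |g i + (c i - g i)| := by ring_nf
        _ ≤ |g i| + |c i - g i| := abs_add_le _ _
        _ ≤ _ := by rw [abs_of_nonneg hgi]; gcongr
    calc _ = |c i * (∏ j ∈ s, c j - ∏ j ∈ s, g j) + (c i - g i) * ∏ j ∈ s, g j| := by ring_nf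
      _ ≤ |c i| * |∏ j ∈ s, c j - ∏ j ∈ s, g j| + |c i - g i| * ∏ j ∈ s, g j := by
        refine (abs_add_le _ _).trans ?_
        rw [abs_mul, abs_mul, abs_of_nonneg hG]
      _ ≤ (g i + b i) * (∏ j ∈ s, (g j + b j) - ∏ j ∈ s, g j) + b i * ∏ j ∈ s, g j := by
        gcongr
        exact (abs_nonneg _).trans hc
      _ = _ := by ring

/-- The independent model for the expectation of a product of orthogonal functions at `p`. -/
def modelFactor (h : κ → ℝ) (x : τ → Finset κ × Finset κ) (p : κ) : ℝ :=
  ∏ t, orthoFactor (h p) (p ∈ (x t).1) (p ∈ (x t).2)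

lemma sum_modelFactor_le {h : κ → ℝ} (hh : ∀ p, 0 ≤ h p) (m P : Finset κ)
    (𝓛 : Finset (Finset κ)) (hP : ∀ δ ∈ 𝓛, δ ⊆ P) (hdown : ∀ δ ∈ 𝓛, ∀ δ' ⊆ δ, δ' ∈ 𝓛) :
    ∑ x ∈ Fintype.piFinset (fun _ : τ => 𝓛 ×ˢ 𝓛), ∏ p ∈ P \ m, modelFactor h x p ≤
      (4 ^ Fintype.card τ) ^ m.card * (∑ δ ∈ 𝓛, ∏ p ∈ δ, h p) ^ Fintype.card τ := by
  unfold modelFactor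
  simp only [Finset.prod_comm (s := P \ m)]
  rw [← Finset.prod_univ_sum (fun _ : τ => 𝓛 ×ˢ 𝓛)
    (fun _ x => ∏ p ∈ P \ m, orthoFactor (h p) (p ∈ x.1) (p ∈ x.2)), Finset.prod_const,
    Finset.card_univ, pow_right_comm, ← mul_pow]
  gcongr
  · exact Finset.sum_nonneg fun x _ => Finset.prod_nonneg fun p _ => orthoFactor_nonneg (hh p) _ _
  · exact sum_prod_orthoFactor_le hh m P 𝓛 hP hdown

lemma sum_modelFactor_eq {h : κ → ℝ} (P : Finset κ) (𝓛 : Finset (Finset κ))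
    (hP : ∀ δ ∈ 𝓛, δ ⊆ P) :
    ∑ x ∈ Fintype.piFinset (fun _ : τ => 𝓛 ×ˢ 𝓛), ∏ p ∈ P, modelFactor h x p =
      (∑ δ ∈ 𝓛, ∏ p ∈ δ, h p) ^ Fintype.card τ := by
  unfold modelFactor
  simp only [Finset.prod_comm (s := P)]
  rw [← Finset.prod_univ_sum (fun _ : τ => 𝓛 ×ˢ 𝓛)
    (fun _ x => ∏ p ∈ P, orthoFactor (h p) (p ∈ x.1) (p ∈ x.2)), Finset.prod_const,
    Finset.card_univ, sum_prod_orthoFactor_eq P 𝓛 hP]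

theorem sum_perturbed_modelFactor_le {h β : κ → ℝ} (hh : ∀ p, 0 ≤ h p) (hβ : ∀ p, 0 ≤ β p)
    (P : Finset κ) (𝓛 : Finset (Finset κ)) (hP : ∀ δ ∈ 𝓛, δ ⊆ P)
    (hdown : ∀ δ ∈ 𝓛, ∀ δ' ⊆ δ, δ' ∈ 𝓛) :
    ∑ x ∈ Fintype.piFinset (fun _ : τ => 𝓛 ×ˢ 𝓛),
      (∏ p ∈ P, (modelFactor h x p + β p) - ∏ p ∈ P, modelFactor h x p) ≤
      (∏ p ∈ P, (1 + 4 ^ Fintype.card τ * β p) - 1) *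
        (∑ δ ∈ 𝓛, ∏ p ∈ δ, h p) ^ Fintype.card τ := by
  have e1 : ∀ x : τ → Finset κ × Finset κ, ∏ p ∈ P, (modelFactor h x p + β p) -
      ∏ p ∈ P, modelFactor h x p =
      ∑ m ∈ P.powerset.erase ∅, (∏ p ∈ m, β p) * ∏ p ∈ P \ m, modelFactor h x p := by
    intro x
    simp only [add_comm (modelFactor h x _)]
    rw [Finset.prod_add, ← Finset.add_sum_erase _ _ (Finset.empty_mem_powerset P)]
    simp
  have e2 : ∏ p ∈ P, (1 + 4 ^ Fintype.card τ * β p) - 1 =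
      ∑ m ∈ P.powerset.erase ∅, (∏ p ∈ m, β p) * (4 ^ Fintype.card τ) ^ m.card := by
    simp only [add_comm (1 : ℝ)]
    rw [Finset.prod_add, ← Finset.add_sum_erase _ _ (Finset.empty_mem_powerset P)]
    simp only [Finset.prod_empty, Finset.prod_const_one, mul_one, add_sub_cancel_left]
    refine Finset.sum_congr rfl fun m _ => ?_
    rw [Finset.prod_mul_distrib, Finset.prod_const, mul_comm]
  simp only [e1, e2]
  rw [Finset.sum_comm, Finset.sum_mul]
  refine Finset.sum_le_sum fun m _ => ?_
  rw [← Finset.mul_sum, mul_assoc]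
  gcongr
  · exact Finset.prod_nonneg fun p _ => hβ p
  · exact sum_modelFactor_le hh m P 𝓛 hP hdown

end TruncatedMoments

/-! ### Local densities of a binary quadratic form -/

/-- The binary quadratic form over a commutative ring. -/
def qform (R : Type*) [CommRing R] (a b c : ℤ) (v : R × R) : R :=
  a * v.1 ^ 2 + b * v.1 * v.2 + c * v.2 ^ 2

section LocalDensity

variable {k : Type} [Field k] [Fintype k] [DecidableEq k] {a b c : ℤ}

/-- The density of the zeros of the form over a finite field. -/
noncomputable def zeroDensity (k : Type) [Field k] [Fintype k] [DecidableEq k] (a b c : ℤ) : ℝ :=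
  avg (fun v : k × k => if qform k a b c v = 0 then (1 : ℝ) else 0)

lemma qform_smul (x : k) (v : k × k) : qform k a b c (x • v) = x ^ 2 * qform k a b c v := by
  simp only [qform, Prod.smul_fst, Prod.smul_snd, smul_eq_mul]
  ring

lemma card_quadratic_roots_le (A B C : k) (hA : A ≠ 0) :
    (Finset.univ.filter fun x : k => A * x ^ 2 + B * x + C = 0).card ≤ 2 := by
  classical
  by_contra! h
  obtain ⟨x, hx, y, hy, z, hz, hxy, hxz, hyz⟩ := Finset.two_lt_card.mp h
  simp only [Finset.mem_filter, Finset.mem_univ, true_and] at hx hy hz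
  have h1 : A * (x + y) + B = 0 := by
    have : (x - y) * (A * (x + y) + B) = 0 := by linear_combination hx - hy
    exact (mul_eq_zero.mp this).resolve_left (sub_ne_zero.mpr hxy)
  have h2 : A * (x + z) + B = 0 := by
    have : (x - z) * (A * (x + z) + B) = 0 := by linear_combination hx - hz
    exact (mul_eq_zero.mp this).resolve_left (sub_ne_zero.mpr hxz)
  have h3 : A * (y - z) = 0 := by linear_combination h1 - h2
  exact (mul_ne_zero hA (sub_ne_zero.mpr hyz)) h3

lemma avg_zero_on_line_le (v e : k × k) (he : qform k a b c e ≠ 0) :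
    avg (fun x : k => if qform k a b c (v + x • e) = 0 then (1 : ℝ) else 0) ≤
      2 / Fintype.card k := by
  unfold avg
  gcongr
  rw [Finset.sum_boole]
  have := card_quadratic_roots_le (qform k a b c e)
    (2 * (a : k) * v.1 * e.1 + (b : k) * (v.1 * e.2 + v.2 * e.1) + 2 * (c : k) * v.2 * e.2)
    (qform k a b c v) he
  refine le_trans (le_of_eq ?_) (Nat.cast_le (α := ℝ).mpr this)
  congr 2
  ext x
  simp only [Finset.mem_filter, Finset.mem_univ, true_and]
  refine Eq.congr_left ?_
  simp only [qform, Prod.fst_add, Prod.snd_add, Prod.smul_fst, Prod.smul_snd, smul_eq_mul]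
  ring

lemma zeroDensity_nonneg : 0 ≤ zeroDensity k a b c :=
  avg_nonneg fun v => by split_ifs <;> norm_num

lemma zeroDensity_le (ha : (a : k) ≠ 0) : zeroDensity k a b c ≤ 2 / Fintype.card k := by
  unfold zeroDensity
  rw [avg_prod, avg_comm]
  refine avg_le_const fun y => ?_
  have := avg_zero_on_line_le (a := a) (b := b) (c := c) ((0, y) : k × k) (1, 0)
    (by simpa [qform] using ha)
  simpa using this

variable {ι τ : Type*} [Fintype ι] [DecidableEq ι] [Fintype τ] [DecidableEq τ]

/-- The affine-linear forms `w t + α • (z.1 + ∑ i, z.2 i • lam t i)`. -/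
def affineForm (α : k) (w : τ → k × k) (lam : τ → ι → k × k) (t : τ) (z : (k × k) × (ι → k)) :
    k × k :=
  w t + α • (z.1 + ∑ i, z.2 i • lam t i)

lemma avg_affineForm {α : k} (hα : α ≠ 0) (w : τ → k × k) (lam : τ → ι → k × k) (t : τ)
    (G : k × k → (ι → k) → ℝ) :
    avg (fun z : (k × k) × (ι → k) => G (affineForm α w lam t z) z.2) =
      avg (fun v => avg (fun x => G v x)) := by
  rw [avg_prod, avg_comm, avg_comm (fun v x => G v x)]
  refine avg_congr fun x => ?_
  rw [← avg_equiv ((Equiv.addRight (∑ i, x i • lam t i)).trans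
    ((Equiv.smulRight (Units.mk0 α hα).ne_zero).trans (Equiv.addLeft (w t)))) (fun v => G v x)]
  rfl

lemma avg_both_zero_le {α : k} (hα : α ≠ 0) (w : τ → k × k) (lam : τ → ι → k × k) {t t' : τ}
    (h : ∃ i, qform k a b c (lam t' i - lam t i) ≠ 0) :
    avg (fun z : (k × k) × (ι → k) =>
      (if qform k a b c (affineForm α w lam t z) = 0 then (1 : ℝ) else 0) *
        if qform k a b c (affineForm α w lam t' z) = 0 then 1 else 0) ≤
      zeroDensity k a b c * (2 / Fintype.card k) := by
  obtain ⟨i, hi⟩ := h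
  have key : ∀ z, affineForm α w lam t' z = affineForm α w lam t z +
      (w t' - w t + α • ∑ i, z.2 i • (lam t' i - lam t i)) := by
    intro z
    simp only [affineForm, smul_add, smul_sub, Finset.sum_sub_distrib]
    abel
  simp only [key]
  rw [avg_affineForm hα w lam t (fun v x => (if qform k a b c v = 0 then (1 : ℝ) else 0) *
        if qform k a b c (v + (w t' - w t + α • ∑ i, x i • (lam t' i - lam t i))) = 0 then 1 else 0)]
  unfold zeroDensity
  rw [← avg_mul_right]
  refine avg_mono fun v => ?_
  rw [avg_mul_left]
  gcongr
  rw [avg_update i]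
  refine avg_le_const fun x => ?_
  refine le_trans (le_of_eq ?_) (avg_zero_on_line_le (a := a) (b := b) (c := c)
    (v + (w t' - w t + α • ∑ j ∈ Finset.univ.erase i, x j • (lam t' j - lam t j)))
    (α • (lam t' i - lam t i)) (by rw [qform_smul]; exact mul_ne_zero (pow_ne_zero 2 hα) hi))
  refine avg_congr fun y => ?_
  rw [← Finset.add_sum_erase _ _ (Finset.mem_univ i), Function.update_self,
    Finset.sum_congr rfl fun j hj => by rw [Function.update_of_ne (Finset.ne_of_mem_erase hj)]]
  have : v + (w t' - w t + α • (y • (lam t' i - lam t i) +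
      ∑ j ∈ Finset.univ.erase i, x j • (lam t' j - lam t j))) =
      v + (w t' - w t + α • ∑ j ∈ Finset.univ.erase i, x j • (lam t' j - lam t j)) +
        y • α • (lam t' i - lam t i) := by
    rw [smul_add, smul_comm y α]
    abel
  rw [this]

end LocalDensity

section LocalFactor

variable {k : Type} [Field k] [Fintype k] [DecidableEq k] {a b c : ℤ}
variable {ι τ : Type*} [Fintype ι] [DecidableEq ι] [Fintype τ] [DecidableEq τ]

/-- The odds `ρ / (1 - ρ)` of a zero of the form over a finite field. -/
noncomputable def zeroOdds (k : Type) [Field k] [Fintype k] [DecidableEq k] (a b c : ℤ) : ℝ :=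
  zeroDensity k a b c / (1 - zeroDensity k a b c)

/-- The mean zero function with value `-1` on the zeros of the form, and constant elsewhere. -/
noncomputable def sieveLetter (k : Type) [Field k] [Fintype k] [DecidableEq k] (a b c : ℤ)
    (v : k × k) : ℝ :=
  if qform k a b c v = 0 then -1 else zeroOdds k a b c

lemma zeroDensity_le_half (hk : 4 ≤ Fintype.card k) (ha : (a : k) ≠ 0) :
    zeroDensity k a b c ≤ 1 / 2 := by
  refine (zeroDensity_le ha).trans ?_
  have : (4 : ℝ) ≤ Fintype.card k := by exact_mod_cast hk
  rw [div_le_div_iff₀ (by linarith) (by norm_num)]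
  linarith

lemma zeroOdds_nonneg (hk : 4 ≤ Fintype.card k) (ha : (a : k) ≠ 0) : 0 ≤ zeroOdds k a b c := by
  have := zeroDensity_le_half (b := b) (c := c) hk ha
  exact div_nonneg zeroDensity_nonneg (by linarith)

lemma zeroOdds_le (hk : 4 ≤ Fintype.card k) (ha : (a : k) ≠ 0) :
    zeroOdds k a b c ≤ 4 / Fintype.card k := by
  have h1 := zeroDensity_le_half (b := b) (c := c) hk ha
  have h2 := zeroDensity_le (b := b) (c := c) ha
  have h3 := zeroDensity_nonneg (k := k) (a := a) (b := b) (c := c)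
  have h4 : (4 : ℝ) / Fintype.card k = 2 * (2 / Fintype.card k) := by ring
  unfold zeroOdds
  rw [div_le_iff₀ (by linarith), h4]
  have h5 : (0 : ℝ) ≤ 2 / Fintype.card k := by positivity
  nlinarith

lemma zeroOdds_le_one (hk : 4 ≤ Fintype.card k) (ha : (a : k) ≠ 0) : zeroOdds k a b c ≤ 1 := by
  have h1 := zeroDensity_le_half (b := b) (c := c) hk ha
  unfold zeroOdds
  rw [div_le_one (by linarith)]
  linarith

lemma avg_sieveLetter (hk : 4 ≤ Fintype.card k) (ha : (a : k) ≠ 0) :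
    avg (sieveLetter k a b c) = 0 := by
  have h1 := zeroDensity_le_half (b := b) (c := c) hk ha
  have h2 : ∀ v, sieveLetter k a b c v = zeroOdds k a b c - (1 + zeroOdds k a b c) *
      if qform k a b c v = 0 then (1 : ℝ) else 0 := by
    intro v
    unfold sieveLetter
    split_ifs <;> ring
  have h3 : 1 - zeroDensity k a b c ≠ 0 := by linarith
  rw [avg_congr h2, avg_sub, avg_const, avg_mul_left]
  change zeroOdds k a b c - (1 + zeroOdds k a b c) * zeroDensity k a b c = 0
  unfold zeroOdds
  field_simp
  ring

lemma avg_sieveLetter_sq (hk : 4 ≤ Fintype.card k) (ha : (a : k) ≠ 0) :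
    avg (fun v => sieveLetter k a b c v * sieveLetter k a b c v) = zeroOdds k a b c := by
  have h1 := zeroDensity_le_half (b := b) (c := c) hk ha
  have h2 : ∀ v, sieveLetter k a b c v * sieveLetter k a b c v =
      zeroOdds k a b c ^ 2 + (1 - zeroOdds k a b c ^ 2) *
      if qform k a b c v = 0 then (1 : ℝ) else 0 := by
    intro v
    unfold sieveLetter
    split_ifs <;> ring
  have h3 : 1 - zeroDensity k a b c ≠ 0 := by linarith
  rw [avg_congr h2, avg_add, avg_const, avg_mul_left]
  change zeroOdds k a b c ^ 2 + (1 - zeroOdds k a b c ^ 2) * zeroDensity k a b c = _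
  unfold zeroOdds
  field_simp
  ring

lemma abs_sieveLetter_le (hk : 4 ≤ Fintype.card k) (ha : (a : k) ≠ 0) (v : k × k) :
    |sieveLetter k a b c v| ≤ (if qform k a b c v = 0 then (1 : ℝ) else 0) + zeroOdds k a b c := by
  have := zeroOdds_nonneg (b := b) (c := c) hk ha
  unfold sieveLetter
  split_ifs
  · simpa using this
  · rw [abs_of_nonneg this, zero_add]

lemma abs_sieveLetter_le_one (hk : 4 ≤ Fintype.card k) (ha : (a : k) ≠ 0) (v : k × k) :
    |sieveLetter k a b c v| ≤ 1 := by
  unfold sieveLetter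
  split_ifs
  · simp
  · rw [abs_of_nonneg (zeroOdds_nonneg hk ha)]
    exact zeroOdds_le_one hk ha

lemma prod_le_mul_of_le_one {g : τ → ℝ} (h0 : ∀ t, 0 ≤ g t) (h1 : ∀ t, g t ≤ 1) {t t' : τ}
    (h : t ≠ t') : ∏ s, g s ≤ g t * g t' := by
  rw [← Finset.mul_prod_erase _ _ (Finset.mem_univ t),
    ← Finset.mul_prod_erase _ _ (Finset.mem_erase.mpr ⟨h.symm, Finset.mem_univ t'⟩), ← mul_assoc]
  exact mul_le_of_le_one_right (mul_nonneg (h0 t) (h0 t'))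
    (Finset.prod_le_one (fun s _ => h0 s) fun s _ => h1 s)

/-- The factor attached to one linear form in the expansion of a product of squares. -/
def letterFactor (y : ℝ) (x x' : Prop) [Decidable x] [Decidable x'] : ℝ :=
  (if x then y else 1) * if x' then y else 1

lemma abs_letterFactor_le_one {y : ℝ} (hy : |y| ≤ 1) (x x' : Prop) [Decidable x] [Decidable x'] :
    |letterFactor y x x'| ≤ 1 := by
  unfold letterFactor
  rw [abs_mul]
  exact mul_le_one₀ (by split_ifs <;> simp [hy]) (abs_nonneg _) (by split_ifs <;> simp [hy])

lemma abs_letterFactor_le {y : ℝ} (hy : |y| ≤ 1) {x x' : Prop} [Decidable x] [Decidable x']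
    (h : x ∨ x') : |letterFactor y x x'| ≤ |y| := by
  unfold letterFactor
  rw [abs_mul]
  have := abs_nonneg y
  split_ifs
  · nlinarith
  · simp
  · simp
  · tauto

theorem abs_avg_letterFactor_sub_le (hk : 4 ≤ Fintype.card k) (ha : (a : k) ≠ 0) {α : k}
    (hα : α ≠ 0) (w : τ → k × k) (lam : τ → ι → k × k)
    (h : ∀ t t', t ≠ t' → ∃ i, qform k a b c (lam t' i - lam t i) ≠ 0)
    (x x' : τ → Prop) [DecidablePred x] [DecidablePred x'] :
    |avg (fun z : (k × k) × (ι → k) =>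
        ∏ t, letterFactor (sieveLetter k a b c (affineForm α w lam t z)) (x t) (x' t)) -
      ∏ t, orthoFactor (zeroOdds k a b c) (x t) (x' t)| ≤ 64 / (Fintype.card k : ℝ) ^ 2 := by
  have hρ := zeroDensity_le (b := b) (c := c) ha
  have hρ0 := zeroDensity_nonneg (k := k) (a := a) (b := b) (c := c)
  have hh := zeroOdds_le (b := b) (c := c) hk ha
  have hh0 := zeroOdds_nonneg (b := b) (c := c) hk ha
  have hh1 := zeroOdds_le_one (b := b) (c := c) hk ha
  have hp : (0 : ℝ) < Fintype.card k := by exact_mod_cast (by omega : 0 < Fintype.card k)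
  by_cases hU : ∃ t t', t ≠ t' ∧ (x t ∨ x' t) ∧ (x t' ∨ x' t')
  · obtain ⟨t, t', hne, ht, ht'⟩ := hU
    have b1 : |avg (fun z : (k × k) × (ι → k) =>
        ∏ t, letterFactor (sieveLetter k a b c (affineForm α w lam t z)) (x t) (x' t))| ≤
        zeroDensity k a b c * (2 / Fintype.card k) + 2 * zeroOdds k a b c * zeroDensity k a b c +
          zeroOdds k a b c ^ 2 := by
      set Z : τ → (k × k) × (ι → k) → ℝ := fun t z =>
        if qform k a b c (affineForm α w lam t z) = 0 then (1 : ℝ) else 0 with hZ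
      have hZavg : ∀ t, avg (Z t) = zeroDensity k a b c := by
        intro t
        have := avg_affineForm hα w lam t
          (fun v _ => if qform k a b c v = 0 then (1 : ℝ) else 0)
        simp only [avg_const] at this
        exact this
      have hle : ∀ z, |∏ t, letterFactor (sieveLetter k a b c (affineForm α w lam t z))
          (x t) (x' t)| ≤ Z t z * Z t' z + zeroOdds k a b c * Z t z + zeroOdds k a b c * Z t' z +
            zeroOdds k a b c ^ 2 := by
        intro z
        rw [Finset.abs_prod]
        refine (prod_le_mul_of_le_one (fun s => abs_nonneg _) (fun s => abs_letterFactor_le_one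
          (abs_sieveLetter_le_one hk ha _) _ _) hne).trans ?_
        have e1 := (abs_letterFactor_le (abs_sieveLetter_le_one (b := b) (c := c) hk ha
          (affineForm α w lam t z)) ht).trans (abs_sieveLetter_le hk ha _)
        have e2 := (abs_letterFactor_le (abs_sieveLetter_le_one (b := b) (c := c) hk ha
          (affineForm α w lam t' z)) ht').trans (abs_sieveLetter_le hk ha _)
        refine (mul_le_mul e1 e2 (abs_nonneg _) ((abs_nonneg _).trans e1)).trans (le_of_eq ?_)
        simp only [hZ]
        ring
      refine (abs_avg_le _).trans ((avg_mono hle).trans ?_)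
      rw [avg_add, avg_add, avg_add, avg_mul_left, avg_mul_left, avg_const, hZavg, hZavg]
      have := avg_both_zero_le (a := a) (b := b) (c := c) hα w lam (h t t' hne)
      simp only [hZ]
      linarith
    have b2 : |∏ t, orthoFactor (zeroOdds k a b c) (x t) (x' t)| ≤ zeroOdds k a b c ^ 2 := by
      rw [abs_of_nonneg (Finset.prod_nonneg fun t _ => orthoFactor_nonneg hh0 _ _)]
      refine (prod_le_mul_of_le_one (fun t => orthoFactor_nonneg hh0 _ _) (fun t => ?_) hne).trans ?_
      · unfold orthoFactor
        split_ifs <;> linarith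
      · have : ∀ s, (x s ∨ x' s) → orthoFactor (zeroOdds k a b c) (x s) (x' s) ≤
            zeroOdds k a b c := by
          intro s hs
          unfold orthoFactor
          split_ifs
          · rfl
          · tauto
          · exact hh0
        rw [sq]
        exact mul_le_mul (this t ht) (this t' ht') (orthoFactor_nonneg hh0 _ _) hh0
    refine (abs_sub _ _).trans ((add_le_add b1 b2).trans ?_)
    set u : ℝ := 1 / Fintype.card k with hu
    have hu0 : 0 ≤ u := by positivity
    have e1 : (2 : ℝ) / Fintype.card k = 2 * u := by rw [hu]; ring
    have e2 : (4 : ℝ) / Fintype.card k = 4 * u := by rw [hu]; ring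
    have e3 : (64 : ℝ) / (Fintype.card k : ℝ) ^ 2 = 64 * u ^ 2 := by rw [hu]; field_simp
    rw [e1] at hρ ⊢
    rw [e2] at hh
    rw [e3]
    nlinarith [mul_nonneg hu0 hρ0, mul_le_mul hh hρ hρ0 (by positivity),
      mul_le_mul hh hh hh0 (by positivity)]
  · have heq : avg (fun z : (k × k) × (ι → k) =>
        ∏ t, letterFactor (sieveLetter k a b c (affineForm α w lam t z)) (x t) (x' t)) =
        ∏ t, orthoFactor (zeroOdds k a b c) (x t) (x' t) := by
      by_cases hex : ∃ t, x t ∨ x' t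
      · obtain ⟨t, ht⟩ := hex
        have hoff : ∀ s, s ≠ t → ¬ x s ∧ ¬ x' s := by
          intro s hs
          by_contra hcon
          exact hU ⟨s, t, hs, by tauto, ht⟩
        have e1 : ∀ z : (k × k) × (ι → k),
            ∏ t, letterFactor (sieveLetter k a b c (affineForm α w lam t z)) (x t) (x' t) =
            letterFactor (sieveLetter k a b c (affineForm α w lam t z)) (x t) (x' t) := by
          intro z
          refine Finset.prod_eq_single t (fun s _ hs => ?_) (by simp)
          simp [letterFactor, hoff s hs]
        have e2 : ∏ t, orthoFactor (zeroOdds k a b c) (x t) (x' t) =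
            orthoFactor (zeroOdds k a b c) (x t) (x' t) := by
          refine Finset.prod_eq_single t (fun s _ hs => ?_) (by simp)
          simp [orthoFactor, hoff s hs]
        rw [avg_congr e1, e2, avg_affineForm hα w lam t
          (fun v _ => letterFactor (sieveLetter k a b c v) (x t) (x' t))]
        simp only [avg_const]
        have m1 := avg_sieveLetter (b := b) (c := c) hk ha
        have m2 := avg_sieveLetter_sq (b := b) (c := c) hk ha
        unfold letterFactor orthoFactor
        by_cases hx : x t <;> by_cases hx' : x' t
        · simpa [hx, hx'] using m2
        · simpa [hx, hx'] using m1
        · simpa [hx, hx'] using m1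
        · tauto
      · push Not at hex
        simp [letterFactor, orthoFactor, hex, avg_const]
    rw [heq, sub_self, abs_zero]
    positivity

end LocalFactor

section Lifting

variable {ι τ : Type*} [Fintype ι] [DecidableEq ι] [Fintype τ] [DecidableEq τ]

/-- The reduction of an integer point. -/
def cast₂ (R : Type*) [CommRing R] (v : ℤ × ℤ) : R × R := (v.1, v.2)

/-- The lift of a residue point to the standard fundamental box. -/
def lift₂ {N : ℕ} (v : ZMod N × ZMod N) : ℤ × ℤ := (v.1.val, v.2.val)

/-- The integer value of a linear form at the standard lift of a residue point. -/
def liftForm {q : ℕ} (lam : τ → ι → ℤ × ℤ) (t : τ) (a : (ZMod q × ZMod q) × (ι → ZMod q)) : ℤ × ℤ :=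
  lift₂ a.1 + ∑ i, ((a.2 i).val : ℤ) • lam t i

lemma val_add_intCast {N : ℕ} [NeZero N] (v : ZMod N) (m : ℤ) (h0 : 0 ≤ (v.val : ℤ) + m)
    (h1 : (v.val : ℤ) + m < N) : ((v + (m : ZMod N)).val : ℤ) = v.val + m := by
  have : v + (m : ZMod N) = ((v.val + m : ℤ) : ZMod N) := by
    push_cast
    rw [ZMod.natCast_zmod_val]
  rw [this, ZMod.val_intCast, Int.emod_eq_of_lt h0 h1]

lemma card_val_near_boundary_le (N X : ℕ) [NeZero N] :
    (Finset.univ.filter fun v : ZMod N => v.val < X ∨ N ≤ v.val + X).card ≤ 2 * X := by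
  have : (Finset.univ.filter fun v : ZMod N => v.val < X ∨ N ≤ v.val + X).card ≤
      (Finset.range X ∪ Finset.Ico (N - X) N).card := by
    refine Finset.card_le_card_of_injOn ZMod.val (fun v hv => ?_)
      ((ZMod.val_injective N).injOn)
    have := ZMod.val_lt v
    simp only [Finset.coe_filter, Finset.mem_univ, true_and, Set.mem_ofPred_eq] at hv
    simp only [Finset.coe_union, Finset.coe_range, Finset.coe_Ico, Set.mem_union, Set.mem_Iio,
      Set.mem_Ico]
    omega
  refine this.trans ((Finset.card_union_le _ _).trans ?_)
  simp only [Finset.card_range, Nat.card_Ico]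
  omega

lemma avg_near_boundary_le (N X : ℕ) [NeZero N] :
    avg (fun v : ZMod N => if v.val < X ∨ N ≤ v.val + X then (1 : ℝ) else 0) ≤ 2 * X / N := by
  unfold avg
  rw [Finset.sum_boole, ZMod.card]
  gcongr
  exact_mod_cast card_val_near_boundary_le N X

lemma abs_liftForm_le {q B : ℕ} [NeZero q] {lam : τ → ι → ℤ × ℤ} {t : τ}
    (hB : 1 + ∑ i, max |(lam t i).1| |(lam t i).2| ≤ B)
    (a : (ZMod q × ZMod q) × (ι → ZMod q)) :
    |(liftForm lam t a).1| ≤ B * q ∧ |(liftForm lam t a).2| ≤ B * q := by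
  have hq : (0 : ℤ) < q := by exact_mod_cast NeZero.pos q
  have hv : ∀ x : ZMod q, |(x.val : ℤ)| ≤ q := by
    intro x
    rw [Nat.abs_cast]
    exact_mod_cast (ZMod.val_lt x).le
  have key : ∀ (x : ZMod q) (f : ι → ℤ), (∀ i, |f i| ≤ max |(lam t i).1| |(lam t i).2|) →
      |(x.val : ℤ) + ∑ i, ((a.2 i).val : ℤ) * f i| ≤ B * q := by
    intro x f hf
    calc |(x.val : ℤ) + ∑ i, ((a.2 i).val : ℤ) * f i|
        ≤ |(x.val : ℤ)| + ∑ i, |((a.2 i).val : ℤ) * f i| :=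
          (abs_add_le _ _).trans (add_le_add le_rfl (Finset.abs_sum_le_sum_abs _ _))
      _ ≤ q + ∑ i, (q : ℤ) * max |(lam t i).1| |(lam t i).2| := by
          refine add_le_add (hv x) (Finset.sum_le_sum fun i _ => ?_)
          rw [abs_mul]
          exact mul_le_mul (hv _) (hf i) (abs_nonneg _) hq.le
      _ = (1 + ∑ i, max |(lam t i).1| |(lam t i).2|) * q := by
          rw [← Finset.mul_sum]; ring
      _ ≤ B * q := by gcongr
  constructor
  · have := key a.1.1 (fun i => (lam t i).1) fun i => le_max_left _ _
    simpa [liftForm, lift₂, Prod.fst_sum] using this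
  · have := key a.1.2 (fun i => (lam t i).2) fun i => le_max_right _ _
    simpa [liftForm, lift₂, Prod.snd_sum] using this

theorem abs_avg_lift_sub_le {N q B : ℕ} [Fact N.Prime] [NeZero q] (lam : τ → ι → ℤ × ℤ)
    (hB : ∀ t, 1 + ∑ i, max |(lam t i).1| |(lam t i).2| ≤ B) (Φ : (τ → ℤ × ℤ) → ℝ)
    (hΦ : ∀ l, |Φ l| ≤ 1) {G e : ℝ} (hG : |G| ≤ 1)
    (he : ∀ l : τ → ℤ × ℤ, |avg (fun a : (ZMod q × ZMod q) × (ι → ZMod q) =>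
      Φ (fun t => l t + liftForm lam t a)) - G| ≤ e) :
    |avg (fun z : (ZMod N × ZMod N) × (ι → ZMod N) =>
      Φ (fun t => lift₂ (z.1 + ∑ i, z.2 i • cast₂ (ZMod N) (lam t i)))) - G| ≤
      e + 8 * Fintype.card τ * B * q / N := by
  set L : τ → (ZMod N × ZMod N) × (ι → ZMod N) → ZMod N × ZMod N :=
    fun t z => z.1 + ∑ i, z.2 i • cast₂ (ZMod N) (lam t i) with hL
  set shift : (ZMod q × ZMod q) × (ι → ZMod q) → (ZMod N × ZMod N) × (ι → ZMod N) :=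
    fun a => (cast₂ (ZMod N) (lift₂ a.1), fun i => ((a.2 i).val : ZMod N)) with hshift
  have hadd : ∀ t z a, L t (z + shift a) = L t z + cast₂ (ZMod N) (liftForm lam t a) := by
    intro t z a
    have : cast₂ (ZMod N) (liftForm lam t a) =
        cast₂ (ZMod N) (lift₂ a.1) + ∑ i, ((a.2 i).val : ZMod N) • cast₂ (ZMod N) (lam t i) := by
      ext <;> simp [cast₂, liftForm, Prod.fst_sum, Prod.snd_sum]
    simp only [hL, hshift, this, Prod.fst_add, Prod.snd_add, Pi.add_apply, add_smul,
      Finset.sum_add_distrib]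
    abel
  set bad : ZMod N → ℝ := fun x => if x.val < B * q ∨ N ≤ x.val + B * q then (1 : ℝ) else 0
    with hbad
  have hbad0 : ∀ x, 0 ≤ bad x := fun x => by simp only [hbad]; split_ifs <;> norm_num
  have havg : avg (fun z => Φ fun t => lift₂ (L t z)) =
      avg (fun z => avg fun a => Φ fun t => lift₂ (L t (z + shift a))) := by
    rw [avg_comm, ← avg_const (X := (ZMod q × ZMod q) × (ι → ZMod q))
      (avg (fun z => Φ fun t => lift₂ (L t z)))]
    refine avg_congr fun a => ?_
    exact (avg_equiv (Equiv.addRight (shift a)) (fun z => Φ fun t => lift₂ (L t z))).symm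
  have hpt : ∀ z, |avg (fun a => Φ fun t => lift₂ (L t (z + shift a))) - G| ≤
      e + 2 * ∑ t, (bad (L t z).1 + bad (L t z).2) := by
    intro z
    by_cases hz : ∀ t, bad (L t z).1 = 0 ∧ bad (L t z).2 = 0
    · have hgood : ∀ t a, lift₂ (L t (z + shift a)) = lift₂ (L t z) + liftForm lam t a := by
        intro t a
        have h1 := (hz t).1
        have h2 := (hz t).2
        have hb := abs_liftForm_le (hB t) a
        simp only [hbad, ite_eq_right_iff, one_ne_zero, imp_false, not_or, not_lt, not_le] at h1 h2
        rw [abs_le, abs_le] at hb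
        rw [hadd]
        obtain ⟨⟨b1, b2⟩, b3, b4⟩ := hb
        have h1' : ((B * q : ℕ) : ℤ) ≤ (L t z).1.val := by exact_mod_cast h1.1
        have h1'' : (((L t z).1.val + B * q : ℕ) : ℤ) < N := by exact_mod_cast h1.2
        have h2' : ((B * q : ℕ) : ℤ) ≤ (L t z).2.val := by exact_mod_cast h2.1
        have h2'' : (((L t z).2.val + B * q : ℕ) : ℤ) < N := by exact_mod_cast h2.2
        push_cast at h1' h1'' h2' h2''
        refine Prod.ext ?_ ?_
        · exact val_add_intCast _ _ (by linarith) (by linarith)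
        · exact val_add_intCast _ _ (by linarith) (by linarith)
      simp only [hgood]
      refine (he _).trans (le_add_of_nonneg_right ?_)
      exact mul_nonneg zero_le_two (Finset.sum_nonneg fun t _ => add_nonneg (hbad0 _) (hbad0 _))
    · push Not at hz
      obtain ⟨t, ht⟩ := hz
      have hone : ∀ x, bad x ≠ 0 → bad x = 1 := by
        intro x hx
        simp only [hbad] at hx ⊢
        split_ifs at hx ⊢ <;> simp_all
      have h1 : (1 : ℝ) ≤ ∑ t, (bad (L t z).1 + bad (L t z).2) := by
        refine le_trans ?_ (Finset.single_le_sum (f := fun t => bad (L t z).1 + bad (L t z).2)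
          (fun t _ => add_nonneg (hbad0 _) (hbad0 _)) (Finset.mem_univ t))
        by_cases h : bad (L t z).1 = 0
        · simp [h, hone _ (ht h)]
        · have := hone _ h
          have := hbad0 (L t z).2
          linarith
      have he0 : 0 ≤ e := (abs_nonneg _).trans (he fun _ => 0)
      have h2 : |avg (fun a => Φ fun t => lift₂ (L t (z + shift a)))| ≤ 1 :=
        (abs_avg_le _).trans (avg_le_const fun a => hΦ _)
      have := abs_sub (avg (fun a => Φ fun t => lift₂ (L t (z + shift a)))) G
      linarith
  rw [havg, ← avg_const (X := (ZMod N × ZMod N) × (ι → ZMod N)) G, ← avg_sub]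
  refine (abs_avg_le _).trans ((avg_mono hpt).trans ?_)
  rw [avg_add, avg_const, avg_mul_left, avg_sum]
  have hN : (0 : ℝ) < N := by exact_mod_cast (Fact.out : N.Prime).pos
  have hform : ∀ t (f : ZMod N × ZMod N → ℝ), avg (fun z => f (L t z)) = avg f := by
    intro t f
    have := avg_affineForm (k := ZMod N) one_ne_zero (fun _ : τ => 0)
      (fun t i => cast₂ (ZMod N) (lam t i)) t (fun v _ => f v)
    simpa [affineForm, avg_const] using this
  have hsum : ∀ t, avg (fun z => bad (L t z).1 + bad (L t z).2) ≤ 4 * B * q / N := by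
    intro t
    rw [hform t (fun v => bad v.1 + bad v.2), avg_add, avg_prod, avg_prod, avg_comm (fun x y => bad (x, y).1)]
    simp only [avg_const]
    have := avg_near_boundary_le N (B * q)
    push_cast at this
    calc _ ≤ 2 * ((B : ℝ) * q) / N + 2 * (B * q) / N := add_le_add this this
      _ = _ := by ring
  have := Finset.sum_le_sum fun t (_ : t ∈ Finset.univ) => hsum t
  rw [Finset.sum_const, Finset.card_univ, nsmul_eq_mul] at this
  refine add_le_add le_rfl ((mul_le_mul_of_nonneg_left this zero_le_two).trans (le_of_eq ?_))
  ring

end Lifting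

instance primesFact (p : Nat.Primes) : Fact (p : ℕ).Prime := ⟨p.2⟩

section ChineseRemainder

variable {ι τ : Type*} [Fintype ι] [DecidableEq ι] [Fintype τ] [DecidableEq τ]

/-- Reduction of a point modulo a divisor of the modulus. -/
def reduce {q : ℕ} (p : ℕ) (a : (ZMod q × ZMod q) × (ι → ZMod q)) :
    (ZMod p × ZMod p) × (ι → ZMod p) :=
  ((a.1.1.val, a.1.2.val), fun i => (a.2 i).val)

lemma avg_pi_prod {κ : Type*} [Fintype κ] [DecidableEq κ] {X : κ → Type*} [∀ i, Fintype (X i)]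
    (G : ∀ i, X i → ℝ) : avg (fun f : ∀ i, X i => ∏ i, G i (f i)) = ∏ i, avg (G i) := by
  unfold avg
  rw [Finset.prod_div_distrib, Finset.prod_univ_sum, Fintype.piFinset_univ, Fintype.card_pi]
  push_cast
  rfl

lemma avg_prod_reduce (P : Finset Nat.Primes) {q : ℕ} [NeZero q] (hq : q = ∏ p ∈ P, (p : ℕ))
    (G : ∀ p : Nat.Primes, (ZMod p × ZMod p) × (ι → ZMod p) → ℝ) :
    avg (fun a : (ZMod q × ZMod q) × (ι → ZMod q) => ∏ p ∈ P, G p (reduce p a)) =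
      ∏ p ∈ P, avg (G p) := by
  rw [← Finset.prod_coe_sort] at hq
  subst hq
  have hco : Pairwise (Function.onFun Nat.Coprime fun p : P => ((p : Nat.Primes) : ℕ)) := by
    intro p p' h
    exact (Nat.coprime_primes p.1.2 p'.1.2).mpr fun h' => h (Subtype.ext (Subtype.ext h'))
  let φ := ZMod.prodEquivPi (fun p : P => ((p : Nat.Primes) : ℕ)) hco
  have hφ : ∀ x p, φ x p = (x.val : ZMod p) := by
    intro x p
    conv_lhs => rw [← ZMod.natCast_zmod_val x, map_natCast, Pi.natCast_apply]
  let e : ((ZMod (∏ p : P, ((p : Nat.Primes) : ℕ)) × ZMod (∏ p : P, ((p : Nat.Primes) : ℕ))) ×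
      (ι → ZMod (∏ p : P, ((p : Nat.Primes) : ℕ)))) ≃
      ∀ p : P, (ZMod (p : Nat.Primes) × ZMod (p : Nat.Primes)) × (ι → ZMod (p : Nat.Primes)) :=
    { toFun := fun a p => ((φ a.1.1 p, φ a.1.2 p), fun i => φ (a.2 i) p)
      invFun := fun f => ((φ.symm fun p => (f p).1.1, φ.symm fun p => (f p).1.2),
        fun i => φ.symm fun p => (f p).2 i)
      left_inv := fun a => Prod.ext (Prod.ext (φ.symm_apply_apply _) (φ.symm_apply_apply _))
        (funext fun i => φ.symm_apply_apply _)
      right_inv := fun f => funext fun p => Prod.ext (Prod.ext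
        (congrFun (φ.apply_symm_apply fun p => (f p).1.1) p)
        (congrFun (φ.apply_symm_apply fun p => (f p).1.2) p))
        (funext fun i => congrFun (φ.apply_symm_apply fun p => (f p).2 i) p) }
  have := avg_equiv e (fun f => ∏ p : P, G p (f p))
  rw [avg_pi_prod] at this
  rw [← Finset.prod_coe_sort P (fun p => avg (G p)), ← this]
  refine avg_congr fun a => ?_
  rw [← Finset.prod_coe_sort]
  refine Finset.prod_congr rfl fun p _ => ?_
  congr 1
  simp only [e, reduce, hφ, Equiv.coe_fn_mk]

lemma sum_inv_sq_primes_le (P : Finset Nat.Primes) {w : ℕ} (hw : 0 < w) (hP : ∀ p ∈ P, w < (p : ℕ)) :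
    ∑ p ∈ P, 1 / ((p : ℕ) : ℝ) ^ 2 ≤ 2 / (w : ℝ) := by
  obtain ⟨n, hn⟩ : ∃ n, ∀ p ∈ P, (p : ℕ) < n :=
    ⟨P.sup (fun p : Nat.Primes => (p : ℕ)) + 1, fun p hp =>
      Nat.lt_succ_of_le (Finset.le_sup (f := fun p : Nat.Primes => (p : ℕ)) hp)⟩
  have h1 : ∑ p ∈ P, 1 / ((p : ℕ) : ℝ) ^ 2 = ∑ m ∈ P.image (fun p : Nat.Primes => (p : ℕ)), ((m : ℝ) ^ 2)⁻¹ := by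
    refine ((Finset.sum_image (f := fun m : ℕ => ((m : ℝ) ^ 2)⁻¹) (g := fun p : Nat.Primes => (p : ℕ))
      fun p _ p' _ h => Subtype.ext h).trans ?_).symm
    simp only [one_div]
  rw [h1]
  refine le_trans (Finset.sum_le_sum_of_subset_of_nonneg (t := Finset.Ioo w n) ?_ ?_)
    ((sum_Ioo_inv_sq_le w n).trans ?_)
  · intro m hm
    obtain ⟨p, hp, rfl⟩ := Finset.mem_image.mp hm
    exact Finset.mem_Ioo.mpr ⟨hP p hp, hn p hp⟩
  · intros; positivity
  · gcongr
    linarith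

lemma prod_one_add_le_exp {κ : Type*} (P : Finset κ) {β : κ → ℝ} (hβ : ∀ p, 0 ≤ β p) :
    ∏ p ∈ P, (1 + β p) ≤ Real.exp (∑ p ∈ P, β p) := by
  rw [Real.exp_sum]
  exact Finset.prod_le_prod (fun p _ => by linarith [hβ p]) fun p _ => by
    linarith [Real.add_one_le_exp (β p)]

end ChineseRemainder

lemma zeroOdds_nonneg' {k : Type} [Field k] [Fintype k] [DecidableEq k] {a b c : ℤ} :
    0 ≤ zeroOdds k a b c := by
  refine div_nonneg zeroDensity_nonneg (sub_nonneg.mpr ?_)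
  exact avg_le_const fun v => by split_ifs <;> norm_num

section SieveWeight

variable {ι τ : Type*} [Fintype ι] [DecidableEq ι] [Fintype τ] [DecidableEq τ]
variable (a b c : ℤ)

/-- The sieve letter at an integer point. -/
noncomputable def letterAt (p : Nat.Primes) (u : ℤ × ℤ) : ℝ :=
  sieveLetter (ZMod p) a b c (cast₂ (ZMod p) u)

/-- The odds of a zero modulo a prime. -/
noncomputable def oddsAt (p : Nat.Primes) : ℝ := zeroOdds (ZMod p) a b c

/-- The sifting sum at an integer point. -/
noncomputable def sieveSum (𝓛 : Finset (Finset Nat.Primes)) (u : ℤ × ℤ) : ℝ :=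
  ∑ δ ∈ 𝓛, ∏ p ∈ δ, letterAt a b c p u

/-- The value of the sifting sum at an unsifted point. -/
noncomputable def sieveMass (𝓛 : Finset (Finset Nat.Primes)) : ℝ :=
  ∑ δ ∈ 𝓛, ∏ p ∈ δ, oddsAt a b c p

/-- One term in the expansion of a product of squares of sifting sums. -/
noncomputable def sieveTerm (PP : Finset Nat.Primes)
    (x : τ → Finset Nat.Primes × Finset Nat.Primes) (u : τ → ℤ × ℤ) : ℝ :=
  ∏ p ∈ PP, ∏ t, letterFactor (letterAt a b c p (u t)) (p ∈ (x t).1) (p ∈ (x t).2)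

variable {a b c}

lemma prod_sieveSum_sq (PP : Finset Nat.Primes) (𝓛 : Finset (Finset Nat.Primes))
    (hP : ∀ δ ∈ 𝓛, δ ⊆ PP) (u : τ → ℤ × ℤ) :
    ∏ t, sieveSum a b c 𝓛 (u t) ^ 2 =
      ∑ x ∈ Fintype.piFinset (fun _ : τ => 𝓛 ×ˢ 𝓛), sieveTerm a b c PP x u := by
  unfold sieveTerm
  simp only [Finset.prod_comm (s := PP)]
  rw [← Finset.prod_univ_sum (fun _ : τ => 𝓛 ×ˢ 𝓛) (fun t x =>
    ∏ p ∈ PP, letterFactor (letterAt a b c p (u t)) (p ∈ x.1) (p ∈ x.2))]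
  refine Finset.prod_congr rfl fun t _ => ?_
  rw [Finset.sum_product, sq, sieveSum, Finset.sum_mul_sum]
  refine Finset.sum_congr rfl fun δ hδ => Finset.sum_congr rfl fun δ' hδ' => ?_
  simp only [letterFactor, Finset.prod_mul_distrib, Finset.prod_ite_mem,
    Finset.inter_eq_right.mpr (hP δ hδ), Finset.inter_eq_right.mpr (hP δ' hδ')]

/-- The conditions on the sifting primes relative to a system of linear forms. -/
structure GoodPrimes (a b c W : ℤ) (PP : Finset Nat.Primes) (lam : τ → ι → ℤ × ℤ) : Prop where
  large : ∀ p ∈ PP, 4 ≤ (p : ℕ)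
  lead : ∀ p ∈ PP, (a : ZMod p) ≠ 0
  modulus : ∀ p ∈ PP, (W : ZMod p) ≠ 0
  nondeg : ∀ p ∈ PP, ∀ t t', t ≠ t' →
    ∃ i, qform (ZMod p) a b c (cast₂ (ZMod p) (lam t' i) - cast₂ (ZMod p) (lam t i)) ≠ 0

variable {W : ℤ} {PP : Finset Nat.Primes} {lam : τ → ι → ℤ × ℤ}

lemma abs_sieveTerm_le_one (hG : GoodPrimes a b c W PP lam)
    (x : τ → Finset Nat.Primes × Finset Nat.Primes) (u : τ → ℤ × ℤ) :
    |sieveTerm a b c PP x u| ≤ 1 := by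
  unfold sieveTerm
  simp only [Finset.abs_prod]
  refine Finset.prod_le_one (fun p _ => Finset.prod_nonneg fun t _ => abs_nonneg _) fun p hp =>
    Finset.prod_le_one (fun t _ => abs_nonneg _) fun t _ => ?_
  have := hG.large p hp
  exact abs_letterFactor_le_one (abs_sieveLetter_le_one (by rwa [ZMod.card]) (hG.lead p hp) _) _ _

lemma cast_shift_eq_affineForm {q : ℕ} [NeZero q] (p : ℕ) [Fact p.Prime] (hpq : p ∣ q) (b₀ : ℤ × ℤ)
    (l : τ → ℤ × ℤ) (t : τ) (z : (ZMod q × ZMod q) × (ι → ZMod q)) :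
    cast₂ (ZMod p) (b₀ + W • (l t + liftForm lam t z)) =
      affineForm (W : ZMod p) (fun t => cast₂ (ZMod p) (b₀ + W • l t))
        (fun t i => cast₂ (ZMod p) (lam t i)) t (reduce p z) := by
  ext <;> simp [cast₂, liftForm, lift₂, affineForm, reduce, Prod.fst_sum, Prod.snd_sum] <;> ring

theorem abs_avg_sieveTerm_sub_le (hG : GoodPrimes a b c W PP lam)
    (x : τ → Finset Nat.Primes × Finset Nat.Primes) (hx : ∀ t, (x t).1 ⊆ PP ∧ (x t).2 ⊆ PP)
    {q : ℕ} [NeZero q]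
    (hq : q = ∏ p ∈ Finset.univ.biUnion fun t => (x t).1 ∪ (x t).2, (p : ℕ)) (b₀ : ℤ × ℤ)
    (l : τ → ℤ × ℤ) :
    |avg (fun z : (ZMod q × ZMod q) × (ι → ZMod q) =>
        sieveTerm a b c PP x fun t => b₀ + W • (l t + liftForm lam t z)) -
      ∏ p ∈ PP, modelFactor (oddsAt a b c) x p| ≤
      ∏ p ∈ PP, (modelFactor (oddsAt a b c) x p + 64 / ((p : ℕ) : ℝ) ^ 2) -
        ∏ p ∈ PP, modelFactor (oddsAt a b c) x p := by
  set P := Finset.univ.biUnion fun t => (x t).1 ∪ (x t).2 with hPdef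
  have hPP : P ⊆ PP := Finset.biUnion_subset.mpr fun t _ =>
    Finset.union_subset (hx t).1 (hx t).2
  have hnot : ∀ p, p ∉ P → ∀ t, p ∉ (x t).1 ∧ p ∉ (x t).2 := by
    intro p hp t
    simp only [hPdef, Finset.mem_biUnion, Finset.mem_univ, true_and, Finset.mem_union, not_exists,
      not_or] at hp
    exact hp t
  set G : ∀ p : Nat.Primes, (ZMod p × ZMod p) × (ι → ZMod p) → ℝ := fun p z =>
    ∏ t, letterFactor (sieveLetter (ZMod p) a b c (affineForm (W : ZMod p)
      (fun t => cast₂ (ZMod p) (b₀ + W • l t)) (fun t i => cast₂ (ZMod p) (lam t i)) t z))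
      (p ∈ (x t).1) (p ∈ (x t).2) with hGdef
  have h1 : ∀ z : (ZMod q × ZMod q) × (ι → ZMod q),
      (sieveTerm a b c PP x fun t => b₀ + W • (l t + liftForm lam t z)) =
        ∏ p ∈ P, G p (reduce p z) := by
    intro z
    unfold sieveTerm
    rw [← Finset.prod_subset hPP]
    · refine Finset.prod_congr rfl fun p hp => Finset.prod_congr rfl fun t _ => ?_
      rw [letterAt, cast_shift_eq_affineForm (p : ℕ) (hq ▸ Finset.dvd_prod_of_mem _ hp)]
    · intro p _ hp
      exact Finset.prod_eq_one fun t _ => by simp [letterFactor, hnot p hp t]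
  rw [avg_congr h1, avg_prod_reduce P hq G, Finset.prod_subset hPP (f := fun p => avg (G p))]
  · refine abs_prod_sub_prod_le PP (fun p _ => Finset.prod_nonneg fun t _ =>
      orthoFactor_nonneg zeroOdds_nonneg' _ _) fun p hp => ?_
    have := abs_avg_letterFactor_sub_le (k := ZMod p) (b := b) (c := c)
      (by rw [ZMod.card]; exact hG.large p hp) (hG.lead p hp)
      (hG.modulus p hp) (fun t => cast₂ (ZMod p) (b₀ + W • l t))
      (fun t i => cast₂ (ZMod p) (lam t i)) (hG.nondeg p hp) (fun t => p ∈ (x t).1)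
      (fun t => p ∈ (x t).2)
    rw [ZMod.card] at this
    exact this
  · intro p _ hp
    have : ∀ z, G p z = 1 := fun z => Finset.prod_eq_one fun t _ => by
      simp [letterFactor, hnot p hp t]
    rw [avg_congr this, avg_const]

lemma prod_biUnion_le {R : ℕ} (x : τ → Finset Nat.Primes × Finset Nat.Primes)
    (hx : ∀ t, ∏ p ∈ (x t).1, (p : ℕ) ≤ R ∧ ∏ p ∈ (x t).2, (p : ℕ) ≤ R) :
    ∏ p ∈ Finset.univ.biUnion fun t => (x t).1 ∪ (x t).2, (p : ℕ) ≤
      (R ^ 2) ^ Fintype.card τ := by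
  have hone : ∀ p : Nat.Primes, 1 ≤ (p : ℕ) := fun p => p.2.one_lt.le
  have hun : ∀ s s' : Finset Nat.Primes, ∏ p ∈ s ∪ s', (p : ℕ) ≤
      (∏ p ∈ s, (p : ℕ)) * ∏ p ∈ s', (p : ℕ) := by
    intro s s'
    rw [← Finset.prod_union_inter]
    exact Nat.le_mul_of_pos_right _ (Finset.prod_pos fun p _ => p.2.pos)
  have key : ∀ T : Finset τ, ∏ p ∈ T.biUnion fun t => (x t).1 ∪ (x t).2, (p : ℕ) ≤
      (R ^ 2) ^ T.card := by
    intro T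
    induction T using Finset.induction with
    | empty => simp
    | insert t T ht ih =>
      rw [Finset.biUnion_insert, Finset.card_insert_of_notMem ht, pow_succ, mul_comm]
      refine (hun _ _).trans (Nat.mul_le_mul ((hun _ _).trans ?_) ih)
      rw [sq]
      exact Nat.mul_le_mul (hx t).1 (hx t).2
  exact key Finset.univ

lemma prod_primes_injective {s s' : Finset Nat.Primes} (h : ∏ p ∈ s, (p : ℕ) = ∏ p ∈ s', (p : ℕ)) :
    s = s' := by
  have key : ∀ s s' : Finset Nat.Primes, ∏ p ∈ s, (p : ℕ) = ∏ p ∈ s', (p : ℕ) → s ⊆ s' := by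
    intro s s' h p hp
    have hd : (p : ℕ) ∣ ∏ p ∈ s', (p : ℕ) := h ▸ Finset.dvd_prod_of_mem _ hp
    obtain ⟨p', hp', hd'⟩ := (Prime.dvd_finset_prod_iff p.2.prime _).mp hd
    have : p = p' := Subtype.ext ((Nat.prime_dvd_prime_iff_eq p.2 p'.2).mp hd')
    rwa [this]
  exact (key s s' h).antisymm (key s' s h.symm)

lemma card_le_of_prod_le {R : ℕ} (𝓛 : Finset (Finset Nat.Primes))
    (h : ∀ δ ∈ 𝓛, ∏ p ∈ δ, (p : ℕ) ≤ R) : 𝓛.card ≤ R := by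
  rw [show R = (Finset.Icc 1 R).card by simp]
  exact Finset.card_le_card_of_injOn (fun δ => ∏ p ∈ δ, (p : ℕ))
    (fun δ hδ => Finset.mem_coe.mpr (Finset.mem_Icc.mpr
      ⟨Nat.succ_le_of_lt (Finset.prod_pos (s := δ) (f := fun p : Nat.Primes => (p : ℕ))
        fun p _ => p.2.pos), h δ hδ⟩))
    fun δ _ δ' _ h => prod_primes_injective h

theorem abs_avg_prod_sieveSum_sq_sub_le {N R B : ℕ} [Fact N.Prime] {w : ℕ} (hw : 0 < w)
    (hG : GoodPrimes a b c W PP lam)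
    (hPw : ∀ p ∈ PP, w < (p : ℕ))
    (hB : ∀ t, 1 + ∑ i, max |(lam t i).1| |(lam t i).2| ≤ B) (𝓛 : Finset (Finset Nat.Primes))
    (hP : ∀ δ ∈ 𝓛, δ ⊆ PP) (hdown : ∀ δ ∈ 𝓛, ∀ δ' ⊆ δ, δ' ∈ 𝓛)
    (hR : ∀ δ ∈ 𝓛, ∏ p ∈ δ, (p : ℕ) ≤ R) (b₀ : ℤ × ℤ) :
    |avg (fun z : (ZMod N × ZMod N) × (ι → ZMod N) => ∏ t, sieveSum a b c 𝓛
        (b₀ + W • lift₂ (z.1 + ∑ i, z.2 i • cast₂ (ZMod N) (lam t i))) ^ 2) -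
      sieveMass a b c 𝓛 ^ Fintype.card τ| ≤
      (Real.exp (4 ^ Fintype.card τ * 128 / w) - 1) * sieveMass a b c 𝓛 ^ Fintype.card τ +
        8 * Fintype.card τ * B * (R : ℝ) ^ (4 * Fintype.card τ) / N := by
  have hmodel0 : ∀ x : τ → Finset Nat.Primes × Finset Nat.Primes, ∀ p,
      0 ≤ modelFactor (oddsAt a b c) x p := fun x p =>
    Finset.prod_nonneg fun t _ => orthoFactor_nonneg zeroOdds_nonneg' _ _
  have hmodel1 : ∀ x : τ → Finset Nat.Primes × Finset Nat.Primes, ∀ p ∈ PP,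
      modelFactor (oddsAt a b c) x p ≤ 1 := by
    intro x p hp
    refine Finset.prod_le_one (fun t _ => orthoFactor_nonneg zeroOdds_nonneg' _ _) fun t _ => ?_
    have : oddsAt a b c p ≤ 1 :=
      zeroOdds_le_one (by rw [ZMod.card]; exact hG.large p hp) (hG.lead p hp)
    unfold orthoFactor
    split_ifs <;> linarith
  have hN : (0 : ℝ) < N := by exact_mod_cast (Fact.out : N.Prime).pos
  simp only [prod_sieveSum_sq PP 𝓛 hP]
  rw [avg_sum, sieveMass, ← sum_modelFactor_eq PP 𝓛 hP, ← Finset.sum_sub_distrib]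
  refine (Finset.abs_sum_le_sum_abs _ _).trans ?_
  have hterm : ∀ x ∈ Fintype.piFinset (fun _ : τ => 𝓛 ×ˢ 𝓛),
      |avg (fun z : (ZMod N × ZMod N) × (ι → ZMod N) => sieveTerm a b c PP x
        fun t => b₀ + W • lift₂ (z.1 + ∑ i, z.2 i • cast₂ (ZMod N) (lam t i))) -
        ∏ p ∈ PP, modelFactor (oddsAt a b c) x p| ≤
      (∏ p ∈ PP, (modelFactor (oddsAt a b c) x p + 64 / ((p : ℕ) : ℝ) ^ 2) -
        ∏ p ∈ PP, modelFactor (oddsAt a b c) x p) +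
        8 * Fintype.card τ * B * (R : ℝ) ^ (2 * Fintype.card τ) / N := by
    intro x hx
    have hx' : ∀ t, (x t).1 ∈ 𝓛 ∧ (x t).2 ∈ 𝓛 := fun t =>
      Finset.mem_product.mp (Fintype.mem_piFinset.mp hx t)
    obtain ⟨q, hq⟩ : ∃ q : ℕ, q = ∏ p ∈ Finset.univ.biUnion fun t => (x t).1 ∪ (x t).2, (p : ℕ) :=
      ⟨_, rfl⟩
    have : NeZero q := ⟨by rw [hq]; exact (Finset.prod_pos fun p _ => p.2.pos).ne'⟩
    have hqR : (q : ℝ) ≤ (R : ℝ) ^ (2 * Fintype.card τ) := by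
      rw [hq, pow_mul]
      exact_mod_cast prod_biUnion_le x fun t => ⟨hR _ (hx' t).1, hR _ (hx' t).2⟩
    have hmain := abs_avg_lift_sub_le (N := N) (q := q) lam hB
      (fun l => sieveTerm a b c PP x fun t => b₀ + W • l t)
      (fun l => abs_sieveTerm_le_one hG x _)
      (G := ∏ p ∈ PP, modelFactor (oddsAt a b c) x p)
      (by
        rw [abs_of_nonneg (Finset.prod_nonneg fun p _ => hmodel0 x p)]
        exact Finset.prod_le_one (fun p _ => hmodel0 x p) (hmodel1 x))
      (fun l => abs_avg_sieveTerm_sub_le hG x (fun t => ⟨hP _ (hx' t).1, hP _ (hx' t).2⟩) hq b₀ l)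
    refine hmain.trans (add_le_add le_rfl ?_)
    gcongr
  refine (Finset.sum_le_sum hterm).trans ?_
  rw [Finset.sum_add_distrib, Finset.sum_const]
  refine add_le_add ?_ ?_
  · refine (sum_perturbed_modelFactor_le (fun p => zeroOdds_nonneg') (fun p => by positivity)
      PP 𝓛 hP hdown).trans ?_
    rw [sum_modelFactor_eq PP 𝓛 hP]
    refine mul_le_mul_of_nonneg_right (sub_le_sub_right ?_ 1) (pow_nonneg
      (Finset.sum_nonneg fun δ _ => Finset.prod_nonneg fun p _ => zeroOdds_nonneg') _)
    refine (prod_one_add_le_exp PP fun p => by positivity).trans (Real.exp_le_exp.mpr ?_)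
    have := sum_inv_sq_primes_le PP hw hPw
    calc ∑ p ∈ PP, (4 : ℝ) ^ Fintype.card τ * (64 / ((p : ℕ) : ℝ) ^ 2)
        = (4 : ℝ) ^ Fintype.card τ * 64 * ∑ p ∈ PP, 1 / ((p : ℕ) : ℝ) ^ 2 := by
          rw [Finset.mul_sum]
          exact Finset.sum_congr rfl fun p _ => by ring
      _ ≤ (4 : ℝ) ^ Fintype.card τ * 64 * (2 / (w : ℝ)) := by gcongr
      _ = (4 : ℝ) ^ Fintype.card τ * 128 / (w : ℝ) := by ring
  · rw [Fintype.card_piFinset, Finset.prod_const, Finset.card_univ, Finset.card_product, nsmul_eq_mul]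
    have hc : (𝓛.card : ℝ) ≤ R := by exact_mod_cast card_le_of_prod_le 𝓛 hR
    push_cast
    calc ((𝓛.card : ℝ) * 𝓛.card) ^ Fintype.card τ *
          (8 * Fintype.card τ * B * (R : ℝ) ^ (2 * Fintype.card τ) / N)
        ≤ ((R : ℝ) * R) ^ Fintype.card τ *
          (8 * Fintype.card τ * B * (R : ℝ) ^ (2 * Fintype.card τ) / N) := by gcongr
      _ = _ := by
        rw [← sq, ← pow_mul, show 4 * Fintype.card τ = 2 * Fintype.card τ + 2 * Fintype.card τ by ring,
          pow_add]
        ring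

end SieveWeight

/-- The primes in the interval `(w, R]`. -/
def primesBetween (w R : ℕ) : Finset Nat.Primes := (Finset.Ioc w R).subtype Nat.Prime

lemma mem_primesBetween {w R : ℕ} {p : Nat.Primes} :
    p ∈ primesBetween w R ↔ w < (p : ℕ) ∧ (p : ℕ) ≤ R := by
  exact Finset.mem_subtype.trans Finset.mem_Ioc

/-- The sets of primes in `(w, R]` whose product is at most `R`. -/
def sieveSupport (w R : ℕ) : Finset (Finset Nat.Primes) :=
  (primesBetween w R).powerset.filter fun δ => ∏ p ∈ δ, (p : ℕ) ≤ R

lemma mem_sieveSupport {w R : ℕ} {δ : Finset Nat.Primes} :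
    δ ∈ sieveSupport w R ↔ δ ⊆ primesBetween w R ∧ ∏ p ∈ δ, (p : ℕ) ≤ R := by
  simp [sieveSupport]

lemma sieveSupport_down {w R : ℕ} {δ δ' : Finset Nat.Primes} (hδ : δ ∈ sieveSupport w R)
    (h : δ' ⊆ δ) : δ' ∈ sieveSupport w R := by
  rw [mem_sieveSupport] at hδ ⊢
  exact ⟨h.trans hδ.1, (Finset.prod_le_prod_of_subset_of_one_le' h
    fun p _ _ => p.2.one_lt.le).trans hδ.2⟩

lemma one_le_sieveMass {a b c : ℤ} {w R : ℕ} (hR : 1 ≤ R) :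
    1 ≤ sieveMass a b c (sieveSupport w R) := by
  have h0 : (∅ : Finset Nat.Primes) ∈ sieveSupport w R := by simp [mem_sieveSupport, hR]
  have := Finset.single_le_sum (f := fun δ => ∏ p ∈ δ, oddsAt a b c p)
    (fun δ _ => Finset.prod_nonneg fun p _ => zeroOdds_nonneg') h0
  simpa [sieveMass] using this

/-- The normalized square of the sifting sum along an arithmetic progression of points, as a
function of residues. -/
noncomputable def sieveWeight (a b c W : ℤ) (w R N : ℕ) (b₀ : ℤ × ℤ) (v : ZMod N × ZMod N) : ℝ :=
  sieveSum a b c (sieveSupport w R) (b₀ + W • lift₂ v) ^ 2 / sieveMass a b c (sieveSupport w R)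

lemma qform_cast₂ (R : Type*) [CommRing R] (a b c : ℤ) (v : ℤ × ℤ) :
    qform R a b c (cast₂ R v) = (binQF a b c v : R) := by
  simp [qform, cast₂, binQF]

lemma intCast_ne_zero_of_lt {p : ℕ} {n : ℤ} (hn : n ≠ 0) (h : n.natAbs < p) : (n : ZMod p) ≠ 0 := by
  rw [Ne, ZMod.intCast_zmod_eq_zero_iff_dvd]
  intro hd
  exact hn (Int.eq_zero_of_abs_lt_dvd hd (by rw [Int.abs_eq_natAbs]; exact_mod_cast h))

theorem sieveWeight_linForms {a b c : ℤ} (hF : ∀ v : ℤ × ℤ, v ≠ 0 → binQF a b c v ≠ 0)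
    (E : Finset (ℤ × ℤ)) (D : ℕ) : ∃ κ : ℕ, ∀ ε : ℝ, 0 < ε → ∃ w₀ : ℕ, ∀ w ≥ w₀, ∀ W : ℤ,
      (∀ p : ℕ, p.Prime → w < p → ¬ (p : ℤ) ∣ W) → ∃ N₀ : ℕ, ∀ N ≥ N₀, ∀ _ : Fact N.Prime,
      ∀ R : ℕ, 1 ≤ R → R ^ κ ≤ N → ∀ b₀ : ℤ × ℤ,
      LinForms (ZMod N) (sieveWeight a b c W w R N b₀) D (cast₂ (ZMod N) '' E) ε := by
  set m := (E.card + 1) ^ D with hm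
  obtain ⟨M, hM⟩ : ∃ M : ℕ, ∀ e ∈ E, max |e.1| |e.2| ≤ M := by
    refine ⟨E.sup fun e => max e.1.natAbs e.2.natAbs, fun e he => ?_⟩
    have := Finset.le_sup (f := fun e : ℤ × ℤ => max e.1.natAbs e.2.natAbs) he
    rw [Int.abs_eq_natAbs, Int.abs_eq_natAbs]
    exact_mod_cast this
  set B := 1 + D * M with hB
  refine ⟨8 * m, fun ε hε => ?_⟩
  obtain ⟨w₁, hw₁⟩ := exists_nat_ge (4 ^ m * 128 / Real.log (1 + ε / 2))
  refine ⟨4 + w₁ + a.natAbs + (E ×ˢ E).sup fun e => (binQF a b c (e.2 - e.1)).natAbs,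
    fun w hw W hW => ?_⟩
  obtain ⟨N₁, hN₁⟩ := exists_nat_ge ((16 * m * B / ε) ^ 2)
  refine ⟨N₁, fun N hN hNp R hR1 hRN b₀ ι _ _ hι T hT => ?_⟩
  have hlog : 0 < Real.log (1 + ε / 2) := Real.log_pos (by linarith)
  have hw0 : 0 < w := by omega
  choose! lam hlamE hlam using fun (t : T) (i : ι) => (hT t.1 t.2 i)
  have hcard : Fintype.card T ≤ m := by
    have : Fintype.card T ≤ Fintype.card (ι → E) := by
      refine Fintype.card_le_of_injective (fun t i => ⟨lam t i, hlamE t i⟩) fun t t' h => ?_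
      ext1
      funext i
      rw [← hlam t i, ← hlam t' i]
      exact congrArg _ (congrArg Subtype.val (congrFun h i))
    refine this.trans ?_
    rw [Fintype.card_fun, Fintype.card_coe]
    exact (Nat.pow_le_pow_left (Nat.le_succ _) _).trans (Nat.pow_le_pow_right (Nat.succ_pos _) hι)
  have hG : GoodPrimes a b c W (primesBetween w R) lam := by
    refine ⟨fun p hp => ?_, fun p hp => ?_, fun p hp => ?_, fun p hp t t' htt => ?_⟩
    · have := (mem_primesBetween.mp hp).1
      omega
    · have := (mem_primesBetween.mp hp).1
      exact intCast_ne_zero_of_lt (by simpa [binQF] using hF (1, 0) (by simp)) (by omega)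
    · rw [Ne, ZMod.intCast_zmod_eq_zero_iff_dvd]
      exact hW p p.2 (mem_primesBetween.mp hp).1
    · obtain ⟨i, hi⟩ : ∃ i, lam t i ≠ lam t' i := by
        by_contra! h
        refine htt (Subtype.ext (funext fun i => ?_))
        rw [← hlam t i, ← hlam t' i, h i]
      refine ⟨i, ?_⟩
      have : cast₂ (ZMod p) (lam t' i) - cast₂ (ZMod p) (lam t i) =
          cast₂ (ZMod p) (lam t' i - lam t i) := by simp [cast₂]
      rw [this, qform_cast₂]
      refine intCast_ne_zero_of_lt (hF _ (sub_ne_zero.mpr hi.symm)) ?_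
      have h1 := Finset.le_sup (f := fun e : (ℤ × ℤ) × (ℤ × ℤ) => (binQF a b c (e.2 - e.1)).natAbs)
        (show (lam t i, lam t' i) ∈ E ×ˢ E from
          Finset.mem_product.mpr ⟨hlamE t i, hlamE t' i⟩)
      have h2 := (mem_primesBetween.mp hp).1
      simp only at h1
      omega
  have hmain := abs_avg_prod_sieveSum_sq_sub_le (N := N) (R := R) (B := B) hw0 hG
    (fun p hp => (mem_primesBetween.mp hp).1) (fun t => ?_) (sieveSupport w R)
    (fun δ hδ => (mem_sieveSupport.mp hδ).1) (fun δ hδ δ' h => sieveSupport_down hδ h)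
    (fun δ hδ => (mem_sieveSupport.mp hδ).2) b₀
  swap
  · have h1 : ∑ i, max |(lam t i).1| |(lam t i).2| ≤ ∑ _i : ι, (M : ℤ) :=
      Finset.sum_le_sum fun i _ => hM _ (hlamE t i)
    rw [Finset.sum_const, Finset.card_univ, nsmul_eq_mul] at h1
    have h2 : (Fintype.card ι : ℤ) * M ≤ D * M := by gcongr
    rw [hB]
    push_cast
    linarith
  set L := sieveMass a b c (sieveSupport w R) with hL
  have hL1 : 1 ≤ L := one_le_sieveMass hR1
  have hLp : 1 ≤ L ^ Fintype.card T := one_le_pow₀ hL1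
  have hprod : ∀ z : (ZMod N × ZMod N) × (ι → ZMod N),
      ∏ t ∈ T, sieveWeight a b c W w R N b₀ (z.1 + ∑ i, z.2 i • t i) =
      (L ^ Fintype.card T)⁻¹ * ∏ t : T, sieveSum a b c (sieveSupport w R)
        (b₀ + W • lift₂ (z.1 + ∑ i, z.2 i • cast₂ (ZMod N) (lam t i))) ^ 2 := by
    intro z
    rw [← Finset.prod_coe_sort]
    simp only [sieveWeight, hlam]
    rw [Finset.prod_div_distrib, Finset.prod_const, Finset.card_univ, div_eq_inv_mul]
  simp only [hprod]
  rw [avg_mul_left]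
  set X := avg fun z : (ZMod N × ZMod N) × (ι → ZMod N) =>
    ∏ t : T, sieveSum a b c (sieveSupport w R)
        (b₀ + W • lift₂ (z.1 + ∑ i, z.2 i • cast₂ (ZMod N) (lam t i))) ^ 2 with hX
  have hNpos : (0 : ℝ) < N := by exact_mod_cast hNp.out.pos
  have e1 : Real.exp (4 ^ Fintype.card T * 128 / w) - 1 ≤ ε / 2 := by
    have : 4 ^ Fintype.card T * 128 / (w : ℝ) ≤ Real.log (1 + ε / 2) := by
      rw [div_le_iff₀ hlog] at hw₁
      have hwr : (w₁ : ℝ) ≤ w := by exact_mod_cast (by omega : w₁ ≤ w)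
      rw [div_le_iff₀ (by exact_mod_cast hw0)]
      calc (4 : ℝ) ^ Fintype.card T * 128 ≤ 4 ^ m * 128 := by gcongr; norm_num
        _ ≤ w₁ * Real.log (1 + ε / 2) := hw₁
        _ ≤ Real.log (1 + ε / 2) * w := by rw [mul_comm]; gcongr
    have := Real.exp_le_exp.mpr this
    rw [Real.exp_log (by linarith)] at this
    linarith
  have e2 : 8 * Fintype.card T * B * (R : ℝ) ^ (4 * Fintype.card T) / N ≤ ε / 2 := by
    have hR1' : (1 : ℝ) ≤ R := by exact_mod_cast hR1
    have h1 : (R : ℝ) ^ (4 * Fintype.card T) ≤ Real.sqrt N := by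
      refine Real.le_sqrt_of_sq_le ?_
      rw [← pow_mul]
      calc (R : ℝ) ^ (4 * Fintype.card T * 2) ≤ (R : ℝ) ^ (8 * m) :=
            pow_le_pow_right₀ hR1' (by omega)
        _ ≤ N := by exact_mod_cast hRN
    have h2 : 16 * m * B / ε ≤ Real.sqrt N := by
      refine Real.le_sqrt_of_sq_le (hN₁.trans ?_)
      exact_mod_cast hN
    rw [div_le_iff₀ hε] at h2
    rw [div_le_iff₀ hNpos]
    calc 8 * (Fintype.card T : ℝ) * B * (R : ℝ) ^ (4 * Fintype.card T)
        ≤ 8 * m * B * Real.sqrt N := by gcongr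
      _ = (16 * m * B) / 2 * Real.sqrt N := by ring
      _ ≤ (Real.sqrt N * ε) / 2 * Real.sqrt N := by gcongr
      _ = ε / 2 * (Real.sqrt N * Real.sqrt N) := by ring
      _ = ε / 2 * N := by rw [Real.mul_self_sqrt hNpos.le]
  have hfac : (L ^ Fintype.card T)⁻¹ * X - 1 = (L ^ Fintype.card T)⁻¹ * (X - L ^ Fintype.card T) := by
    rw [mul_sub, inv_mul_cancel₀ (by positivity)]
  rw [hfac, abs_mul, abs_of_nonneg (by positivity), inv_mul_le_iff₀ (by positivity)]
  refine hmain.trans ?_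
  have := mul_le_mul_of_nonneg_right e1 (by positivity : 0 ≤ L ^ Fintype.card T)
  nlinarith

lemma sieveWeight_of_sifted {a b c W : ℤ} {w R N : ℕ} (hR : 1 ≤ R) {b₀ : ℤ × ℤ}
    {v : ZMod N × ZMod N}
    (h : ∀ p : ℕ, p.Prime → w < p → p ≤ R → ¬ (p : ℤ) ∣ binQF a b c (b₀ + W • lift₂ v)) :
    sieveWeight a b c W w R N b₀ v = sieveMass a b c (sieveSupport w R) := by
  have h1 : sieveSum a b c (sieveSupport w R) (b₀ + W • lift₂ v) =
      sieveMass a b c (sieveSupport w R) := by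
    refine Finset.sum_congr rfl fun δ hδ => Finset.prod_congr rfl fun p hp => ?_
    have hp' := mem_primesBetween.mp ((mem_sieveSupport.mp hδ).1 hp)
    unfold letterAt sieveLetter oddsAt
    rw [if_neg]
    rw [qform_cast₂, ZMod.intCast_zmod_eq_zero_iff_dvd]
    exact h p p.2 hp'.1 hp'.2
  have := one_le_sieveMass (a := a) (b := b) (c := c) (w := w) hR
  rw [sieveWeight, h1, sq, mul_div_assoc, div_self (by linarith), mul_one]

section
open MeasureTheory MvPowerSeries

/-- The data of a free commutative monoid on `P` with an additive weight (a logarithmic norm) and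
a class map to `G`. -/
structure ClassSystem (P G : Type) [AddCommGroup G] where
  wt : P → ℝ
  wt_pos : ∀ p, 0 < wt p
  cls : P → G
  finite_ball : ∀ y : ℝ, {a : P →₀ ℕ | Finsupp.linearCombination ℕ wt a ≤ y}.Finite

namespace ClassSystem
variable {P G : Type} [AddCommGroup G] (A : ClassSystem P G)

/-- The logarithmic norm. -/
noncomputable def len : (P →₀ ℕ) →ₗ[ℕ] ℝ := Finsupp.linearCombination ℕ A.wt

/-- The class of an element. -/
noncomputable def cl : (P →₀ ℕ) →ₗ[ℕ] G := Finsupp.linearCombination ℕ A.cls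

/-- The finite set of elements of logarithmic norm at most `y`. -/
noncomputable def ball (y : ℝ) : Finset (P →₀ ℕ) := (A.finite_ball y).toFinset

theorem mem_ball {y : ℝ} {a : P →₀ ℕ} : a ∈ A.ball y ↔ A.len a ≤ y := by
  simp [ball, len]

theorem len_single (p : P) (n : ℕ) : A.len (Finsupp.single p n) = n * A.wt p := by
  simp [len]

theorem len_nonneg (a : P →₀ ℕ) : 0 ≤ A.len a := by
  rw [len, Finsupp.linearCombination_apply]
  exact Finset.sum_nonneg fun p _ => by
    simp only [nsmul_eq_mul]; exact mul_nonneg (Nat.cast_nonneg _) (A.wt_pos p).le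

theorem ball_mono {y z : ℝ} (h : y ≤ z) : A.ball y ⊆ A.ball z := fun a ha =>
  A.mem_ball.2 ((A.mem_ball.1 ha).trans h)

/-- The smoothed sum of `f` over elements of logarithmic norm near `x`. -/
noncomputable def sm (f : MvPowerSeries P ℂ) (k : ℝ → ℝ) (x : ℝ) : ℂ :=
  ∑' a, coeff a f * (k (A.len a - x) : ℂ)

theorem sm_eq {k : ℝ → ℝ} {β : ℝ} (hk : ∀ t, β < t → k t = 0) (f : MvPowerSeries P ℂ) {x Y : ℝ}
    (h : x + β ≤ Y) : A.sm f k x = ∑ a ∈ A.ball Y, coeff a f * (k (A.len a - x) : ℂ) := by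
  refine tsum_eq_sum fun a ha => ?_
  rw [mem_ball, not_le] at ha
  rw [hk _ (by linarith)]; simp

theorem sm_eq_zero {k : ℝ → ℝ} {β : ℝ} (hk : ∀ t, β < t → k t = 0) (f : MvPowerSeries P ℂ) {x : ℝ}
    (h : x < -β) : A.sm f k x = 0 := by
  rw [A.sm_eq hk f le_rfl]
  refine Finset.sum_eq_zero fun a _ => ?_
  rw [hk _ (by linarith [A.len_nonneg a])]; simp

theorem continuous_sm {k : ℝ → ℝ} {β : ℝ} (hc : Continuous k) (hk : ∀ t, β < t → k t = 0)
    (f : MvPowerSeries P ℂ) : Continuous (A.sm f k) := by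
  refine continuous_iff_continuousAt.2 fun x => ?_
  have : (fun z => ∑ a ∈ A.ball (x + 1 + β), coeff a f * (k (A.len a - z) : ℂ)) =ᶠ[nhds x] A.sm f k := by
    filter_upwards [Iio_mem_nhds (show x < x + 1 by linarith)] with z hz
    exact (A.sm_eq hk f (by simp at hz; linarith)).symm
  refine ContinuousAt.congr (Continuous.continuousAt ?_) this
  fun_prop

/-- Convolution of kernels. -/
noncomputable def kconv (k₁ k₂ : ℝ → ℝ) (t : ℝ) : ℝ := ∫ u, k₁ u * k₂ (t - u)

theorem kconv_eq_zero {k₁ k₂ : ℝ → ℝ} {β₁ β₂ : ℝ} (h₁ : ∀ t, β₁ < t → k₁ t = 0)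
    (h₂ : ∀ t, β₂ < t → k₂ t = 0) (t : ℝ) (ht : β₁ + β₂ < t) : kconv k₁ k₂ t = 0 := by
  have : (fun u => k₁ u * k₂ (t - u)) = fun _ => 0 := by
    funext u
    rcases lt_or_ge β₁ u with h | h
    · rw [h₁ _ h, zero_mul]
    · rw [h₂ _ (by linarith), mul_zero]
  simp [kconv, this]

/-- The sum over factorizations, regarded as a smoothed sum of a convolution. -/
theorem sum_sum_ball_eq [DecidableEq P] (f g : MvPowerSeries P ℂ) {K : ℝ → ℝ} {y Y : ℝ}
    (hK : ∀ t, Y - y < t → K t = 0) :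
    ∑ a ∈ A.ball Y, ∑ b ∈ A.ball Y, coeff a f * coeff b g * (K (A.len a + A.len b - y) : ℂ) =
      A.sm (f * g) K y := by
  classical
  rw [A.sm_eq hK _ (show y + (Y - y) ≤ Y by linarith), ← Finset.sum_product']
  have h1 : ∀ c, coeff c (f * g) * (K (A.len c - y) : ℂ) =
      ∑ q ∈ Finset.HasAntidiagonal.antidiagonal c, coeff q.1 f * coeff q.2 g * (K (A.len q.1 + A.len q.2 - y) : ℂ) := by
    intro c
    rw [coeff_mul, Finset.sum_mul]
    refine Finset.sum_congr rfl fun q hq => ?_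
    rw [Finset.HasAntidiagonal.mem_antidiagonal] at hq
    rw [← hq, map_add]
  rw [Finset.sum_congr rfl fun c _ => h1 c, Finset.sum_sigma']
  symm
  refine Finset.sum_of_injOn (fun q : (Σ _ : P →₀ ℕ, (P →₀ ℕ) × (P →₀ ℕ)) => q.2) ?_ ?_ ?_ ?_
  · rintro ⟨c, q⟩ h ⟨c', q'⟩ h' e
    simp only [Finset.coe_sigma, Set.mem_sigma_iff, Finset.mem_coe, Finset.HasAntidiagonal.mem_antidiagonal] at h h' e
    subst e
    obtain ⟨_, h⟩ := h
    obtain ⟨_, h'⟩ := h'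
    subst h; subst h'; rfl
  · rintro ⟨c, q⟩ h
    simp only [Finset.coe_sigma, Set.mem_sigma_iff, Finset.mem_coe, Finset.HasAntidiagonal.mem_antidiagonal] at h
    obtain ⟨h, e⟩ := h
    rw [mem_ball, ← e, map_add] at h
    simp only [Finset.coe_product, Set.mem_prod, Finset.mem_coe, mem_ball]
    exact ⟨by linarith [A.len_nonneg q.2], by linarith [A.len_nonneg q.1]⟩
  · rintro ⟨a, b⟩ - hn
    rw [hK, Complex.ofReal_zero, mul_zero]
    by_contra hlt
    refine hn ⟨⟨a + b, (a, b)⟩, ?_, rfl⟩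
    simp only [Finset.coe_sigma, Set.mem_sigma_iff, Finset.mem_coe, Finset.HasAntidiagonal.mem_antidiagonal, mem_ball,
      map_add, and_true]
    push Not at hlt
    dsimp at hlt
    linarith
  · rintro ⟨c, q⟩ _; rfl

theorem integral_sm_mul_sm [DecidableEq P] {k₁ k₂ : ℝ → ℝ} {β₁ β₂ : ℝ} (hc₁ : Continuous k₁) (hc₂ : Continuous k₂)
    (h₁ : ∀ t, t ∉ Set.Icc 0 β₁ → k₁ t = 0) (h₂ : ∀ t, t ∉ Set.Icc 0 β₂ → k₂ t = 0)
    (hβ₁ : 0 ≤ β₁) (hβ₂ : 0 ≤ β₂)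
    (f g : MvPowerSeries P ℂ) (y : ℝ) :
    ∫ u, A.sm f k₁ u * A.sm g k₂ (y - u) = A.sm (f * g) (kconv k₁ k₂) y := by
  have h₁' : ∀ t, β₁ < t → k₁ t = 0 := fun t ht => h₁ t fun h => absurd h.2 (not_le.2 ht)
  have h₂' : ∀ t, β₂ < t → k₂ t = 0 := fun t ht => h₂ t fun h => absurd h.2 (not_le.2 ht)
  set Y := y + (β₁ + β₂) with hY
  have e1 : ∀ u, A.sm f k₁ u * A.sm g k₂ (y - u) = ∑ a ∈ A.ball Y, ∑ b ∈ A.ball Y,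
      coeff a f * coeff b g * ((k₁ (A.len a - u) * k₂ (A.len b - (y - u)) : ℝ) : ℂ) := by
    intro u
    have e2 : ∀ z, A.sm f k₁ u * z = (∑ a ∈ A.ball Y, coeff a f * (k₁ (A.len a - u) : ℂ)) * z ∨ u > y + β₂ := by
      intro z
      by_cases hu : u ≤ y + β₂
      · left; rw [A.sm_eq h₁' f (show u + β₁ ≤ Y by linarith)]
      · right; linarith
    have e3 : A.sm f k₁ u * A.sm g k₂ (y - u) = (∑ a ∈ A.ball Y, coeff a f * (k₁ (A.len a - u) : ℂ)) *
        ∑ b ∈ A.ball Y, coeff b g * (k₂ (A.len b - (y - u)) : ℂ) := by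
      by_cases hv : y - u + β₂ ≤ Y
      · rw [← A.sm_eq h₂' g hv]
        rcases e2 (A.sm g k₂ (y - u)) with h | h
        · exact h
        · rw [A.sm_eq_zero h₂' g (show y - u < -β₂ by linarith), mul_zero, mul_zero]
      · rw [A.sm_eq_zero h₁' f (show u < -β₁ by linarith), zero_mul]
        rw [Finset.sum_eq_zero, zero_mul]
        intro a _
        rw [h₁' _ (by linarith [A.len_nonneg a])]; simp
    rw [e3, Finset.sum_mul_sum]
    refine Finset.sum_congr rfl fun a _ => Finset.sum_congr rfl fun b _ => ?_
    push_cast; ring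
  have hint : ∀ a b : P →₀ ℕ, Integrable fun u =>
      coeff a f * coeff b g * ((k₁ (A.len a - u) * k₂ (A.len b - (y - u)) : ℝ) : ℂ) := by
    intro a b
    refine Continuous.integrable_of_hasCompactSupport (by fun_prop) ?_
    refine HasCompactSupport.intro (K := Set.Icc (A.len a - β₁) (A.len a)) isCompact_Icc fun u hu => ?_
    rw [h₁, zero_mul, Complex.ofReal_zero, mul_zero]
    rintro ⟨p, q⟩
    exact hu ⟨by linarith, by linarith⟩
  simp_rw [e1]
  rw [integral_finsetSum _ fun a _ => integrable_finsetSum _ fun b _ => hint a b]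
  simp_rw [integral_finsetSum _ fun b _ => hint _ b]
  rw [← A.sum_sum_ball_eq f g (Y := Y) (fun t ht => kconv_eq_zero h₁' h₂' t (by linarith))]
  refine Finset.sum_congr rfl fun a _ => Finset.sum_congr rfl fun b _ => ?_
  rw [integral_const_mul, integral_complex_ofReal]
  congr 2
  rw [kconv, ← integral_sub_left_eq_self (fun u => k₁ u * k₂ (A.len a + A.len b - y - u)) volume (A.len a)]
  refine integral_congr_ae (ae_of_all _ fun u => ?_)
  dsimp only
  ring_nf

end ClassSystem
end

section
open MeasureTheory MvPowerSeries Finset.HasAntidiagonal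

namespace ClassSystem
variable {P G : Type} [AddCommGroup G] [Finite G] [DecidableEq P] (A : ClassSystem P G)

/-- The von Mangoldt function: the weight of `p` at the positive multiples of `p`. -/
noncomputable def lam (a : P →₀ ℕ) : ℝ :=
  ∑ p ∈ a.support, if a = Finsupp.single p (a p) then A.wt p else 0

theorem lam_nonneg (a : P →₀ ℕ) : 0 ≤ A.lam a :=
  Finset.sum_nonneg fun p _ => by split_ifs <;> [exact (A.wt_pos p).le; exact le_rfl]

theorem lam_single (p : P) {n : ℕ} (hn : n ≠ 0) : A.lam (Finsupp.single p n) = A.wt p := by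
  rw [lam, Finsupp.support_single _ hn]; simp

theorem exists_of_lam_ne_zero {a : P →₀ ℕ} (h : A.lam a ≠ 0) :
    ∃ p n, n ≠ 0 ∧ a = Finsupp.single p n := by
  obtain ⟨p, hp, h⟩ := Finset.exists_ne_zero_of_sum_ne_zero h
  rw [Ne, ite_eq_right_iff, Classical.not_imp] at h
  exact ⟨p, a p, by simpa using hp, h.1⟩

theorem sum_lam_antidiagonal (a : P →₀ ℕ) : ∑ q ∈ antidiagonal a, A.lam q.2 = A.len a := by
  have h1 : ∀ q ∈ antidiagonal a, A.lam q.2 = ∑ p ∈ a.support,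
      if q.2 p ≠ 0 ∧ q.2 = Finsupp.single p (q.2 p) then A.wt p else 0 := by
    intro q hq
    rw [mem_antidiagonal] at hq
    have hs : q.2.support ⊆ a.support := by
      rw [← hq]; intro p hp; simp at hp ⊢; omega
    rw [lam]
    refine Finset.sum_subset_zero_on_sdiff hs (fun p hp => ?_) (fun p hp => ?_)
    · simp only [Finset.mem_sdiff, Finsupp.mem_support_iff, not_not] at hp
      rw [if_neg]; exact fun h => h.1 hp.2
    · rw [Finsupp.mem_support_iff] at hp
      simp [hp]
  rw [Finset.sum_congr rfl h1, Finset.sum_comm, len, Finsupp.linearCombination_apply, Finsupp.sum]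
  refine Finset.sum_congr rfl fun p hp => ?_
  rw [← Finset.sum_filter, Finset.sum_const]
  congr 1
  rw [← Nat.add_sub_cancel (a p) 1, ← Nat.card_Icc]
  symm
  refine Finset.card_bij (fun j _ => (a - Finsupp.single p j, Finsupp.single p j)) ?_ ?_ ?_
  · intro j hj
    rw [Finset.mem_Icc] at hj
    simp only [Finset.mem_filter, mem_antidiagonal, Finsupp.single_eq_same, and_true]
    refine ⟨tsub_add_cancel_of_le ?_, by omega⟩
    rw [Finsupp.single_le_iff]; exact hj.2
  · intro j _ j' _ h
    have := congrArg (fun q => q.2 p) h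
    simpa using this
  · rintro ⟨u, v⟩ h
    simp only [Finset.mem_filter, mem_antidiagonal] at h
    obtain ⟨h, hv, e⟩ := h
    refine ⟨v p, ?_, ?_⟩
    · rw [Finset.mem_Icc, ← h, Finsupp.add_apply]; omega
    · rw [← e, ← h, add_tsub_cancel_right]

theorem lam_nsmul {n : ℕ} (hn : n ≠ 0) (a : P →₀ ℕ) : A.lam (n • a) = A.lam a := by
  have hs : (n • a).support = a.support := by
    ext p; simp [hn]
  rw [lam, lam, hs]
  refine Finset.sum_congr rfl fun p _ => ?_
  congr 1
  rw [Finsupp.smul_apply, ← Finsupp.smul_single, eq_iff_iff]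
  constructor
  · intro h
    ext q
    have := DFunLike.congr_fun h q
    simp only [Finsupp.smul_apply, smul_eq_mul] at this
    exact Nat.eq_of_mul_eq_mul_left (Nat.pos_of_ne_zero hn) this
  · intro h; rw [← h]

/-- The derivation multiplying the coefficient at `a` by its logarithmic norm. -/
noncomputable def der (f : MvPowerSeries P ℂ) : MvPowerSeries P ℂ :=
  fun a => (A.len a : ℂ) * coeff a f

theorem coeff_der (f : MvPowerSeries P ℂ) (a : P →₀ ℕ) :
    coeff a (A.der f) = (A.len a : ℂ) * coeff a f := rfl

theorem der_mul (f g : MvPowerSeries P ℂ) : A.der (f * g) = A.der f * g + f * A.der g := by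
  ext a
  rw [map_add, coeff_der, coeff_mul, coeff_mul, coeff_mul, Finset.mul_sum, ← Finset.sum_add_distrib]
  refine Finset.sum_congr rfl fun q hq => ?_
  rw [mem_antidiagonal] at hq
  rw [coeff_der, coeff_der, ← hq, map_add]
  push_cast; ring

/-- The character `ψ` as a series. -/
noncomputable def chi (ψ : AddChar G ℂ) : MvPowerSeries P ℂ := fun a => ψ (A.cl a)

theorem coeff_chi (ψ : AddChar G ℂ) (a : P →₀ ℕ) : coeff a (A.chi ψ) = ψ (A.cl a) := rfl

/-- The von Mangoldt function twisted by the character `ψ`. -/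
noncomputable def lamS (ψ : AddChar G ℂ) : MvPowerSeries P ℂ := fun a => (A.lam a : ℂ) * ψ (A.cl a)

theorem coeff_lamS (ψ : AddChar G ℂ) (a : P →₀ ℕ) :
    coeff a (A.lamS ψ) = (A.lam a : ℂ) * ψ (A.cl a) := rfl

theorem der_chi (ψ : AddChar G ℂ) : A.der (A.chi ψ) = A.chi ψ * A.lamS ψ := by
  ext a
  rw [coeff_der, coeff_mul, ← A.sum_lam_antidiagonal, Complex.ofReal_sum, Finset.sum_mul]
  refine Finset.sum_congr rfl fun q hq => ?_
  rw [mem_antidiagonal] at hq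
  rw [coeff_chi, coeff_chi, coeff_lamS, ← hq, map_add, AddChar.map_add_eq_mul]
  ring

/-- The fourfold product `1 * 1 * ψ * ψ⁻¹`, whose coefficients are nonnegative. -/
noncomputable def quad (ψ : AddChar G ℂ) : MvPowerSeries P ℂ :=
  (A.chi ψ * A.chi 1) * (A.chi ψ⁻¹ * A.chi 1)

theorem len_pos {a : P →₀ ℕ} (ha : a ≠ 0) : 0 < A.len a := by
  rw [len, Finsupp.linearCombination_apply, Finsupp.sum]
  refine Finset.sum_pos (fun p hp => ?_) (Finsupp.support_nonempty_iff.2 ha)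
  rw [nsmul_eq_mul]
  exact mul_pos (Nat.cast_pos.2 (Nat.pos_of_ne_zero (by simpa using hp))) (A.wt_pos p)

theorem lam_zero : A.lam 0 = 0 := by simp [lam]

theorem len_mul_coeff_quad (ψ : AddChar G ℂ) (a : P →₀ ℕ) : (A.len a : ℂ) * coeff a (A.quad ψ) =
    ∑ q ∈ antidiagonal a, coeff q.1 (A.quad ψ) *
      ((A.lam q.2 * (2 + 2 * (ψ (A.cl q.2)).re) : ℝ) : ℂ) := by
  have h : A.der (A.quad ψ) = A.quad ψ * (A.lamS ψ + A.lamS 1 + (A.lamS ψ⁻¹ + A.lamS 1)) := by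
    rw [quad, der_mul, der_mul, der_mul]
    simp only [der_chi]
    ring
  rw [← coeff_der, h, coeff_mul]
  refine Finset.sum_congr rfl fun q _ => ?_
  congr 1
  simp only [map_add, coeff_lamS, AddChar.one_apply]
  have : ψ⁻¹ (A.cl q.2) = 2 * ((ψ (A.cl q.2)).re : ℂ) - ψ (A.cl q.2) := by
    rw [AddChar.inv_apply', AddChar.inv_apply_eq_conj, eq_sub_iff_add_eq, add_comm, Complex.add_conj]
    push_cast; rfl
  rw [this]; push_cast; ring

theorem coeff_quad_zero (ψ : AddChar G ℂ) : coeff 0 (A.quad ψ) = 1 := by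
  have h : ∀ ψ : AddChar G ℂ, constantCoeff (A.chi ψ) = 1 := fun ψ => by
    rw [← coeff_zero_eq_constantCoeff_apply, coeff_chi, map_zero, AddChar.map_zero_eq_one]
  simp [quad, h]

theorem exists_coeff_quad (ψ : AddChar G ℂ) (a : P →₀ ℕ) :
    ∃ r : ℝ, 0 ≤ r ∧ coeff a (A.quad ψ) = r := by
  induction a using WellFoundedLT.induction with
  | ind a ih =>
    rcases eq_or_ne a 0 with rfl | ha
    · exact ⟨1, zero_le_one, by rw [coeff_quad_zero, Complex.ofReal_one]⟩
    choose! r hr0 hr using ih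
    have hl := A.len_pos ha
    refine ⟨(∑ q ∈ antidiagonal a, r q.1 * (A.lam q.2 * (2 + 2 * (ψ (A.cl q.2)).re))) / A.len a, ?_, ?_⟩
    · refine div_nonneg (Finset.sum_nonneg fun q hq => ?_) hl.le
      rw [mem_antidiagonal] at hq
      rcases eq_or_ne q.2 0 with h0 | h0
      · rw [h0, lam_zero]; simp
      have hlt : q.1 < a := by
        rw [← hq]; exact lt_add_of_pos_right _ (pos_iff_ne_zero.2 h0)
      have h1 : |(ψ (A.cl q.2)).re| ≤ 1 := (Complex.abs_re_le_norm _).trans (AddChar.norm_apply _ _).le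
      exact mul_nonneg (hr0 _ hlt) (mul_nonneg (A.lam_nonneg _) (by linarith [(abs_le.1 h1).1]))
    · rw [Complex.ofReal_div, eq_div_iff (by exact_mod_cast hl.ne'), mul_comm, len_mul_coeff_quad]
      push_cast
      refine Finset.sum_congr rfl fun q hq => ?_
      rw [mem_antidiagonal] at hq
      rcases eq_or_ne q.2 0 with h0 | h0
      · rw [h0, lam_zero]; simp
      rw [hr q.1 (by rw [← hq]; exact lt_add_of_pos_right _ (pos_iff_ne_zero.2 h0))]

theorem re_coeff_quad_nonneg (ψ : AddChar G ℂ) (a : P →₀ ℕ) : 0 ≤ (coeff a (A.quad ψ)).re := by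
  obtain ⟨r, h0, h⟩ := A.exists_coeff_quad ψ a
  rw [h, Complex.ofReal_re]; exact h0

theorem lam_le_coeff_quad (ψ : AddChar G ℂ) (a : P →₀ ℕ) (ha : ψ (A.cl a) = 1) :
    4 * A.lam a ≤ A.len a * (coeff a (A.quad ψ)).re := by
  have h := congrArg Complex.re (A.len_mul_coeff_quad ψ a)
  rw [Complex.re_ofReal_mul, Complex.re_sum] at h
  rw [h]
  have : 4 * A.lam a = (coeff (0, a).1 (A.quad ψ) *
      ((A.lam (0, a).2 * (2 + 2 * (ψ (A.cl (0, a).2)).re) : ℝ) : ℂ)).re := by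
    simp only [coeff_quad_zero, ha, one_mul, Complex.ofReal_re, Complex.one_re]; ring
  rw [this]
  refine Finset.single_le_sum (f := fun q : (P →₀ ℕ) × (P →₀ ℕ) => (coeff q.1 (A.quad ψ) *
      ((A.lam q.2 * (2 + 2 * (ψ (A.cl q.2)).re) : ℝ) : ℂ)).re) (fun q _ => ?_) (by simp)
  rw [Complex.re_mul_ofReal]
  have h1 : |(ψ (A.cl q.2)).re| ≤ 1 := (Complex.abs_re_le_norm _).trans (AddChar.norm_apply _ _).le
  exact mul_nonneg (A.re_coeff_quad_nonneg ψ _)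
    (mul_nonneg (A.lam_nonneg _) (by linarith [(abs_le.1 h1).1]))

end ClassSystem
end

section
open MeasureTheory MvPowerSeries Finset.HasAntidiagonal

namespace ClassSystem
variable {P G : Type} [AddCommGroup G] [Finite G] [DecidableEq P] (A : ClassSystem P G)

theorem sm_mul {k : ℝ → ℝ} {β : ℝ} (hk : ∀ t, β < t → k t = 0) (f g : MvPowerSeries P ℂ) (x : ℝ) :
    A.sm (f * g) k x = ∑ b ∈ A.ball (x + β), coeff b g * A.sm f k (x - A.len b) := by
  rw [← A.sum_sum_ball_eq f g (K := k) (y := x) (Y := x + β) (fun t ht => hk t (by linarith)),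
    Finset.sum_comm]
  refine Finset.sum_congr rfl fun b _ => ?_
  rw [A.sm_eq hk f (show x - A.len b + β ≤ x + β by linarith [A.len_nonneg b]), Finset.mul_sum]
  refine Finset.sum_congr rfl fun a _ => ?_
  rw [show A.len a + A.len b - x = A.len a - (x - A.len b) by ring]; ring

/-- The analytic input: a smooth kernel whose sums over characters are regular, and a Chebyshev upper
bound. -/
structure Kernel (k : ℝ → ℝ) (β κ C : ℝ) : Prop where
  cont : Continuous k
  nonneg : ∀ t, 0 ≤ k t
  supp : ∀ t, t ∉ Set.Icc 0 β → k t = 0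
  integral : ∫ t, k t = 1
  pos_β : 0 < β
  pos_κ : 0 < κ
  nonneg_C : 0 ≤ C
  triv : ∀ x, ‖A.sm (A.chi 1) k x - (κ * Real.exp x : ℝ)‖ ≤ C
  char : ∀ ψ : AddChar G ℂ, ψ ≠ 1 → ∀ x, ‖A.sm (A.chi ψ) k x‖ ≤ C
  char_mul : ∀ ψ : AddChar G ℂ, ψ ≠ 1 → ∀ x, ‖A.sm (A.chi ψ) (fun t => t * k t) x‖ ≤ C
  cheb : ∀ y, ∑ a ∈ A.ball y, A.lam a ≤ C * Real.exp y

variable {A} {k : ℝ → ℝ} {β κ C : ℝ}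

theorem Kernel.eq_zero (h : A.Kernel k β κ C) : ∀ t, β < t → k t = 0 := fun t ht =>
  h.supp t fun hh => absurd hh.2 (not_le.2 ht)

theorem Kernel.mul_eq_zero (h : A.Kernel k β κ C) : ∀ t, β < t → t * k t = 0 := fun t ht => by
  rw [h.eq_zero t ht, mul_zero]

theorem Kernel.sm_der (h : A.Kernel k β κ C) (f : MvPowerSeries P ℂ) (x : ℝ) :
    A.sm (A.der f) k x = A.sm f (fun t => t * k t) x + x * A.sm f k x := by
  rw [A.sm_eq h.eq_zero _ le_rfl, A.sm_eq h.eq_zero _ le_rfl, A.sm_eq h.mul_eq_zero _ le_rfl,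
    Finset.mul_sum, ← Finset.sum_add_distrib]
  refine Finset.sum_congr rfl fun a _ => ?_
  rw [coeff_der]; push_cast; ring

theorem Kernel.norm_sm_le (h : A.Kernel k β κ C) (f : MvPowerSeries P ℂ) (hf : ∀ a, ‖coeff a f‖ ≤ 1)
    (x : ℝ) : ‖A.sm f k x‖ ≤ κ * Real.exp x + C := by
  have h1 : ‖A.sm f k x‖ ≤ ‖A.sm (A.chi 1) k x‖ := by
    have e : A.sm (A.chi 1) k x = ((∑ a ∈ A.ball (x + β), k (A.len a - x) : ℝ) : ℂ) := by
      rw [A.sm_eq h.eq_zero _ le_rfl, Complex.ofReal_sum]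
      exact Finset.sum_congr rfl fun a _ => by rw [coeff_chi, AddChar.one_apply, one_mul]
    rw [e, Complex.norm_real, Real.norm_of_nonneg (Finset.sum_nonneg fun _ _ => h.nonneg _),
      A.sm_eq h.eq_zero _ le_rfl]
    refine (norm_sum_le _ _).trans (Finset.sum_le_sum fun a _ => ?_)
    rw [norm_mul, Complex.norm_real, Real.norm_of_nonneg (h.nonneg _)]
    exact mul_le_of_le_one_left (h.nonneg _) (hf a)
  have h2 := h.triv x
  have h3 := norm_le_norm_add_norm_sub' (A.sm (A.chi 1) k x) ((κ * Real.exp x : ℝ) : ℂ)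
  rw [Complex.norm_real, Real.norm_of_nonneg (mul_nonneg h.pos_κ.le (Real.exp_pos x).le)] at h3
  linarith

theorem Kernel.norm_sm_mul_le (h : A.Kernel k β κ C) (f : MvPowerSeries P ℂ)
    (hf : ∀ a, ‖coeff a f‖ ≤ 1) (x : ℝ) :
    ‖A.sm f (fun t => t * k t) x‖ ≤ β * (κ * Real.exp x + C) := by
  have e : A.sm (A.chi 1) k x = ((∑ a ∈ A.ball (x + β), k (A.len a - x) : ℝ) : ℂ) := by
    rw [A.sm_eq h.eq_zero _ le_rfl, Complex.ofReal_sum]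
    exact Finset.sum_congr rfl fun a _ => by rw [coeff_chi, AddChar.one_apply, one_mul]
  have h2 := h.norm_sm_le (A.chi 1) (fun a => by simp [coeff_chi]) x
  rw [e, Complex.norm_real, Real.norm_of_nonneg (Finset.sum_nonneg fun _ _ => h.nonneg _)] at h2
  refine le_trans ?_ (mul_le_mul_of_nonneg_left h2 h.pos_β.le)
  rw [A.sm_eq h.mul_eq_zero _ le_rfl, Finset.mul_sum]
  refine (norm_sum_le _ _).trans (Finset.sum_le_sum fun a _ => ?_)
  rw [norm_mul, Complex.norm_real, norm_mul, Real.norm_of_nonneg (h.nonneg _)]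
  refine (mul_le_of_le_one_left (by positivity [h.nonneg (A.len a - x)]) (hf a)).trans ?_
  by_cases ht : A.len a - x ∈ Set.Icc 0 β
  · rw [Real.norm_of_nonneg ht.1]
    exact mul_le_mul_of_nonneg_right ht.2 (h.nonneg _)
  · rw [h.supp _ ht, mul_zero, mul_zero]

variable (A) in
/-- The logarithmic mean of the von Mangoldt function twisted by `ψ`. -/
noncomputable def mert (ψ : AddChar G ℂ) (y : ℝ) : ℂ :=
  ∑ b ∈ A.ball y, (A.lam b * Real.exp (-A.len b) : ℝ) * ψ (A.cl b)

theorem norm_mert_le (ψ : AddChar G ℂ) {y z : ℝ} (h : y ≤ z) :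
    ‖A.mert ψ y‖ ≤ ∑ b ∈ A.ball z, A.lam b := by
  refine (norm_sum_le _ _).trans ?_
  refine le_trans (Finset.sum_le_sum fun b _ => ?_)
    (Finset.sum_le_sum_of_subset_of_nonneg (A.ball_mono h) fun b _ _ => A.lam_nonneg b)
  rw [norm_mul, AddChar.norm_apply, mul_one, Complex.norm_real, Real.norm_of_nonneg
    (mul_nonneg (A.lam_nonneg b) (Real.exp_pos _).le)]
  exact mul_le_of_le_one_right (A.lam_nonneg b) (Real.exp_le_one_iff.2 (by linarith [A.len_nonneg b]))

/-- Mertens' estimate for the trivial character. -/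
theorem Kernel.mert_one (h : A.Kernel k β κ C) : ∃ C', ∀ y, 0 ≤ y → ‖A.mert 1 y - y‖ ≤ C' := by
  have h0 : ∀ a, ‖coeff a (A.chi 1)‖ ≤ 1 := fun a => by simp [coeff_chi]
  have key : ∀ x, 0 ≤ x → ‖A.mert 1 (x + β) - x‖ ≤ (β * (κ + C) + C + C * C * Real.exp β) / κ := by
    intro x hx
    have e1 := h.sm_der (A.chi 1) x
    rw [der_chi, A.sm_mul h.eq_zero] at e1
    have e2 : ∑ b ∈ A.ball (x + β), coeff b (A.lamS 1) * A.sm (A.chi 1) k (x - A.len b) =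
        (κ * Real.exp x : ℝ) * A.mert 1 (x + β) + ∑ b ∈ A.ball (x + β), (A.lam b : ℂ) *
          (A.sm (A.chi 1) k (x - A.len b) - (κ * Real.exp (x - A.len b) : ℝ)) := by
      rw [mert, Finset.mul_sum, ← Finset.sum_add_distrib]
      refine Finset.sum_congr rfl fun b _ => ?_
      rw [coeff_lamS, AddChar.one_apply, sub_eq_add_neg x, Real.exp_add]
      push_cast; ring
    have e3 : ‖∑ b ∈ A.ball (x + β), (A.lam b : ℂ) *
          (A.sm (A.chi 1) k (x - A.len b) - (κ * Real.exp (x - A.len b) : ℝ))‖ ≤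
        C * C * Real.exp β * Real.exp x := by
      refine (norm_sum_le _ _).trans ((Finset.sum_le_sum fun b _ => ?_).trans
        (show ∑ b ∈ A.ball (x + β), A.lam b * C ≤ _ from ?_))
      · rw [norm_mul, Complex.norm_real, Real.norm_of_nonneg (A.lam_nonneg b)]
        exact mul_le_mul_of_nonneg_left (h.triv _) (A.lam_nonneg b)
      · rw [← Finset.sum_mul]
        refine (mul_le_mul_of_nonneg_right (h.cheb _) h.nonneg_C).trans (le_of_eq ?_)
        rw [Real.exp_add]; ring
    have e4 := h.norm_sm_mul_le (A.chi 1) h0 x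
    have e5 := h.triv x
    have he := Real.add_one_le_exp x
    have e6 : (κ * Real.exp x : ℝ) * (A.mert 1 (x + β) - x) = A.sm (A.chi 1) (fun t => t * k t) x +
        x * (A.sm (A.chi 1) k x - (κ * Real.exp x : ℝ)) - ∑ b ∈ A.ball (x + β), (A.lam b : ℂ) *
          (A.sm (A.chi 1) k (x - A.len b) - (κ * Real.exp (x - A.len b) : ℝ)) := by
      linear_combination e1 - e2
    have hp : 0 < κ * Real.exp x := mul_pos h.pos_κ (Real.exp_pos x)
    have e7 : κ * Real.exp x * ‖A.mert 1 (x + β) - x‖ ≤ β * (κ * Real.exp x + C) + x * C +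
        C * C * Real.exp β * Real.exp x := by
      rw [← Real.norm_of_nonneg hp.le, ← Complex.norm_real, ← norm_mul, e6]
      refine (norm_sub_le _ _).trans (add_le_add ((norm_add_le _ _).trans (add_le_add ?_ ?_)) e3)
      · rwa [Complex.norm_real, Real.norm_of_nonneg hp.le]
      · rw [norm_mul, Complex.norm_real, Real.norm_of_nonneg hx]
        exact mul_le_mul_of_nonneg_left e5 hx
    rw [le_div_iff₀ h.pos_κ]
    have hC := h.nonneg_C
    have hβ := h.pos_β
    refine le_of_mul_le_mul_right ?_ (Real.exp_pos x)
    have i1 : C * (x + 1) ≤ C * Real.exp x := mul_le_mul_of_nonneg_left he hC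
    have i2 : β * C * (x + 1) ≤ β * C * Real.exp x := mul_le_mul_of_nonneg_left he (by positivity)
    have i3 : 0 ≤ β * C * x := by positivity
    nlinarith
  refine ⟨(β * (κ + C) + C + C * C * Real.exp β) / κ + β + C * Real.exp β, fun y hy => ?_⟩
  have hC := h.nonneg_C
  have hβ := h.pos_β
  have hκ := h.pos_κ
  have p1 : 0 ≤ (β * (κ + C) + C + C * C * Real.exp β) / κ := by positivity
  have p2 : 0 ≤ C * Real.exp β := by positivity
  rcases le_total β y with hb | hb
  · have := key (y - β) (by linarith)
    rw [sub_add_cancel] at this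
    have e : A.mert 1 y - y = (A.mert 1 y - (y - β : ℝ)) - (β : ℝ) := by push_cast; ring
    rw [e]
    refine (norm_sub_le _ _).trans ?_
    rw [Complex.norm_real, Real.norm_of_nonneg hβ.le]
    linarith
  · refine (norm_sub_le _ _).trans ?_
    rw [Complex.norm_real, Real.norm_of_nonneg hy]
    have := (norm_mert_le (A := A) (1 : AddChar G ℂ) hb).trans (h.cheb β)
    linarith

end ClassSystem
end

section
open MeasureTheory MvPowerSeries Finset.HasAntidiagonal

namespace ClassSystem
variable {P G : Type} [AddCommGroup G] [Finite G] [DecidableEq P] (A : ClassSystem P G)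

/-- The value at `1` of the `L`-function of `ψ`, computed through a kernel supported in `[0, β]`. -/
noncomputable def lval (k : ℝ → ℝ) (β : ℝ) (ψ : AddChar G ℂ) : ℂ :=
  ∫ u in Set.Ioi (-β), (Real.exp (-u) : ℂ) * A.sm (A.chi ψ) k u

variable {A} {k : ℝ → ℝ} {β κ C : ℝ}

theorem integrableOn_exp_neg (c : ℝ) : IntegrableOn (fun u : ℝ => Real.exp (-u)) (Set.Ioi c) := by
  simpa using exp_neg_integrableOn_Ioi c one_pos

theorem Kernel.continuous_exp_mul_sm (h : A.Kernel k β κ C) (f : MvPowerSeries P ℂ) :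
    Continuous fun u : ℝ => (Real.exp (-u) : ℂ) * A.sm f k u := by
  have := A.continuous_sm h.cont h.eq_zero f
  fun_prop

theorem Kernel.integrableOn_lval (h : A.Kernel k β κ C) {ψ : AddChar G ℂ} (hψ : ψ ≠ 1) (c : ℝ) :
    IntegrableOn (fun u : ℝ => (Real.exp (-u) : ℂ) * A.sm (A.chi ψ) k u) (Set.Ioi c) := by
  refine Integrable.mono' ((integrableOn_exp_neg c).mul_const C)
    (h.continuous_exp_mul_sm _).aestronglyMeasurable (ae_of_all _ fun u => ?_)
  rw [norm_mul, Complex.norm_real, Real.norm_of_nonneg (Real.exp_pos _).le]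
  exact mul_le_mul_of_nonneg_left (h.char ψ hψ u) (Real.exp_pos _).le

theorem Kernel.norm_lval_sub_le (h : A.Kernel k β κ C) {ψ : AddChar G ℂ} (hψ : ψ ≠ 1) {y : ℝ}
    (hy : -β ≤ y) :
    ‖A.lval k β ψ - ∫ u in (-β)..y, (Real.exp (-u) : ℂ) * A.sm (A.chi ψ) k u‖ ≤
      C * Real.exp (-y) := by
  rw [lval, intervalIntegral.integral_of_le hy, ← Set.Ioc_union_Ioi_eq_Ioi hy,
    setIntegral_union Set.Ioc_disjoint_Ioi_same measurableSet_Ioi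
      ((h.integrableOn_lval hψ (-β)).mono_set Set.Ioc_subset_Ioi_self) (h.integrableOn_lval hψ y),
    add_sub_cancel_left]
  refine (norm_integral_le_of_norm_le ((integrableOn_exp_neg y).const_mul C)
    (ae_of_all _ fun u => ?_)).trans (le_of_eq ?_)
  · rw [norm_mul, Complex.norm_real, Real.norm_of_nonneg (Real.exp_pos _).le, mul_comm]
    exact mul_le_mul_of_nonneg_right (h.char ψ hψ u) (Real.exp_pos _).le
  · rw [integral_const_mul, integral_exp_neg_Ioi]

theorem Kernel.integral_exp_mul_sm_der (h : A.Kernel k β κ C) (ψ : AddChar G ℂ)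
    {y : ℝ} (hy : 0 ≤ y) :
    ∫ x in (-β)..y, (Real.exp (-x) : ℂ) * A.sm (A.der (A.chi ψ)) k x =
      ∑ b ∈ A.ball (y + β), coeff b (A.lamS ψ) * (Real.exp (-A.len b) *
        ∫ u in (-β)..(y - A.len b), (Real.exp (-u) : ℂ) * A.sm (A.chi ψ) k u) := by
  have hβ := h.pos_β
  have e1 : ∀ x ∈ Set.uIcc (-β) y, (Real.exp (-x) : ℂ) * A.sm (A.der (A.chi ψ)) k x =
      ∑ b ∈ A.ball (y + β), coeff b (A.lamS ψ) *
        ((Real.exp (-x) : ℂ) * A.sm (A.chi ψ) k (x - A.len b)) := by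
    intro x hx
    rw [Set.uIcc_of_le (by linarith)] at hx
    rw [der_chi, A.sm_mul h.eq_zero, Finset.sum_subset (A.ball_mono
      (show x + β ≤ y + β by linarith [hx.2])), Finset.mul_sum]
    · exact Finset.sum_congr rfl fun b _ => by ring
    · intro b _ hb
      rw [mem_ball, not_le] at hb
      rw [A.sm_eq_zero h.eq_zero _ (by linarith), mul_zero]
  rw [intervalIntegral.integral_congr e1, intervalIntegral.integral_finsetSum]
  · refine Finset.sum_congr rfl fun b hb => ?_
    rw [mem_ball] at hb
    have hl := A.len_nonneg b
    rw [intervalIntegral.integral_const_mul]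
    congr 1
    have e2 : ∀ x, (Real.exp (-x) : ℂ) * A.sm (A.chi ψ) k (x - A.len b) = Real.exp (-A.len b) *
        ((fun u : ℝ => (Real.exp (-u) : ℂ) * A.sm (A.chi ψ) k u) (x - A.len b)) := by
      intro x
      rw [show -x = -A.len b + -(x - A.len b) by ring, Real.exp_add]
      push_cast; ring
    simp_rw [e2]
    rw [intervalIntegral.integral_const_mul, 
      intervalIntegral.integral_comp_sub_right
        (fun u : ℝ => (Real.exp (-u) : ℂ) * A.sm (A.chi ψ) k u) (A.len b)]
    congr 1
    have hi : ∀ a b : ℝ, IntervalIntegrable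
        (fun u : ℝ => (Real.exp (-u) : ℂ) * A.sm (A.chi ψ) k u) volume a b := fun a b =>
      (h.continuous_exp_mul_sm _).intervalIntegrable _ _
    rw [← intervalIntegral.integral_add_adjacent_intervals (hi (-β - A.len b) (-β)) (hi (-β) _)]
    rw [intervalIntegral.integral_of_le (by linarith), ← integral_Ico_eq_integral_Ioc,
      setIntegral_eq_zero_of_forall_eq_zero, zero_add]
    intro u hu
    rw [A.sm_eq_zero h.eq_zero _ hu.2, mul_zero]
  · intro b _
    have := A.continuous_sm h.cont h.eq_zero (A.chi ψ)
    exact Continuous.intervalIntegrable (by fun_prop) _ _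

theorem Kernel.lval_mul_mert (h : A.Kernel k β κ C) {ψ : AddChar G ℂ} (hψ : ψ ≠ 1) :
    ∃ C', ∀ y, 0 ≤ y → ‖A.lval k β ψ * A.mert ψ y‖ ≤ C' := by
  have hβ := h.pos_β
  have hC := h.nonneg_C
  set w : ℝ → ℝ := fun x => C * (2 * Real.exp (-(1 / 2) * x) + 2 * β * Real.exp (-x)) with hw
  have hwint : IntegrableOn w (Set.Ioi (-β)) :=
    (((exp_neg_integrableOn_Ioi (-β) (by norm_num : (0:ℝ) < 1 / 2)).const_mul 2).add
      ((integrableOn_exp_neg (-β)).const_mul (2 * β))).const_mul C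
  have hw0 : ∀ x, 0 ≤ w x := fun x => by positivity
  have key : ∀ y, 0 ≤ y → ‖A.lval k β ψ * A.mert ψ (y + β)‖ ≤
      C * C * Real.exp β + ∫ x in Set.Ioi (-β), w x := by
    intro y hy
    have e1 : A.lval k β ψ * A.mert ψ (y + β) = (∑ b ∈ A.ball (y + β), coeff b (A.lamS ψ) *
        (Real.exp (-A.len b) * (A.lval k β ψ -
          ∫ u in (-β)..(y - A.len b), (Real.exp (-u) : ℂ) * A.sm (A.chi ψ) k u))) +
        ∫ x in (-β)..y, (Real.exp (-x) : ℂ) * A.sm (A.der (A.chi ψ)) k x := by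
      rw [h.integral_exp_mul_sm_der ψ hy, mert, Finset.mul_sum, ← Finset.sum_add_distrib]
      refine Finset.sum_congr rfl fun b _ => ?_
      rw [coeff_lamS]; push_cast; ring
    rw [e1]
    refine (norm_add_le _ _).trans (add_le_add ?_ ?_)
    · refine (norm_sum_le _ _).trans ((Finset.sum_le_sum fun b hb => ?_).trans
        (show ∑ b ∈ A.ball (y + β), A.lam b * (C * Real.exp (-y)) ≤ _ from ?_))
      · rw [mem_ball] at hb
        rw [coeff_lamS, norm_mul, norm_mul, norm_mul, AddChar.norm_apply, mul_one, Complex.norm_real,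
          Real.norm_of_nonneg (A.lam_nonneg b), Complex.norm_real,
          Real.norm_of_nonneg (Real.exp_pos _).le]
        refine mul_le_mul_of_nonneg_left ?_ (A.lam_nonneg b)
        refine (mul_le_mul_of_nonneg_left (h.norm_lval_sub_le hψ (by linarith))
          (Real.exp_pos _).le).trans (le_of_eq ?_)
        rw [mul_left_comm, ← Real.exp_add]; congr 2; ring
      · rw [← Finset.sum_mul]
        refine (mul_le_mul_of_nonneg_right (h.cheb _) (by positivity)).trans (le_of_eq ?_)
        rw [mul_mul_mul_comm, ← Real.exp_add]; congr 2; ring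
    · rw [intervalIntegral.integral_of_le (by linarith)]
      refine (norm_integral_le_of_norm_le (hwint.mono_set Set.Ioc_subset_Ioi_self)
        ((ae_restrict_mem measurableSet_Ioc).mono fun x hx => ?_)).trans
        (setIntegral_mono_set hwint (ae_of_all _ hw0) Set.Ioc_subset_Ioi_self.eventuallyLE)
      rw [norm_mul, Complex.norm_real, Real.norm_of_nonneg (Real.exp_pos _).le, h.sm_der]
      have i1 : ‖A.sm (A.chi ψ) (fun t => t * k t) x + x * A.sm (A.chi ψ) k x‖ ≤ C + |x| * C := by
        refine (norm_add_le _ _).trans (add_le_add (h.char_mul ψ hψ x) ?_)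
        rw [norm_mul, Complex.norm_real, Real.norm_eq_abs]
        exact mul_le_mul_of_nonneg_left (h.char ψ hψ x) (abs_nonneg x)
      have i2 : 1 + |x| ≤ 2 * Real.exp (x / 2) + 2 * β := by
        have : |x| ≤ x + 2 * β := abs_le.2 ⟨by linarith [hx.1], by linarith [hx.1]⟩
        linarith [Real.add_one_le_exp (x / 2)]
      refine (mul_le_mul_of_nonneg_left i1 (Real.exp_pos _).le).trans ?_
      calc Real.exp (-x) * (C + |x| * C) = C * (Real.exp (-x) * (1 + |x|)) := by ring
        _ ≤ C * (Real.exp (-x) * (2 * Real.exp (x / 2) + 2 * β)) :=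
            mul_le_mul_of_nonneg_left (mul_le_mul_of_nonneg_left i2 (Real.exp_pos _).le) hC
        _ = w x := by
            simp only [hw]
            rw [show -(1 / 2) * x = -x + x / 2 by ring, Real.exp_add]; ring
  have hI : 0 ≤ ∫ x in Set.Ioi (-β), w x := integral_nonneg hw0
  refine ⟨C * C * Real.exp β + (∫ x in Set.Ioi (-β), w x) + ‖A.lval k β ψ‖ * (C * Real.exp β),
    fun y hy => ?_⟩
  rcases le_total β y with hb | hb
  · have := key (y - β) (by linarith)
    rw [sub_add_cancel] at this
    have : 0 ≤ ‖A.lval k β ψ‖ * (C * Real.exp β) := by positivity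
    linarith
  · rw [norm_mul]
    have := mul_le_mul_of_nonneg_left ((norm_mert_le (A := A) ψ hb).trans (h.cheb β))
      (norm_nonneg (A.lval k β ψ))
    have : 0 ≤ C * C * Real.exp β := by positivity
    linarith

end ClassSystem
end

section
open MeasureTheory MvPowerSeries Finset.HasAntidiagonal

namespace ClassSystem
variable {P G : Type} [AddCommGroup G] [Finite G] [DecidableEq P] {A : ClassSystem P G}
  {k : ℝ → ℝ} {β κ C : ℝ}

theorem kconv_eq_zero_of_notMem {k₁ k₂ : ℝ → ℝ} {β₁ β₂ : ℝ} (h₁ : ∀ t, t ∉ Set.Icc 0 β₁ → k₁ t = 0)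
    (h₂ : ∀ t, t ∉ Set.Icc 0 β₂ → k₂ t = 0) (t : ℝ) (ht : t ∉ Set.Icc 0 (β₁ + β₂)) :
    kconv k₁ k₂ t = 0 := by
  have : (fun u => k₁ u * k₂ (t - u)) = fun _ => 0 := by
    funext u
    by_cases hu : u ∈ Set.Icc 0 β₁
    · rw [h₂, mul_zero]
      exact fun hv => ht ⟨by linarith [hv.1, hu.1], by linarith [hv.2, hu.2]⟩
    · rw [h₁ _ hu, zero_mul]
  simp [kconv, this]

theorem kconv_eq_convolution (k₁ k₂ : ℝ → ℝ) :
    kconv k₁ k₂ = convolution k₁ k₂ (ContinuousLinearMap.mul ℝ ℝ) volume := by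
  funext t; simp [kconv, convolution]

theorem hasCompactSupport_of_notMem {k : ℝ → ℝ} {β : ℝ} (h : ∀ t, t ∉ Set.Icc 0 β → k t = 0) :
    HasCompactSupport k :=
  HasCompactSupport.intro isCompact_Icc h

theorem continuous_kconv {k₁ k₂ : ℝ → ℝ} {β₂ : ℝ} (hc₁ : Continuous k₁) (hc₂ : Continuous k₂)
    (h₂ : ∀ t, t ∉ Set.Icc 0 β₂ → k₂ t = 0) : Continuous (kconv k₁ k₂) := by
  rw [kconv_eq_convolution]
  exact (hasCompactSupport_of_notMem h₂).continuous_convolution_right _ hc₁.locallyIntegrable hc₂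

theorem integral_kconv {k₁ k₂ : ℝ → ℝ} {β₁ β₂ : ℝ} (hc₁ : Continuous k₁) (hc₂ : Continuous k₂)
    (h₁ : ∀ t, t ∉ Set.Icc 0 β₁ → k₁ t = 0) (h₂ : ∀ t, t ∉ Set.Icc 0 β₂ → k₂ t = 0) :
    ∫ t, kconv k₁ k₂ t = (∫ t, k₁ t) * ∫ t, k₂ t := by
  rw [kconv_eq_convolution, integral_convolution _
    (hc₁.integrable_of_hasCompactSupport (hasCompactSupport_of_notMem h₁))
    (hc₂.integrable_of_hasCompactSupport (hasCompactSupport_of_notMem h₂))]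
  rfl

theorem kconv_nonneg {k₁ k₂ : ℝ → ℝ} (h₁ : ∀ t, 0 ≤ k₁ t) (h₂ : ∀ t, 0 ≤ k₂ t) (t : ℝ) :
    0 ≤ kconv k₁ k₂ t := integral_nonneg fun _ => mul_nonneg (h₁ _) (h₂ _)

theorem Kernel.sm_chi_inv (h : A.Kernel k β κ C) (ψ : AddChar G ℂ) (x : ℝ) :
    A.sm (A.chi ψ⁻¹) k x = (starRingEnd ℂ) (A.sm (A.chi ψ) k x) := by
  rw [A.sm_eq h.eq_zero _ le_rfl, A.sm_eq h.eq_zero _ le_rfl, map_sum]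
  refine Finset.sum_congr rfl fun a _ => ?_
  rw [map_mul, Complex.conj_ofReal, coeff_chi, coeff_chi, AddChar.inv_apply',
    AddChar.inv_apply_eq_conj]

theorem Kernel.lval_inv (h : A.Kernel k β κ C) (ψ : AddChar G ℂ) :
    A.lval k β ψ⁻¹ = (starRingEnd ℂ) (A.lval k β ψ) := by
  rw [lval, lval, ← integral_conj]
  simp_rw [h.sm_chi_inv, map_mul, Complex.conj_ofReal]

/-- If the `L`-value of `ψ` vanishes, then the smoothed sums of `ψ * 1` grow at most linearly. -/
theorem Kernel.norm_sm_chi_mul_one_le (h : A.Kernel k β κ C) {ψ : AddChar G ℂ} (hψ : ψ ≠ 1)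
    (hL : A.lval k β ψ = 0) {y : ℝ} (hy : -(2 * β) ≤ y) :
    ‖A.sm (A.chi ψ * A.chi 1) (kconv k k) y‖ ≤ κ * C + C * C * (y + 2 * β) := by
  have hβ := h.pos_β
  have hC := h.nonneg_C
  have hκ := h.pos_κ
  rw [← A.integral_sm_mul_sm h.cont h.cont h.supp h.supp hβ.le hβ.le]
  have c1 := A.continuous_sm h.cont h.eq_zero (A.chi ψ)
  have c2 := A.continuous_sm h.cont h.eq_zero (A.chi 1)
  have e1 : ∫ u, A.sm (A.chi ψ) k u * A.sm (A.chi 1) k (y - u) =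
      ∫ u in (-β)..(y + β), A.sm (A.chi ψ) k u * A.sm (A.chi 1) k (y - u) := by
    rw [intervalIntegral.integral_of_le (by linarith), ← integral_Icc_eq_integral_Ioc,
      setIntegral_eq_integral_of_forall_compl_eq_zero]
    intro u hu
    rw [Set.mem_Icc, not_and_or, not_le, not_le] at hu
    rcases hu with hu | hu
    · rw [A.sm_eq_zero h.eq_zero _ hu, zero_mul]
    · rw [A.sm_eq_zero h.eq_zero (A.chi 1) (by linarith), mul_zero]
  have e2 : ∀ u, A.sm (A.chi ψ) k u * A.sm (A.chi 1) k (y - u) =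
      ((κ * Real.exp y : ℝ) : ℂ) * ((Real.exp (-u) : ℂ) * A.sm (A.chi ψ) k u) +
      A.sm (A.chi ψ) k u * (A.sm (A.chi 1) k (y - u) - (κ * Real.exp (y - u) : ℝ)) := by
    intro u
    rw [sub_eq_add_neg y, Real.exp_add]; push_cast; ring
  rw [e1, intervalIntegral.integral_congr fun u _ => e2 u, intervalIntegral.integral_add
    (Continuous.intervalIntegrable (by fun_prop) _ _) (Continuous.intervalIntegrable (by fun_prop) _ _)]
  refine (norm_add_le _ _).trans (add_le_add ?_ ?_)
  · have := h.norm_lval_sub_le hψ (show -β ≤ y + β by linarith)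
    rw [hL, zero_sub, norm_neg] at this
    rw [intervalIntegral.integral_const_mul, norm_mul, Complex.norm_real,
      Real.norm_of_nonneg (by positivity)]
    refine (mul_le_mul_of_nonneg_left this (by positivity)).trans ?_
    rw [mul_mul_mul_comm, ← Real.exp_add]
    exact mul_le_of_le_one_right (by positivity) (Real.exp_le_one_iff.2 (by linarith))
  · refine (intervalIntegral.norm_integral_le_of_norm_le_const (C := C * C) fun u _ => ?_).trans
      (le_of_eq ?_)
    · rw [norm_mul]; exact mul_le_mul (h.char ψ hψ u) (h.triv _) (norm_nonneg _) hC
    · rw [abs_of_nonneg (by linarith)]; ring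

theorem Kernel.norm_sm_quad_le (h : A.Kernel k β κ C) {ψ : AddChar G ℂ} (hψ : ψ ≠ 1)
    (hL : A.lval k β ψ = 0) {y Y : ℝ} (hY : 0 ≤ Y) (hy : y ≤ Y) :
    ‖A.sm (A.quad ψ) (kconv (kconv k k) (kconv k k)) y‖ ≤
      (κ * C + C * C * (Y + 4 * β)) ^ 2 * (Y + 4 * β) := by
  have hβ := h.pos_β
  have hC := h.nonneg_C
  have hκ := h.pos_κ
  have ck := continuous_kconv h.cont h.cont h.supp
  have sk := kconv_eq_zero_of_notMem h.supp h.supp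
  have sk' : ∀ t, β + β < t → kconv k k t = 0 := kconv_eq_zero h.eq_zero h.eq_zero
  have hψ' : ψ⁻¹ ≠ 1 := inv_ne_one.2 hψ
  have hL' : A.lval k β ψ⁻¹ = 0 := by rw [h.lval_inv, hL, map_zero]
  rw [quad, ← A.integral_sm_mul_sm ck ck sk sk (by linarith) (by linarith)]
  have e1 : ∀ u, u ∉ Set.Icc (-(2 * β)) (y + 2 * β) →
      A.sm (A.chi ψ * A.chi 1) (kconv k k) u * A.sm (A.chi ψ⁻¹ * A.chi 1) (kconv k k) (y - u) = 0 := by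
    intro u hu
    rw [Set.mem_Icc, not_and_or, not_le, not_le] at hu
    rcases hu with hu | hu
    · rw [A.sm_eq_zero sk' _ (by linarith), zero_mul]
    · rw [A.sm_eq_zero sk' (A.chi ψ⁻¹ * A.chi 1) (by linarith), mul_zero]
  rw [← setIntegral_eq_integral_of_forall_compl_eq_zero e1]
  rcases lt_or_ge y (-(4 * β)) with h4 | h4
  · rw [Set.Icc_eq_empty (by linarith)]; simp; positivity
  refine (norm_setIntegral_le_of_norm_le_const (C := (κ * C + C * C * (Y + 4 * β)) ^ 2)
    (by simp) fun u hu => ?_).trans ?_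
  · rw [norm_mul, pow_two]
    have m : ∀ v, v ≤ Y + 2 * β → κ * C + C * C * (v + 2 * β) ≤ κ * C + C * C * (Y + 4 * β) := by
      intro v hv
      have : C * C * (v + 2 * β) ≤ C * C * (Y + 4 * β) :=
        mul_le_mul_of_nonneg_left (by linarith) (by positivity)
      linarith
    exact mul_le_mul ((h.norm_sm_chi_mul_one_le hψ hL hu.1).trans (m _ (by linarith [hu.2])))
      ((h.norm_sm_chi_mul_one_le hψ' hL' (by linarith [hu.2])).trans (m _ (by linarith [hu.1])))
      (norm_nonneg _) (by positivity)
  · refine mul_le_mul_of_nonneg_left ?_ (by positivity)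
    rw [Measure.real, Real.volume_Icc, ENNReal.toReal_ofReal (by linarith)]
    linarith

theorem Kernel.sum_quad_le (h : A.Kernel k β κ C) {ψ : AddChar G ℂ} (hψ : ψ ≠ 1)
    (hL : A.lval k β ψ = 0) {Y : ℝ} (hY : 0 ≤ Y) :
    ∑ a ∈ A.ball Y with 4 * β ≤ A.len a, (coeff a (A.quad ψ)).re ≤
      Y * ((κ * C + C * C * (Y + 4 * β)) ^ 2 * (Y + 4 * β)) := by
  have hβ := h.pos_β
  have ck := continuous_kconv h.cont h.cont h.supp
  have sk := kconv_eq_zero_of_notMem h.supp h.supp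
  set K := kconv (kconv k k) (kconv k k) with hK
  have cK : Continuous K := continuous_kconv ck ck sk
  have sK : ∀ t, t ∉ Set.Icc 0 (β + β + (β + β)) → K t = 0 := kconv_eq_zero_of_notMem sk sk
  have iK : ∫ t, K t = 1 := by
    rw [integral_kconv ck ck sk sk, integral_kconv h.cont h.cont h.supp h.supp, h.integral]; norm_num
  have nK : ∀ t, 0 ≤ K t := kconv_nonneg (kconv_nonneg h.nonneg h.nonneg)
    (kconv_nonneg h.nonneg h.nonneg)
  have sK' : ∀ t, 4 * β < t → K t = 0 := fun t ht => sK t fun hh => by linarith [hh.2]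
  have e1 : ∀ u ∈ Set.uIcc 0 Y, (A.sm (A.quad ψ) K u).re =
      ∑ a ∈ A.ball (Y + 4 * β), (coeff a (A.quad ψ)).re * K (A.len a - u) := by
    intro u hu
    rw [Set.uIcc_of_le hY] at hu
    rw [A.sm_eq sK' _ (show u + 4 * β ≤ Y + 4 * β by linarith [hu.2]), Complex.re_sum]
    exact Finset.sum_congr rfl fun a _ => Complex.re_mul_ofReal _ _
  have e2 : ∫ u in (0)..Y, (A.sm (A.quad ψ) K u).re =
      ∑ a ∈ A.ball (Y + 4 * β), (coeff a (A.quad ψ)).re * ∫ u in (0)..Y, K (A.len a - u) := by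
    rw [intervalIntegral.integral_congr e1, intervalIntegral.integral_finsetSum]
    · exact Finset.sum_congr rfl fun a _ => intervalIntegral.integral_const_mul _ _
    · exact fun a _ => Continuous.intervalIntegrable (by fun_prop) _ _
  have e3 : ∀ a, 4 * β ≤ A.len a → A.len a ≤ Y → ∫ u in (0)..Y, K (A.len a - u) = 1 := by
    intro a ha ha'
    rw [intervalIntegral.integral_comp_sub_left, intervalIntegral.integral_of_le (by linarith),
      ← integral_Icc_eq_integral_Ioc, setIntegral_eq_integral_of_forall_compl_eq_zero, iK]
    intro t ht
    exact sK t fun hh => ht ⟨by linarith [hh.1], by linarith [hh.2]⟩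
  have e4 : ∑ a ∈ A.ball Y with 4 * β ≤ A.len a, (coeff a (A.quad ψ)).re ≤
      ∫ u in (0)..Y, (A.sm (A.quad ψ) K u).re := by
    rw [e2]
    have hsub : (A.ball Y).filter (fun a => 4 * β ≤ A.len a) ⊆ A.ball (Y + 4 * β) :=
      (Finset.filter_subset _ _).trans (A.ball_mono (by linarith))
    refine le_trans (le_of_eq ?_) (Finset.sum_le_sum_of_subset_of_nonneg hsub fun a _ _ =>
        mul_nonneg (A.re_coeff_quad_nonneg ψ a)
          (intervalIntegral.integral_nonneg hY fun _ _ => nK _))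
    refine Finset.sum_congr rfl fun a ha => ?_
    rw [Finset.mem_filter, mem_ball] at ha
    rw [e3 a ha.2 ha.1, mul_one]
  refine e4.trans ((le_abs_self _).trans ?_)
  rw [← Real.norm_eq_abs]
  refine (intervalIntegral.norm_integral_le_of_norm_le_const
    (C := (κ * C + C * C * (Y + 4 * β)) ^ 2 * (Y + 4 * β)) fun u hu => ?_).trans (le_of_eq ?_)
  · rw [Set.uIoc_of_le hY] at hu
    rw [Real.norm_eq_abs]
    exact (Complex.abs_re_le_norm _).trans (h.norm_sm_quad_le hψ hL hY hu.2)
  · rw [sub_zero, abs_of_nonneg hY, mul_comm]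

end ClassSystem
end

section
open MeasureTheory MvPowerSeries Finset.HasAntidiagonal

namespace ClassSystem
variable {P G : Type} [AddCommGroup G] [Finite G] [DecidableEq P] {A : ClassSystem P G}
  {k : ℝ → ℝ} {β κ C : ℝ}

/-- The sum of the von Mangoldt function over a window, from its logarithmic mean. -/
theorem sum_lam_window_ge (A : ClassSystem P G) (q : (P →₀ ℕ) → Prop) [DecidablePred q] {m C' : ℝ}
    (h : ∀ y, 0 ≤ y → |(∑ b ∈ A.ball y with q b, A.lam b * Real.exp (-A.len b)) - m * y| ≤ C')
    {a z : ℝ} (ha : 0 ≤ a) (hz : a ≤ z) :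
    Real.exp (z - a) * (m * a - 2 * C') ≤ ∑ b ∈ A.ball z with q b ∧ z - a < A.len b, A.lam b := by
  have h1 := abs_le.1 (h z (by linarith))
  have h2 := abs_le.1 (h (z - a) (by linarith))
  have e1 : ∑ b ∈ A.ball z with q b, A.lam b * Real.exp (-A.len b) =
      (∑ b ∈ A.ball (z - a) with q b, A.lam b * Real.exp (-A.len b)) +
      ∑ b ∈ A.ball z with q b ∧ z - a < A.len b, A.lam b * Real.exp (-A.len b) := by
    rw [← Finset.sum_filter_add_sum_filter_not _ (fun b => A.len b ≤ z - a)]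
    congr 1
    · refine Finset.sum_congr ?_ fun _ _ => rfl
      ext b
      simp only [Finset.mem_filter, mem_ball]
      constructor
      · rintro ⟨⟨_, hq⟩, hb⟩; exact ⟨hb, hq⟩
      · rintro ⟨hb, hq⟩; exact ⟨⟨by linarith, hq⟩, hb⟩
    · rw [Finset.filter_filter]
      simp only [not_le]
  have e2 : ∑ b ∈ A.ball z with q b ∧ z - a < A.len b, A.lam b * Real.exp (-A.len b) ≤
      ∑ b ∈ A.ball z with q b ∧ z - a < A.len b, A.lam b * Real.exp (-(z - a)) := by
    refine Finset.sum_le_sum fun b hb => mul_le_mul_of_nonneg_left ?_ (A.lam_nonneg b)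
    exact Real.exp_le_exp.2 (by linarith [(Finset.mem_filter.1 hb).2.2])
  rw [← Finset.sum_mul] at e2
  have e3 : m * a - 2 * C' ≤ (∑ b ∈ A.ball z with q b ∧ z - a < A.len b, A.lam b) *
      Real.exp (-(z - a)) := by linarith
  calc Real.exp (z - a) * (m * a - 2 * C') ≤ Real.exp (z - a) *
        ((∑ b ∈ A.ball z with q b ∧ z - a < A.len b, A.lam b) * Real.exp (-(z - a))) :=
        mul_le_mul_of_nonneg_left e3 (Real.exp_pos _).le
    _ = _ := by
        rw [mul_left_comm, ← Real.exp_add, add_neg_cancel, Real.exp_zero, mul_one]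

/-- Exponentials outgrow the polynomial bound that a vanishing `L`-value would give. -/
theorem not_forall_exp_le {n κ C β B : ℝ} (hn : 1 ≤ n) (hκ : 0 ≤ κ) (hC : 0 ≤ C) (hβ : 0 ≤ β)
    (hB : 0 ≤ B) (key : ∀ z : ℝ, 2 * B + 1 + 4 * β ≤ z → 4 * Real.exp (z - (2 * B + 1)) ≤
      (n * z) * ((n * z) * ((κ * C + C * C * (n * z + 4 * β)) ^ 2 * (n * z + 4 * β)))) : False := by
  obtain ⟨Q, hQ⟩ : ∃ Q : ℝ, Q = n ^ 2 * ((κ * C + C * C * (n + 4 * β)) ^ 2 * (n + 4 * β)) := ⟨_, rfl⟩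
  have hQ0 : 0 ≤ Q := by rw [hQ]; positivity
  have he := Real.exp_pos (2 * B + 1)
  obtain ⟨z, hz⟩ : ∃ z : ℝ, z = 2 * B + 1 + 4 * β + 720 * Real.exp (2 * B + 1) * Q := ⟨_, rfl⟩
  have h0 : 0 ≤ 720 * Real.exp (2 * B + 1) * Q := by positivity
  have hz1 : 1 ≤ z := by linarith
  have k1 := key z (by linarith)
  have i1 : n * z + 4 * β ≤ (n + 4 * β) * z := by nlinarith
  have i2 : κ * C + C * C * (n * z + 4 * β) ≤ (κ * C + C * C * (n + 4 * β)) * z := by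
    have : C * C * (n * z + 4 * β) ≤ C * C * ((n + 4 * β) * z) :=
      mul_le_mul_of_nonneg_left i1 (by positivity)
    have : κ * C * 1 ≤ κ * C * z := mul_le_mul_of_nonneg_left hz1 (by positivity)
    linarith
  have k2 : (n * z) * ((n * z) * ((κ * C + C * C * (n * z + 4 * β)) ^ 2 * (n * z + 4 * β))) ≤
      Q * z ^ 5 := by
    calc _ ≤ (n * z) * ((n * z) * (((κ * C + C * C * (n + 4 * β)) * z) ^ 2 * ((n + 4 * β) * z))) := by
          gcongr
      _ = _ := by rw [hQ]; ring
  have k3 := Real.pow_div_factorial_le_exp z (by linarith) 6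
  rw [Real.exp_sub] at k1
  have k4 : 4 * (Real.exp z / Real.exp (2 * B + 1)) ≤ Q * z ^ 5 := k1.trans k2
  rw [← mul_div_assoc, div_le_iff₀ he] at k4
  have k5 : z ^ 6 / 720 ≤ Real.exp z := by simpa [Nat.factorial] using k3
  have z5 : 0 < z ^ 5 := by positivity
  have k6 : z ^ 5 * z ≤ z ^ 5 * (720 * Real.exp (2 * B + 1) * Q) := by
    have : 0 ≤ Q * z ^ 5 * Real.exp (2 * B + 1) := by positivity
    have e1 : z ^ 5 * z = z ^ 6 := by ring
    have e2 : z ^ 5 * (720 * Real.exp (2 * B + 1) * Q) = 720 * (Q * z ^ 5 * Real.exp (2 * B + 1)) := by ring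
    rw [e1, e2]; linarith
  have := le_of_mul_le_mul_left k6 z5
  linarith

theorem Kernel.lval_ne_zero (h : A.Kernel k β κ C) {ψ : AddChar G ℂ} (hψ : ψ ≠ 1) :
    A.lval k β ψ ≠ 0 := by
  intro hL
  have hβ := h.pos_β
  have hC := h.nonneg_C
  have hκ := h.pos_κ
  obtain ⟨C', hC'⟩ := h.mert_one
  have hC'0 : 0 ≤ C' := (norm_nonneg _).trans (hC' 0 le_rfl)
  set n : ℕ := Nat.card G
  have hn : 0 < n := Nat.card_pos
  have hn1 : (1 : ℝ) ≤ n := by exact_mod_cast hn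
  have hm : ∀ y, 0 ≤ y →
      |(∑ b ∈ A.ball y with True, A.lam b * Real.exp (-A.len b)) - 1 * y| ≤ C' := by
    intro y hy
    have := hC' y hy
    have e : A.mert 1 y - y = ((∑ b ∈ A.ball y with True, A.lam b * Real.exp (-A.len b) - 1 * y : ℝ) : ℂ) := by
      simp [mert]
    rwa [e, Complex.norm_real] at this
  have key : ∀ z : ℝ, 2 * C' + 1 + 4 * β ≤ z → 4 * Real.exp (z - (2 * C' + 1)) ≤
      (n * z) * ((n * z) * ((κ * C + C * C * (n * z + 4 * β)) ^ 2 * (n * z + 4 * β))) := by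
    intro z hz
    have hz0 : 0 < z := by linarith
    have hY : 0 < n * z := by positivity
    have hz1 : z ≤ n * z := le_mul_of_one_le_left hz0.le hn1
    refine le_trans ?_ (mul_le_mul_of_nonneg_left (h.sum_quad_le hψ hL hY.le) hY.le)
    have w := A.sum_lam_window_ge (fun _ => True) hm (show (0:ℝ) ≤ 2 * C' + 1 by linarith)
      (show 2 * C' + 1 ≤ z by linarith)
    rw [show 1 * (2 * C' + 1) - 2 * C' = 1 by ring, mul_one] at w
    have w2 : 4 * ∑ b ∈ A.ball z with True ∧ z - (2 * C' + 1) < A.len b, A.lam b ≤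
        n * z * ∑ b ∈ A.ball z with True ∧ z - (2 * C' + 1) < A.len b, (coeff (n • b) (A.quad ψ)).re := by
      rw [Finset.mul_sum, Finset.mul_sum]
      refine Finset.sum_le_sum fun b hb => ?_
      have hb1 := A.mem_ball.1 (Finset.mem_filter.1 hb).1
      have hψb : ψ (A.cl (n • b)) = 1 := by
        rw [map_nsmul, card_nsmul_eq_zero', AddChar.map_zero_eq_one]
      have := A.lam_le_coeff_quad ψ (n • b) hψb
      rw [A.lam_nsmul hn.ne', map_nsmul, nsmul_eq_mul] at this
      exact this.trans (mul_le_mul_of_nonneg_right (mul_le_mul_of_nonneg_left hb1 (by positivity))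
        (A.re_coeff_quad_nonneg ψ _))
    refine (mul_le_mul_of_nonneg_left w (by norm_num)).trans (w2.trans
      (mul_le_mul_of_nonneg_left ?_ hY.le))
    have inj : Function.Injective fun b : P →₀ ℕ => n • b := fun b b' hbb => by
      ext p
      exact Nat.eq_of_mul_eq_mul_left hn (by simpa using DFunLike.congr_fun hbb p)
    rw [← Finset.sum_image (f := fun a => (coeff a (A.quad ψ)).re) (fun b _ b' _ hbb => inj hbb)]
    refine Finset.sum_le_sum_of_subset_of_nonneg (fun a ha => ?_) fun a _ _ =>
      A.re_coeff_quad_nonneg ψ a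
    obtain ⟨b, hb, rfl⟩ := Finset.mem_image.1 ha
    rw [Finset.mem_filter, mem_ball] at hb ⊢
    rw [map_nsmul, nsmul_eq_mul]
    refine ⟨mul_le_mul_of_nonneg_left hb.1 (by positivity), ?_⟩
    have := le_mul_of_one_le_left (A.len_nonneg b) hn1
    linarith [hb.2.2]
  exact not_forall_exp_le hn1 hκ.le hC hβ.le hC'0 key

theorem Kernel.exists_norm_mert_le (h : A.Kernel k β κ C) {ψ : AddChar G ℂ} (hψ : ψ ≠ 1) :
    ∃ C', ∀ y, 0 ≤ y → ‖A.mert ψ y‖ ≤ C' := by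
  obtain ⟨C', hC'⟩ := h.lval_mul_mert hψ
  have hL : 0 < ‖A.lval k β ψ‖ := norm_pos_iff.2 (h.lval_ne_zero hψ)
  refine ⟨C' / ‖A.lval k β ψ‖, fun y hy => ?_⟩
  rw [le_div_iff₀ hL, mul_comm, ← norm_mul]
  exact hC' y hy

/-- Mertens' estimate in a class. -/
theorem Kernel.mert_class (h : A.Kernel k β κ C) [DecidableEq G] :
    ∃ C', ∀ g : G, ∀ y, 0 ≤ y →
      |(∑ b ∈ A.ball y with A.cl b = g, A.lam b * Real.exp (-A.len b)) - (Nat.card G : ℝ)⁻¹ * y| ≤ C' := by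
  classical
  cases nonempty_fintype G
  have hc : 0 < Nat.card G := Nat.card_pos
  have : ∀ ψ : AddChar G ℂ, ∃ C', ∀ y : ℝ, 0 ≤ y → ‖A.mert ψ y - if ψ = 1 then (y : ℂ) else 0‖ ≤ C' := by
    intro ψ
    by_cases hψ : ψ = 1
    · subst hψ; simpa using h.mert_one
    · simpa [hψ] using h.exists_norm_mert_le hψ
  choose C' hC' using this
  refine ⟨(Nat.card G : ℝ)⁻¹ * ∑ ψ, C' ψ, fun g y hy => ?_⟩
  have e1 : ((((∑ b ∈ A.ball y with A.cl b = g, A.lam b * Real.exp (-A.len b)) -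
      (Nat.card G : ℝ)⁻¹ * y : ℝ)) : ℂ) = (Nat.card G : ℂ)⁻¹ *
        ∑ ψ : AddChar G ℂ, ψ (-g) * (A.mert ψ y - if ψ = 1 then (y : ℂ) else 0) := by
    have e2 : ∑ ψ : AddChar G ℂ, ψ (-g) * (A.mert ψ y - if ψ = 1 then (y : ℂ) else 0) =
        (∑ b ∈ A.ball y, ((A.lam b * Real.exp (-A.len b) : ℝ) : ℂ) *
          ∑ ψ : AddChar G ℂ, ψ (A.cl b - g)) - y := by
      simp only [mul_sub, Finset.sum_sub_distrib, mul_ite, mul_zero, Finset.sum_ite_eq',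
        Finset.mem_univ, if_true, AddChar.one_apply, one_mul]
      congr 1
      simp only [mert, Finset.mul_sum]
      rw [Finset.sum_comm]
      refine Finset.sum_congr rfl fun b _ => Finset.sum_congr rfl fun ψ _ => ?_
      rw [sub_eq_add_neg, AddChar.map_add_eq_mul]; ring
    rw [e2]
    simp only [AddChar.sum_apply_eq_ite, sub_eq_zero, mul_ite, mul_zero, ← Finset.sum_filter]
    rw [← Finset.sum_mul, mul_sub, ← Nat.card_eq_fintype_card]
    have : (Nat.card G : ℂ) ≠ 0 := by exact_mod_cast hc.ne'
    push_cast
    field_simp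
  rw [← Real.norm_eq_abs, ← Complex.norm_real, e1, norm_mul, norm_inv, Complex.norm_natCast]
  refine mul_le_mul_of_nonneg_left ((norm_sum_le _ _).trans (Finset.sum_le_sum fun ψ _ => ?_))
    (by positivity)
  rw [norm_mul, AddChar.norm_apply, one_mul]
  exact hC' ψ y hy

end ClassSystem
end

section
open MeasureTheory MvPowerSeries Finset.HasAntidiagonal

namespace ClassSystem
variable {P G : Type} [AddCommGroup G] [Finite G] [DecidableEq P] {A : ClassSystem P G}
  {k : ℝ → ℝ} {β κ C : ℝ}

/-- Smoothed class counts control smoothed character sums. -/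
theorem norm_sm_chi_sub_le [DecidableEq G] (hk : ∀ t, β < t → k t = 0)
    (h : ∀ g x, |(∑ a ∈ A.ball (x + β) with A.cl a = g, k (A.len a - x)) - κ * Real.exp x| ≤ C)
    (ψ : AddChar G ℂ) [Decidable (ψ = 1)] (x : ℝ) :
    ‖A.sm (A.chi ψ) k x - if ψ = 1 then ((Nat.card G * κ * Real.exp x : ℝ) : ℂ) else 0‖ ≤
      Nat.card G * C := by
  cases nonempty_fintype G
  have e1 : A.sm (A.chi ψ) k x =
      ∑ g, ψ g * ((∑ a ∈ A.ball (x + β) with A.cl a = g, k (A.len a - x) : ℝ) : ℂ) := by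
    rw [A.sm_eq hk _ le_rfl, ← Finset.sum_fiberwise _ A.cl]
    refine Finset.sum_congr rfl fun g _ => ?_
    rw [Complex.ofReal_sum, Finset.mul_sum]
    refine Finset.sum_congr rfl fun a ha => ?_
    rw [coeff_chi, (Finset.mem_filter.1 ha).2]
  have e2 : (if ψ = 1 then ((Nat.card G * κ * Real.exp x : ℝ) : ℂ) else 0) =
      ∑ g, ψ g * ((κ * Real.exp x : ℝ) : ℂ) := by
    rw [← Finset.sum_mul, AddChar.sum_eq_ite, Nat.card_eq_fintype_card]
    have : (ψ = 0) ↔ (ψ = 1) := Iff.rfl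
    simp only [this]
    split_ifs <;> push_cast <;> ring
  rw [e1, e2, ← Finset.sum_sub_distrib]
  refine (norm_sum_le _ _).trans ?_
  rw [Nat.card_eq_fintype_card, ← nsmul_eq_mul, ← Finset.card_univ]
  refine Finset.sum_le_card_nsmul _ _ _ fun g _ => ?_
  rw [← mul_sub, norm_mul, AddChar.norm_apply, one_mul, ← Complex.ofReal_sub, Complex.norm_real]
  exact h g x

theorem exists_kernel [DecidableEq G] {κ' C₁ C₂ C₃ : ℝ} (hc : Continuous k) (h0 : ∀ t, 0 ≤ k t)
    (hs : ∀ t, t ∉ Set.Icc 0 β → k t = 0) (hi : ∫ t, k t = 1) (hβ : 0 < β) (hκ : 0 < κ)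
    (h1 : ∀ g x, |(∑ a ∈ A.ball (x + β) with A.cl a = g, k (A.len a - x)) - κ * Real.exp x| ≤ C₁)
    (h2 : ∀ g x, |(∑ a ∈ A.ball (x + β) with A.cl a = g, (A.len a - x) * k (A.len a - x)) -
      κ' * Real.exp x| ≤ C₂)
    (h3 : ∀ y, ∑ a ∈ A.ball y, A.lam a ≤ C₃ * Real.exp y) :
    ∃ κ C, A.Kernel k β κ C := by
  classical
  have hk : ∀ t, β < t → k t = 0 := fun t ht => hs t fun hh => absurd hh.2 (not_le.2 ht)
  have hk' : ∀ t, β < t → t * k t = 0 := fun t ht => by rw [hk t ht, mul_zero]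
  have hn : (0:ℝ) < Nat.card G := by exact_mod_cast Nat.card_pos
  have hC1 : 0 ≤ C₁ := (abs_nonneg _).trans (h1 0 0)
  have hC2 : 0 ≤ C₂ := (abs_nonneg _).trans (h2 0 0)
  have hC3 : 0 ≤ C₃ := by
    have := (Finset.sum_nonneg fun a _ => A.lam_nonneg a).trans (h3 0)
    simpa using this
  have p1 : 0 ≤ Nat.card G * C₁ := by positivity
  have p2 : 0 ≤ Nat.card G * C₂ := by positivity
  refine ⟨Nat.card G * κ, Nat.card G * C₁ + Nat.card G * C₂ + C₃, hc, h0, hs, hi, hβ, by positivity,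
    by positivity, fun x => ?_, fun ψ hψ x => ?_, fun ψ hψ x => ?_, fun y => ?_⟩
  · have := norm_sm_chi_sub_le hk h1 1 x
    rw [if_pos rfl] at this
    linarith
  · have := norm_sm_chi_sub_le hk h1 ψ x
    rw [if_neg hψ, sub_zero] at this
    linarith
  · have := norm_sm_chi_sub_le (k := fun t => t * k t) hk' h2 ψ x
    rw [if_neg hψ, sub_zero] at this
    linarith
  · refine (h3 y).trans (mul_le_mul_of_nonneg_right (by linarith) (Real.exp_pos _).le)

/-- Chebyshev's lower bound in a class. -/
theorem Kernel.exists_le_sum_lam (h : A.Kernel k β κ C) [DecidableEq G] :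
    ∃ c > 0, ∃ Y, ∀ y, Y ≤ y → ∀ g, c * Real.exp y ≤ ∑ a ∈ A.ball y with A.cl a = g, A.lam a := by
  obtain ⟨C', hC'⟩ := h.mert_class
  have hn : (0:ℝ) < Nat.card G := by exact_mod_cast Nat.card_pos
  have hC0 : 0 ≤ C' := (abs_nonneg _).trans (hC' 0 0 le_rfl)
  refine ⟨Real.exp (-(Nat.card G * (2 * C' + 1))), Real.exp_pos _, Nat.card G * (2 * C' + 1),
    fun y hy g => ?_⟩
  have := A.sum_lam_window_ge (fun a => A.cl a = g) (hC' g)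
    (show 0 ≤ Nat.card G * (2 * C' + 1) by positivity) hy
  rw [inv_mul_cancel_left₀ hn.ne', add_sub_cancel_left, mul_one, sub_eq_add_neg, Real.exp_add,
    mul_comm] at this
  refine this.trans (Finset.sum_le_sum_of_subset_of_nonneg (fun a ha => ?_) fun a _ _ => A.lam_nonneg a)
  rw [Finset.mem_filter] at ha ⊢
  exact ⟨ha.1, ha.2.1⟩

/-- The harmonic sum over elements of bounded norm grows at least linearly. -/
theorem Kernel.exists_le_sum_exp_neg_len (h : A.Kernel k β κ C) :
    ∃ c > 0, ∃ C', ∀ y, 0 ≤ y → c * y - C' ≤ ∑ a ∈ A.ball y, Real.exp (-A.len a) := by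
  have hβ := h.pos_β
  have hC := h.nonneg_C
  have main : ∀ y, 0 ≤ y → κ * y - C ≤
      ∑ a ∈ A.ball (y + β), Real.exp (β - A.len a) := by
    intro y hy
    have e1 : ∀ x ∈ Set.Icc 0 y, κ - C * Real.exp (-x) ≤
        ∑ a ∈ A.ball (y + β), Real.exp (-x) * k (A.len a - x) := by
      intro x hx
      have := h.triv x
      rw [A.sm_eq h.eq_zero _ (show x + β ≤ y + β by linarith [hx.2])] at this
      have e : (∑ a ∈ A.ball (y + β), coeff a (A.chi 1) * (k (A.len a - x) : ℂ)) -
          ((κ * Real.exp x : ℝ) : ℂ) =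
          ((∑ a ∈ A.ball (y + β), k (A.len a - x) - κ * Real.exp x : ℝ) : ℂ) := by
        simp [coeff_chi]
      rw [e, Complex.norm_real] at this
      have := (abs_le.1 this).1
      rw [← Finset.mul_sum]
      have h2 := mul_le_mul_of_nonneg_left (show κ * Real.exp x - C ≤
        ∑ a ∈ A.ball (y + β), k (A.len a - x) by linarith) (Real.exp_pos (-x)).le
      have h3 : Real.exp (-x) * Real.exp x = 1 := by rw [← Real.exp_add]; simp
      calc _ = Real.exp (-x) * (κ * Real.exp x - C) := by linear_combination -κ * h3
        _ ≤ _ := h2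
    have hck := h.cont
    have e2 : ∫ x in (0)..y, (κ - C * Real.exp (-x)) ≤
        ∫ x in (0)..y, ∑ a ∈ A.ball (y + β), Real.exp (-x) * k (A.len a - x) :=
      intervalIntegral.integral_mono_on hy (Continuous.intervalIntegrable (by fun_prop) _ _)
        (Continuous.intervalIntegrable (by fun_prop) _ _) e1
    have e3 : ∫ x in (0)..y, (κ - C * Real.exp (-x)) ≥ κ * y - C := by
      rw [intervalIntegral.integral_sub (Continuous.intervalIntegrable (by fun_prop) _ _)
        (Continuous.intervalIntegrable (by fun_prop) _ _), intervalIntegral.integral_const,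
        intervalIntegral.integral_const_mul, intervalIntegral.integral_comp_neg (fun x => Real.exp x),
        integral_exp]
      simp only [neg_zero, Real.exp_zero, sub_zero, smul_eq_mul]
      nlinarith [mul_nonneg hC (Real.exp_pos (-y)).le]
    rw [intervalIntegral.integral_finsetSum fun a _ =>
      Continuous.intervalIntegrable (by fun_prop) _ _] at e2
    refine e3.le.trans (e2.trans (Finset.sum_le_sum fun a _ => ?_))
    have e4 : ∀ x ∈ Set.Icc 0 y, Real.exp (-x) * k (A.len a - x) ≤
        Real.exp (β - A.len a) * k (A.len a - x) := by
      intro x _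
      by_cases hx : β < A.len a - x
      · rw [h.eq_zero _ hx]; simp
      · exact mul_le_mul_of_nonneg_right (Real.exp_le_exp.2 (by linarith)) (h.nonneg _)
    refine (intervalIntegral.integral_mono_on hy (Continuous.intervalIntegrable (by fun_prop) _ _)
        (Continuous.intervalIntegrable (by fun_prop) _ _) e4).trans ?_
    rw [intervalIntegral.integral_const_mul, intervalIntegral.integral_comp_sub_left]
    refine mul_le_of_le_one_right (Real.exp_pos _).le ?_
    rw [intervalIntegral.integral_of_le (by linarith), ← h.integral]
    refine setIntegral_le_integral (hck.integrable_of_hasCompactSupport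
      (HasCompactSupport.intro isCompact_Icc fun t ht => h.supp t ht)) ?_
    exact Filter.Eventually.of_forall h.nonneg
  refine ⟨Real.exp (-β) * κ, mul_pos (Real.exp_pos _) h.pos_κ, Real.exp (-β) * (κ * β + C),
    fun y hy => ?_⟩
  rcases le_or_gt β y with hy' | hy'
  · have := mul_le_mul_of_nonneg_left (main (y - β) (by linarith)) (Real.exp_pos (-β)).le
    rw [sub_add_cancel, Finset.mul_sum] at this
    simp only [← Real.exp_add, neg_add_cancel_left, sub_eq_add_neg] at this
    refine le_trans (le_of_eq ?_) this
    ring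
  · have h2 : 0 ≤ ∑ a ∈ A.ball y, Real.exp (-A.len a) := Finset.sum_nonneg fun _ _ => (Real.exp_pos _).le
    refine le_trans ?_ h2
    have : κ * y ≤ κ * β := mul_le_mul_of_nonneg_left hy'.le h.pos_κ.le
    nlinarith [mul_nonneg (Real.exp_pos (-β)).le (show 0 ≤ κ * β + C - κ * y by linarith)]

end ClassSystem
end

section
open MeasureTheory

/-- Riemann sums over a shifted lattice: a second-order error term. -/
theorem abs_sum_sub_integral_le {g : ℝ → ℝ} {B K : ℝ} (hc : Continuous g) (hB : 0 ≤ B)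
    (hs : ∀ u, B < |u| → g u = 0) (hK : ∀ u h, |g (u + h) + g (u - h) - 2 * g u| ≤ K * h ^ 2)
    {T : ℝ} (hT : 1 ≤ T) (c : ℝ) (J : Finset ℤ) (hJ : ∀ j : ℤ, g ((j + c) / T) ≠ 0 → j ∈ J) :
    |∑ j ∈ J, g ((j + c) / T) - T * ∫ u, g u| ≤ K * (2 * B + 2) / T := by
  have hT0 : 0 < T := by linarith
  have hK0 : 0 ≤ K := by simpa using (abs_nonneg _).trans (hK 0 1)
  set F : ℝ → ℝ := fun s => g ((s + c) / T) with hF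
  have cF : Continuous F := by fun_prop
  have sF : ∀ s, B * T < |s + c| → F s = 0 := fun s hh => hs _ (by
    rw [abs_div, abs_of_pos hT0, lt_div_iff₀ hT0]; exact hh)
  have iF : Integrable F := cF.integrable_of_hasCompactSupport
    (HasCompactSupport.intro (K := Set.Icc (-(B * T) - c) (B * T - c)) isCompact_Icc fun s hh => by
      refine sF s ?_
      by_contra! h2
      have := abs_le.1 h2
      exact hh ⟨by linarith, by linarith⟩)
  have e1 : ∫ s, F s = T * ∫ u, g u := by
    have := integral_add_right_eq_self (fun s => g (s / T)) c (μ := volume)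
    rw [hF]
    refine this.trans ?_
    rw [Measure.integral_comp_div, smul_eq_mul, abs_of_pos hT0]
  set J' : Finset ℤ := Finset.Icc ⌈-(B * T) - 1 / 2 - c⌉ ⌊B * T + 1 / 2 - c⌋ with hJ'
  have mJ : ∀ j : ℤ, j ∉ J' → B * T + 1 / 2 < |(j : ℝ) + c| := by
    intro j hj
    by_contra! h2
    have := abs_le.1 h2
    refine hj (Finset.mem_Icc.2 ⟨Int.ceil_le.2 (by linarith), Int.le_floor.2 (by linarith)⟩)
  have hsum := iF.hasSum_intervalIntegral (-(1 / 2))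
  have e2 : ∫ s, F s = ∑ j ∈ J', ∫ s in (-(1 / 2) + (j : ℝ))..(-(1 / 2) + (j : ℝ) + 1), F s := by
    refine hsum.unique (hasSum_sum_of_ne_finset_zero fun j hj => ?_)
    rw [intervalIntegral.integral_congr (g := fun _ => (0 : ℝ)), intervalIntegral.integral_zero]
    intro s hs'
    rw [Set.uIcc_of_le (by linarith)] at hs'
    refine sF s ?_
    have h1 := mJ j hj
    have h2 : |(j : ℝ) + c| ≤ |s + c| + |(j : ℝ) - s| := by
      have := abs_add_le (s + c) ((j : ℝ) - s)
      rwa [show s + c + ((j : ℝ) - s) = j + c by ring] at this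
    have h3 : |(j : ℝ) - s| ≤ 1 / 2 := abs_le.2 ⟨by linarith [hs'.2], by linarith [hs'.1]⟩
    linarith
  have e3 : ∑ j ∈ J, g ((j + c) / T) = ∑ j ∈ J', F j := by
    have hz : ∀ j : ℤ, j ∉ J' → F j = 0 := fun j hj => sF j (by linarith [mJ j hj])
    have h1 : ∑ j ∈ J, F j = ∑ j ∈ J ∪ J', F j :=
      Finset.sum_subset Finset.subset_union_left fun j _ hj => by_contra fun h => hj (hJ j h)
    have h2 : ∑ j ∈ J', F j = ∑ j ∈ J ∪ J', F j :=
      Finset.sum_subset Finset.subset_union_right fun j _ hj => hz j hj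
    exact h1.trans h2.symm
  have e4 : ∀ j : ℤ, |F j - ∫ s in (-(1 / 2) + (j : ℝ))..(-(1 / 2) + (j : ℝ) + 1), F s| ≤ K / T ^ 2 := by
    intro j
    have a1 : ∫ s in (-(1 / 2) + (j : ℝ))..(-(1 / 2) + (j : ℝ) + 1), F s =
        ∫ t in (-(1 / 2) : ℝ)..(1 / 2), F (j + t) := by
      rw [intervalIntegral.integral_comp_add_left (fun t => F t)]
      congr 1 <;> ring
    have a2 : ∫ t in (-(1 / 2) : ℝ)..(1 / 2), F (j + t) = ∫ t in (-(1 / 2) : ℝ)..(1 / 2), F (j - t) := by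
      have := intervalIntegral.integral_comp_neg (a := -(1 / 2)) (b := 1 / 2) fun t => F (j + t)
      rw [neg_neg] at this
      rw [← this]
      simp only [sub_eq_add_neg]
    have i1 : IntervalIntegrable (fun t => F (j + t)) volume (-(1 / 2)) (1 / 2) :=
      Continuous.intervalIntegrable (by fun_prop) _ _
    have i2 : IntervalIntegrable (fun t => F (j - t)) volume (-(1 / 2)) (1 / 2) :=
      Continuous.intervalIntegrable (by fun_prop) _ _
    have a3 : F j - ∫ t in (-(1 / 2) : ℝ)..(1 / 2), F (j + t) =
        -(1 / 2) * ∫ t in (-(1 / 2) : ℝ)..(1 / 2), (F (j + t) + F (j - t) - 2 * F j) := by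
      rw [intervalIntegral.integral_sub (i1.add i2) intervalIntegrable_const,
        intervalIntegral.integral_add i1 i2, ← a2, intervalIntegral.integral_const, smul_eq_mul]
      ring
    rw [a1, a3, abs_mul]
    have a4 : ‖∫ t in (-(1 / 2) : ℝ)..(1 / 2), (F (j + t) + F (j - t) - 2 * F j)‖ ≤
        K / T ^ 2 * |1 / 2 - -(1 / 2)| := by
      refine intervalIntegral.norm_integral_le_of_norm_le_const fun t ht => ?_
      rw [Set.uIoc_of_le (by norm_num)] at ht
      rw [Real.norm_eq_abs]
      have := hK ((j + c) / T) (t / T)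
      simp only [hF]
      rw [show (j + t + c) / T = (j + c) / T + t / T by ring,
        show (j - t + c) / T = (j + c) / T - t / T by ring]
      refine this.trans ?_
      rw [div_pow, ← mul_div_assoc]
      refine div_le_div_of_nonneg_right (mul_le_of_le_one_right hK0 ?_) (by positivity)
      nlinarith [ht.1, ht.2]
    rw [Real.norm_eq_abs] at a4
    norm_num at a4 ⊢
    have : 0 ≤ K / T ^ 2 := by positivity
    linarith
  rw [← e1, e2, e3, ← Finset.sum_sub_distrib]
  refine (Finset.abs_sum_le_sum_abs _ _).trans ((Finset.sum_le_card_nsmul _ _ _ fun j _ => e4 j).trans ?_)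
  have hcard : (J'.card : ℝ) ≤ (2 * B + 2) * T := by
    rw [hJ', Int.card_Icc]
    have h1 := Int.le_ceil (-(B * T) - 1 / 2 - c)
    have h2 := Int.floor_le (B * T + 1 / 2 - c)
    have h4 : 2 * B * T + 2 ≤ (2 * B + 2) * T := by nlinarith
    have h5 : (((⌊B * T + 1 / 2 - c⌋ + 1 - ⌈-(B * T) - 1 / 2 - c⌉).toNat : ℤ) : ℝ) ≤ (2 * B + 2) * T := by
      rw [Int.toNat_eq_max]
      push_cast
      refine max_le (by linarith) (by positivity)
    exact_mod_cast h5
  rw [nsmul_eq_mul]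
  calc (J'.card : ℝ) * (K / T ^ 2) ≤ (2 * B + 2) * T * (K / T ^ 2) :=
        mul_le_mul_of_nonneg_right hcard (by positivity)
    _ = _ := by field_simp

/-- The two-dimensional version, with a bounded error term. -/
theorem abs_sum_sub_integral_prod_le {f : ℝ × ℝ → ℝ} {B K : ℝ} (hc : Continuous f) (hB : 0 ≤ B)
    (hs : ∀ p, B < ‖p‖ → f p = 0) (hK : ∀ p h, |f (p + h) + f (p - h) - 2 * f p| ≤ K * ‖h‖ ^ 2)
    {T : ℝ} (hT : 1 ≤ T) (c d : ℝ) (J : Finset (ℤ × ℤ))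
    (hJ : ∀ j : ℤ × ℤ, f ((j.1 + c) / T, (j.2 + d) / T) ≠ 0 → j ∈ J) :
    |∑ j ∈ J, f ((j.1 + c) / T, (j.2 + d) / T) - T ^ 2 * ∫ p, f p| ≤
      K * (2 * B + 2) * (4 * B + 2) := by
  have hT0 : 0 < T := by linarith
  have hK0 : 0 ≤ K := by simpa using (abs_nonneg _).trans (hK 0 (1, 1))
  set G : ℝ → ℝ := fun u => ∫ v, f (u, v) with hG
  have s1 : ∀ u v, B < |u| → f (u, v) = 0 := fun u v h => hs _ (h.trans_le (norm_fst_le (u, v)))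
  have s2 : ∀ u v, B < |v| → f (u, v) = 0 := fun u v h => hs _ (h.trans_le (norm_snd_le (u, v)))
  have GI : ∀ u, G u = ∫ v in (-B)..B, f (u, v) := by
    intro u
    rw [intervalIntegral.integral_of_le (by linarith), ← integral_Icc_eq_integral_Ioc,
      setIntegral_eq_integral_of_forall_compl_eq_zero]
    intro v hv
    refine s2 _ _ ?_
    by_contra! h
    exact hv (abs_le.1 h)
  have cG : Continuous G := by
    have : G = fun u => ∫ v in (-B)..B, f (u, v) := funext GI
    rw [this]
    exact intervalIntegral.continuous_parametric_intervalIntegral_of_continuous' (f := fun u v => f (u, v))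
      (by rw [Function.uncurry_def]; fun_prop) _ _
  have sG : ∀ u, B < |u| → G u = 0 := fun u hu => by simp [hG, s1 u _ hu]
  have KG : ∀ u h, |G (u + h) + G (u - h) - 2 * G u| ≤ (2 * B * K) * h ^ 2 := by
    intro u h
    have ii : ∀ w, IntervalIntegrable (fun v => f (w, v)) volume (-B) B := fun w =>
      Continuous.intervalIntegrable (by fun_prop) _ _
    rw [GI, GI, GI, ← intervalIntegral.integral_const_mul, ← intervalIntegral.integral_add (ii _) (ii _),
      ← intervalIntegral.integral_sub ((ii _).add (ii _)) ((ii _).const_mul _), ← Real.norm_eq_abs]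
    refine (intervalIntegral.norm_integral_le_of_norm_le_const (C := K * h ^ 2) fun v _ => ?_).trans ?_
    · rw [Real.norm_eq_abs]
      have := hK (u, v) (h, 0)
      simpa [Prod.norm_def] using this
    · rw [sub_neg_eq_add, abs_of_nonneg (by linarith)]
      exact le_of_eq (by ring)
  have iG : ∫ p, f p = ∫ u, G u := by
    rw [Measure.volume_eq_prod]
    refine integral_prod f (hc.integrable_of_hasCompactSupport ?_)
    refine HasCompactSupport.intro (isCompact_closedBall (0 : ℝ × ℝ) B) fun p hp => hs p ?_
    simpa using hp
  -- reduce to a box of lattice points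
  set J₁ : Finset ℤ := Finset.Icc ⌈-(B * T) - c⌉ ⌊B * T - c⌋ with hJ₁
  set J₂ : Finset ℤ := Finset.Icc ⌈-(B * T) - d⌉ ⌊B * T - d⌋ with hJ₂
  have mem : ∀ (e : ℝ) (j : ℤ), |(j + e) / T| ≤ B → j ∈ Finset.Icc ⌈-(B * T) - e⌉ ⌊B * T - e⌋ := by
    intro e j hj
    rw [abs_div, abs_of_pos hT0, div_le_iff₀ hT0, abs_le] at hj
    exact Finset.mem_Icc.2 ⟨Int.ceil_le.2 (by linarith), Int.le_floor.2 (by linarith)⟩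
  have e0 : ∑ j ∈ J, f ((j.1 + c) / T, (j.2 + d) / T) =
      ∑ i ∈ J₁, ∑ j ∈ J₂, f ((i + c) / T, (j + d) / T) := by
    rw [← Finset.sum_product']
    refine (Finset.sum_subset (Finset.subset_union_left (s₂ := J₁ ×ˢ J₂)) fun j _ hj =>
      by_contra fun h => hj (hJ j h)).trans
      (Finset.sum_subset (Finset.subset_union_right (s₁ := J)) fun j _ hj => ?_).symm
    by_contra h
    refine hj (Finset.mem_product.2 ⟨mem _ _ ?_, mem _ _ ?_⟩)
    · by_contra! h2; exact h (s1 _ _ h2)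
    · by_contra! h2; exact h (s2 _ _ h2)
  have e1 : ∀ i : ℤ, |∑ j ∈ J₂, f ((i + c) / T, (j + d) / T) - T * G ((i + c) / T)| ≤
      K * (2 * B + 2) / T := fun i =>
    abs_sum_sub_integral_le (g := fun v => f ((i + c) / T, v)) (by fun_prop) hB (fun v => s2 _ v)
      (fun v h => by
        have := hK ((i + c) / T, v) (0, h)
        simpa [Prod.norm_def] using this) hT d J₂
      fun j hj => mem _ _ (by by_contra! h2; exact hj (s2 _ _ h2))
  have e2 := abs_sum_sub_integral_le cG hB sG KG hT c J₁
    fun j hj => mem _ _ (by by_contra! h2; exact hj (sG _ h2))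
  have hcard : (J₁.card : ℝ) ≤ (2 * B + 2) * T := by
    rw [hJ₁, Int.card_Icc]
    have h1 := Int.le_ceil (-(B * T) - c)
    have h2 := Int.floor_le (B * T - c)
    have h4 : 2 * B * T + 1 ≤ (2 * B + 2) * T := by nlinarith
    have h5 : (((⌊B * T - c⌋ + 1 - ⌈-(B * T) - c⌉).toNat : ℤ) : ℝ) ≤ (2 * B + 2) * T := by
      rw [Int.toNat_eq_max]
      push_cast
      refine max_le (by linarith) (by positivity)
    exact_mod_cast h5
  have e3 : |∑ i ∈ J₁, (∑ j ∈ J₂, f ((i + c) / T, (j + d) / T) - T * G ((i + c) / T))| ≤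
      K * (2 * B + 2) * (2 * B + 2) := by
    refine (Finset.abs_sum_le_sum_abs _ _).trans
      ((Finset.sum_le_card_nsmul _ _ _ fun i _ => e1 i).trans ?_)
    rw [nsmul_eq_mul]
    calc (J₁.card : ℝ) * (K * (2 * B + 2) / T) ≤ (2 * B + 2) * T * (K * (2 * B + 2) / T) :=
          mul_le_mul_of_nonneg_right hcard (by positivity)
      _ = _ := by field_simp
  rw [Finset.sum_sub_distrib, ← Finset.mul_sum] at e3
  have e4 : |T * (∑ i ∈ J₁, G ((i + c) / T)) - T ^ 2 * ∫ u, G u| ≤ 2 * B * K * (2 * B + 2) := by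
    rw [pow_two, mul_assoc, ← mul_sub, abs_mul, abs_of_pos hT0]
    refine (mul_le_mul_of_nonneg_left e2 hT0.le).trans (le_of_eq ?_)
    field_simp
  rw [e0, iG]
  refine (abs_sub_le _ (T * ∑ i ∈ J₁, G ((i + c) / T)) _).trans ?_
  linarith
end

section
open MeasureTheory

theorem ContDiff.exists_abs_second_diff_le {E : Type*} [NormedAddCommGroup E] [NormedSpace ℝ E]
    {F : E → ℝ} (hF : ContDiff ℝ 2 F) (hc : HasCompactSupport F) :
    ∃ K, ∀ p h, |F (p + h) + F (p - h) - 2 * F p| ≤ K * ‖h‖ ^ 2 := by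
  obtain ⟨K, hK⟩ := ContDiff.lipschitzWith_of_hasCompactSupport (hc.fderiv ℝ)
    (hF.fderiv_right (m := 1) (by norm_num)) one_ne_zero
  have hd : Differentiable ℝ F := hF.differentiable (by norm_num)
  refine ⟨2 * K, fun p h => ?_⟩
  have key := Convex.norm_image_sub_le_of_norm_hasFDerivWithin_le (𝕜 := ℝ)
    (f := fun u => F (p + u) + F (p - u)) (f' := fun u => fderiv ℝ F (p + u) - fderiv ℝ F (p - u))
    (C := 2 * K * ‖h‖) (s := Metric.closedBall 0 ‖h‖) (x := 0) (y := h) (fun u _ => ?_)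
    (fun u hu => ?_) (convex_closedBall _ _) (by simp) (by simp)
  · simp only [add_zero, sub_zero, Real.norm_eq_abs] at key
    rw [show F (p + h) + F (p - h) - 2 * F p = F (p + h) + F (p - h) - (F p + F p) by ring]
    refine key.trans (le_of_eq ?_)
    ring
  · have h1 : HasFDerivAt (fun u => F (p + u)) (fderiv ℝ F (p + u)) u := by
      exact ((hd (p + u)).hasFDerivAt.comp u ((hasFDerivAt_id u).const_add p)).congr_fderiv (by ext v; simp)
    have h2 : HasFDerivAt (fun u => F (p - u)) (-fderiv ℝ F (p - u)) u := by
      have := (hd (p - u)).hasFDerivAt.comp u ((hasFDerivAt_id u).const_sub p)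
      refine this.congr_fderiv ?_
      ext v; simp
    exact ((h1.add h2).congr_fderiv (sub_eq_add_neg _ _).symm).hasFDerivWithinAt
  · have h1 := hK.dist_le_mul (p + u) (p - u)
    rw [dist_eq_norm, dist_eq_norm] at h1
    refine h1.trans ?_
    have h2 : ‖p + u - (p - u)‖ ≤ 2 * ‖h‖ := by
      rw [show p + u - (p - u) = u + u by abel]
      have := norm_add_le u u
      have hu' : ‖u‖ ≤ ‖h‖ := by simpa using hu
      linarith
    calc (K : ℝ) * ‖p + u - (p - u)‖ ≤ K * (2 * ‖h‖) := mul_le_mul_of_nonneg_left h2 K.2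
      _ = _ := by ring

/-- Counting points of a shifted planar lattice with a smooth weight. -/
theorem exists_lattice_sum_le {F : ℝ × ℝ → ℝ} (hF : ContDiff ℝ 2 F) (hc : HasCompactSupport F)
    {p q : Fin 2 → ℝ} (hΔ : p 0 * q 1 - p 1 * q 0 ≠ 0) :
    ∃ C, ∀ T, 1 ≤ T → ∀ x y : ℝ, ∀ J : Finset (ℤ × ℤ),
      (∀ j : ℤ × ℤ, F ((x + j.1 * p 0 + j.2 * p 1) / T, (y + j.1 * q 0 + j.2 * q 1) / T) ≠ 0 → j ∈ J) →
      |∑ j ∈ J, F ((x + j.1 * p 0 + j.2 * p 1) / T, (y + j.1 * q 0 + j.2 * q 1) / T) -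
        T ^ 2 * (|p 0 * q 1 - p 1 * q 0|⁻¹ * ∫ z, F z)| ≤ C := by
  set Φ := Matrix.toLin (Module.Basis.finTwoProd ℝ) (Module.Basis.finTwoProd ℝ) !![p 0, p 1; q 0, q 1]
    with hΦ
  have hdet : LinearMap.det Φ = p 0 * q 1 - p 1 * q 0 := by
    rw [hΦ, LinearMap.det_toLin, Matrix.det_fin_two_of]
  have hdet0 : LinearMap.det Φ ≠ 0 := by rw [hdet]; exact hΔ
  have happ : ∀ z, Φ z = (p 0 * z.1 + p 1 * z.2, q 0 * z.1 + q 1 * z.2) := fun z =>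
    Matrix.toLin_finTwoProd_apply _ _ _ _ z
  set e : (ℝ × ℝ) ≃ₗ[ℝ] (ℝ × ℝ) := LinearEquiv.ofIsUnitDet (f := Φ)
    (v := Module.Basis.finTwoProd ℝ) (v' := Module.Basis.finTwoProd ℝ)
    (by rw [LinearMap.det_toMatrix]; exact isUnit_iff_ne_zero.2 hdet0) with he
  have heapp : ∀ z, e z = Φ z := fun z => rfl
  set e' := e.toContinuousLinearEquiv with he'
  have heapp' : ∀ z, e' z = Φ z := fun z => rfl
  set f : ℝ × ℝ → ℝ := fun z => F (e' z) with hf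
  have hf2 : ContDiff ℝ 2 f := hF.comp e'.contDiff
  have hfc : HasCompactSupport f := hc.comp_homeomorph e'.toHomeomorph
  obtain ⟨K, hK⟩ := hf2.exists_abs_second_diff_le hfc
  obtain ⟨B, hB⟩ := hfc.isCompact.isBounded.subset_closedBall (0 : ℝ × ℝ)
  have hint : ∫ z, f z = |p 0 * q 1 - p 1 * q 0|⁻¹ * ∫ z, F z := by
    have h1 := Measure.map_linearMap_addHaar_eq_smul_addHaar (volume : Measure (ℝ × ℝ)) hdet0
    have h2 : ∫ z, F z ∂(Measure.map Φ volume) = ∫ z, f z :=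
      integral_map (φ := Φ) e'.continuous.aemeasurable hF.continuous.aestronglyMeasurable
    rw [← h2, h1, integral_smul_measure, hdet, ENNReal.toReal_ofReal (abs_nonneg _), abs_inv, smul_eq_mul]
  refine ⟨K * (2 * max B 0 + 2) * (4 * max B 0 + 2), fun T hT x y J hJ => ?_⟩
  obtain ⟨⟨c, d⟩, hcd⟩ := e.surjective (x, y)
  rw [heapp, happ] at hcd
  simp only [Prod.mk.injEq] at hcd
  have key : ∀ j : ℤ × ℤ, f ((j.1 + c) / T, (j.2 + d) / T) =
      F ((x + j.1 * p 0 + j.2 * p 1) / T, (y + j.1 * q 0 + j.2 * q 1) / T) := by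
    intro j
    rw [hf]
    simp only [heapp', happ, ← hcd.1, ← hcd.2]
    congr 2 <;> ring
  have := abs_sum_sub_integral_prod_le (B := max B 0) hf2.continuous (le_max_right _ _)
    (fun z hz => by
      by_contra h
      have := hB (subset_tsupport f h)
      rw [mem_closedBall_zero_iff] at this
      exact absurd (this.trans (le_max_left B 0)) (not_le.2 hz)) hK hT c d J
    (fun j hj => hJ j (by rw [← key]; exact hj))
  simp only [key, hint] at this
  exact this
end

/-- The data of a real quadratic order of integers: its two real embeddings, and the arithmetic
facts about it that are used for counting ideals in ray classes. -/
structure RealQuad (D : ℤ) (O : Type) [CommRing O] [IsDedekindDomain O] [Module.Free ℤ O]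
    [Module.Finite ℤ O] where
  σ : O →+* ℝ
  τ : O →+* ℝ
  σ_inj : Function.Injective σ
  τ_inj : Function.Injective τ
  norm : ∀ x, (Ideal.absNorm (Ideal.span {x}) : ℝ) = |σ x * τ x|
  trace : ∀ x, ∃ t : ℤ, σ x + τ x = t
  pos : 0 < D
  root : ∀ B C : ℤ, B ^ 2 - 4 * C = D → ∃ θ : O, σ θ = (B + √D) / 2 ∧ τ θ = (B - √D) / 2
  sqrtD : O
  σ_sqrtD : σ sqrtD = √D
  τ_sqrtD : τ sqrtD = -√D
  basis : Module.Basis (Fin 2) ℤ O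
  count : ∃ C : ℝ, ∀ X : ℝ, 1 ≤ X → (Nat.card {I : Ideal O // (Ideal.absNorm I : ℝ) ≤ X} : ℝ) ≤ C * X
  exists_unit : ∀ m : ℤ, m ≠ 0 → ∃ u : Oˣ, (u : O) ≠ 1 ∧ (m : O) ∣ u - 1 ∧ 0 < σ u ∧ 0 < τ u

namespace RealQuad

variable {D : ℤ} {O : Type} [CommRing O] [IsDedekindDomain O] [Module.Free ℤ O]
  [Module.Finite ℤ O] (H : RealQuad D O) {m : ℤ}
include H

theorem sqrt_pos : 0 < √(D : ℝ) := Real.sqrt_pos.2 (by exact_mod_cast H.pos)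

theorem charZero : CharZero O :=
  ⟨fun a b h => by have := congrArg H.σ h; simpa using this⟩

/-- Totally positive elements congruent to `1` modulo `m`. -/
def Pos (m : ℤ) (x : O) : Prop := (m : O) ∣ x - 1 ∧ 0 < H.σ x ∧ 0 < H.τ x

variable {H}

theorem Pos.ne_zero {x : O} (h : H.Pos m x) : x ≠ 0 := fun h0 => by
  have := h.2.1; simp [h0] at this

theorem pos_one : H.Pos m 1 := by simp [Pos]

theorem Pos.mul {x y : O} (hx : H.Pos m x) (hy : H.Pos m y) : H.Pos m (x * y) := by
  refine ⟨?_, by rw [map_mul]; exact mul_pos hx.2.1 hy.2.1, by rw [map_mul]; exact mul_pos hx.2.2 hy.2.2⟩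
  rw [show x * y - 1 = x * (y - 1) + (x - 1) by ring]
  exact dvd_add (dvd_mul_of_dvd_right hy.1 _) hx.1

theorem Pos.of_mul {x y : O} (hx : H.Pos m x) (hxy : H.Pos m (x * y)) : H.Pos m y := by
  have h1 := hxy.2.1
  have h2 := hxy.2.2
  rw [map_mul] at h1 h2
  refine ⟨?_, (mul_pos_iff_of_pos_left hx.2.1).1 h1, (mul_pos_iff_of_pos_left hx.2.2).1 h2⟩
  rw [show y - 1 = (x * y - 1) - y * (x - 1) by ring]
  exact dvd_sub hxy.1 (dvd_mul_of_dvd_right hx.1 _)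

theorem pos_sq {x : O} (hx : x ≠ 0) (h : (m : O) ∣ x - 1) : H.Pos m (x ^ 2) := by
  refine ⟨?_, ?_, ?_⟩
  · rw [show x ^ 2 - 1 = (x + 1) * (x - 1) by ring]
    exact dvd_mul_of_dvd_right h _
  · rw [map_pow]; have := (map_ne_zero_iff H.σ H.σ_inj).2 hx; positivity
  · rw [map_pow]; have := (map_ne_zero_iff H.τ H.τ_inj).2 hx; positivity

theorem Pos.unit_inv {u : Oˣ} (h : H.Pos m u) : H.Pos m (↑u⁻¹ : O) :=
  Pos.of_mul h (by rw [Units.mul_inv]; exact pos_one)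

theorem Pos.unit_zpow {u : Oˣ} (h : H.Pos m u) (n : ℤ) : H.Pos m (↑(u ^ n) : O) := by
  induction n using Int.induction_on with
  | zero => simpa using pos_one
  | succ n ih => rw [zpow_add_one, Units.val_mul]; exact ih.mul h
  | pred n ih => rw [zpow_sub_one, Units.val_mul]; exact ih.mul h.unit_inv

theorem Pos.unit_mul_eq_one {u : Oˣ} (h : H.Pos m u) : H.σ u * H.τ u = 1 := by
  have := H.norm u
  rw [Ideal.span_singleton_eq_top.2 u.isUnit, Ideal.absNorm_top,
    abs_of_pos (mul_pos h.2.1 h.2.2)] at this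
  exact_mod_cast this.symm

variable (H)

/-- Logarithms of totally positive units congruent to `1` modulo `m`. -/
def unitLogs (m : ℤ) : AddSubgroup ℝ where
  carrier := {t | ∃ u : Oˣ, H.Pos m u ∧ Real.log (H.σ u) = t}
  zero_mem' := ⟨1, by simpa using pos_one, by simp⟩
  add_mem' := by
    rintro _ _ ⟨u, hu, rfl⟩ ⟨v, hv, rfl⟩
    refine ⟨u * v, by rw [Units.val_mul]; exact hu.mul hv, ?_⟩
    rw [Units.val_mul, map_mul, Real.log_mul hu.2.1.ne' hv.2.1.ne']
  neg_mem' := by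
    rintro _ ⟨u, hu, rfl⟩
    refine ⟨u⁻¹, hu.unit_inv, ?_⟩
    rw [← Real.log_inv]
    congr 1
    refine eq_inv_of_mul_eq_one_left ?_
    rw [← map_mul, Units.inv_mul, map_one]

/-- The totally positive units congruent to `1` modulo `m` form an infinite cyclic group. -/
theorem exists_generator (hm : m ≠ 0) : ∃ η : Oˣ, H.Pos m η ∧ 0 < Real.log (H.σ η) ∧
    ∀ u : Oˣ, H.Pos m u → ∃ n : ℤ, u = η ^ n := by
  have hlog0 : ∀ u : Oˣ, H.Pos m u → Real.log (H.σ u) = 0 → u = 1 := by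
    intro u hu h
    have h1 : H.σ u = 1 := Real.eq_one_of_pos_of_log_eq_zero hu.2.1 h
    exact Units.ext (H.σ_inj (by rw [h1, Units.val_one, map_one]))
  have hiso : Disjoint (H.unitLogs m : Set ℝ) (Set.Ioo 0 (Real.log 2)) := by
    rw [Set.disjoint_left]
    rintro _ ⟨u, hu, rfl⟩ ⟨h1, h2⟩
    have h3 : 1 < H.σ u := (Real.log_pos_iff hu.2.1.le).1 h1
    have h4 : H.σ u < 2 := (Real.log_lt_log_iff hu.2.1 two_pos).1 h2
    have h5 := hu.unit_mul_eq_one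
    obtain ⟨t, ht⟩ := H.trace u
    have h6 : (2 : ℝ) < t := by rw [← ht]; nlinarith [sq_nonneg (H.σ (u : O) - 1), mul_pos (sub_pos.2 h3) (sub_pos.2 h3)]
    have h7 : (t : ℝ) < 3 := by rw [← ht]; nlinarith
    have h8 : 2 < t := by exact_mod_cast h6
    have h9 : t < 3 := by exact_mod_cast h7
    omega
  obtain ⟨l, hl⟩ := AddSubgroup.cyclic_of_isolated_zero (Real.log_pos one_lt_two) hiso
  rw [← AddSubgroup.zmultiples_eq_closure] at hl
  obtain ⟨u, hu1, hu⟩ := H.exists_unit m hm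
  have hu0 : Real.log (H.σ u) ≠ 0 := fun h => hu1 (by rw [hlog0 u hu h, Units.val_one])
  have hl0 : l ≠ 0 := by
    rintro rfl
    have : Real.log (H.σ u) ∈ H.unitLogs m := ⟨u, hu, rfl⟩
    rw [hl, AddSubgroup.mem_zmultiples_iff] at this
    obtain ⟨k, hk⟩ := this
    exact hu0 (by rw [← hk, smul_zero])
  have habs : ∃ η : Oˣ, H.Pos m η ∧ Real.log (H.σ η) = |l| := by
    have h1 : l ∈ H.unitLogs m := by rw [hl]; exact AddSubgroup.mem_zmultiples l
    rcases abs_choice l with h | h <;> rw [h]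
    exacts [h1, (H.unitLogs m).neg_mem h1]
  obtain ⟨η, hη, hηl⟩ := habs
  refine ⟨η, hη, by rw [hηl]; exact abs_pos.2 hl0, fun v hv => ?_⟩
  have hlogz : ∀ n : ℤ, Real.log (H.σ ↑(η ^ n)) = n * |l| := by
    intro n
    rw [← hηl, ← Real.log_zpow]
    congr 1
    exact congrArg Units.val (map_zpow (Units.map (H.σ : O →* ℝ)) η n) |>.trans (by simp)
  have h1 : Real.log (H.σ v) ∈ H.unitLogs m := ⟨v, hv, rfl⟩
  rw [hl, AddSubgroup.mem_zmultiples_iff] at h1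
  obtain ⟨k, hk⟩ := h1
  have key : ∃ n : ℤ, Real.log (H.σ v) = n * |l| := by
    rcases abs_choice l with h | h <;> rw [h]
    exacts [⟨k, by rw [← hk]; simp⟩, ⟨-k, by rw [← hk]; simp⟩]
  obtain ⟨n, hn⟩ := key
  refine ⟨n, ?_⟩
  have h2 : H.Pos m ↑(v * (η ^ n)⁻¹) := by
    rw [Units.val_mul]; exact hv.mul (hη.unit_zpow n).unit_inv
  have h3 := hlog0 _ h2 (by
    rw [Units.val_mul, map_mul, Real.log_mul hv.2.1.ne' (hη.unit_zpow n).unit_inv.2.1.ne', hn,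
      ← zpow_neg, hlogz]
    push_cast; ring)
  exact mul_inv_eq_one.1 h3

/-- A smooth cutoff on the log-ratio of the two embeddings, forming a partition of unity over
each orbit of totally positive units congruent to `1` modulo `m`. -/
theorem exists_cutoff (hm : m ≠ 0) : ∃ (θ : ℝ → ℝ) (B : ℝ), ContDiff ℝ 2 θ ∧ (∀ t, 0 ≤ θ t) ∧
    θ 0 = 1 ∧ (∀ t, B < |t| → θ t = 0) ∧ ∀ γ : O, H.Pos m γ → ∀ E : Finset O,
      (∀ x, x ∈ E → Associated γ x ∧ H.Pos m x) →
      (∀ x, Associated γ x → H.Pos m x → θ (Real.log (H.σ x / H.τ x)) ≠ 0 → x ∈ E) →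
      ∑ x ∈ E, θ (Real.log (H.σ x / H.τ x)) = 1 := by
  classical
  obtain ⟨η, hη, hη0, hgen⟩ := H.exists_generator hm
  obtain ⟨l, hl⟩ : ∃ l, l = 2 * Real.log (H.σ η) := ⟨_, rfl⟩
  have hl0 : 0 < l := by rw [hl]; positivity
  obtain ⟨θ, hθ⟩ : ∃ θ : ℝ → ℝ, ∀ t, θ t =
    Real.smoothTransition (t / l + 1) - Real.smoothTransition (t / l) := ⟨_, fun _ => rfl⟩
  have hsupp : ∀ t, θ t ≠ 0 → -1 < t / l ∧ t / l < 1 := by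
    intro t ht
    by_contra hcon
    rw [not_and_or, not_lt, not_lt] at hcon
    refine ht ?_
    rw [hθ]
    rcases hcon with h | h
    · rw [Real.smoothTransition.zero_of_nonpos (by linarith), Real.smoothTransition.zero_of_nonpos (by linarith), sub_zero]
    · rw [Real.smoothTransition.one_of_one_le (by linarith), Real.smoothTransition.one_of_one_le h, sub_self]
  refine ⟨θ, l, ?_, fun t => ?_, ?_, fun t ht => ?_, fun γ hγ E hE1 hE2 => ?_⟩
  · have hs : ContDiff ℝ 2 Real.smoothTransition := Real.smoothTransition.contDiff (n := 2)
    have : θ = fun t => Real.smoothTransition (t / l + 1) - Real.smoothTransition (t / l) := funext hθ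
    rw [this]
    exact (hs.comp ((contDiff_id.div_const l).add contDiff_const)).sub (hs.comp (contDiff_id.div_const l))
  · rw [hθ, sub_nonneg]
    exact Real.smoothTransition.monotone (by linarith)
  · rw [hθ, zero_div, zero_add, Real.smoothTransition.one_of_one_le le_rfl, Real.smoothTransition.zero_of_nonpos le_rfl, sub_zero]
  · by_contra h
    have h1 := hsupp t h
    rw [lt_div_iff₀ hl0, div_lt_iff₀ hl0] at h1
    exact absurd (abs_lt.2 ⟨by linarith, by linarith⟩) (not_lt.2 ht.le)
  · obtain ⟨t, ht⟩ : ∃ t, t = Real.log (H.σ γ / H.τ γ) := ⟨_, rfl⟩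
    obtain ⟨e, he⟩ : ∃ e : ℤ → O, ∀ n, e n = γ * ↑(η ^ n) := ⟨_, fun _ => rfl⟩
    have hpos : ∀ n, H.Pos m (e n) := fun n => by rw [he]; exact hγ.mul (hη.unit_zpow n)
    have hlogη : Real.log (H.σ η / H.τ η) = l := by
      have h1 := hη.unit_mul_eq_one
      rw [show H.σ (η : O) / H.τ η = H.σ η ^ 2 by
        rw [div_eq_iff hη.2.2.ne', sq, mul_assoc, h1, mul_one], Real.log_pow, hl]
      norm_num
    have hlog : ∀ n : ℤ, Real.log (H.σ (e n) / H.τ (e n)) = t + n * l := by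
      intro n
      have h1 : H.σ (e n) / H.τ (e n) = H.σ γ / H.τ γ * (H.σ η / H.τ η) ^ n := by
        have hs : ∀ f : O →+* ℝ, f ↑(η ^ n) = f η ^ n := fun f =>
          (congrArg Units.val (map_zpow (Units.map (f : O →* ℝ)) η n)).trans (by simp)
        rw [he, map_mul, map_mul, hs, hs, div_zpow, mul_div_mul_comm]
      rw [h1, Real.log_mul (div_pos hγ.2.1 hγ.2.2).ne' (zpow_pos (div_pos hη.2.1 hη.2.2) n).ne',
        Real.log_zpow, hlogη, ht]
    have hinj : Function.Injective e := by
      intro n n' h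
      have := congrArg (fun x => Real.log (H.σ x / H.τ x)) h
      simp only [hlog] at this
      have h2 : (n : ℝ) = n' := mul_right_cancel₀ hl0.ne' (add_left_cancel this)
      exact_mod_cast h2
    have hsurj : ∀ x, Associated γ x → H.Pos m x → ∃ n, x = e n := by
      rintro x ⟨u, rfl⟩ hx
      obtain ⟨n, rfl⟩ := hgen u (hγ.of_mul hx)
      exact ⟨n, (he n).symm⟩
    obtain ⟨K, hK⟩ := exists_nat_gt (|t / l| + 1)
    have hKt := abs_lt.1 (show |t / l| < K - 1 by linarith)
    have hinj' : Function.Injective fun i : ℕ => e (i - K) := fun i j h => by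
      have := hinj h; simpa using this
    calc ∑ x ∈ E, θ (Real.log (H.σ x / H.τ x))
        = ∑ x ∈ (Finset.range (2 * K)).map ⟨_, hinj'⟩, θ (Real.log (H.σ x / H.τ x)) := by
          refine Finset.sum_congr_of_eq_on_inter (fun x hx hx' => ?_) (fun x hx hx' => ?_) (fun _ _ _ => rfl)
          · by_contra h
            obtain ⟨n, rfl⟩ := hsurj x (hE1 x hx).1 (hE1 x hx).2
            rw [hlog] at h
            have h1 := hsupp _ h
            rw [add_div, mul_div_cancel_right₀ _ hl0.ne'] at h1
            have h2 : (-(K : ℤ)) < n := by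
              have : -(K : ℝ) < n := by linarith
              exact_mod_cast this
            have h3 : n < K := by
              have : (n : ℝ) < K := by linarith
              exact_mod_cast this
            refine hx' (Finset.mem_map.2 ⟨(n + K).toNat, Finset.mem_range.2 (by omega), ?_⟩)
            change e _ = e n
            congr 1; omega
          · by_contra h
            obtain ⟨i, -, rfl⟩ := Finset.mem_map.1 hx
            exact hx' (hE2 _ (by change Associated γ (e _); rw [he]; exact ⟨_, rfl⟩) (hpos _) h)
      _ = ∑ i ∈ Finset.range (2 * K), (Real.smoothTransition (t / l - K + ((i + 1 : ℕ) : ℝ)) -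
            Real.smoothTransition (t / l - K + (i : ℝ))) := by
          rw [Finset.sum_map]
          refine Finset.sum_congr rfl fun i _ => ?_
          change θ (Real.log (H.σ (e _) / H.τ (e _))) = _
          rw [hlog, hθ, add_div, mul_div_cancel_right₀ _ hl0.ne']
          push_cast
          congr 2 <;> ring
      _ = 1 := by
          rw [Finset.sum_range_sub fun i : ℕ => Real.smoothTransition (t / l - K + (i : ℝ))]
          rw [Real.smoothTransition.one_of_one_le (by push_cast; linarith),
            Real.smoothTransition.zero_of_nonpos (by push_cast; linarith), sub_zero]

end RealQuad

/-- The congruence on a commutative monoid that kills a submonoid. -/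
def AddSubmonoid.quotCon {M : Type*} [AddCommMonoid M] (N : AddSubmonoid M) : AddCon M where
  r a b := ∃ c ∈ N, ∃ d ∈ N, a + c = b + d
  iseqv := by
    refine ⟨fun a => ⟨0, N.zero_mem, 0, N.zero_mem, rfl⟩, ?_, ?_⟩
    · rintro a b ⟨c, hc, d, hd, h⟩
      exact ⟨d, hd, c, hc, h.symm⟩
    · rintro a b e ⟨c, hc, d, hd, h⟩ ⟨c', hc', d', hd', h'⟩
      refine ⟨c + c', N.add_mem hc hc', d + d', N.add_mem hd hd', ?_⟩
      rw [← add_assoc, h, add_right_comm, h', add_right_comm, add_assoc]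
  add' := by
    rintro a b a' b' ⟨c, hc, d, hd, h⟩ ⟨c', hc', d', hd', h'⟩
    refine ⟨c + c', N.add_mem hc hc', d + d', N.add_mem hd hd', ?_⟩
    rw [add_add_add_comm, h, h', add_add_add_comm]

/-- Nonzero prime ideals not containing `m`. -/
abbrev PrimeAway (O : Type) [CommRing O] (m : ℤ) : Type := {p : Ideal O // Prime p ∧ (m : O) ∉ p}

section
variable {O : Type} [CommRing O] [IsDedekindDomain O] {m : ℤ}

/-- The ideal with a given prime factorization. -/
noncomputable def toIdeal (a : PrimeAway O m →₀ ℕ) : Ideal O := ((Finsupp.toMultiset a).map Subtype.val).prod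

theorem toIdeal_zero : toIdeal (0 : PrimeAway O m →₀ ℕ) = ⊤ := by simp [toIdeal, Ideal.one_eq_top]

theorem toIdeal_add (a b : PrimeAway O m →₀ ℕ) : toIdeal (a + b) = toIdeal a * toIdeal b := by
  simp [toIdeal]

theorem toIdeal_single (p : PrimeAway O m) (n : ℕ) : toIdeal (Finsupp.single p n) = (p : Ideal O) ^ n := by
  simp [toIdeal, Finsupp.toMultiset_single, Multiset.map_nsmul, Multiset.prod_nsmul]

theorem toIdeal_ne_bot (a : PrimeAway O m →₀ ℕ) : toIdeal a ≠ ⊥ := by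
  refine Multiset.prod_ne_zero fun h => ?_
  obtain ⟨p, -, hp⟩ := Multiset.mem_map.1 h
  exact p.2.1.ne_zero hp

theorem toIdeal_injective : Function.Injective (toIdeal : (PrimeAway O m →₀ ℕ) → Ideal O) := by
  intro a b h
  have h1 : ∀ a : PrimeAway O m →₀ ℕ, UniqueFactorizationMonoid.normalizedFactors (toIdeal a) =
      (Finsupp.toMultiset a).map Subtype.val := fun a =>
    UniqueFactorizationMonoid.normalizedFactors_prod_of_prime fun p hp => by
      obtain ⟨q, -, rfl⟩ := Multiset.mem_map.1 hp
      exact q.2.1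
  exact Multiset.toFinsupp.symm.injective (Multiset.map_injective Subtype.val_injective ((h1 a).symm.trans (h ▸ h1 b)))

theorem PrimeAway.isCoprime (p : PrimeAway O m) : IsCoprime (p : Ideal O) (Ideal.span {(m : O)}) := by
  have h1 := Ideal.isPrime_of_prime p.2.1
  have h2 := h1.isMaximal p.2.1.ne_zero
  rw [Ideal.isCoprime_iff_sup_eq]
  refine h2.1.2 _ (lt_of_le_of_ne le_sup_left fun h => p.2.2 ?_)
  rw [h]
  exact Ideal.mem_sup_right (Ideal.mem_span_singleton_self _)

theorem toIdeal_isCoprime (a : PrimeAway O m →₀ ℕ) : IsCoprime (toIdeal a) (Ideal.span {(m : O)}) := by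
  rw [toIdeal]
  generalize Finsupp.toMultiset a = s
  induction s using Multiset.induction_on with
  | empty => rw [Multiset.map_zero, Multiset.prod_zero]; exact isCoprime_one_left
  | cons p s ih => rw [Multiset.map_cons, Multiset.prod_cons]; exact p.isCoprime.mul_left ih

theorem exists_toIdeal_eq {J : Ideal O} (hJ : J ≠ ⊥) (hc : IsCoprime J (Ideal.span {(m : O)})) :
    ∃ a : PrimeAway O m →₀ ℕ, toIdeal a = J := by
  induction J using UniqueFactorizationMonoid.induction_on_prime with
  | h₁ => exact absurd rfl hJ
  | h₂ x hx => exact ⟨0, by rw [toIdeal_zero, Ideal.isUnit_iff.1 hx]⟩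
  | h₃ a p ha hp ih =>
    obtain ⟨h1, h2⟩ := IsCoprime.mul_left_iff.1 hc
    obtain ⟨x, hx⟩ := ih ha h2
    have hm : (m : O) ∉ p := fun h => by
      rw [Ideal.isCoprime_iff_sup_eq, sup_eq_left.2 ((Ideal.span_singleton_le_iff_mem _).2 h)] at h1
      exact (Ideal.isPrime_of_prime hp).ne_top h1
    exact ⟨Finsupp.single ⟨p, hp, hm⟩ 1 + x, by rw [toIdeal_add, hx, toIdeal_single, pow_one]⟩

theorem exists_mem_dvd_sub_one (a : PrimeAway O m →₀ ℕ) :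
    ∃ x ∈ toIdeal a, x ≠ 0 ∧ (m : O) ∣ x - 1 := by
  obtain ⟨x, hx, y, hy, hxy⟩ := Ideal.isCoprime_iff_exists.1 (toIdeal_isCoprime a)
  rw [Ideal.mem_span_singleton] at hy
  have h1 : (m : O) ∣ x - 1 := by rw [← hxy, sub_add_cancel_left]; exact (dvd_neg).2 hy
  by_cases hx0 : x = 0
  · obtain ⟨z, hz, hz0⟩ := Submodule.exists_mem_ne_zero_of_ne_bot (toIdeal_ne_bot a)
    refine ⟨z, hz, hz0, dvd_trans h1 ?_⟩
    rw [hx0, zero_sub]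
    exact (isUnit_one.neg).dvd
  · exact ⟨x, hx, hx0, h1⟩

theorem isCoprime_of_dvd_sub_one {J : Ideal O} {x : O} (h : (m : O) ∣ x - 1) (hJ : J ∣ Ideal.span {x}) :
    IsCoprime J (Ideal.span {(m : O)}) := by
  rw [Ideal.isCoprime_iff_exists]
  refine ⟨x, Ideal.dvd_span_singleton.1 hJ, 1 - x, ?_, by ring⟩
  rw [Ideal.mem_span_singleton, ← neg_sub]
  exact (dvd_neg).2 h

end

namespace RealQuad

variable {D : ℤ} {O : Type} [CommRing O] [IsDedekindDomain O] [Module.Free ℤ O]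
  [Module.Finite ℤ O] (H : RealQuad D O) (m : ℤ)

/-- Factorizations of principal ideals with a totally positive generator that is `1` mod `m`. -/
def principal : AddSubmonoid (PrimeAway O m →₀ ℕ) where
  carrier := {a | ∃ x, H.Pos m x ∧ toIdeal a = Ideal.span {x}}
  zero_mem' := ⟨1, pos_one, by rw [toIdeal_zero, Ideal.span_singleton_one]⟩
  add_mem' := by
    rintro a b ⟨x, hx, ha⟩ ⟨y, hy, hb⟩
    exact ⟨x * y, hx.mul hy, by rw [toIdeal_add, ha, hb, Ideal.span_singleton_mul_span_singleton]⟩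

/-- The narrow ray class group modulo `m`. -/
abbrev RayClass : Type := (H.principal m).quotCon.Quotient

variable {m}

theorem exists_add_mem_principal (a : PrimeAway O m →₀ ℕ) : ∃ b, a + b ∈ H.principal m := by
  obtain ⟨x, hx, hx0, hx1⟩ := exists_mem_dvd_sub_one a
  have hp : H.Pos m (x ^ 2) := pos_sq hx0 hx1
  obtain ⟨J, hJ⟩ := Ideal.dvd_span_singleton.2 (show x ^ 2 ∈ toIdeal a from Ideal.pow_mem_of_mem _ hx 2 two_pos)
  have hJ0 : J ≠ ⊥ := by
    rintro rfl
    rw [← Ideal.zero_eq_bot, mul_zero, Ideal.zero_eq_bot, Ideal.span_singleton_eq_bot] at hJ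
    exact hp.ne_zero hJ
  obtain ⟨b, rfl⟩ := exists_toIdeal_eq (m := m) hJ0 (isCoprime_of_dvd_sub_one hp.1 ⟨_, hJ.trans (mul_comm _ _)⟩)
  exact ⟨b, x ^ 2, hp, by rw [toIdeal_add, hJ]⟩

theorem mk_eq_zero_iff (a : PrimeAway O m →₀ ℕ) :
    (a : H.RayClass m) = 0 ↔ ∃ x, H.Pos m x ∧ toIdeal a = Ideal.span {x} := by
  have h0 : (a : H.RayClass m) = 0 ↔ ∃ c ∈ H.principal m, ∃ d ∈ H.principal m, a + c = 0 + d :=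
    AddCon.eq (c := (H.principal m).quotCon)
  rw [h0]
  refine ⟨?_, fun h => ⟨0, zero_mem _, a, h, by rw [add_zero, zero_add]⟩⟩
  rintro ⟨c, ⟨x, hx, hc⟩, d, ⟨y, hy, hd⟩, h⟩
  have h1 := congrArg toIdeal h
  rw [toIdeal_add, zero_add, hc, hd] at h1
  obtain ⟨z, rfl⟩ : x ∣ y := by
    rw [← Ideal.mem_span_singleton, ← Ideal.dvd_span_singleton]
    exact ⟨_, h1.symm.trans (mul_comm _ _)⟩
  refine ⟨z, hx.of_mul hy, ?_⟩
  rw [← Ideal.span_singleton_mul_span_singleton, mul_comm] at h1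
  exact mul_left_cancel₀ (by rw [Ideal.zero_eq_bot, Ne, Ideal.span_singleton_eq_bot]; exact hx.ne_zero) h1

theorem exists_add_eq_zero (q : H.RayClass m) : ∃ r, r + q = 0 := by
  induction q using AddCon.induction_on with
  | _ a =>
    obtain ⟨b, hb⟩ := H.exists_add_mem_principal a
    refine ⟨(b : H.RayClass m), ?_⟩
    rw [add_comm]
    exact (H.mk_eq_zero_iff (a + b)).2 hb

noncomputable instance : Neg (H.RayClass m) := ⟨fun q => (H.exists_add_eq_zero q).choose⟩

noncomputable instance : AddCommGroup (H.RayClass m) :=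
  { (inferInstance : AddCommMonoid (H.RayClass m)) with
    zsmul := zsmulRec
    neg_add_cancel := fun q => (H.exists_add_eq_zero q).choose_spec }

include H in
theorem one_lt_absNorm (p : PrimeAway O m) : 1 < Ideal.absNorm (p : Ideal O) := by
  have h1 : Ideal.absNorm (p : Ideal O) ≠ 1 := fun h =>
    (Ideal.isPrime_of_prime p.2.1).ne_top (Ideal.absNorm_eq_one_iff.1 h)
  have h2 : Ideal.absNorm (p : Ideal O) ≠ 0 := fun h => p.2.1.ne_zero (Ideal.absNorm_eq_zero_iff.1 h)
  omega

include H in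
theorem absNorm_pos (a : PrimeAway O m →₀ ℕ) : 0 < Ideal.absNorm (toIdeal a) := by
  have := H.charZero
  exact Nat.pos_of_ne_zero fun h => toIdeal_ne_bot a (Ideal.absNorm_eq_zero_iff.1 h)

include H in
theorem linearCombination_log (a : PrimeAway O m →₀ ℕ) :
    Finsupp.linearCombination ℕ (fun p : PrimeAway O m => Real.log (Ideal.absNorm (p : Ideal O))) a =
      Real.log (Ideal.absNorm (toIdeal a)) := by
  induction a using Finsupp.induction_linear with
  | zero => simp [toIdeal_zero]
  | add a b ha hb =>
    have h1 := H.absNorm_pos a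
    have h2 := H.absNorm_pos b
    rw [map_add, ha, hb, toIdeal_add, map_mul, Nat.cast_mul, Real.log_mul (by positivity) (by positivity)]
  | single p n => rw [toIdeal_single, Finsupp.linearCombination_single]; simp

variable (m)

/-- The monoid of ideals prime to `m`, with its narrow ray class map. -/
noncomputable def classSystem : ClassSystem (PrimeAway O m) (H.RayClass m) where
  wt p := Real.log (Ideal.absNorm (p : Ideal O))
  wt_pos p := Real.log_pos (by exact_mod_cast H.one_lt_absNorm p)
  cls p := ((Finsupp.single p 1 : PrimeAway O m →₀ ℕ) : H.RayClass m)
  finite_ball y := by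
    have := H.charZero
    refine ((Ideal.finite_setOfPred_absNorm_le (S := O) ⌊Real.exp y⌋₊).preimage
      (toIdeal_injective (m := m)).injOn).subset fun a ha => ?_
    rw [Set.mem_ofPred_eq, H.linearCombination_log] at ha
    have h1 := H.absNorm_pos a
    exact Nat.le_floor ((Real.log_le_iff_le_exp (by exact_mod_cast h1)).1 ha)

variable {m}

theorem len_eq (a : PrimeAway O m →₀ ℕ) :
    (H.classSystem m).len a = Real.log (Ideal.absNorm (toIdeal a)) := H.linearCombination_log a

theorem exp_len (a : PrimeAway O m →₀ ℕ) :
    Real.exp ((H.classSystem m).len a) = Ideal.absNorm (toIdeal a) := by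
  rw [H.len_eq, Real.exp_log (by exact_mod_cast H.absNorm_pos a)]

theorem cl_eq (a : PrimeAway O m →₀ ℕ) : (H.classSystem m).cl a = (a : H.RayClass m) := by
  have h0 : ∀ a b : PrimeAway O m →₀ ℕ, ((a + b : PrimeAway O m →₀ ℕ) : H.RayClass m) = a + b := fun _ _ => rfl
  have h1 : ((0 : PrimeAway O m →₀ ℕ) : H.RayClass m) = 0 := rfl
  induction a using Finsupp.induction_linear with
  | zero => rw [map_zero, h1]
  | add a b ha hb => rw [map_add, ha, hb, h0]
  | single p n =>
    induction n with
    | zero => rw [Finsupp.single_zero, map_zero, h1]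
    | succ n ih =>
      rw [Finsupp.single_add, map_add, ih, h0]
      congr 1
      rw [ClassSystem.cl, Finsupp.linearCombination_single, one_nsmul]
      rfl

theorem cl_eq_zero_iff (a : PrimeAway O m →₀ ℕ) :
    (H.classSystem m).cl a = 0 ↔ ∃ x, H.Pos m x ∧ toIdeal a = Ideal.span {x} := by
  rw [cl_eq, mk_eq_zero_iff]

theorem cl_surjective (g : H.RayClass m) : ∃ a, (H.classSystem m).cl a = g := by
  induction g using AddCon.induction_on with
  | _ a => exact ⟨a, H.cl_eq a⟩

end RealQuad

section
open MeasureTheory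

/-- A weight on the positive quadrant in logarithmic coordinates. -/
noncomputable def logCone (φ θ : ℝ → ℝ) (z : ℝ × ℝ) : ℝ :=
  if 0 < z.1 ∧ 0 < z.2 then φ (Real.log z.1 + Real.log z.2) * θ (Real.log z.1 - Real.log z.2) else 0

section logCone
variable {φ θ : ℝ → ℝ} {β B : ℝ} (hφ : ∀ t, t ∉ Set.Icc 0 β → φ t = 0) (hθ : ∀ t, B < |t| → θ t = 0)
include hφ hθ

theorem mem_of_logCone_ne_zero {z : ℝ × ℝ} (hz : logCone φ θ z ≠ 0) : (0 < z.1 ∧ 0 < z.2) ∧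
    z ∈ Set.Icc (Real.exp (-(β + B))) (Real.exp (β + B)) ×ˢ Set.Icc (Real.exp (-(β + B))) (Real.exp (β + B)) := by
  unfold logCone at hz
  split_ifs at hz with h
  · refine ⟨h, ?_⟩
    have h1 : Real.log z.1 + Real.log z.2 ∈ Set.Icc 0 β := by
      by_contra hc; exact hz (by rw [hφ _ hc, zero_mul])
    have h2 : |Real.log z.1 - Real.log z.2| ≤ B := by
      by_contra hc; exact hz (by rw [hθ _ (not_le.1 hc), mul_zero])
    have h3 := abs_le.1 h2
    have h4 := h1.1
    have h5 := h1.2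
    refine ⟨⟨?_, ?_⟩, ⟨?_, ?_⟩⟩
    · rw [← Real.le_log_iff_exp_le h.1]; linarith
    · rw [← Real.log_le_iff_le_exp h.1]; linarith
    · rw [← Real.le_log_iff_exp_le h.2]; linarith
    · rw [← Real.log_le_iff_le_exp h.2]; linarith
  · exact absurd rfl hz

theorem logCone_compact : HasCompactSupport (logCone φ θ) :=
  HasCompactSupport.intro (isCompact_Icc.prod isCompact_Icc) fun z hz => by
    by_contra h; exact hz (mem_of_logCone_ne_zero hφ hθ h).2

theorem logCone_contDiff (h1 : ContDiff ℝ 2 φ) (h2 : ContDiff ℝ 2 θ) : ContDiff ℝ 2 (logCone φ θ) := by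
  rw [contDiff_iff_contDiffAt]
  intro z
  by_cases hz : z ∈ Set.Icc (Real.exp (-(β + B))) (Real.exp (β + B)) ×ˢ Set.Icc (Real.exp (-(β + B))) (Real.exp (β + B))
  · have hz1 : 0 < z.1 := (Real.exp_pos _).trans_le hz.1.1
    have hz2 : 0 < z.2 := (Real.exp_pos _).trans_le hz.2.1
    have hev : logCone φ θ =ᶠ[nhds z] fun z => φ (Real.log z.1 + Real.log z.2) * θ (Real.log z.1 - Real.log z.2) := by
      filter_upwards [continuous_fst.continuousAt.eventually (lt_mem_nhds hz1),
        continuous_snd.continuousAt.eventually (lt_mem_nhds hz2)] with y hy1 hy2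
      exact if_pos ⟨hy1, hy2⟩
    refine ContDiffAt.congr_of_eventuallyEq ?_ hev
    have l1 : ContDiffAt ℝ 2 (fun z : ℝ × ℝ => Real.log z.1) z := contDiffAt_fst.log hz1.ne'
    have l2 : ContDiffAt ℝ 2 (fun z : ℝ × ℝ => Real.log z.2) z := contDiffAt_snd.log hz2.ne'
    exact (h1.contDiffAt.comp z (l1.add l2)).mul (h2.contDiffAt.comp z (l1.sub l2))
  · have hev : logCone φ θ =ᶠ[nhds z] fun _ => 0 := by
      filter_upwards [(isClosed_Icc.prod isClosed_Icc).isOpen_compl.mem_nhds hz] with y hy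
      by_contra h
      exact hy (mem_of_logCone_ne_zero hφ hθ h).2
    exact contDiffAt_const.congr_of_eventuallyEq hev

theorem logCone_integral_pos (h1 : ContDiff ℝ 2 φ) (h2 : ContDiff ℝ 2 θ) (h3 : ∀ t, 0 ≤ φ t)
    (h4 : ∀ t, 0 ≤ θ t) (h5 : θ 0 = 1) {t : ℝ} (ht : φ t ≠ 0) : 0 < ∫ z, logCone φ θ z := by
  refine (logCone_contDiff hφ hθ h1 h2).continuous.integral_pos_of_hasCompactSupport_nonneg_nonzero
    (x := (Real.exp (t / 2), Real.exp (t / 2))) (logCone_compact hφ hθ) (fun z => ?_) ?_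
  · rw [Pi.zero_apply, logCone]
    split_ifs
    exacts [mul_nonneg (h3 _) (h4 _), le_rfl]
  · rw [logCone, if_pos ⟨Real.exp_pos _, Real.exp_pos _⟩]
    simp only [Real.log_exp, sub_self, add_halves, h5, mul_one]
    exact ht

end logCone

namespace RealQuad

variable {D : ℤ} {O : Type} [CommRing O] [IsDedekindDomain O] [Module.Free ℤ O]
  [Module.Finite ℤ O] (H : RealQuad D O) {m : ℤ}

theorem finite_bounded (R : ℝ) : {x : O | |H.σ x| ≤ R ∧ |H.τ x| ≤ R}.Finite := by
  choose tr htr using H.trace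
  have hs := H.sqrt_pos
  obtain ⟨K, hK⟩ := exists_nat_gt (2 * R + 2 * R * √(D : ℝ))
  have hbd : ∀ n : ℤ, |(n : ℝ)| ≤ 2 * R + 2 * R * √(D : ℝ) → n ∈ Set.Icc (-(K : ℤ)) K := by
    intro n hn
    have := abs_le.1 (hn.trans hK.le)
    exact ⟨by exact_mod_cast this.1, by exact_mod_cast this.2⟩
  refine Set.Finite.of_injOn (f := fun x => (tr x, tr (x * H.sqrtD)))
    (t := Set.Icc (-(K : ℤ)) K ×ˢ Set.Icc (-(K : ℤ)) K) ?_ ?_ ((Set.finite_Icc _ _).prod (Set.finite_Icc _ _))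
  · rintro x ⟨h1, h2⟩
    have hR : 0 ≤ R := (abs_nonneg _).trans h1
    refine ⟨hbd _ ?_, hbd _ ?_⟩
    · rw [← htr]
      exact (abs_add_le _ _).trans (by nlinarith [mul_nonneg hR hs.le])
    · rw [← htr, map_mul, map_mul, H.σ_sqrtD, H.τ_sqrtD]
      refine (abs_add_le _ _).trans ?_
      rw [abs_mul, abs_mul, abs_neg, abs_of_pos hs]
      nlinarith
  · intro x _ y _ h
    simp only [Prod.mk.injEq] at h
    have h1 := htr x
    have h2 := htr (x * H.sqrtD)
    rw [h.1, ← htr] at h1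
    rw [h.2, ← htr, map_mul, map_mul, map_mul, map_mul, H.σ_sqrtD, H.τ_sqrtD] at h2
    apply H.σ_inj
    have : (H.σ x - H.σ y) * √(D : ℝ) = 0 := by linear_combination (√(D : ℝ) * h1 + h2) / 2
    exact sub_eq_zero.1 ((mul_eq_zero.1 this).resolve_right hs.ne')

/-- The covolume of the ring of integers. -/
noncomputable def covol : ℝ :=
  |H.σ (H.basis 0) * H.τ (H.basis 1) - H.σ (H.basis 1) * H.τ (H.basis 0)|

theorem det_eq (f : Fin 2 → O) : H.σ (f 0) * H.τ (f 1) - H.σ (f 1) * H.τ (f 0) = H.basis.det f *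
    (H.σ (H.basis 0) * H.τ (H.basis 1) - H.σ (H.basis 1) * H.τ (H.basis 0)) := by
  have h : ∀ i, f i = (H.basis.toMatrix f 0 i : O) * H.basis 0 + (H.basis.toMatrix f 1 i : O) * H.basis 1 := fun i => by
    have := (H.basis.sum_repr (f i)).symm
    rw [Fin.sum_univ_two] at this
    simpa [zsmul_eq_mul, Module.Basis.toMatrix_apply] using this
  rw [Module.Basis.det_apply, Matrix.det_fin_two]
  conv_lhs => rw [h 0, h 1]
  simp only [map_add, map_mul, map_intCast]
  push_cast
  ring

theorem covol_pos : 0 < H.covol := by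
  refine abs_pos.2 fun h => ?_
  have := H.det_eq ![1, H.sqrtD]
  rw [h, mul_zero] at this
  simp only [Matrix.cons_val_zero, Matrix.cons_val_one, map_one, H.σ_sqrtD, H.τ_sqrtD] at this
  linarith [H.sqrt_pos]

theorem abs_det_eq {I : Ideal O} (bI : Module.Basis (Fin 2) ℤ I) :
    |H.σ (bI 0) * H.τ (bI 1) - H.σ (bI 1) * H.τ (bI 0)| = Ideal.absNorm I * H.covol := by
  have := H.det_eq (Subtype.val ∘ bI)
  simp only [Function.comp_apply] at this
  rw [this, abs_mul, covol, ← Ideal.natAbs_det_basis_change H.basis I bI, Nat.cast_natAbs, Int.cast_abs]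

/-- Smoothed counting of ideals in a ray class. -/
theorem exists_abs_sum_sub_le (hm : m ≠ 0) {φ θ : ℝ → ℝ} {β B : ℝ} (hβ : 0 ≤ β)
    (hφ : ∀ t, t ∉ Set.Icc 0 β → φ t = 0)
    (hθ : ∀ t, B < |t| → θ t = 0) (h1 : ContDiff ℝ 2 φ) (h2 : ContDiff ℝ 2 θ)
    (hcut : ∀ γ : O, H.Pos m γ → ∀ E : Finset O,
      (∀ x, x ∈ E → Associated γ x ∧ H.Pos m x) →
      (∀ x, Associated γ x → H.Pos m x → θ (Real.log (H.σ x / H.τ x)) ≠ 0 → x ∈ E) →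
      ∑ x ∈ E, θ (Real.log (H.σ x / H.τ x)) = 1) [DecidableEq (H.RayClass m)] (g : H.RayClass m) :
    ∃ C, ∀ x, |(∑ a ∈ (H.classSystem m).ball (x + β) with (H.classSystem m).cl a = g,
      φ ((H.classSystem m).len a - x)) - (m ^ 2 * H.covol)⁻¹ * (∫ z, logCone φ θ z) * Real.exp x| ≤ C := by
  classical
  obtain ⟨A, hA⟩ : ∃ A, A = H.classSystem m := ⟨_, rfl⟩
  rw [← hA]
  obtain ⟨b, hb⟩ := H.cl_surjective (-g)
  rw [← hA] at hb
  obtain ⟨c, hc⟩ : ∃ c, c = toIdeal b := ⟨_, rfl⟩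
  obtain ⟨γ₀, hγ₀, -, hγ₀1⟩ := exists_mem_dvd_sub_one b
  rw [← hc] at hγ₀
  have hcop : IsCoprime c (Ideal.span {(m : O)}) := hc ▸ toIdeal_isCoprime b
  have hchar := H.charZero
  have hm0 : (m : O) ≠ 0 := Int.cast_ne_zero.2 hm
  have hLmem : ∀ x, x ∈ c * Ideal.span {(m : O)} ↔ x ∈ c ∧ (m : O) ∣ x := fun x => by
    rw [Ideal.mul_eq_inf_of_isCoprime hcop, Ideal.mem_inf, Ideal.mem_span_singleton]
  obtain ⟨nc, hnc⟩ : ∃ nc : ℝ, nc = Ideal.absNorm c := ⟨_, rfl⟩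
  have hnc1 : 1 ≤ nc := by
    rw [hnc, hc]; exact_mod_cast H.absNorm_pos b
  have hc0 : c ≠ ⊥ := hc ▸ toIdeal_ne_bot b
  have hL0 : c * Ideal.span {(m : O)} ≠ ⊥ :=
    mul_ne_zero hc0 (by rw [Ideal.zero_eq_bot, Ne, Ideal.span_singleton_eq_bot]; exact hm0)
  have hLnorm : (Ideal.absNorm (c * Ideal.span {(m : O)}) : ℝ) = nc * m ^ 2 := by
    rw [map_mul, Nat.cast_mul, ← hnc, H.norm, map_intCast, map_intCast, ← sq, abs_of_nonneg (sq_nonneg _)]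
  have bI := Ideal.selfBasis H.basis _ hL0
  have hdet := H.abs_det_eq bI
  rw [hLnorm] at hdet
  have hm2 : (0 : ℝ) < m ^ 2 := by positivity
  have hdet0 : H.σ (bI 0) * H.τ (bI 1) - H.σ (bI 1) * H.τ (bI 0) ≠ 0 := by
    rw [← abs_pos, hdet]
    have := H.covol_pos
    positivity
  obtain ⟨C, hC⟩ := exists_lattice_sum_le (logCone_contDiff hφ hθ h1 h2) (logCone_compact hφ hθ)
    (p := fun i => H.σ (bI i)) (q := fun i => H.τ (bI i)) hdet0
  simp only [hdet] at hC
  obtain ⟨e, he⟩ : ∃ e : ℤ × ℤ → O, ∀ j, e j = γ₀ + (j.1 * bI 0 + j.2 * bI 1) := ⟨_, fun _ => rfl⟩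
  have heinj : Function.Injective e := by
    intro i j h
    rw [he, he] at h
    have h3 := Fintype.linearIndependent_iff.1 bI.linearIndependent ![i.1 - j.1, i.2 - j.2] (by
      apply Subtype.ext
      simp only [Fin.sum_univ_two, Submodule.coe_add, Submodule.coe_smul, zsmul_eq_mul, ZeroMemClass.coe_zero, Matrix.cons_val_zero, Matrix.cons_val_one]
      push_cast
      linear_combination h)
    have h30 := h3 0
    have h31 := h3 1
    simp only [Matrix.cons_val_zero, Matrix.cons_val_one, sub_eq_zero] at h30 h31
    exact Prod.ext h30 h31
  have hemem : ∀ j, e j ∈ c ∧ (m : O) ∣ e j - 1 := fun j => by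
    have h3 := (hLmem _).1 ((c * Ideal.span {(m : O)}).add_mem (Ideal.mul_mem_left _ (j.1 : O) (bI 0).2)
      (Ideal.mul_mem_left _ (j.2 : O) (bI 1).2))
    rw [he]
    exact ⟨c.add_mem hγ₀ h3.1, by rw [add_sub_right_comm]; exact dvd_add hγ₀1 h3.2⟩
  have hesurj : ∀ x ∈ c, (m : O) ∣ x - 1 → ∃ j, e j = x := fun x hx hx1 => by
    have h3 : x - γ₀ ∈ c * Ideal.span {(m : O)} := (hLmem _).2 ⟨c.sub_mem hx hγ₀, by
      rw [← sub_sub_sub_cancel_right x γ₀ 1]; exact dvd_sub hx1 hγ₀1⟩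
    refine ⟨(bI.repr ⟨_, h3⟩ 0, bI.repr ⟨_, h3⟩ 1), ?_⟩
    have h4 := congrArg Subtype.val (bI.sum_repr ⟨_, h3⟩)
    rw [Fin.sum_univ_two] at h4
    push_cast at h4
    simp only [zsmul_eq_mul] at h4
    rw [he]
    linear_combination h4
  obtain ⟨Mφ, hMφ⟩ := isCompact_Icc.exists_bound_of_continuousOn (s := Set.Icc 0 β) h1.continuous.continuousOn
  have hMφ' : ∀ t, |φ t| ≤ |Mφ| := fun t => by
    by_cases ht : t ∈ Set.Icc 0 β
    · exact (hMφ t ht).trans (le_abs_self _)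
    · rw [hφ t ht, abs_zero]; exact abs_nonneg _
  obtain ⟨κ, hκ⟩ : ∃ κ, κ = (m ^ 2 * H.covol)⁻¹ * ∫ z, logCone φ θ z := ⟨_, rfl⟩
  rw [← hκ]
  refine ⟨max C ((A.ball β).card * |Mφ| + |κ|), fun x => ?_⟩
  rcases lt_or_ge x 0 with hx | hx
  · refine le_trans ?_ (le_max_right _ _)
    refine (abs_sub _ _).trans (add_le_add ?_ ?_)
    · refine (Finset.abs_sum_le_sum_abs _ _).trans ((Finset.sum_le_sum fun a _ => hMφ' _).trans ?_)
      rw [Finset.sum_const, nsmul_eq_mul]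
      gcongr
      exact (Finset.filter_subset _ _).trans (A.ball_mono (by linarith))
    · rw [abs_mul, abs_of_pos (Real.exp_pos x)]
      exact mul_le_of_le_one_right (abs_nonneg _) (Real.exp_le_one_iff.2 hx.le)
  refine le_trans ?_ (le_max_left _ _)
  obtain ⟨T, hT⟩ : ∃ T, T = √(nc * Real.exp x) := ⟨_, rfl⟩
  have hncx : 1 ≤ nc * Real.exp x := one_le_mul_of_one_le_of_one_le hnc1 (Real.one_le_exp hx)
  have hT1 : 1 ≤ T := hT ▸ Real.one_le_sqrt.2 hncx
  have hT0 : 0 < T := by linarith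
  have hT2 : T ^ 2 = nc * Real.exp x := by rw [hT, Real.sq_sqrt (by linarith)]
  obtain ⟨w, hw⟩ : ∃ w : O → ℝ, ∀ γ, w γ = logCone φ θ (H.σ γ / T, H.τ γ / T) := ⟨_, fun _ => rfl⟩
  have hwpos : ∀ γ, w γ ≠ 0 → 0 < H.σ γ ∧ 0 < H.τ γ := fun γ h => by
    rw [hw] at h
    have h3 := (mem_of_logCone_ne_zero hφ hθ h).1
    exact ⟨(div_pos_iff_of_pos_right hT0).1 h3.1, (div_pos_iff_of_pos_right hT0).1 h3.2⟩
  have hfin : {j | w (e j) ≠ 0}.Finite := by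
    refine ((H.finite_bounded (Real.exp (β + B) * T)).preimage heinj.injOn).subset fun j hj => ?_
    have h3 := hwpos _ hj
    rw [Set.mem_ofPred_eq, hw] at hj
    have h4 := (mem_of_logCone_ne_zero hφ hθ hj).2
    exact ⟨by rw [abs_of_pos h3.1]; exact (div_le_iff₀ hT0).1 h4.1.2,
      by rw [abs_of_pos h3.2]; exact (div_le_iff₀ hT0).1 h4.2.2⟩
  have hcount := hC T hT1 (H.σ γ₀) (H.τ γ₀) hfin.toFinset
  have hwe : ∀ j : ℤ × ℤ, logCone φ θ ((H.σ γ₀ + j.1 * H.σ (bI 0) + j.2 * H.σ (bI 1)) / T,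
      (H.τ γ₀ + j.1 * H.τ (bI 0) + j.2 * H.τ (bI 1)) / T) = w (e j) := fun j => by
    rw [hw, he]; simp only [map_add, map_mul, map_intCast, add_assoc]
  simp only [hwe] at hcount
  have hcount := hcount fun j hj => hfin.mem_toFinset.2 hj
  have hmain : T ^ 2 * ((nc * m ^ 2 * H.covol)⁻¹ * ∫ z, logCone φ θ z) = κ * Real.exp x := by
    rw [hT2, hκ]
    have := H.covol_pos
    field_simp
  rw [hmain] at hcount
  suffices hs : ∑ a ∈ A.ball (x + β) with A.cl a = g, φ (A.len a - x) = ∑ j ∈ hfin.toFinset, w (e j) by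
    rw [hs]; exact hcount
  obtain ⟨E, hE⟩ : ∃ E : Finset O, E = hfin.toFinset.map ⟨e, heinj⟩ := ⟨_, rfl⟩
  have hEmem : ∀ γ, γ ∈ E ↔ γ ∈ c ∧ H.Pos m γ ∧ w γ ≠ 0 := fun γ => by
    rw [hE, Finset.mem_map]
    constructor
    · rintro ⟨j, hj, rfl⟩
      have hj' : w (e j) ≠ 0 := hfin.mem_toFinset.1 hj
      exact ⟨(hemem j).1, ⟨(hemem j).2, hwpos _ hj'⟩, hj'⟩
    · rintro ⟨h3, h4, h5⟩
      obtain ⟨j, rfl⟩ := hesurj γ h3 h4.1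
      exact ⟨j, hfin.mem_toFinset.2 h5, rfl⟩
  have hwval : ∀ a γ, H.Pos m γ → Ideal.span {γ} = toIdeal a * c →
      w γ = φ (A.len a - x) * θ (Real.log (H.σ γ / H.τ γ)) := fun a γ hγ h => by
    have h3 := H.norm γ
    rw [h, map_mul, Nat.cast_mul, ← hnc, abs_of_pos (mul_pos hγ.2.1 hγ.2.2)] at h3
    have h4 : (0 : ℝ) < Ideal.absNorm (toIdeal a) := by exact_mod_cast H.absNorm_pos a
    have h5 := congrArg Real.log h3
    rw [Real.log_mul h4.ne' (by positivity), Real.log_mul hγ.2.1.ne' hγ.2.2.ne', ← H.len_eq, ← hA] at h5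
    have h6 := congrArg Real.log hT2
    rw [Real.log_pow, Real.log_mul (by positivity) (Real.exp_pos _).ne', Real.log_exp] at h6
    rw [hw, logCone, if_pos ⟨div_pos hγ.2.1 hT0, div_pos hγ.2.2 hT0⟩]
    simp only [Real.log_div hγ.2.1.ne' hT0.ne', Real.log_div hγ.2.2.ne' hT0.ne', Real.log_div hγ.2.1.ne' hγ.2.2.ne']
    push_cast at h6
    congr 2 <;> linarith
  have hsum : ∑ j ∈ hfin.toFinset, w (e j) = ∑ γ ∈ E, w γ := by rw [hE, Finset.sum_map]; rfl
  rw [hsum]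
  have hcl : ∀ a, A.cl a = g ↔ ∃ γ, H.Pos m γ ∧ Ideal.span {γ} = toIdeal a * c := fun a => by
    have h3 : A.cl a = g ↔ A.cl (a + b) = 0 := by rw [map_add, hb, ← sub_eq_add_neg, sub_eq_zero]
    rw [h3, hA, H.cl_eq_zero_iff, toIdeal_add, hc]
    simp only [eq_comm]
  have hfib : ∀ a, A.cl a = g → φ (A.len a - x) = ∑ γ ∈ E, if Ideal.span {γ} = toIdeal a * c then w γ else 0 := by
    intro a ha
    obtain ⟨γ, hγ, hγa⟩ := (hcl a).1 ha
    rw [← Finset.sum_filter]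
    have h3 : ∀ y ∈ E.filter (fun γ => Ideal.span {γ} = toIdeal a * c),
        w y = φ (A.len a - x) * θ (Real.log (H.σ y / H.τ y)) := fun y hy => by
      rw [Finset.mem_filter, hEmem] at hy
      exact hwval a y hy.1.2.1 hy.2
    rw [Finset.sum_congr rfl h3, ← Finset.mul_sum]
    by_cases h0 : φ (A.len a - x) = 0
    · rw [h0, zero_mul]
    rw [hcut γ hγ, mul_one]
    · intro y hy
      rw [Finset.mem_filter, hEmem] at hy
      exact ⟨Ideal.span_singleton_eq_span_singleton.1 (hγa.trans hy.2.symm), hy.1.2.1⟩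
    · intro y hy hyp hθy
      have h4 : Ideal.span {y} = toIdeal a * c := (Ideal.span_singleton_eq_span_singleton.2 hy).symm.trans hγa
      rw [Finset.mem_filter, hEmem]
      refine ⟨⟨?_, hyp, ?_⟩, h4⟩
      · rw [← Ideal.dvd_span_singleton, h4]; exact dvd_mul_left _ _
      · rw [hwval a y hyp h4]; exact mul_ne_zero h0 hθy
  rw [Finset.sum_congr rfl fun a ha => hfib a (Finset.mem_filter.1 ha).2, Finset.sum_comm]
  refine Finset.sum_congr rfl fun γ hγ => ?_
  obtain ⟨h3, h4, h5⟩ := (hEmem γ).1 hγ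
  obtain ⟨J, hJ⟩ := Ideal.dvd_span_singleton.2 h3
  have hJ0 : J ≠ ⊥ := by
    rintro rfl
    rw [← Ideal.zero_eq_bot, mul_zero, Ideal.zero_eq_bot, Ideal.span_singleton_eq_bot] at hJ
    exact h4.ne_zero hJ
  obtain ⟨a, rfl⟩ := exists_toIdeal_eq (m := m) hJ0 (isCoprime_of_dvd_sub_one h4.1 ⟨_, hJ.trans (mul_comm _ _)⟩)
  have h6 : Ideal.span {γ} = toIdeal a * c := hJ.trans (mul_comm _ _)
  rw [Finset.sum_eq_single a, if_pos h6]
  · intro a' _ hne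
    refine if_neg fun h => hne (toIdeal_injective (mul_right_cancel₀ hc0 (h.symm.trans h6)))
  · intro ha
    exfalso
    refine ha (Finset.mem_filter.2 ⟨A.mem_ball.2 ?_, (hcl a).2 ⟨γ, h4, h6⟩⟩)
    rw [hwval a γ h4 h6] at h5
    by_contra h7
    exact h5 (by rw [hφ _ fun h => h7 (by linarith [h.2]), zero_mul])

end RealQuad
end

section
open MeasureTheory

namespace RealQuad

/-- The set of natural numbers that are norms of elements of a finite set. -/
noncomputable def normImage {O : Type} [CommRing O] [IsDedekindDomain O] [Module.Free ℤ O] {m : ℤ}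
    (s : Finset (PrimeAway O m →₀ ℕ)) : Finset ℕ := s.image fun a => Ideal.absNorm (toIdeal a)

variable {D : ℤ} {O : Type} [CommRing O] [IsDedekindDomain O] [Module.Free ℤ O]
  [Module.Finite ℤ O] (H : RealQuad D O) {m : ℤ}

theorem exists_bump : ∃ k : ℝ → ℝ, ContDiff ℝ 2 k ∧ (∀ t, 0 ≤ k t) ∧ (∀ t ∉ Set.Icc (0:ℝ) 1, k t = 0) ∧
    ∫ t, k t = 1 := by
  let f : ContDiffBump (1 / 2 : ℝ) := ⟨1 / 4, 1 / 2, by norm_num, by norm_num⟩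
  refine ⟨f.normed volume, f.contDiff_normed, f.nonneg_normed, fun t ht => ?_, f.integral_normed⟩
  by_contra h
  have h1 : t ∈ Function.support (f.normed volume) := h
  rw [f.support_normed_eq, Metric.mem_ball, Real.dist_eq, abs_lt] at h1
  have h2 : f.rOut = 1 / 2 := rfl
  rw [h2] at h1
  exact ht ⟨by linarith, by linarith⟩

include H in
theorem absNorm_natCast (n : ℕ) : Ideal.absNorm (Ideal.span {(n : O)}) = n ^ 2 := by
  have h := H.norm n
  rw [map_natCast, map_natCast, abs_of_nonneg (by positivity), ← pow_two] at h
  exact_mod_cast h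

include H in
theorem exists_prime_mem (p : PrimeAway O m) : ∃ q : ℕ, q.Prime ∧ (q : O) ∈ (p : Ideal O) := by
  have h1 := Ideal.isPrime_of_prime p.2.1
  have h2 := Ideal.absNorm_mem (p : Ideal O)
  have h3 := H.one_lt_absNorm p
  generalize Ideal.absNorm (p : Ideal O) = n at h2 h3
  induction n using induction_on_primes with
  | zero => omega
  | one => omega
  | prime_mul q n hq ih =>
    rw [Nat.cast_mul] at h2
    rcases h1.mem_or_mem h2 with h | h
    · exact ⟨q, hq, h⟩
    · by_cases hn : 1 < n
      · exact ih h hn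
      · have : n = 0 ∨ n = 1 := by omega
        rcases this with rfl | rfl
        · omega
        · exact absurd ((Ideal.eq_top_iff_one _).2 (by simpa using h)) h1.ne_top

include H in
theorem prod_absNorm_dvd (s : Finset (PrimeAway O m)) (q : ℕ) (h : ∀ p ∈ s, (q : O) ∈ (p : Ideal O)) :
    ∏ p ∈ s, Ideal.absNorm (p : Ideal O) ∣ q ^ 2 := by
  have h1 : ∏ p ∈ s.map (Function.Embedding.subtype _), p ∣ Ideal.span {(q : O)} := by
    refine Finset.prod_primes_dvd _ (fun p hp => ?_) fun p hp => ?_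
    · obtain ⟨p, -, rfl⟩ := Finset.mem_map.1 hp
      exact p.2.1
    · obtain ⟨p, hp', rfl⟩ := Finset.mem_map.1 hp
      exact Ideal.dvd_span_singleton.2 (h _ hp')
  have h2 := map_dvd Ideal.absNorm h1
  rwa [H.absNorm_natCast, map_prod, Finset.prod_map] at h2

include H in
theorem absNorm_eq_pow (p : PrimeAway O m) {q : ℕ} (hq : q.Prime) (h : (q : O) ∈ (p : Ideal O)) :
    ∃ j, j ≠ 0 ∧ j ≤ 2 ∧ Ideal.absNorm (p : Ideal O) = q ^ j := by
  have h1 := H.prod_absNorm_dvd {p} q (by simpa using h)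
  rw [Finset.prod_singleton, Nat.dvd_prime_pow hq] at h1
  obtain ⟨j, hj, h2⟩ := h1
  refine ⟨j, ?_, hj, h2⟩
  rintro rfl
  exact (H.one_lt_absNorm p).ne' (h2.trans (pow_zero q))

include H in
theorem card_le_two_of_mem (s : Finset (PrimeAway O m)) {q : ℕ} (hq : q.Prime)
    (h : ∀ p ∈ s, (q : O) ∈ (p : Ideal O)) : s.card ≤ 2 := by
  have h1 : q ^ s.card ∣ q ^ 2 := by
    rw [← Finset.prod_const]
    refine dvd_trans (Finset.prod_dvd_prod_of_dvd _ _ fun p hp => ?_) (H.prod_absNorm_dvd s q h)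
    obtain ⟨j, hj, -, h2⟩ := H.absNorm_eq_pow p hq (h p hp)
    rw [h2]
    exact dvd_pow_self _ hj
  exact (Nat.pow_dvd_pow_iff_le_right hq.one_lt).1 h1

theorem exists_card_ball_le : ∃ C : ℝ, ∀ y, 0 ≤ y → (((H.classSystem m).ball y).card : ℝ) ≤ C * Real.exp y := by
  have := H.charZero
  obtain ⟨C, hC⟩ := H.count
  refine ⟨C, fun y hy => le_trans ?_ (hC _ (Real.one_le_exp hy))⟩
  have hf : {I : Ideal O | (Ideal.absNorm I : ℝ) ≤ Real.exp y}.Finite :=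
    (Ideal.finite_setOfPred_absNorm_le ⌊Real.exp y⌋₊).subset fun I hI => Nat.le_floor (by exact hI)
  have : Finite {I : Ideal O // (Ideal.absNorm I : ℝ) ≤ Real.exp y} := hf.to_subtype
  rw [Nat.cast_le, ← Nat.card_eq_finsetCard]
  refine Nat.card_le_card_of_injective (fun a => ⟨toIdeal a.1, ?_⟩) fun a b h => ?_
  · rw [← H.exp_len]
    exact Real.exp_le_exp.2 ((ClassSystem.mem_ball _).1 a.2)
  · exact Subtype.ext (toIdeal_injective (Subtype.ext_iff.1 h))

theorem rayClass_finite (hm : m ≠ 0) : Finite (H.RayClass m) := by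
  classical
  by_contra hinf
  rw [not_finite_iff_infinite] at hinf
  obtain ⟨k, hk, hk0, hks, hki⟩ := exists_bump
  obtain ⟨θ, B, h1, h2, h3, h4, hcut⟩ := H.exists_cutoff hm
  obtain ⟨M, hM⟩ := (isCompact_Icc (a := (0:ℝ)) (b := 1)).exists_bound_of_continuousOn hk.continuous.continuousOn
  have hM' : ∀ t, k t ≤ M := fun t => by
    by_cases ht : t ∈ Set.Icc (0:ℝ) 1
    · exact (le_abs_self _).trans (hM t ht)
    · rw [hks t ht]
      exact (norm_nonneg _).trans (hM 0 ⟨le_rfl, zero_le_one⟩)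
  obtain ⟨C₀, hC₀⟩ := H.exists_card_ball_le (m := m)
  obtain ⟨t, ht⟩ : ∃ t, k t ≠ 0 := by
    by_contra! h
    simp [h] at hki
  obtain ⟨κ, hκ⟩ : ∃ κ, κ = ((m:ℝ) ^ 2 * H.covol)⁻¹ * ∫ z, logCone k θ z := ⟨_, rfl⟩
  have hκ0 : 0 < κ := by
    rw [hκ]
    have h5 := H.covol_pos
    have h6 := logCone_integral_pos hks h4 hk h1 hk0 h2 h3 ht
    have h7 : (m:ℝ) ≠ 0 := by exact_mod_cast hm
    positivity
  obtain ⟨n, hn⟩ := exists_nat_gt ((M * C₀ * Real.exp 1 + 1) / κ)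
  rw [div_lt_iff₀ hκ0] at hn
  obtain ⟨s, hs⟩ := Infinite.exists_subset_card_eq (H.RayClass m) n
  choose C hC using fun g => H.exists_abs_sum_sub_le hm zero_le_one hks h4 hk h1 hcut g
  have key : ∀ x, 0 ≤ x → Real.exp x ≤ ∑ g ∈ s, C g := by
    intro x hx
    have h5 : ∑ g ∈ s, (κ * Real.exp x - C g) ≤
        ∑ g ∈ s, ∑ a ∈ (H.classSystem m).ball (x + 1) with (H.classSystem m).cl a = g,
          k ((H.classSystem m).len a - x) := by
      refine Finset.sum_le_sum fun g _ => ?_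
      have := (abs_le.1 (hC g x)).1
      rw [hκ]
      linarith
    have h6 : ∑ g ∈ s, ∑ a ∈ (H.classSystem m).ball (x + 1) with (H.classSystem m).cl a = g,
          k ((H.classSystem m).len a - x) ≤ ∑ a ∈ (H.classSystem m).ball (x + 1),
          k ((H.classSystem m).len a - x) := by
      rw [← Finset.sum_biUnion fun g _ g' _ h => Finset.disjoint_filter.2 fun a _ h1 h2 => h (h1.symm.trans h2)]
      refine Finset.sum_le_sum_of_subset_of_nonneg (fun a ha => ?_) fun _ _ _ => hk0 _
      obtain ⟨g, -, h⟩ := Finset.mem_biUnion.1 ha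
      exact (Finset.mem_filter.1 h).1
    have h7 := Finset.sum_le_card_nsmul ((H.classSystem m).ball (x + 1))
      (fun a => k ((H.classSystem m).len a - x)) M fun a _ => hM' _
    rw [nsmul_eq_mul] at h7
    have h8 := mul_le_mul_of_nonneg_right (hC₀ (x + 1) (by linarith)) ((hk0 t).trans (hM' t))
    rw [Finset.sum_sub_distrib, Finset.sum_const, hs, nsmul_eq_mul] at h5
    rw [Real.exp_add] at h8
    have h9 := mul_le_mul_of_nonneg_right hn.le (Real.exp_pos x).le
    nlinarith
  have h10 := key (|∑ g ∈ s, C g|) (abs_nonneg _)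
  have h11 := Real.add_one_le_exp |∑ g ∈ s, C g|
  have h12 := le_abs_self (∑ g ∈ s, C g)
  linarith

section
variable [Finite (H.RayClass m)]

theorem exists_of_lam_ne_zero {a : PrimeAway O m →₀ ℕ} (h : (H.classSystem m).lam a ≠ 0) :
    ∃ p n, a = Finsupp.single p n ∧ (Ideal.absNorm (toIdeal a)).minFac.Prime ∧
      ((Ideal.absNorm (toIdeal a)).minFac : O) ∈ (p : Ideal O) ∧
      (H.classSystem m).lam a ≤ 2 * ArithmeticFunction.vonMangoldt (Ideal.absNorm (toIdeal a)) := by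
  obtain ⟨p, n, hn, rfl⟩ := ClassSystem.exists_of_lam_ne_zero _ h
  obtain ⟨q, hq, hqp⟩ := H.exists_prime_mem p
  obtain ⟨j, hj, hj2, hN⟩ := H.absNorm_eq_pow p hq hqp
  have hjn : j * n ≠ 0 := mul_ne_zero hj hn
  have h1 : Ideal.absNorm (toIdeal (Finsupp.single p n)) = q ^ (j * n) := by
    rw [toIdeal_single, map_pow, hN, pow_mul]
  rw [h1, hq.pow_minFac hjn, ArithmeticFunction.vonMangoldt_apply_pow hjn,
    ArithmeticFunction.vonMangoldt_apply_prime hq, ClassSystem.lam_single _ _ hn]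
  refine ⟨p, n, rfl, hq, hqp, ?_⟩
  change Real.log (Ideal.absNorm (p : Ideal O)) ≤ _
  rw [hN, Nat.cast_pow, Real.log_pow]
  have : (j : ℝ) ≤ 2 := by exact_mod_cast hj2
  exact mul_le_mul_of_nonneg_right this (Real.log_nonneg (by exact_mod_cast hq.one_le))

theorem sum_lam_le (s : Finset (PrimeAway O m →₀ ℕ)) :
    ∑ a ∈ s, (H.classSystem m).lam a ≤ 4 * ∑ n ∈ normImage s, ArithmeticFunction.vonMangoldt n := by
  classical
  rw [← Finset.sum_fiberwise_of_maps_to (t := normImage s) (g := fun a => Ideal.absNorm (toIdeal a))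
    (fun a ha => Finset.mem_image_of_mem _ ha), Finset.mul_sum]
  refine Finset.sum_le_sum fun n _ => ?_
  rw [← Finset.sum_filter_ne_zero]
  obtain ⟨E, hE⟩ : ∃ E, E = {a ∈ {a ∈ s | Ideal.absNorm (toIdeal a) = n} | (H.classSystem m).lam a ≠ 0} :=
    ⟨_, rfl⟩
  rw [← hE]
  have hmem : ∀ a ∈ E, Ideal.absNorm (toIdeal a) = n ∧ (H.classSystem m).lam a ≠ 0 := fun a ha => by
    rw [hE, Finset.mem_filter, Finset.mem_filter] at ha
    exact ⟨ha.1.2, ha.2⟩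
  have hcard : E.card ≤ 2 := by
    by_contra! hc
    obtain ⟨a, ha, b, hb, c, hc, hab, hac, hbc⟩ := Finset.two_lt_card.1 hc
    have key : ∀ a ∈ E, ∃ p k, a = Finsupp.single p k ∧ n.minFac.Prime ∧ (n.minFac : O) ∈ (p : Ideal O) ∧
        Ideal.absNorm (p : Ideal O) ^ k = n := by
      intro a ha
      obtain ⟨p, k, h1, h2, h3, -⟩ := H.exists_of_lam_ne_zero (hmem a ha).2
      rw [(hmem a ha).1] at h2 h3
      refine ⟨p, k, h1, h2, h3, ?_⟩
      rw [← (hmem a ha).1, h1, toIdeal_single, map_pow]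
    obtain ⟨p, k, rfl, hq, hp, hpn⟩ := key a ha
    obtain ⟨p', k', rfl, -, hp', hpn'⟩ := key b hb
    obtain ⟨r, l, rfl, -, hr, hrn⟩ := key c hc
    have hinj : ∀ {p p' : PrimeAway O m} {k k' : ℕ}, Ideal.absNorm (p : Ideal O) ^ k = n →
        Ideal.absNorm (p' : Ideal O) ^ k' = n → Finsupp.single p k ≠ Finsupp.single p' k' → p ≠ p' := by
      rintro p p' k k' h1 h2 h rfl
      exact h (by rw [Nat.pow_right_injective (H.one_lt_absNorm p) (h1.trans h2.symm)])
    have h1 := H.card_le_two_of_mem {p, p', r} hq (by simp [hp, hp', hr])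
    rw [Finset.card_eq_three.2 ⟨p, p', r, hinj hpn hpn' hab, hinj hpn hrn hac, hinj hpn' hrn hbc, rfl⟩] at h1
    omega
  have hle : ∀ a ∈ E, (H.classSystem m).lam a ≤ 2 * ArithmeticFunction.vonMangoldt n := fun a ha => by
    obtain ⟨p, k, -, -, -, h⟩ := H.exists_of_lam_ne_zero (hmem a ha).2
    rwa [(hmem a ha).1] at h
  refine (Finset.sum_le_card_nsmul _ _ _ hle).trans ?_
  rw [nsmul_eq_mul]
  have h0 : (0:ℝ) ≤ ArithmeticFunction.vonMangoldt n := ArithmeticFunction.vonMangoldt_nonneg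
  have h2 : (E.card : ℝ) ≤ 2 := by exact_mod_cast hcard
  nlinarith

theorem normImage_subset {s : Finset (PrimeAway O m →₀ ℕ)} {y : ℝ} (hs : s ⊆ (H.classSystem m).ball y) :
    normImage s ⊆ Finset.Ioc 0 ⌊Real.exp y⌋₊ := by
  intro n hn
  obtain ⟨a, ha, rfl⟩ := Finset.mem_image.1 hn
  refine Finset.mem_Ioc.2 ⟨H.absNorm_pos a, Nat.le_floor ?_⟩
  rw [← H.exp_len]
  exact Real.exp_le_exp.2 ((ClassSystem.mem_ball _).1 (hs ha))

theorem sum_lam_ball_le (y : ℝ) :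
    ∑ a ∈ (H.classSystem m).ball y, (H.classSystem m).lam a ≤ 4 * (Real.log 4 + 4) * Real.exp y := by
  refine (H.sum_lam_le _).trans ?_
  have h1 := Chebyshev.psi_le_const_mul_self (Real.exp_pos y).le
  have h2 : ∑ n ∈ normImage ((H.classSystem m).ball y), ArithmeticFunction.vonMangoldt n ≤
      Chebyshev.psi (Real.exp y) :=
    Finset.sum_le_sum_of_subset_of_nonneg (H.normImage_subset subset_rfl)
      fun _ _ _ => ArithmeticFunction.vonMangoldt_nonneg
  linarith

open ClassSystem in
theorem exists_kernel (hm : m ≠ 0) : ∃ (k : ℝ → ℝ) (β κ C : ℝ), (H.classSystem m).Kernel k β κ C := by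
  classical
  obtain ⟨k, hk, hk0, hks, hki⟩ := exists_bump
  obtain ⟨θ, B, h1, h2, h3, h4, hcut⟩ := H.exists_cutoff hm
  obtain ⟨t, ht⟩ : ∃ t, k t ≠ 0 := by
    by_contra! h
    simp [h] at hki
  choose C₁ hC₁ using fun g => H.exists_abs_sum_sub_le hm zero_le_one hks h4 hk h1 hcut g
  choose C₂ hC₂ using fun g => H.exists_abs_sum_sub_le hm zero_le_one (φ := fun t => t * k t)
    (fun t ht => by rw [hks t ht, mul_zero]) h4 (contDiff_id.mul hk) h1 hcut g
  obtain ⟨M₁, hM₁⟩ := Finite.exists_le C₁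
  obtain ⟨M₂, hM₂⟩ := Finite.exists_le C₂
  have hκ : 0 < ((m:ℝ) ^ 2 * H.covol)⁻¹ * ∫ z, logCone k θ z := by
    have h5 := H.covol_pos
    have h6 := logCone_integral_pos hks h4 hk h1 hk0 h2 h3 ht
    have h7 : (m:ℝ) ≠ 0 := by exact_mod_cast hm
    positivity
  obtain ⟨κ, C, h⟩ := ClassSystem.exists_kernel (A := H.classSystem m) hk.continuous hk0 hks hki one_pos hκ
    (fun g x => (hC₁ g x).trans (hM₁ g)) (fun g x => (hC₂ g x).trans (hM₂ g)) H.sum_lam_ball_le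
  exact ⟨k, 1, κ, C, h⟩

theorem exists_primes_of_class (hm : m ≠ 0) : ∃ c > 0, ∃ X₀ : ℝ, ∀ X, X₀ ≤ X → ∀ g : H.RayClass m,
    ∃ s : Finset ℕ, (∀ q ∈ s, q.Prime ∧ (q:ℝ) ≤ X ∧
      ∃ a, (H.classSystem m).cl a = g ∧ Ideal.absNorm (toIdeal a) = q) ∧ c * X / Real.log X ≤ s.card := by
  classical
  obtain ⟨k, β, κ, C, hK⟩ := H.exists_kernel hm
  obtain ⟨c, hc, Y, h⟩ := hK.exists_le_sum_lam
  obtain ⟨C', hC'⟩ := Chebyshev.psi_sub_theta_le_mul_sqrt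
  refine ⟨c / 8, by positivity, max (Real.exp Y) (max 2 ((8 * C' / c) ^ 2)), fun X hX g => ?_⟩
  have hX2 : 2 ≤ X := (le_max_left _ _).trans ((le_max_right _ _).trans hX)
  have hX0 : 0 < X := by linarith
  have h1 := h (Real.log X) ((Real.le_log_iff_exp_le hX0).2 ((le_max_left _ _).trans hX)) g
  obtain ⟨E, hE⟩ : ∃ E, E = {a ∈ (H.classSystem m).ball (Real.log X) | (H.classSystem m).cl a = g} := ⟨_, rfl⟩
  rw [← hE, Real.exp_log hX0] at h1
  have hsub := H.normImage_subset (hE ▸ Finset.filter_subset _ _ : E ⊆ (H.classSystem m).ball (Real.log X))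
  rw [Real.exp_log hX0] at hsub
  have h2 := h1.trans (H.sum_lam_le E)
  rw [← Finset.sum_filter_add_sum_filter_not _ (fun n => n.Prime)] at h2
  have h3 : ∑ n ∈ normImage E with ¬ n.Prime, ArithmeticFunction.vonMangoldt n ≤ C' * √X := by
    refine le_trans ?_ (hC' X)
    rw [Chebyshev.psi_sub_theta_eq_sum_not_prime]
    exact Finset.sum_le_sum_of_subset_of_nonneg (Finset.filter_subset_filter _ hsub)
      fun _ _ _ => ArithmeticFunction.vonMangoldt_nonneg
  have h4 : ∑ n ∈ normImage E with n.Prime, ArithmeticFunction.vonMangoldt n ≤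
      ({n ∈ normImage E | n.Prime} : Finset ℕ).card • Real.log X := by
    refine Finset.sum_le_card_nsmul _ _ _ fun n hn => ?_
    obtain ⟨h5, h6⟩ := Finset.mem_filter.1 hn
    rw [ArithmeticFunction.vonMangoldt_apply_prime h6]
    exact Real.log_le_log (by exact_mod_cast h6.pos) (Nat.le_floor_iff hX0.le |>.1 (Finset.mem_Ioc.1 (hsub h5)).2)
  refine ⟨{n ∈ normImage E | n.Prime}, fun q hq => ?_, ?_⟩
  · obtain ⟨h5, h6⟩ := Finset.mem_filter.1 hq
    refine ⟨h6, Nat.le_floor_iff hX0.le |>.1 (Finset.mem_Ioc.1 (hsub h5)).2, ?_⟩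
    obtain ⟨a, ha, h7⟩ := Finset.mem_image.1 h5
    rw [hE] at ha
    exact ⟨a, (Finset.mem_filter.1 ha).2, h7⟩
  · rw [div_le_iff₀ (Real.log_pos (by linarith))]
    rw [nsmul_eq_mul] at h4
    have h5 : 8 * C' / c ≤ √X := Real.le_sqrt_of_sq_le ((le_max_right _ _).trans ((le_max_right _ _).trans hX))
    rw [div_le_iff₀ hc] at h5
    have h6 := mul_le_mul_of_nonneg_right h5 (Real.sqrt_nonneg X)
    have h7 := Real.mul_self_sqrt hX0.le
    nlinarith

theorem exists_le_sum_exp_neg_len (hm : m ≠ 0) : ∃ c > 0, ∃ C', ∀ y, 0 ≤ y →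
    c * y - C' ≤ ∑ a ∈ (H.classSystem m).ball y, Real.exp (-(H.classSystem m).len a) := by
  classical
  obtain ⟨k, β, κ, C, hK⟩ := H.exists_kernel hm
  exact hK.exists_le_sum_exp_neg_len

end

end RealQuad
end

theorem exists_not_dvd_binQF {a b c : ℤ} (h : Int.gcd a (Int.gcd b c : ℤ) = 1) (s : Finset ℕ)
    (hs : ∀ p ∈ s, p.Prime) : ∃ v, ∀ p ∈ s, ¬ (p : ℤ) ∣ binQF a b c v := by
  classical
  induction s using Finset.induction_on with
  | empty => exact ⟨0, by simp⟩
  | insert p s hp ih =>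
    obtain ⟨v, hv⟩ := ih fun q hq => hs q (Finset.mem_insert_of_mem hq)
    have hpp := hs p (Finset.mem_insert_self _ _)
    obtain ⟨e, he⟩ : ∃ e : ℤ × ℤ, ¬ (p : ℤ) ∣ binQF a b c e := by
      by_contra! h'
      have h1 := h' (1, 0)
      have h2 := h' (0, 1)
      have h3 := h' (1, 1)
      simp only [binQF] at h1 h2 h3
      ring_nf at h1 h2 h3
      have h4 : (p : ℤ) ∣ b := by
        have := (h3.sub h1).sub h2
        ring_nf at this
        exact this
      have h5 := Int.dvd_coe_gcd h1 (Int.dvd_coe_gcd h4 h2)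
      rw [h] at h5
      exact hpp.one_lt.ne' (by exact_mod_cast Int.eq_one_of_dvd_one (by positivity) h5)
    have hco : IsCoprime ((∏ q ∈ s, q : ℕ) : ℤ) (p : ℤ) := by
      rw [Nat.isCoprime_iff_coprime]
      refine Nat.Coprime.prod_left fun q hq => ?_
      rw [Nat.coprime_primes (hs q (Finset.mem_insert_of_mem hq)) hpp]
      rintro rfl
      exact hp hq
    obtain ⟨Q, hQ⟩ : ∃ Q : ℤ, Q = ((∏ q ∈ s, q : ℕ) : ℤ) := ⟨_, rfl⟩
    rw [← hQ] at hco
    obtain ⟨x, y, hxy⟩ := hco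
    refine ⟨(v.1 + Q * (x * (e.1 - v.1)), v.2 + Q * (x * (e.2 - v.2))), fun q hq => ?_⟩
    rcases Finset.mem_insert.1 hq with rfl | hq
    · intro h1
      refine he ((Int.ModEq.dvd_iff ?_).1 h1)
      have h2 : ∀ e v : ℤ, v + Q * (x * (e - v)) ≡ e [ZMOD q] := fun e v =>
        (Int.modEq_iff_dvd).2 ⟨y * (e - v), by linear_combination -(e - v) * hxy⟩
      have h3 := h2 e.1 v.1
      have h4 := h2 e.2 v.2
      unfold binQF
      gcongr
    · intro h1
      refine hv q hq ((Int.ModEq.dvd_iff ?_).1 h1)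
      have hqQ : (q : ℤ) ∣ Q := hQ ▸ Int.natCast_dvd_natCast.2 (Finset.dvd_prod_of_mem _ hq)
      have h2 : ∀ z v : ℤ, v + Q * z ≡ v [ZMOD q] := fun z v =>
        (Int.modEq_iff_dvd).2 (by rw [sub_add_cancel_left]; exact (hqQ.mul_right z).neg_right)
      have h3 := h2 (x * (e.1 - v.1)) v.1
      have h4 := h2 (x * (e.2 - v.2)) v.2
      unfold binQF
      gcongr

/-- A primitive indefinite form is equivalent to one whose leading coefficient is negative and prime to
a given modulus. -/
theorem exists_neg_coprime {a b c m : ℤ} (h : Int.gcd a (Int.gcd b c : ℤ) = 1) (ha : 0 < a)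
    (hD : 0 < b ^ 2 - 4 * a * c) (hm : m ≠ 0) : ∃ x y : ℤ, IsCoprime x y ∧ binQF a b c (x, y) < 0 ∧
      IsCoprime (binQF a b c (x, y)) m := by
  obtain ⟨v, hv⟩ := exists_not_dvd_binQF h m.natAbs.primeFactors fun p hp => (Nat.mem_primeFactors.1 hp).1
  have h1 : ∃ v, binQF a b c v < 0 ∧ IsCoprime (binQF a b c v) m := by
    obtain ⟨M, hM⟩ : ∃ M : ℤ, M = |m| := ⟨_, rfl⟩
    have hM0 : 1 ≤ M := by rw [hM]; exact Int.one_le_abs hm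
    obtain ⟨L, hL⟩ : ∃ L : ℤ, L = 2 * a * v.1 * (-b) + b * (v.1 * (2 * a) + v.2 * (-b)) + 2 * c * v.2 * (2 * a) :=
      ⟨_, rfl⟩
    obtain ⟨t, ht⟩ : ∃ t : ℤ, t = |binQF a b c v| + |L| + 1 := ⟨_, rfl⟩
    have hN : binQF a b c (v.1 + M * t * (-b), v.2 + M * t * (2 * a)) =
        binQF a b c v + M * t * (L - M * t * (a * (b ^ 2 - 4 * a * c))) := by
      rw [hL]; unfold binQF; ring
    refine ⟨(v.1 + M * t * (-b), v.2 + M * t * (2 * a)), ?_, ?_⟩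
    · rw [hN]
      have h2 : 1 ≤ a * (b ^ 2 - 4 * a * c) := Int.add_one_le_of_lt (mul_pos ha hD)
      have h3 := le_abs_self L
      have h4 := le_abs_self (binQF a b c v)
      have h4' := abs_nonneg (binQF a b c v)
      have h5 : 1 ≤ t := by linarith [abs_nonneg L]
      have h6 : 1 ≤ M * t := one_le_mul_of_one_le_of_one_le hM0 h5
      have h7 : t ≤ M * t := by nlinarith
      have h8 : M * t ≤ M * t * (a * (b ^ 2 - 4 * a * c)) := by nlinarith
      nlinarith
    · rw [hN, Int.isCoprime_iff_gcd_eq_one]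
      by_contra hg
      obtain ⟨p, hp, hpd⟩ := Nat.exists_prime_and_dvd hg
      have h2 := (Int.natCast_dvd_natCast.2 hpd).trans (Int.gcd_dvd_left _ _)
      have h3 := (Int.natCast_dvd_natCast.2 hpd).trans (Int.gcd_dvd_right _ _)
      refine hv p (Nat.mem_primeFactors.2 ⟨hp, Int.natCast_dvd.1 h3, Int.natAbs_ne_zero.2 hm⟩) ?_
      refine (dvd_add_left ?_).1 h2
      rw [mul_assoc]
      exact dvd_mul_of_dvd_left (hM ▸ (dvd_abs _ _).2 h3) _
  obtain ⟨⟨x, y⟩, h2, h3⟩ := h1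
  have hxy : 0 < Int.gcd x y := by
    rw [Int.gcd_pos_iff]
    by_contra! h'
    simp [binQF, h'.1, h'.2] at h2
  obtain ⟨g, x', y', hg, hc, hx, hy⟩ := Int.exists_gcd_one' hxy
  rw [hx, hy] at h2 h3
  have h4 : binQF a b c (x' * (g:ℤ), y' * (g:ℤ)) = binQF a b c (x', y') * (g:ℤ) ^ 2 := by unfold binQF; ring
  rw [h4] at h2 h3
  exact ⟨x', y', Int.isCoprime_iff_gcd_eq_one.2 hc, by by_contra! h'; nlinarith [sq_nonneg (g:ℤ)],
    h3.of_mul_left_left⟩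

theorem sq_le_of_abs_sub_le {A B ε ε' : ℝ} (hAB : A * B ≤ 0) (hε : 1 < ε) (h : ε * ε' = 1)
    (h1 : |A - B| ≤ |ε * A - ε' * B|) : B ^ 2 ≤ ε * -(A * B) := by
  have h0 : 0 < ε' := by
    by_contra! h'
    nlinarith
  have key : ∀ P Q : ℝ, 0 ≤ P → 0 ≤ Q → P + Q ≤ ε * P + ε' * Q → Q ^ 2 ≤ ε * (P * Q) := by
    intro P Q hP hQ h2
    have h3 : 0 ≤ (ε - 1) * (P - ε' * Q) := by nlinarith
    have h4 : 0 ≤ P - ε' * Q := nonneg_of_mul_nonneg_right h3 (by linarith)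
    have h5 : Q ≤ ε * P := by nlinarith
    nlinarith
  rcases mul_nonpos_iff.1 hAB with ⟨hA, hB⟩ | ⟨hA, hB⟩
  · have := key A (-B) hA (by linarith) (by
      rw [abs_of_nonneg (by linarith), abs_of_nonneg (by nlinarith)] at h1; linarith)
    linarith
  · have := key (-A) B (by linarith) hB (by
      rw [abs_of_nonpos (by linarith), abs_of_nonpos (by nlinarith)] at h1; linarith)
    linarith

/-- Every represented value is represented by a point of comparable size. -/
theorem exists_repr_le {a b c : ℤ} (ha : 0 < a) (hD : 0 < b ^ 2 - 4 * a * c)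
    (hsq : ¬ ∃ m : ℤ, b ^ 2 - 4 * a * c = m ^ 2) : ∃ C : ℝ, 1 ≤ C ∧ ∀ q : ℕ, (∃ v, binQF a b c v = -q) →
      ∃ v, binQF a b c v = -q ∧ v ∈ supBox (C * √q) := by
  obtain ⟨D, hDD⟩ : ∃ D, D = b ^ 2 - 4 * a * c := ⟨_, rfl⟩
  rw [← hDD] at hD hsq
  obtain ⟨t, u, htu, ht, hu⟩ : ∃ t u : ℤ, t ^ 2 - (b ^ 2 - 4 * a * c) * u ^ 2 = 1 ∧ 0 ≤ t ∧ 0 < u := by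
    obtain ⟨t, u, htu, hu⟩ := Pell.exists_of_not_isSquare hD fun ⟨r, hr⟩ => hsq ⟨r, by rw [hr]; ring⟩
    exact ⟨|t|, |u|, by rwa [sq_abs, sq_abs, ← hDD], abs_nonneg _, abs_pos.2 hu⟩
  obtain ⟨d, hd⟩ : ∃ d, d = √(D:ℝ) := ⟨_, rfl⟩
  have hD' : (0:ℝ) < D := by exact_mod_cast hD
  have hd0 : 0 < d := hd ▸ Real.sqrt_pos.2 hD'
  have hd2 : d ^ 2 = (b:ℝ) ^ 2 - 4 * a * c := by
    rw [hd, Real.sq_sqrt hD'.le, hDD]; push_cast; ring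
  have ha' : (0:ℝ) < a := by exact_mod_cast ha
  have hu' : (0:ℝ) < u := by exact_mod_cast hu
  have ht' : (0:ℝ) ≤ t := by exact_mod_cast ht
  have htu' : (t:ℝ) ^ 2 - ((b:ℝ) ^ 2 - 4 * a * c) * u ^ 2 = 1 := by exact_mod_cast htu
  have hε : (t + u * d) * (t - u * d) = (1:ℝ) := by linear_combination htu' - u ^ 2 * hd2
  have hε1 : 1 < t + u * d := by
    have := mul_pos hu' hd0
    nlinarith
  obtain ⟨r, hr⟩ : ∃ r, r = √((t + u * d) * a) := ⟨_, rfl⟩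
  have hr0 : 0 ≤ r := hr ▸ Real.sqrt_nonneg _
  refine ⟨1 + 2 * r / d + (2 * r + |(b:ℝ)| * (2 * r / d)) / (2 * a), ?_, fun q hq => ?_⟩
  · rw [add_assoc]
    exact le_add_of_nonneg_right (by positivity)
  obtain ⟨v, hv, hmin⟩ : ∃ v, binQF a b c v = -q ∧ ∀ w, binQF a b c w = -q → |v.2| ≤ |w.2| := by
    classical
    have h1 : ∃ n, ∃ v, binQF a b c v = -q ∧ v.2.natAbs = n := let ⟨v, hv⟩ := hq; ⟨_, v, hv, rfl⟩
    obtain ⟨v, hv, h2⟩ := Nat.find_spec h1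
    refine ⟨v, hv, fun w hw => ?_⟩
    rw [Int.abs_eq_natAbs, Int.abs_eq_natAbs, h2]
    exact_mod_cast Nat.find_min' h1 ⟨w, hw, rfl⟩
  obtain ⟨x, y⟩ := v
  refine ⟨(x, y), hv, ?_⟩
  obtain ⟨A, hA⟩ : ∃ A : ℝ, A = a * x + (b + d) / 2 * y := ⟨_, rfl⟩
  obtain ⟨B, hB⟩ : ∃ B : ℝ, B = a * x + (b - d) / 2 * y := ⟨_, rfl⟩
  have hv' : (a:ℝ) * x ^ 2 + b * x * y + c * y ^ 2 = -q := by unfold binQF at hv; exact_mod_cast hv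
  have hAB : A * B = -(a * q) := by
    rw [hA, hB]; linear_combination a * hv' - y ^ 2 / 4 * hd2
  have hABd : A - B = d * y := by rw [hA, hB]; ring
  have step : ∀ u : ℤ, t ^ 2 - (b ^ 2 - 4 * a * c) * u ^ 2 = 1 →
      |A - B| ≤ |(t + u * d) * A - (t - u * d) * B| := by
    intro u hu
    have h1 := hmin ((t - b * u) * x - 2 * c * u * y, 2 * a * u * x + (t + b * u) * y) (by
      unfold binQF at hv ⊢
      dsimp only at hv ⊢
      linear_combination (t ^ 2 - (b ^ 2 - 4 * a * c) * u ^ 2) * hv - q * hu)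
    have h2 : (t + u * d) * A - (t - u * d) * B = d * ((2 * a * u * x + (t + b * u) * y : ℤ):ℝ) := by
      rw [hA, hB]; push_cast; ring
    rw [h2, hABd, abs_mul, abs_mul]
    refine mul_le_mul_of_nonneg_left ?_ (abs_nonneg _)
    exact_mod_cast h1
  have hq0 : (0:ℝ) ≤ q := Nat.cast_nonneg q
  have hneg : A * B ≤ 0 := by rw [hAB]; nlinarith
  have hB2 := sq_le_of_abs_sub_le hneg hε1 hε (step u htu)
  have hA2 : A ^ 2 ≤ (t + u * d) * -(B * A) := by
    refine sq_le_of_abs_sub_le (by linarith) hε1 hε ?_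
    have h1 := step (-u) (by rw [neg_sq]; exact htu)
    rw [abs_sub_comm, abs_sub_comm (_ * B)]
    push_cast at h1
    convert h1 using 3 <;> ring
  have hrq : ((t + u * d) * (a * q) : ℝ) = (r * √q) ^ 2 := by
    rw [hr, mul_pow, Real.sq_sqrt (by positivity), Real.sq_sqrt hq0]; ring
  have hs0 := Real.sqrt_nonneg (q:ℝ)
  rw [hAB, neg_neg, hrq] at hB2
  rw [mul_comm B, hAB, neg_neg, hrq] at hA2
  have hB3 := abs_le_of_sq_le_sq hB2 (by positivity)
  have hA3 := abs_le_of_sq_le_sq hA2 (by positivity)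
  have hy : |(y:ℝ)| ≤ 2 * r / d * √q := by
    have h1 : d * |(y:ℝ)| ≤ 2 * (r * √q) := by
      rw [← congrArg (· * |(y:ℝ)|) (abs_of_pos hd0)]
      beta_reduce
      rw [← abs_mul, ← hABd]
      refine (abs_sub _ _).trans ?_
      linarith
    rw [div_mul_eq_mul_div, le_div_iff₀ hd0]
    linarith
  have hx : |(x:ℝ)| ≤ (2 * r + |(b:ℝ)| * (2 * r / d)) / (2 * a) * √q := by
    have h1 : 2 * a * (x:ℝ) = A + B - b * y := by rw [hA, hB]; ring
    have h2 : 2 * a * |(x:ℝ)| ≤ 2 * (r * √q) + |(b:ℝ)| * (2 * r / d * √q) := by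
      rw [← congrArg (· * |(x:ℝ)|) (abs_of_pos (show (0:ℝ) < 2 * a by positivity))]
      beta_reduce
      rw [← abs_mul, h1]
      refine (abs_sub _ _).trans ?_
      have h3 := abs_add_le A B
      rw [abs_mul]
      have h4 := mul_le_mul_of_nonneg_left hy (abs_nonneg (b:ℝ))
      linarith
    rw [div_mul_eq_mul_div, le_div_iff₀ (by positivity)]
    linarith
  have p1 : 0 ≤ 2 * r / d * √q := by positivity
  have p2 : 0 ≤ (2 * r + |(b:ℝ)| * (2 * r / d)) / (2 * a) * √q := by positivity
  exact ⟨hx.trans (by linarith), hy.trans (by linarith)⟩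

theorem supBox_finite (M : ℝ) : (supBox M).Finite := by
  refine (Set.finite_Icc ((-⌈M⌉, -⌈M⌉) : ℤ × ℤ) (⌈M⌉, ⌈M⌉)).subset fun w hw => ?_
  have key : ∀ x : ℤ, |(x:ℝ)| ≤ M → -⌈M⌉ ≤ x ∧ x ≤ ⌈M⌉ := fun x hx => by
    have := (abs_le.1 (hx.trans (Int.le_ceil M)))
    exact_mod_cast this
  exact ⟨⟨(key _ hw.1).1, (key _ hw.2).1⟩, ⟨(key _ hw.1).2, (key _ hw.2).2⟩⟩

namespace RealQuad

variable {D : ℤ} {O : Type} [CommRing O] [IsDedekindDomain O] [Module.Free ℤ O]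
  [Module.Finite ℤ O] (H : RealQuad D O) {m : ℤ}

theorem absNorm_le_of_natCast_mem {I : Ideal O} {n : ℕ} (hn : 0 < n) (h : (n : O) ∈ I)
    (hx : ∀ x : O, ∃ z : ℤ, x - z ∈ I) : Ideal.absNorm I ≤ n := by
  rw [Ideal.absNorm_apply, Submodule.cardQuot_apply, ← Nat.card_fin n]
  refine Nat.card_le_card_of_surjective (fun i : Fin n => Ideal.Quotient.mk I ((i : ℕ) : O)) fun x => ?_
  obtain ⟨x, rfl⟩ := Ideal.Quotient.mk_surjective x
  obtain ⟨z, hz⟩ := hx x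
  have hn' : (n : ℤ) ≠ 0 := by exact_mod_cast hn.ne'
  refine ⟨⟨(z % n).toNat, (Int.toNat_lt (Int.emod_nonneg _ hn')).2 (Int.emod_lt_of_pos _ (by exact_mod_cast hn))⟩, ?_⟩
  refine (Ideal.Quotient.eq.2 ?_).symm
  have h1 : (((z % n).toNat : ℕ) : O) = ((z % n : ℤ) : O) := by
    rw [← Int.cast_natCast, Int.toNat_of_nonneg (Int.emod_nonneg _ hn')]
  have h2 : x - ((z % n).toNat : ℕ) = (x - z) + (n : O) * ((z / n : ℤ) : O) := by
    rw [h1]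
    have h3 := congrArg (Int.cast : ℤ → O) (Int.emod_add_mul_ediv z n)
    push_cast at h3
    linear_combination -h3
  dsimp only
  rw [h2]
  exact I.add_mem hz (I.mul_mem_right _ h)

include H in
theorem exists_two_mul_eq (x : O) : ∃ s t : ℤ, ((2 * D : ℤ) : O) * x = (s : O) + t * H.sqrtD := by
  obtain ⟨s, hs⟩ := H.trace x
  obtain ⟨t, ht⟩ := H.trace (x * H.sqrtD)
  refine ⟨D * s, t, H.σ_inj ?_⟩
  rw [map_mul, map_mul, H.σ_sqrtD, H.τ_sqrtD] at ht
  simp only [map_mul, map_add, map_intCast, H.σ_sqrtD]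
  have h1 := Real.mul_self_sqrt (show (0:ℝ) ≤ D by exact_mod_cast H.pos.le)
  push_cast
  linear_combination D * hs + √D * ht + (H.τ x - H.σ x) * h1

include H in
theorem absNorm_intCast (a : ℤ) : Ideal.absNorm (Ideal.span {(a : O)}) = a.natAbs * a.natAbs := by
  have h := H.norm a
  rw [map_intCast, map_intCast, abs_mul] at h
  rw [← Nat.cast_inj (R := ℝ), h]
  push_cast
  simp

/-- The ideal `(a, θ)` has residue ring `ℤ / a`. -/
theorem absNorm_span_pair_le {a : ℤ} {θ : O} (ha : a ≠ 0) (hco : IsCoprime a (2 * D))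
    (hθ : ∃ i j : ℤ, H.sqrtD = i + j * θ) :
    (∀ x : O, ∃ z : ℤ, x - z ∈ Ideal.span {(a : O), θ}) ∧ Ideal.absNorm (Ideal.span {(a : O), θ}) ≤ a.natAbs := by
  obtain ⟨i, j, hij⟩ := hθ
  have ha1 : (a : O) ∈ Ideal.span {(a : O), θ} := Ideal.subset_span (by simp)
  have ha2 : θ ∈ Ideal.span {(a : O), θ} := Ideal.subset_span (by simp)
  have h1 : ∀ x : O, ∃ z : ℤ, x - z ∈ Ideal.span {(a : O), θ} := by
    intro x
    obtain ⟨u, v, huv⟩ := hco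
    obtain ⟨s, t, hst⟩ := H.exists_two_mul_eq x
    refine ⟨v * (s + t * i), Ideal.mem_span_pair.2 ⟨u * x, v * t * j, ?_⟩⟩
    have h2 := congrArg (Int.cast : ℤ → O) huv
    push_cast at h2 hst ⊢
    rw [hij] at hst
    linear_combination x * h2 - v * hst
  refine ⟨h1, absNorm_le_of_natCast_mem (Int.natAbs_pos.2 ha) ?_ h1⟩
  rw [← Int.cast_natCast]
  rcases Int.natAbs_eq a with h | h
  · rwa [← h]
  · rwa [show (a.natAbs : ℤ) = -a by omega, Int.cast_neg, neg_mem_iff]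

/-- In a suitable class, the norm of every ideal is represented by `-F`. -/
theorem exists_class_repr {a b c : ℤ} (hD : b ^ 2 - 4 * a * c = D) (ha : a < 0) (hco : IsCoprime a (2 * D)) :
    ∃ g : H.RayClass (2 * D), ∀ e, (H.classSystem (2 * D)).cl e = g →
      ∃ v, binQF a b c v = -(Ideal.absNorm (toIdeal e) : ℤ) := by
  have := H.charZero
  obtain ⟨θ, hσ, hτ⟩ := H.root b (a * c) (by linarith)
  have hd := Real.mul_self_sqrt (show (0:ℝ) ≤ D by exact_mod_cast H.pos.le)
  have hD' : (b:ℝ) ^ 2 - 4 * a * c = D := by exact_mod_cast hD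
  have hθ : H.sqrtD = (-b : ℤ) + (2 : ℤ) * θ := H.σ_inj (by
    simp only [map_mul, map_add, map_intCast, H.σ_sqrtD, hσ]; push_cast; ring)
  have hprod : θ * (b - θ) = a * c := H.σ_inj (by
    simp only [map_mul, map_sub, map_intCast, hσ]; linear_combination hD' / 4 - hd / 4)
  obtain ⟨I, hI⟩ : ∃ I, I = Ideal.span {(a : O), θ} := ⟨_, rfl⟩
  have h1 := H.absNorm_span_pair_le ha.ne hco ⟨_, _, hθ⟩
  have h2 := H.absNorm_span_pair_le (θ := b - θ) ha.ne hco ⟨b, -2, by rw [hθ]; push_cast; ring⟩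
  have haI : (a : O) ∈ I := hI ▸ Ideal.subset_span (by simp)
  have hI0 : I ≠ ⊥ := fun h => by
    rw [h, Ideal.mem_bot] at haI
    exact ha.ne (by exact_mod_cast haI)
  have hle : I * Ideal.span {(a : O), b - θ} ≤ Ideal.span {(a : O)} := by
    rw [hI, Ideal.mul_le]
    intro r hr s hs
    obtain ⟨x, y, rfl⟩ := Ideal.mem_span_pair.1 hr
    obtain ⟨z, w, rfl⟩ := Ideal.mem_span_pair.1 hs
    rw [Ideal.mem_span_singleton]
    exact ⟨x * z * a + x * w * (b - θ) + y * z * θ + y * w * c, by linear_combination y * w * hprod⟩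
  rw [← hI] at h1
  have hN : Ideal.absNorm I = a.natAbs := by
    refine le_antisymm h1.2 ?_
    have h3 := Ideal.absNorm_dvd_absNorm_of_le hle
    rw [H.absNorm_intCast, map_mul] at h3
    have h4 : 0 < Ideal.absNorm I * Ideal.absNorm (Ideal.span {(a : O), b - θ}) := by
      refine Nat.pos_of_ne_zero (mul_ne_zero (mt Ideal.absNorm_eq_zero_iff.1 hI0) (mt Ideal.absNorm_eq_zero_iff.1 fun h => ?_))
      have h5 : (a : O) ∈ Ideal.span {(a : O), b - θ} := Ideal.subset_span (by simp)
      rw [h, Ideal.mem_bot] at h5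
      exact ha.ne (by exact_mod_cast h5)
    have h5 := (Nat.le_of_dvd h4 h3).trans (Nat.mul_le_mul_left _ h2.2)
    exact Nat.le_of_mul_le_mul_right h5 (Int.natAbs_pos.2 ha.ne)
  have hint : ∀ u : ℤ, (u : O) ∈ I → a ∣ u := by
    intro u hu
    have h3 : ((Int.gcd a u : ℕ) : O) ∈ I := by
      have h4 := congrArg (Int.cast : ℤ → O) (Int.gcd_eq_gcd_ab a u)
      push_cast at h4
      rw [h4]
      exact I.add_mem (I.mul_mem_right _ haI) (I.mul_mem_right _ hu)
    have h4 := absNorm_le_of_natCast_mem (Int.gcd_pos_of_ne_zero_left u ha.ne) h3 h1.1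
    rw [hN] at h4
    have h5 : Int.gcd a u = a.natAbs :=
      le_antisymm (Nat.le_of_dvd (Int.natAbs_pos.2 ha.ne) (Int.gcd_dvd_natAbs_left a u)) h4
    rw [← Int.natAbs_dvd, ← h5]
    exact Int.gcd_dvd_right a u
  have hcoI : IsCoprime I (Ideal.span {((2 * D : ℤ) : O)}) := by
    obtain ⟨u, v, huv⟩ := hco
    refine Ideal.isCoprime_iff_exists.2 ⟨u * a, I.mul_mem_left _ haI, v * (2 * D : ℤ),
      Ideal.mul_mem_left _ _ (Ideal.mem_span_singleton_self _), ?_⟩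
    exact_mod_cast congrArg (Int.cast : ℤ → O) huv
  obtain ⟨n₀, hn₀⟩ := exists_toIdeal_eq hI0 hcoI
  refine ⟨-(H.classSystem (2 * D)).cl n₀, fun e he => ?_⟩
  have h3 : (H.classSystem (2 * D)).cl (e + n₀) = 0 := by rw [map_add, he, neg_add_cancel]
  obtain ⟨γ, hγ, hγe⟩ := (H.cl_eq_zero_iff _).1 h3
  rw [toIdeal_add, hn₀] at hγe
  have hγI : γ ∈ I := Ideal.dvd_span_singleton.1 ⟨toIdeal e, by rw [← hγe, mul_comm]⟩
  obtain ⟨x, hx⟩ := hγ.1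
  obtain ⟨s, t, hst⟩ := H.exists_two_mul_eq x
  have hγ1 : γ = ((1 + s - b * t : ℤ) : O) + ((2 * t : ℤ) : O) * θ := by
    rw [hst, hθ] at hx
    push_cast at hx ⊢
    linear_combination hx
  obtain ⟨z, hz⟩ := hint (1 + s - b * t) (by
    have h4 : ((1 + s - b * t : ℤ) : O) = γ - ((2 * t : ℤ) : O) * θ := by rw [hγ1]; ring
    rw [h4]
    exact I.sub_mem hγI (I.mul_mem_left _ (hI ▸ Ideal.subset_span (by simp))))
  refine ⟨(z, 2 * t), ?_⟩
  have h4 := H.norm γ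
  rw [← hγe, map_mul, hN, abs_of_pos (mul_pos hγ.2.1 hγ.2.2), hγ1, hz] at h4
  have ha' : (a:ℝ) < 0 := by exact_mod_cast ha
  simp only [map_mul, map_add, map_intCast, hσ, hτ] at h4
  push_cast at h4
  rw [Nat.cast_natAbs, Int.cast_abs, abs_of_neg ha'] at h4
  have h5 : (a:ℝ) * ((a:ℝ) * z ^ 2 + b * z * (2 * t) + c * (2 * t) ^ 2) = a * -(Ideal.absNorm (toIdeal e) : ℝ) := by
    linear_combination -h4 + t ^ 2 * hd - t ^ 2 * hD'
  have h6 := mul_left_cancel₀ ha'.ne h5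
  unfold binQF
  exact_mod_cast h6

include H in
/-- Chebyshev's lower bound for the primes represented by `-F`. -/
theorem exists_primes_repr {a b c : ℤ} (hprim : Int.gcd a (Int.gcd b c : ℤ) = 1) (ha : 0 < a)
    (hD : b ^ 2 - 4 * a * c = D) : ∃ κ > 0, ∃ X₀ : ℝ, ∀ X, X₀ ≤ X →
    ∃ s : Finset ℕ, (∀ q ∈ s, q.Prime ∧ (q:ℝ) ≤ X ∧ ∃ v, binQF a b c v = -q) ∧ κ * X / Real.log X ≤ s.card := by
  have hm : (2 * D : ℤ) ≠ 0 := by have := H.pos; omega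
  obtain ⟨x, y, ⟨w, u, hxy⟩, hneg, hco⟩ := exists_neg_coprime hprim ha (hD ▸ H.pos) hm
  have := H.rayClass_finite hm
  obtain ⟨g, hg⟩ := H.exists_class_repr (a := binQF a b c (x, y)) (b := 2 * a * x * (-u) + b * (x * w + y * (-u)) +
    2 * c * y * w) (c := binQF a b c (-u, w)) (by
      rw [← hD]; unfold binQF
      linear_combination (b ^ 2 - 4 * a * c) * (w * x + u * y + 1) * hxy) hneg hco
  obtain ⟨κ, hκ, X₀, h⟩ := H.exists_primes_of_class hm
  refine ⟨κ, hκ, X₀, fun X hX => ?_⟩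
  obtain ⟨s, hs, hc⟩ := h X hX g
  refine ⟨s, fun q hq => ?_, hc⟩
  obtain ⟨h1, h2, e, he, h3⟩ := hs q hq
  obtain ⟨v, hv⟩ := hg e he
  refine ⟨h1, h2, (x * v.1 - u * v.2, y * v.1 + w * v.2), ?_⟩
  rw [← h3, ← hv]
  unfold binQF
  ring

include H in
theorem exists_card_repr {a b c : ℤ} (hprim : Int.gcd a (Int.gcd b c : ℤ) = 1) (ha : 0 < a)
    (hD : b ^ 2 - 4 * a * c = D) (hsq : ¬ ∃ m : ℤ, b ^ 2 - 4 * a * c = m ^ 2) :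
    ∃ κ > 0, ∃ M₀ : ℝ, ∀ M, M₀ ≤ M → κ * M ^ 2 / Real.log M ≤
      (({v : ℤ × ℤ | 0 < -binQF a b c v ∧ Prime (-binQF a b c v)} ∩ supBox M).ncard : ℝ) := by
  obtain ⟨κ, hκ, X₀, h⟩ := H.exists_primes_repr hprim ha hD
  obtain ⟨C, hC, hr⟩ := exists_repr_le ha (hD ▸ H.pos) hsq
  have hC0 : 0 < C := by linarith
  refine ⟨κ / (2 * C ^ 2), by positivity, max (2 * C) (C * |X₀| + C), fun M hM => ?_⟩
  have hM1 : 2 * C ≤ M := (le_max_left _ _).trans hM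
  have hM0 : 0 < M := by linarith
  have hMC : 2 ≤ M / C := by rwa [le_div_iff₀ hC0]
  have hX : X₀ ≤ (M / C) ^ 2 := by
    have h1 : |X₀| + 1 ≤ M / C := by
      rw [le_div_iff₀ hC0]; linarith [(le_max_right _ _).trans hM]
    nlinarith [le_abs_self X₀, abs_nonneg X₀]
  obtain ⟨s, hs, hc⟩ := h _ hX
  choose! v hv hv' using fun q hq => hr q (hs q hq).2.2
  have hinj : Set.InjOn v s := fun p hp q hq hpq => by
    have := (hv p hp).symm.trans ((congrArg (binQF a b c) hpq).trans (hv q hq))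
    exact_mod_cast neg_injective this
  have hsub : v '' s ⊆ {v : ℤ × ℤ | 0 < -binQF a b c v ∧ Prime (-binQF a b c v)} ∩ supBox M := by
    rintro _ ⟨q, hq, rfl⟩
    obtain ⟨h1, h2, -⟩ := hs q hq
    refine ⟨?_, ?_⟩
    · change 0 < -binQF a b c (v q) ∧ Prime (-binQF a b c (v q))
      rw [hv q hq, neg_neg]
      exact ⟨by exact_mod_cast h1.pos, Nat.prime_iff_prime_int.1 h1⟩
    · have h3 : C * √q ≤ M := by
        rw [← le_div_iff₀' hC0]
        exact Real.sqrt_le_iff.2 ⟨by linarith, h2⟩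
      exact ⟨(hv' q hq).1.trans h3, (hv' q hq).2.trans h3⟩
  have hfin := supBox_finite M
  have h1 := Set.ncard_le_ncard hsub (hfin.subset Set.inter_subset_right)
  rw [Set.ncard_image_of_injOn hinj, Set.ncard_coe_finset] at h1
  refine le_trans ?_ (hc.trans (by exact_mod_cast h1))
  have h2 : 0 < Real.log (M / C) := Real.log_pos (by linarith)
  have h3 : Real.log (M / C) ≤ Real.log M :=
    Real.log_le_log (by linarith) (div_le_self hM0.le hC)
  rw [Real.log_pow, div_le_div_iff₀ (by linarith) (by push_cast; positivity)]
  have h4 : κ * (M / C) ^ 2 = 2 * (κ / (2 * C ^ 2) * M ^ 2) := by field_simp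
  rw [h4]
  push_cast
  have : 0 ≤ κ / (2 * C ^ 2) * M ^ 2 := by positivity
  nlinarith

end RealQuad

/-- The order of integers of a real quadratic field carries the structure `RealQuad`. -/
theorem exists_realQuad {D : ℤ} (hD : 0 < D) (hsq : ¬IsSquare D) :
    ∃ (O : Type) (_ : CommRing O) (_ : IsDedekindDomain O) (_ : Module.Free ℤ O)
      (_ : Module.Finite ℤ O), Nonempty (RealQuad D O) := by
  haveI : Fact (∀ r : ℚ, r ^ 2 ≠ (D : ℚ) + 0 * r) := ⟨fun r hr => hsq
    (Rat.isSquare_intCast_iff.1 ⟨r, by linear_combination -hr⟩)⟩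
  let K := QuadraticAlgebra ℚ (D : ℚ) 0
  haveI hfin : FiniteDimensional ℚ K :=
    inferInstanceAs (Module.Finite ℚ (QuadraticAlgebra ℚ (D : ℚ) 0))
  haveI : NumberField K := { to_charZero := inferInstance, to_finiteDimensional := by convert hfin }
  have hD0 : (0 : ℝ) ≤ D := by exact_mod_cast hD.le
  have hs : ∀ s : ℝ, s * s = D → ∃ e : K →+* ℝ, ∀ z : K, e z = z.re + z.im * s := fun s h =>
    ⟨((QuadraticAlgebra.lift (a := (D : ℚ)) (b := 0) (A := ℝ) ⟨s, by simp [h, Algebra.smul_def]⟩ :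
      K →ₐ[ℚ] ℝ) : K →+* ℝ), fun z => by
      change z.re • (1 : ℝ) + z.im • s = _
      simp [Rat.smul_def]⟩
  obtain ⟨e, he⟩ := hs (√D) (Real.mul_self_sqrt hD0)
  obtain ⟨e', he'⟩ := hs (-√D) (by rw [neg_mul_neg, Real.mul_self_sqrt hD0])
  have hnorm : ∀ x : NumberField.RingOfIntegers K, ((Algebra.norm ℤ x : ℤ) : ℝ) = e x * e' x := by
    intro x
    have h1 : ((Algebra.norm ℤ x : ℤ) : ℚ) = QuadraticAlgebra.norm (x : K) := by
      rw [Algebra.coe_norm_int, ← QuadraticAlgebra.det_toLinearMap_eq_norm, Algebra.norm_apply]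
      congr!
    rw [← Rat.cast_intCast, h1, QuadraticAlgebra.norm_def, he, he']
    push_cast
    linear_combination ((x : K).im : ℝ) ^ 2 * Real.mul_self_sqrt hD0
  have hint : ∀ (t n : ℤ) (z : QuadraticAlgebra ℚ (D : ℚ) 0), z ^ 2 - t * z + n = 0 →
      ∃ θ : NumberField.RingOfIntegers K, (θ : K) = z := by
    intro t n z h
    have : IsIntegral ℤ (z : K) := ⟨Polynomial.X ^ 2 - Polynomial.C t * Polynomial.X + Polynomial.C n,
      by monicity!, by
        rw [← Polynomial.aeval_def]
        simpa using h⟩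
    exact ⟨⟨z, this⟩, rfl⟩
  obtain ⟨w, hw⟩ := hint 0 (-D) (⟨0, 1⟩ : QuadraticAlgebra ℚ (D : ℚ) 0)
    (by ext <;> simp [sq])
  have hwσ : e w = √D := by rw [hw, he]; simp
  have hwτ : e' w = -√D := by rw [hw, he']; simp
  have hinj := NumberField.RingOfIntegers.coe_injective (K := K)
  let σ := e.comp (algebraMap (NumberField.RingOfIntegers K) K)
  let τ := e'.comp (algebraMap (NumberField.RingOfIntegers K) K)
  refine ⟨NumberField.RingOfIntegers K, inferInstance, inferInstance, inferInstance, inferInstance,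
    ⟨{ σ := σ, τ := τ, σ_inj := e.injective.comp hinj, τ_inj := e'.injective.comp hinj, pos := hD
       sqrtD := w, σ_sqrtD := hwσ, τ_sqrtD := hwτ, norm := ?_, trace := ?_, root := ?_
       basis := Module.finBasisOfFinrankEq ℤ _ ?_, count := ?_, exists_unit := ?_ }⟩⟩
  · intro x
    rw [Ideal.absNorm_span_singleton, Nat.cast_natAbs, Int.cast_abs, hnorm]
    rfl
  · intro x
    refine ⟨Algebra.norm ℤ (x + 1) - Algebra.norm ℤ x - 1, ?_⟩
    push_cast
    rw [hnorm, hnorm]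
    simp [σ, τ]
    ring
  · intro B C h
    have h2 : (D : ℚ) = B ^ 2 - 4 * C := by exact_mod_cast h.symm
    obtain ⟨θ, hθ⟩ := hint B C (⟨B / 2, 1 / 2⟩ : QuadraticAlgebra ℚ (D : ℚ) 0)
      (by ext <;> simp [sq] <;> linarith)
    refine ⟨θ, (congrArg e hθ).trans ?_, (congrArg e' hθ).trans ?_⟩
    · rw [he]; push_cast; ring
    · rw [he']; push_cast; ring
  · rw [NumberField.RingOfIntegers.rank]
    convert QuadraticAlgebra.finrank_eq_two (R := ℚ) (D : ℚ) 0
  · have ht := NumberField.Ideal.tendsto_norm_le_div_atTop K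
    obtain ⟨X₀, hX₀⟩ := Filter.eventually_atTop.1 (ht.eventually_le_const (lt_add_one _))
    revert hX₀
    generalize (_ / _ + 1 : ℝ) = C
    intro hX₀
    have h1 : 1 ≤ max X₀ 1 := le_max_right _ _
    have h0 : ∀ Y, 1 ≤ Y → X₀ ≤ Y → _ ≤ C * Y := fun Y h h' =>
      (div_le_iff₀ (by linarith)).1 (hX₀ Y h')
    have hC : 0 ≤ C := (by positivity : (0 : ℝ) ≤ _).trans (hX₀ _ (le_max_left _ 1))
    refine ⟨C * max X₀ 1, fun X hX => ?_⟩
    have h2 : max X₀ 1 ≤ max X₀ 1 * X := le_mul_of_one_le_right (by linarith) hX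
    have h3 : X ≤ max X₀ 1 * X := le_mul_of_one_le_left (by linarith) h1
    rw [mul_assoc]
    refine le_trans ?_ (h0 _ (h1.trans h2) ((le_max_left _ _).trans h2))
    rw [Nat.cast_le]
    have hf : {I : Ideal (NumberField.RingOfIntegers K) |
        (Ideal.absNorm I : ℝ) ≤ max X₀ 1 * X}.Finite :=
      (Ideal.finite_setOfPred_absNorm_le ⌊max X₀ 1 * X⌋₊).subset fun I hI => Nat.le_floor hI
    exact Nat.card_mono hf fun I hI => le_trans hI h3
  · intro m hm
    obtain ⟨x, y, h, hy⟩ := Pell.exists_of_not_isSquare (d := D * m ^ 2) (by positivity)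
      (fun ⟨k, hk⟩ => hsq (by
        obtain ⟨l, rfl⟩ := (Int.pow_dvd_pow_iff two_ne_zero).1 (⟨D, by linarith⟩ : m ^ 2 ∣ k ^ 2)
        exact ⟨l, mul_right_cancel₀ (pow_ne_zero 2 hm) (by linear_combination hk)⟩))
    have hw2 : w ^ 2 = D := e.injective.comp hinj (by
      change σ (w ^ 2) = σ D
      rw [map_pow, map_intCast]
      exact (congrArg (· ^ 2) hwσ).trans (Real.sq_sqrt hD0))
    have h' : (x : NumberField.RingOfIntegers K) ^ 2 - D * m ^ 2 * y ^ 2 = 1 := by exact_mod_cast h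
    have hσ : σ ((x + y * m * w) ^ 2) = (x + y * m * √D) ^ 2 := by
      simp only [map_pow, map_add, map_mul, map_intCast, show σ w = √D from hwσ]
    have hτ : τ ((x + y * m * w) ^ 2) = (x - y * m * √D) ^ 2 := by
      simp only [map_pow, map_add, map_mul, map_intCast, show τ w = -√D from hwτ, mul_neg,
        sub_eq_add_neg]
    have hr : (x + y * m * √D) * (x - y * m * √D) = 1 := by
      have : (x : ℝ) ^ 2 - D * m ^ 2 * y ^ 2 = 1 := by exact_mod_cast h
      linear_combination this - (y : ℝ) ^ 2 * m ^ 2 * Real.sq_sqrt hD0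
    have hu : (x + y * m * w) * (x - y * m * w) = 1 := by
      linear_combination h' - (y : NumberField.RingOfIntegers K) ^ 2 * m ^ 2 * hw2
    refine ⟨⟨(x + y * m * w) ^ 2, (x - y * m * w) ^ 2, ?_, ?_⟩, fun h1 => ?_, ?_, ?_, ?_⟩
    · rw [← mul_pow, hu, one_pow]
    · rw [← mul_pow, mul_comm, hu, one_pow]
    · have h1 : (x + y * m * w) ^ 2 = 1 := h1
      rw [h1, map_one] at hσ hτ
      have : (x : ℝ) * y * m * √D = 0 := by linear_combination (hτ - hσ) / 4
      have hsD : √(D : ℝ) ≠ 0 := (Real.sqrt_pos.2 (by exact_mod_cast hD)).ne'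
      have hx : x = 0 := by simpa [hy, hm, hsD] using this
      rw [hx] at h
      linarith [(by positivity : 0 ≤ D * m ^ 2 * y ^ 2)]
    · exact ⟨2 * D * m * y ^ 2 + 2 * x * y * w, by
        change (x + y * m * w) ^ 2 - 1 = _
        linear_combination (y : NumberField.RingOfIntegers K) ^ 2 * m ^ 2 * hw2 + h'⟩
    · exact hσ ▸ sq_pos_of_ne_zero (left_ne_zero_of_mul_eq_one hr)
    · exact hτ ▸ sq_pos_of_ne_zero (right_ne_zero_of_mul_eq_one hr)

section
variable {P : Type} {μ : (P →₀ ℕ) → ℝ} (h0 : ∀ a, 0 ≤ μ a) (h1 : μ 0 = 1)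
  (hadd : ∀ a b, μ (a + b) = μ a * μ b)
include h0 h1 hadd

/-- A finite Euler product. -/
theorem sum_le_prod_of_fiber_le {ι : Type} [DecidableEq ι] (q : P → ι) (β : ι → ℝ) (U : Finset ι)
    (B : Finset (P →₀ ℕ)) (hU : ∀ a ∈ B, ∀ p ∈ a.support, q p ∈ U)
    (hβ : ∀ i ∈ U, ∀ B' : Finset (P →₀ ℕ), (∀ a' ∈ B', ∃ a ∈ B, a' = a.filter (q · = i)) →
      ∑ a ∈ B', μ a ≤ β i) : ∑ a ∈ B, μ a ≤ ∏ i ∈ U, β i := by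
  classical
  induction U using Finset.induction_on generalizing B with
  | empty =>
    have : B ⊆ {0} := fun a ha => by
      rw [Finset.mem_singleton, ← Finsupp.support_eq_empty, Finset.eq_empty_iff_forall_notMem]
      exact fun p hp => absurd (hU a ha p hp) (Finset.notMem_empty _)
    refine (Finset.sum_le_sum_of_subset_of_nonneg this fun a _ _ => h0 a).trans ?_
    simp [h1]
  | insert i U hi IH =>
    let e : (P →₀ ℕ) → (P →₀ ℕ) × (P →₀ ℕ) := fun a => (a.filter (q · = i), a.filter (¬ q · = i))
    have he : ∀ a, (e a).1 + (e a).2 = a := fun a => Finsupp.filter_pos_add_filter_neg a _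
    have hinj : Function.Injective e := fun a a' h => by rw [← he a, h, he]
    rw [Finset.prod_insert hi]
    calc ∑ a ∈ B, μ a = ∑ z ∈ B.image e, μ z.1 * μ z.2 := by
          rw [Finset.sum_image hinj.injOn]
          exact Finset.sum_congr rfl fun a _ => by rw [← hadd, he]
      _ ≤ ∑ z ∈ (B.image fun a => (e a).1) ×ˢ (B.image fun a => (e a).2), μ z.1 * μ z.2 := by
          refine Finset.sum_le_sum_of_subset_of_nonneg (fun z hz => ?_) fun z _ _ => mul_nonneg (h0 _) (h0 _)
          obtain ⟨a, ha, rfl⟩ := Finset.mem_image.1 hz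
          exact Finset.mem_product.2 ⟨Finset.mem_image_of_mem (fun a => (e a).1) ha,
            Finset.mem_image_of_mem (fun a => (e a).2) ha⟩
      _ = (∑ a ∈ B.image fun a => (e a).1, μ a) * ∑ a ∈ B.image fun a => (e a).2, μ a := by
          rw [Finset.sum_mul_sum, Finset.sum_product]
      _ ≤ _ := by
          refine mul_le_mul (hβ i (Finset.mem_insert_self _ _) _ fun a' ha' => ?_)
            (IH _ (fun a' ha' p hp => ?_) fun j hj B' hB' => hβ j (Finset.mem_insert_of_mem hj) B'
              fun a' ha' => ?_) (Finset.sum_nonneg fun a _ => h0 a) ?_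
          · obtain ⟨a, ha, rfl⟩ := Finset.mem_image.1 ha'
            exact ⟨a, ha, rfl⟩
          · obtain ⟨a, ha, rfl⟩ := Finset.mem_image.1 ha'
            rw [Finsupp.support_filter, Finset.mem_filter] at hp
            exact Finset.mem_of_mem_insert_of_ne (hU a ha p hp.1) hp.2
          · obtain ⟨a'', ha'', rfl⟩ := hB' a' ha'
            obtain ⟨a, ha, rfl⟩ := Finset.mem_image.1 ha''
            refine ⟨a, ha, ?_⟩
            ext p
            by_cases h : q p = j
            · have : ¬ j = i := fun h' => hi (h' ▸ hj)
              simp [e, Finsupp.filter_apply, h, this]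
            · simp [Finsupp.filter_apply, h]
          · simpa using hβ i (Finset.mem_insert_self _ _) ∅ (by simp)

/-- A finite geometric Euler product. -/
theorem sum_le_prod_inv_one_sub (s : Finset P) (x : P → ℝ) (hx : ∀ p ∈ s, x p < 1)
    (hμ : ∀ p ∈ s, ∀ n, μ (Finsupp.single p n) = x p ^ n) (B : Finset (P →₀ ℕ))
    (hB : ∀ a ∈ B, a.support ⊆ s) : ∑ a ∈ B, μ a ≤ ∏ p ∈ s, (1 - x p)⁻¹ := by
  classical
  refine sum_le_prod_of_fiber_le h0 h1 hadd id _ s B hB fun p hp B' hB' => ?_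
  have hs : ∀ a ∈ B', a = Finsupp.single p (a p) := fun a ha => by
    obtain ⟨a, -, rfl⟩ := hB' a ha
    ext p'
    by_cases h : p' = p
    · subst h; simp
    · simp [Finsupp.filter_apply, h, Finsupp.single_apply, Ne.symm h]
  have hx0 : 0 ≤ x p := by
    rw [← pow_one (x p), ← hμ p hp 1]
    exact h0 _
  rw [← tsum_geometric_of_lt_one hx0 (hx p hp)]
  have hinj : Set.InjOn (fun a : P →₀ ℕ => a p) B' := fun a ha a' ha' h => by
    rw [hs a ha, hs a' ha', show a p = a' p from h]
  calc ∑ a ∈ B', μ a = ∑ n ∈ B'.image fun a => a p, x p ^ n := by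
        rw [Finset.sum_image hinj]
        exact Finset.sum_congr rfl fun a ha => by rw [← hμ p hp, ← hs a ha]
    _ ≤ _ := (summable_geometric_of_lt_one hx0 (hx p hp)).sum_le_tsum _ fun n _ => pow_nonneg hx0 n

end

section
variable {k : Type} [Field k] [Fintype k] [DecidableEq k] {a b c : ℤ}

theorem one_sub_zeroDensity : 1 - zeroDensity k a b c =
    ((Finset.univ.filter fun v => qform k a b c v ≠ 0).card : ℝ) / Fintype.card k ^ 2 := by
  have h : 1 - zeroDensity k a b c = avg (fun _ : k × k => (1 : ℝ)) - zeroDensity k a b c := by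
    rw [avg_const]
  rw [h, zeroDensity, ← avg_sub, avg]
  congr 1
  · rw [Finset.card_filter]
    push_cast
    exact Finset.sum_congr rfl fun v _ => by
      by_cases hv : qform k a b c v = 0 <;> simp [hv]
  · rw [Fintype.card_prod]; push_cast; ring

theorem zeroDensity_lt_one (ha : (a : k) ≠ 0) : zeroDensity k a b c < 1 := by
  rw [← sub_pos, one_sub_zeroDensity]
  have : 0 < (Finset.univ.filter fun v => qform k a b c v ≠ 0).card :=
    Finset.card_pos.2 ⟨(1, 0), Finset.mem_filter.2 ⟨Finset.mem_univ _, by simp [qform, ha]⟩⟩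
  have := Fintype.card_pos (α := k)
  positivity

theorem one_sub_zeroDensity_le : 1 - zeroDensity k a b c ≤ 1 - ((Fintype.card k : ℝ) ^ 2)⁻¹ := by
  have h0 : (0 : ℝ) < Fintype.card k := by exact_mod_cast Fintype.card_pos (α := k)
  have : (Finset.univ.filter fun v => qform k a b c v ≠ 0).card < Fintype.card k ^ 2 := by
    rw [sq, ← Fintype.card_prod]
    exact Finset.card_lt_univ_of_notMem (x := (0, 0)) (by
      rw [Finset.mem_filter]
      simp [qform])
  have : ((Finset.univ.filter fun v => qform k a b c v ≠ 0).card : ℝ) + 1 ≤ Fintype.card k ^ 2 := by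
    exact_mod_cast this
  rw [one_sub_zeroDensity, ← one_div, le_sub_iff_add_le, ← add_div, div_le_one (by positivity)]
  exact this

theorem one_sub_zeroDensity_le_sq (ha : (a : k) ≠ 0) {t : k} (ht : t ^ 2 - b * t + a * c = 0)
    (hb : 2 * t ≠ b) : 1 - zeroDensity k a b c ≤ (1 - (Fintype.card k : ℝ)⁻¹) ^ 2 := by
  have h0 : (0 : ℝ) < Fintype.card k := by exact_mod_cast Fintype.card_pos (α := k)
  let S : Finset k := Finset.univ.erase 0
  have hS : (S.card : ℝ) = Fintype.card k - 1 := by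
    rw [Finset.card_erase_of_mem (Finset.mem_univ _), Finset.card_univ, Nat.cast_sub Fintype.card_pos,
      Nat.cast_one]
  have h : (Finset.univ.filter fun v => qform k a b c v ≠ 0).card ≤ (S ×ˢ S).card := by
    refine Finset.card_le_card_of_injOn (fun v => (a * v.1 + t * v.2, a * v.1 + (b - t) * v.2))
      (fun v hv => ?_) fun v _ w _ h => ?_
    · have h1 : (a * v.1 + t * v.2) * (a * v.1 + (b - t) * v.2) = a * qform k a b c v := by
        rw [qform]; linear_combination (-v.2 ^ 2) * ht
      have h2 : (a : k) * qform k a b c v ≠ 0 := mul_ne_zero ha (by simpa using hv)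
      rw [← h1] at h2
      simpa [S] using mul_ne_zero_iff.1 h2
    · obtain ⟨h1, h2⟩ := Prod.mk.inj h
      have h3 : v.2 = w.2 := sub_eq_zero.1 ((mul_eq_zero.1
        (by linear_combination h1 - h2 : (2 * t - b) * (v.2 - w.2) = 0)).resolve_left (sub_ne_zero.2 hb))
      rw [h3] at h1
      exact Prod.ext (mul_left_cancel₀ ha (add_right_cancel h1)) h3
  rw [one_sub_zeroDensity, div_le_iff₀ (by positivity), ← mul_pow, sub_mul, inv_mul_cancel₀ h0.ne',
    one_mul, ← hS, sq]
  exact_mod_cast h.trans_eq (Finset.card_product _ _)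

end

namespace RealQuad

variable {D : ℤ} {O : Type} [CommRing O] [IsDedekindDomain O] [Module.Free ℤ O]
  [Module.Finite ℤ O] (H : RealQuad D O) {m : ℤ}
include H

theorem exists_root_of_absNorm_eq {b n : ℤ} (hD : b ^ 2 - 4 * n = D) {I : Ideal O} {q : ℕ}
    (hq : q.Prime) (hI : Ideal.absNorm I = q) : ∃ t : ZMod q, t ^ 2 - b * t + n = 0 := by
  obtain ⟨θ, h1, h2⟩ := H.root b n hD
  have hD0 : (0 : ℝ) ≤ D := by exact_mod_cast H.pos.le
  have hθ : θ ^ 2 - b * θ + n = 0 := H.σ_inj (by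
    have : ((b : ℝ)) ^ 2 - 4 * n = D := by exact_mod_cast hD
    simp only [map_add, map_sub, map_mul, map_pow, map_intCast, map_zero, h1]
    linear_combination (Real.sq_sqrt hD0 - this) / 4)
  haveI : Fact q.Prime := ⟨hq⟩
  have hc : Nat.card (O ⧸ I) = q := by rw [← hI, Ideal.absNorm_apply, Submodule.cardQuot_apply]
  haveI := Nat.finite_of_card_ne_zero (hc ▸ hq.ne_zero)
  letI := Fintype.ofFinite (O ⧸ I)
  rw [Nat.card_eq_fintype_card] at hc
  let e := ZMod.ringEquivOfPrime (O ⧸ I) hq hc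
  refine ⟨e.symm (Ideal.Quotient.mk I θ), ?_⟩
  have := congrArg (fun x => e.symm (Ideal.Quotient.mk I x)) hθ
  simpa using this

end RealQuad

/-- The primes up to `w` that do not divide `m`. -/
noncomputable def primesAway (m : ℤ) (w : ℕ) : Finset Nat.Primes :=
  (primesBetween 0 w).filter fun p : Nat.Primes => ¬ ((p : ℕ) : ℤ) ∣ m

theorem mem_primesAway {m : ℤ} {w : ℕ} {p : Nat.Primes} :
    p ∈ primesAway m w ↔ (p : ℕ) ≤ w ∧ ¬ ((p : ℕ) : ℤ) ∣ m := by
  rw [primesAway, Finset.mem_filter, mem_primesBetween, and_iff_right p.2.pos]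

namespace RealQuad

variable {D : ℤ} {O : Type} [CommRing O] [IsDedekindDomain O] [Module.Free ℤ O]
  [Module.Finite ℤ O] (H : RealQuad D O) {m : ℤ}
include H

theorem prod_inv_le_inv_one_sub_zeroDensity {a b c : ℤ} (hD : b ^ 2 - 4 * a * c = D) (q : Nat.Primes)
    (ha : (a : ZMod q) ≠ 0) (hD0 : (D : ZMod q) ≠ 0) (s : Finset (PrimeAway O m))
    (hs : ∀ p ∈ s, ((q : ℕ) : O) ∈ (p : Ideal O)) :
    ∏ p ∈ s, (1 - (Ideal.absNorm (p : Ideal O) : ℝ)⁻¹)⁻¹ ≤ (1 - zeroDensity (ZMod q) a b c)⁻¹ := by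
  have hq1 : (1 : ℝ) < (q : ℕ) := by exact_mod_cast q.2.one_lt
  have hx0 : 0 ≤ 1 - ((q : ℕ) : ℝ)⁻¹ := sub_nonneg.2 (inv_le_one_of_one_le₀ hq1.le)
  have hx1 : 1 - ((q : ℕ) : ℝ)⁻¹ ≤ 1 := sub_le_self _ (by positivity)
  have hρ := sub_pos.2 (zeroDensity_lt_one (b := b) (c := c) ha)
  rw [Finset.prod_inv_distrib]
  refine inv_anti₀ hρ ?_
  by_cases h : ∃ p ∈ s, Ideal.absNorm (p : Ideal O) = q
  · obtain ⟨p, hp, hpq⟩ := h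
    obtain ⟨t, ht⟩ := H.exists_root_of_absNorm_eq (b := b) (n := a * c) (by linarith) q.2 hpq
    push_cast at ht
    have h1 : (2 : ZMod q) * t ≠ b := fun h => hD0 (by
      rw [← hD]; push_cast; linear_combination (-4) * ht + (2 * t - b) * h)
    refine (one_sub_zeroDensity_le_sq ha ht h1).trans ?_
    rw [ZMod.card]
    calc _ ≤ (1 - ((q : ℕ) : ℝ)⁻¹) ^ s.card :=
          pow_le_pow_of_le_one hx0 hx1 (H.card_le_two_of_mem s q.2 hs)
      _ ≤ _ := by
          rw [← Finset.prod_const]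
          refine Finset.prod_le_prod (fun _ _ => hx0) fun p hp => sub_le_sub_left ?_ _
          obtain ⟨j, hj, -, h2⟩ := H.absNorm_eq_pow p q.2 (hs p hp)
          refine inv_anti₀ (by linarith) ?_
          rw [h2]
          exact_mod_cast Nat.le_self_pow hj _
  · have hsq : ∀ p ∈ s, Ideal.absNorm (p : Ideal O) = (q : ℕ) ^ 2 := fun p hp => by
      obtain ⟨j, hj, hj2, h2⟩ := H.absNorm_eq_pow p q.2 (hs p hp)
      obtain rfl | rfl : j = 1 ∨ j = 2 := by omega
      · exact absurd ⟨p, hp, h2.trans (pow_one _)⟩ h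
      · exact h2
    have h1 := H.prod_absNorm_dvd s q hs
    rw [Finset.prod_congr rfl hsq, Finset.prod_const, ← pow_mul,
      Nat.pow_dvd_pow_iff_le_right q.2.one_lt] at h1
    refine one_sub_zeroDensity_le.trans ?_
    rw [ZMod.card, Finset.prod_congr rfl fun p hp => by rw [hsq p hp], Finset.prod_const, Nat.cast_pow]
    exact le_of_eq_of_le (pow_one _).symm (pow_le_pow_of_le_one
      (sub_nonneg.2 (inv_le_one_of_one_le₀ (one_le_pow₀ hq1.le))) (sub_le_self _ (by positivity)) (by omega))

/-- The part of the sifting density at small primes complements `sieveMass` to a quantity that grows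
at least as fast as the corresponding sum over ideals. -/
theorem sum_ball_le_sieveMass {a b c : ℤ} (hD : b ^ 2 - 4 * a * c = D) (ha : a ≠ 0) {w R : ℕ}
    (hw : (a * D).natAbs ≤ w) (hR : 1 ≤ R) :
    ∑ e ∈ (H.classSystem (a * D)).ball (Real.log R), Real.exp (-(H.classSystem (a * D)).len e) ≤
      sieveMass a b c (sieveSupport w R) *
        ∏ p ∈ primesAway (a * D) w, (1 - zeroDensity (ZMod p) a b c)⁻¹ := by
  classical
  have := H.charZero
  choose q₀ hq₀ hq using fun p : PrimeAway O (a * D) => H.exists_prime_mem p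
  let q : PrimeAway O (a * D) → Nat.Primes := fun p => ⟨q₀ p, hq₀ p⟩
  have hqm : ∀ p, ¬ (q₀ p : ℤ) ∣ a * D := fun p ⟨x, hx⟩ => p.2.2 ((congrArg (· ∈ (p : Ideal O))
    ((congrArg (Int.cast : ℤ → O) hx).trans (by push_cast; rfl))).mpr (Ideal.mul_mem_right (x : O) _ (hq p)))
  set A := H.classSystem (a * D) with hA
  let δ : (PrimeAway O (a * D) →₀ ℕ) → Finset Nat.Primes := fun e =>
    (e.support.image q).filter fun ℓ => w < (ℓ : ℕ)
  have hle : ∀ e ∈ A.ball (Real.log R), Ideal.absNorm (toIdeal e) ≤ R := fun e he => by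
    have := Real.exp_le_exp.2 (A.mem_ball.1 he)
    rw [H.exp_len, Real.exp_log (by exact_mod_cast hR)] at this
    exact_mod_cast this
  have hdvd : ∀ e : PrimeAway O (a * D) →₀ ℕ, ∀ ℓ : Nat.Primes, ℓ ∈ e.support.image q → (ℓ : ℕ) ∣ Ideal.absNorm (toIdeal e) := fun e ℓ hℓ => by
    obtain ⟨p, hp, rfl⟩ := Finset.mem_image.1 hℓ
    obtain ⟨j, hj, -, h2⟩ := H.absNorm_eq_pow p (hq₀ p) (hq p)
    refine (dvd_pow_self (q₀ p) hj).trans (h2 ▸ Ideal.absNorm_dvd_absNorm_of_le (Ideal.le_of_dvd ?_))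
    have : e = Finsupp.single p (e p) + e.erase p := (Finsupp.single_add_erase p e).symm
    rw [this, toIdeal_add, toIdeal_single]
    exact (dvd_pow_self _ (Finsupp.mem_support_iff.1 hp)).mul_right _
  have hmaps : ∀ e ∈ A.ball (Real.log R), δ e ∈ sieveSupport w R := fun e he => by
    refine mem_sieveSupport.2 ⟨fun ℓ hℓ => ?_, ?_⟩
    · have h := Finset.mem_filter.1 hℓ
      exact mem_primesBetween.2 ⟨h.2, (Nat.le_of_dvd (H.absNorm_pos e) (hdvd e ℓ h.1)).trans (hle e he)⟩
    · refine (Nat.le_of_dvd (H.absNorm_pos e) ?_).trans (hle e he)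
      have h := Finset.prod_primes_dvd (s := (δ e).map ⟨fun ℓ : Nat.Primes => (ℓ : ℕ), Subtype.val_injective⟩)
        (Ideal.absNorm (toIdeal e)) (fun ℓ hℓ => ?_) fun ℓ hℓ => ?_
      · rwa [Finset.prod_map] at h
      · obtain ⟨ℓ, -, rfl⟩ := Finset.mem_map.1 hℓ
        exact ℓ.2.prime
      · obtain ⟨ℓ, h', rfl⟩ := Finset.mem_map.1 hℓ
        exact hdvd e ℓ (Finset.mem_filter.1 h').1
  have hloc : ∀ (ℓ : Nat.Primes), ¬ ((ℓ : ℕ) : ℤ) ∣ a * D → ∀ B : Finset (PrimeAway O (a * D) →₀ ℕ),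
      (∀ e ∈ B, ∀ p ∈ e.support, q p = ℓ) →
      ∑ e ∈ B, Real.exp (-A.len e) ≤ (1 - zeroDensity (ZMod ℓ) a b c)⁻¹ := by
    intro ℓ hℓ B hB
    have hne : ∀ x : ℤ, x ∣ a * D → (x : ZMod ℓ) ≠ 0 := fun x hx h =>
      hℓ (((ZMod.intCast_zmod_eq_zero_iff_dvd x ℓ).1 h).trans hx)
    have h1 := fun p => H.one_lt_absNorm (m := a * D) p
    refine (sum_le_prod_inv_one_sub (μ := fun e => Real.exp (-A.len e)) (fun _ => (Real.exp_pos _).le)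
      (by simp) (fun e e' => by rw [← Real.exp_add, map_add, neg_add]) (B.biUnion Finsupp.support)
      (fun p => (Ideal.absNorm (p : Ideal O) : ℝ)⁻¹) (fun p _ => inv_lt_one_of_one_lt₀ (by exact_mod_cast h1 p))
      (fun p _ n => ?_) B fun e he => Finset.subset_biUnion_of_mem Finsupp.support he).trans
      (H.prod_inv_le_inv_one_sub_zeroDensity hD ℓ (hne a (dvd_mul_right _ _)) (hne D (dvd_mul_left _ _))
        _ fun p hp => ?_)
    · rw [A.len_single, Real.exp_neg, Real.exp_nat_mul]
      change (Real.exp (Real.log _) ^ n)⁻¹ = _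
      rw [Real.exp_log (by exact_mod_cast (h1 p).le), inv_pow]
    · obtain ⟨e, he, hp⟩ := Finset.mem_biUnion.1 hp
      rw [← hB e he p hp]
      exact hq p
  rw [← Finset.sum_fiberwise_of_maps_to hmaps, sieveMass, Finset.sum_mul]
  refine Finset.sum_le_sum fun Δ hΔ => ?_
  have hΔw : ∀ ℓ ∈ Δ, w < (ℓ : ℕ) := fun ℓ hℓ => (mem_primesBetween.1 ((mem_sieveSupport.1 hΔ).1 hℓ)).1
  have hdis : Disjoint Δ (primesAway (a * D) w) := Finset.disjoint_left.2 fun ℓ h1 h2 => by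
    exact absurd (hΔw ℓ h1) (not_lt.2 (mem_primesAway.1 h2).1)
  have hm : a * D ≠ 0 := mul_ne_zero ha H.pos.ne'
  refine (sum_le_prod_of_fiber_le (μ := fun e => Real.exp (-A.len e)) (fun _ => (Real.exp_pos _).le)
    (by simp) (fun e e' => by rw [← Real.exp_add, map_add, neg_add]) q
    (fun ℓ => if ℓ ∈ Δ then oddsAt a b c ℓ else (1 - zeroDensity (ZMod ℓ) a b c)⁻¹) (Δ ∪ primesAway (a * D) w) _
    (fun e he p hp => ?_) fun ℓ hℓ B hB => ?_).trans_eq ?_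
  · have h1 := (Finset.mem_filter.1 he).2
    have h2 := Finset.mem_image_of_mem q hp
    by_cases h3 : w < (q p : ℕ)
    · exact Finset.mem_union_left _ (h1 ▸ Finset.mem_filter.2 ⟨h2, h3⟩)
    · refine Finset.mem_union_right _ (mem_primesAway.2 ⟨not_lt.1 h3, hqm p⟩)
  · have hℓm : ¬ ((ℓ : ℕ) : ℤ) ∣ a * D := by
      rcases Finset.mem_union.1 hℓ with h | h
      · intro h'
        have := Int.natAbs_dvd_natAbs.2 h'
        exact absurd (Nat.le_of_dvd (Int.natAbs_pos.2 hm) this) (not_le.2 (hw.trans_lt (hΔw ℓ h)))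
      · exact (mem_primesAway.1 h).2
    have hBs : ∀ e ∈ B, ∀ p ∈ e.support, q p = ℓ := fun e he p hp => by
      obtain ⟨e, -, rfl⟩ := hB e he
      rw [Finsupp.support_filter] at hp
      exact (Finset.mem_filter.1 hp).2
    beta_reduce
    split_ifs with h
    · have h0 : 0 ∉ B := fun h0 => by
        obtain ⟨e, he, h1⟩ := hB 0 h0
        have h2 : ℓ ∈ δ e := (Finset.mem_filter.1 he).2 ▸ h
        obtain ⟨p, hp, hpℓ⟩ := Finset.mem_image.1 (Finset.mem_filter.1 h2).1
        have h3 := DFunLike.congr_fun h1 p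
        rw [Finsupp.filter_apply, if_pos hpℓ] at h3
        exact Finsupp.mem_support_iff.1 hp h3.symm
      have h2 := hloc ℓ hℓm (insert 0 B) fun e he => by
        rcases Finset.mem_insert.1 he with rfl | he
        · simp
        · exact hBs e he
      rw [Finset.sum_insert h0, map_zero, neg_zero, Real.exp_zero] at h2
      have h3 : (a : ZMod ℓ) ≠ 0 := fun h =>
        hℓm (((ZMod.intCast_zmod_eq_zero_iff_dvd a ℓ).1 h).trans (dvd_mul_right _ _))
      have h4 : 1 - zeroDensity (ZMod ℓ) a b c ≠ 0 := (sub_pos.2 (zeroDensity_lt_one h3)).ne'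
      have h5 : oddsAt a b c ℓ = (1 - zeroDensity (ZMod ℓ) a b c)⁻¹ - 1 := by
        rw [oddsAt, zeroOdds]; field_simp; ring
      linarith
    · exact hloc ℓ hℓm B hBs
  · rw [Finset.prod_union hdis]
    congr 1
    · exact Finset.prod_congr rfl fun ℓ h => if_pos h
    · exact Finset.prod_congr rfl fun ℓ h => if_neg fun h' => Finset.disjoint_left.1 hdis h' h

end RealQuad

theorem val_add_mul_eq {N Q B : ℕ} [NeZero N] (hN : 2 * Q * (1 + B) < N) {x k : ZMod N} {t s : ℤ}
    (ht : (t : ZMod N) = k) (htQ : |t| ≤ 2 * Q) (hs : |s| ≤ B) (h0 : x.val ≤ 2 * Q)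
    (h1 : (x + k * s).val ≤ 2 * Q) : ((x + k * s).val : ℤ) = x.val + t * s := by
  have hd : (N : ℤ) ∣ (x + k * s).val - (x.val + t * s) := by
    rw [← ZMod.intCast_zmod_eq_zero_iff_dvd]
    push_cast
    simp [ht]
  refine sub_eq_zero.1 (Int.eq_zero_of_abs_lt_dvd hd ?_)
  have h2 : |t * s| ≤ 2 * Q * B := by
    rw [abs_mul]
    exact mul_le_mul htQ hs (abs_nonneg _) (by positivity)
  have h3 := abs_le.1 h2
  zify at hN h0 h1
  rw [abs_lt]
  constructor <;> nlinarith

/-- A constellation modulo `N` of points with small coordinates lifts to the integers. -/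
theorem exists_lift_constellation {N Q B : ℕ} [NeZero N] (hB : 1 ≤ B) (hN : 2 * Q * (1 + B) < N)
    {v : ZMod N × ZMod N} {k : ZMod N} (hk : k ≠ 0)
    (h : ∀ s : ℤ × ℤ, |s.1| ≤ B → |s.2| ≤ B → (v + k • cast₂ (ZMod N) s).1.val ≤ 2 * Q ∧
      (v + k • cast₂ (ZMod N) s).2.val ≤ 2 * Q) :
    ∃ t : ℤ, t ≠ 0 ∧ ∀ s : ℤ × ℤ, |s.1| ≤ B → |s.2| ≤ B →
      lift₂ (v + k • cast₂ (ZMod N) s) = lift₂ v + t • s := by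
  have h0 := h 0 (by simp) (by simp)
  have h1 := (h (1, 0) (by simpa using hB) (by simp)).1
  simp only [cast₂, Prod.fst_add, Prod.snd_add, Prod.smul_fst, Prod.smul_snd, smul_eq_mul,
    Prod.fst_zero, Prod.snd_zero, Int.cast_zero, mul_zero, add_zero, Int.cast_one, mul_one] at h0 h1
  have ht : (((v.1 + k).val - v.1.val : ℤ) : ZMod N) = k := by push_cast; simp
  refine ⟨(v.1 + k).val - v.1.val, fun h2 => hk (by rw [← ht, h2, Int.cast_zero]), fun s hs1 hs2 => ?_⟩
  have htQ : |((v.1 + k).val - v.1.val : ℤ)| ≤ 2 * Q := by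
    have := h0.1
    rw [abs_le]
    omega
  have h2 := h s hs1 hs2
  simp only [cast₂, Prod.fst_add, Prod.snd_add, Prod.smul_fst, Prod.smul_snd, smul_eq_mul] at h2
  exact Prod.ext (val_add_mul_eq hN ht htQ hs1 h0.1 h2.1) (val_add_mul_eq hN ht htQ hs2 h0.2 h2.2)

theorem exists_frequently_of_limsup_pos {f g : ℝ → ℝ} (hf : ∀ x, 0 ≤ f x) (hg : ∀ x, 0 ≤ g x)
    (h : 0 < Filter.limsup (fun x => f x / g x) Filter.atTop) :
    ∃ δ > 0, ∃ᶠ x in Filter.atTop, δ * g x ≤ f x := by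
  refine ⟨_, half_pos h, (Filter.frequently_lt_of_lt_limsup ?_ (half_lt_self h)).mono fun x hx => ?_⟩
  · exact Filter.IsBoundedUnder.isCoboundedUnder_le
      (Filter.isBoundedUnder_of ⟨0, fun x => div_nonneg (hf x) (hg x)⟩)
  · rcases (hg x).eq_or_lt with h0 | h0
    · simp only [← h0, mul_zero, hf x]
    · exact ((lt_div_iff₀ h0).1 hx).le

theorem ncard_small_values_le {a b c : ℤ} (ha : a ≠ 0) (R : ℕ) {M : ℝ} (hM : 0 ≤ M) :
    (({v : ℤ × ℤ | 0 < -binQF a b c v ∧ -binQF a b c v ≤ R} ∩ supBox M).ncard : ℝ) ≤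
      2 * R * (2 * M + 1) := by
  let T : Finset (ℤ × ℤ × Bool) := Finset.Icc (-⌊M⌋) ⌊M⌋ ×ˢ Finset.Icc 1 (R : ℤ) ×ˢ Finset.univ
  have hT : (T.card : ℝ) ≤ 2 * R * (2 * M + 1) := by
    have h0 : 0 ≤ ⌊M⌋ := Int.floor_nonneg.2 hM
    have h1 : (((⌊M⌋ + 1 - -⌊M⌋).toNat : ℤ) : ℝ) ≤ 2 * M + 1 := by
      rw [Int.toNat_of_nonneg (by omega)]
      push_cast
      linarith [Int.floor_le M]
    simp only [T, Finset.card_product, Int.card_Icc, Finset.card_univ, Fintype.card_bool,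
      add_sub_cancel_right, Int.toNat_natCast]
    push_cast at h1 ⊢
    have : (0 : ℝ) ≤ R := Nat.cast_nonneg R
    nlinarith
  refine le_trans ?_ hT
  rw [← Set.ncard_coe_finset]
  refine Nat.cast_le.2 (Set.ncard_le_ncard_of_injOn
    (fun v => (v.2, -binQF a b c v, decide (0 ≤ 2 * a * v.1 + b * v.2))) ?_ ?_ T.finite_toSet)
  · rintro v ⟨⟨h1, h2⟩, -, h3⟩
    have h4 := abs_le.1 h3
    simp only [T, Finset.coe_product, Set.mem_prod, Finset.mem_coe, Finset.mem_Icc, Finset.mem_univ,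
      and_true]
    refine ⟨⟨?_, Int.le_floor.2 h4.2⟩, by omega, h2⟩
    have := Int.le_floor.2 (by push_cast; linarith : ((-v.2 : ℤ) : ℝ) ≤ M)
    omega
  · rintro ⟨x, y⟩ - ⟨x', y'⟩ - h
    simp only [Prod.mk.injEq, decide_eq_decide, binQF] at h
    obtain ⟨rfl, h1, h2⟩ := h
    have h3 : (2 * a * x + b * y) ^ 2 = (2 * a * x' + b * y) ^ 2 := by linear_combination -4 * a * h1
    have h4 : 2 * a * x + b * y = 2 * a * x' + b * y := by
      rcases sq_eq_sq_iff_eq_or_eq_neg.1 h3 with h | h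
      · exact h
      · by_cases hx : 0 ≤ 2 * a * x + b * y
        · have := h2.1 hx
          omega
        · have := fun h => hx (h2.2 h)
          omega
    have : x = x' := mul_left_cancel₀ (mul_ne_zero two_ne_zero ha) (by linarith)
    rw [this]

/-- Among points where the form is coprime to the primes of `T`, many are congruent modulo all of
these primes. -/
theorem exists_card_fiber_le {a b c : ℤ} (T : Finset Nat.Primes) (A : Finset (ℤ × ℤ)) (hA : A.Nonempty)
    (h : ∀ v ∈ A, ∀ p ∈ T, ¬ ((p : ℕ) : ℤ) ∣ binQF a b c v) :
    ∃ v₀ ∈ A, (A.card : ℝ) ≤ (A.filter fun v => ((∏ p ∈ T, (p : ℕ) : ℕ) : ℤ) ∣ v.1 - v₀.1 ∧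
        ((∏ p ∈ T, (p : ℕ) : ℕ) : ℤ) ∣ v.2 - v₀.2).card *
      ((∏ p ∈ T, (p : ℕ) : ℕ) ^ 2 * ∏ p ∈ T, (1 - zeroDensity (ZMod p) a b c)) := by
  classical
  let g : ℤ × ℤ → ∀ p : T, ZMod p.1 × ZMod p.1 := fun v p => cast₂ _ v
  let U := Fintype.piFinset fun p : T =>
    Finset.univ.filter fun v : ZMod p.1 × ZMod p.1 => qform (ZMod p.1) a b c v ≠ 0
  have hU : (U.card : ℝ) = (∏ p ∈ T, (p : ℕ) : ℕ) ^ 2 * ∏ p ∈ T, (1 - zeroDensity (ZMod p) a b c) := by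
    rw [Fintype.card_piFinset, ← Finset.prod_coe_sort T, ← Finset.prod_coe_sort T]
    push_cast
    rw [← Finset.prod_pow, ← Finset.prod_mul_distrib]
    refine Finset.prod_congr rfl fun p _ => ?_
    have : ((p.1 : ℕ) : ℝ) ≠ 0 := Nat.cast_ne_zero.2 p.1.2.pos.ne'
    rw [one_sub_zeroDensity, ZMod.card]
    field_simp
  have hmap : ∀ v ∈ A, g v ∈ U := fun v hv => Fintype.mem_piFinset.2 fun p =>
    Finset.mem_filter.2 ⟨Finset.mem_univ _, by
      rw [qform_cast₂, Ne, ZMod.intCast_zmod_eq_zero_iff_dvd]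
      exact h v hv p p.2⟩
  obtain ⟨v₁, hv₁⟩ := hA
  have hU0 : (0 : ℝ) < U.card := Nat.cast_pos.2 (Finset.card_pos.2 ⟨_, hmap v₁ hv₁⟩)
  obtain ⟨y, hy, hc⟩ := Finset.exists_le_card_fiber_of_nsmul_le_card_of_maps_to (s := A) (t := U)
    (f := g) (b := (A.card : ℝ) / U.card) hmap ⟨_, hmap v₁ hv₁⟩
    (by rw [nsmul_eq_mul, mul_div_cancel₀ _ hU0.ne'])
  have hne : 0 < (A.filter fun x => g x = y).card := by
    have : (0 : ℝ) < A.card / U.card := div_pos (Nat.cast_pos.2 (Finset.card_pos.2 ⟨v₁, hv₁⟩)) hU0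
    exact_mod_cast this.trans_le hc
  obtain ⟨v₀, hv₀⟩ := Finset.card_pos.1 hne
  obtain ⟨h0, rfl⟩ := Finset.mem_filter.1 hv₀
  refine ⟨v₀, h0, ?_⟩
  rw [← hU]
  rw [div_le_iff₀ hU0] at hc
  refine hc.trans (mul_le_mul_of_nonneg_right (Nat.cast_le.2 (Finset.card_le_card fun v hv => ?_)) hU0.le)
  obtain ⟨hv, hg⟩ := Finset.mem_filter.1 hv
  have hdvd : ∀ m n : ℤ, (∀ p : T, (m : ZMod p.1) = n) → ((∏ p ∈ T, (p : ℕ) : ℕ) : ℤ) ∣ m - n := by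
    intro m n hmn
    push_cast
    refine Finset.prod_dvd_of_coprime (fun p _ q _ hpq => ?_) fun p hp => ?_
    · exact Nat.isCoprime_iff_coprime.2 ((Nat.coprime_primes p.2 q.2).2 fun h => hpq (Subtype.ext h))
    · rw [← ZMod.intCast_zmod_eq_zero_iff_dvd, Int.cast_sub, sub_eq_zero]
      exact hmn ⟨p, hp⟩
  exact Finset.mem_filter.2 ⟨hv, hdvd _ _ fun p => congrArg Prod.fst (congrFun hg p),
    hdvd _ _ fun p => congrArg Prod.snd (congrFun hg p)⟩

theorem sieveMass_le {a b c : ℤ} {w R : ℕ} (ha : a ≠ 0) (hw : a.natAbs ≤ w) (h3 : 3 ≤ w) :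
    sieveMass a b c (sieveSupport w R) ≤ R := by
  have h : ∀ δ ∈ sieveSupport w R, ∏ p ∈ δ, oddsAt a b c p ≤ 1 := fun δ hδ =>
    Finset.prod_le_one (fun p _ => zeroOdds_nonneg') fun p hp => by
      have hp' := (mem_primesBetween.1 ((mem_sieveSupport.1 hδ).1 hp)).1
      exact zeroOdds_le_one (by rw [ZMod.card]; omega) (intCast_ne_zero_of_lt ha (by omega))
  refine (Finset.sum_le_sum h).trans ?_
  rw [Finset.sum_const, nsmul_eq_mul, mul_one]
  exact Nat.cast_le.2 (card_le_of_prod_le _ fun δ hδ => (mem_sieveSupport.1 hδ).2)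

theorem exists_constellation_of_avg {N Q B W : ℕ} [Fact N.Prime] (hB : 1 ≤ B)
    (hN : 2 * Q * (1 + B) < N) (hW : 0 < W) {X : Set (ℤ × ℤ)} {b₀ : ℤ × ℤ} {r : ℕ}
    {s : Fin (r + 1) → ℤ × ℤ} (hs : ∀ e : ℤ × ℤ, |e.1| ≤ B → |e.2| ≤ B → ∃ j, s j = e)
    {f : ZMod N × ZMod N → ℝ} {μ c : ℝ} (hf0 : ∀ v, 0 ≤ f v) (hfμ : ∀ v, f v ≤ μ)
    (hf : ∀ v, f v ≠ 0 → (v.1.val ≤ 2 * Q ∧ v.2.val ≤ 2 * Q) ∧ b₀ + (W : ℤ) • lift₂ v ∈ X)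
    (hc : c ≤ avg fun p : (ZMod N × ZMod N) × ZMod N => ∏ j, f (p.1 + p.2 • cast₂ (ZMod N) (s j)))
    (hμ : μ ^ (r + 1) < c * N) :
    ∃ (v : ℤ × ℤ) (k : ℕ), 0 < k ∧ ∀ e : ℤ × ℤ, |e.1| ≤ B → |e.2| ≤ B → v + k • e ∈ X := by
  classical
  obtain ⟨v, k, hk, hvk⟩ : ∃ (v : ZMod N × ZMod N) (k : ZMod N), k ≠ 0 ∧ ∏ j, f (v + k • cast₂ (ZMod N) (s j)) ≠ 0 := by
    by_contra! h
    have h1 : avg (fun p : (ZMod N × ZMod N) × ZMod N => ∏ j, f (p.1 + p.2 • cast₂ (ZMod N) (s j))) ≤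
        avg fun p : (ZMod N × ZMod N) × ZMod N => if p.2 = 0 then μ ^ (r + 1) else 0 := by
      refine avg_mono fun p => ?_
      split_ifs with hp
      · refine (Finset.prod_le_prod (fun j _ => hf0 _) fun j _ => hfμ _).trans_eq ?_
        simp
      · exact (h _ _ hp).le
    have hN0 : (0 : ℝ) < N := Nat.cast_pos.2 (Fact.out : N.Prime).pos
    have h2 : avg (fun p : (ZMod N × ZMod N) × ZMod N => if p.2 = 0 then μ ^ (r + 1) else 0) =
        μ ^ (r + 1) / N := by
      refine (avg_prod _).trans ((avg_const
        (avg fun y : ZMod N => if y = 0 then μ ^ (r + 1) else 0)).trans ?_)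
      rw [avg, Finset.sum_ite_eq' Finset.univ (0 : ZMod N) fun _ => μ ^ (r + 1),
        if_pos (Finset.mem_univ _), ZMod.card]
    rw [h2] at h1
    exact absurd ((le_div_iff₀ hN0).1 (hc.trans h1)) (not_le.2 hμ)
  have hne : ∀ e : ℤ × ℤ, |e.1| ≤ B → |e.2| ≤ B → f (v + k • cast₂ (ZMod N) e) ≠ 0 := by
    intro e h1 h2
    obtain ⟨j, rfl⟩ := hs e h1 h2
    exact Finset.prod_ne_zero_iff.1 hvk j (Finset.mem_univ _)
  obtain ⟨t, ht, hl⟩ := exists_lift_constellation hB hN hk fun e h1 h2 => (hf _ (hne e h1 h2)).1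
  have key : ∀ e : ℤ × ℤ, |e.1| ≤ B → |e.2| ≤ B →
      (b₀ + (W : ℤ) • lift₂ v) + ((W : ℤ) * t) • e ∈ X := fun e h1 h2 => by
    have := (hf _ (hne e h1 h2)).2
    rwa [hl e h1 h2, smul_add, smul_smul, ← add_assoc] at this
  refine ⟨b₀ + (W : ℤ) • lift₂ v, W * t.natAbs, Nat.mul_pos hW (Int.natAbs_pos.2 ht), fun e h1 h2 => ?_⟩
  rw [← natCast_zsmul, Nat.cast_mul]
  rcases Int.natAbs_eq t with h | h
  · rw [← h]
    exact key e h1 h2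
  · have := key (-e) (by simpa using h1) (by simpa using h2)
    rwa [smul_neg, ← neg_smul, ← mul_neg, show -t = (t.natAbs : ℤ) by omega] at this

/-- The points of a residue class in a box correspond to residues in a smaller box. -/
theorem card_le_card_residues {N Q W : ℕ} [NeZero N] (hW : 0 < W) (hN : 2 * Q < N) {M : ℝ}
    (hM : 2 * M ≤ W * Q) {v₀ : ℤ × ℤ} (hv₀ : v₀ ∈ supBox M) (Y : Finset (ℤ × ℤ))
    (hY : ∀ v ∈ Y, v ∈ supBox M ∧ (W : ℤ) ∣ v.1 - v₀.1 ∧ (W : ℤ) ∣ v.2 - v₀.2) [DecidableEq (ℤ × ℤ)] :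
    Y.card ≤ (Finset.univ.filter fun u : ZMod N × ZMod N => (u.1.val ≤ 2 * Q ∧ u.2.val ≤ 2 * Q) ∧
      (v₀ - (W : ℤ) • ((Q : ℤ), (Q : ℤ))) + (W : ℤ) • lift₂ u ∈ Y).card := by
  have hW' : (0 : ℝ) < W := Nat.cast_pos.2 hW
  have key : ∀ x x₀ : ℤ, |(x : ℝ)| ≤ M → |(x₀ : ℝ)| ≤ M → (W : ℤ) ∣ x - x₀ →
      ∃ n : ℕ, n ≤ 2 * Q ∧ x = x₀ - W * Q + W * n := by
    rintro x x₀ hx hx₀ ⟨q, hq⟩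
    have hq' : (x : ℝ) - x₀ = W * q := by exact_mod_cast hq
    have h1 := abs_le.1 hx
    have h2 := abs_le.1 hx₀
    have h3 : (q : ℝ) ≤ Q := le_of_mul_le_mul_left (by linarith) hW'
    have h4 : -(Q : ℝ) ≤ q := le_of_mul_le_mul_left (by linarith) hW'
    have h5 : q ≤ Q := by exact_mod_cast h3
    have h6 : -(Q : ℤ) ≤ q := by exact_mod_cast h4
    refine ⟨(q + Q).toNat, by omega, ?_⟩
    rw [Int.toNat_of_nonneg (by omega)]
    linear_combination hq
  choose! n hn hx using fun (v : ℤ × ℤ) (hv : v ∈ Y) =>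
    key v.1 v₀.1 (hY v hv).1.1 hv₀.1 (hY v hv).2.1
  choose! m hm hy using fun (v : ℤ × ℤ) (hv : v ∈ Y) =>
    key v.2 v₀.2 (hY v hv).1.2 hv₀.2 (hY v hv).2.2
  have hlift : ∀ v ∈ Y, (v₀ - (W : ℤ) • ((Q : ℤ), (Q : ℤ))) +
      (W : ℤ) • lift₂ (((n v : ZMod N), (m v : ZMod N))) = v := by
    intro v hv
    have h1 := hn v hv
    have h2 := hm v hv
    ext
    · simp only [lift₂, ZMod.val_natCast_of_lt (show n v < N by omega), Prod.fst_add, Prod.fst_sub,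
        Prod.smul_fst, smul_eq_mul]
      exact (hx v hv).symm
    · simp only [lift₂, ZMod.val_natCast_of_lt (show m v < N by omega), Prod.snd_add, Prod.snd_sub,
        Prod.smul_snd, smul_eq_mul]
      exact (hy v hv).symm
  refine Finset.card_le_card_of_injOn (fun v => ((n v : ZMod N), (m v : ZMod N))) (fun v hv => ?_)
    fun v hv v' hv' h => ?_
  · have h1 := hn v hv
    have h2 := hm v hv
    refine Finset.mem_coe.2 (Finset.mem_filter.2 ⟨Finset.mem_univ _, ⟨?_, ?_⟩, ?_⟩)
    · rwa [ZMod.val_natCast_of_lt (by omega)]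
    · rwa [ZMod.val_natCast_of_lt (by omega)]
    · rwa [hlift v hv]
  · rw [← hlift v hv, ← hlift v' hv']
    exact congrArg (fun u => (v₀ - (W : ℤ) • ((Q : ℤ), (Q : ℤ))) + (W : ℤ) • lift₂ u) h

theorem exists_root_floor {K N : ℕ} (hK : 0 < K) (hN : 1 ≤ N) :
    ∃ R : ℕ, 1 ≤ R ∧ R ^ K ≤ N ∧ Real.log N / K - Real.log 2 ≤ Real.log R := by
  have hN1 : (1 : ℝ) ≤ N := by exact_mod_cast hN
  have hK0 : (0 : ℝ) < K := Nat.cast_pos.2 hK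
  obtain ⟨x, hx⟩ : ∃ x : ℝ, x = (N : ℝ) ^ ((K : ℝ)⁻¹) := ⟨_, rfl⟩
  have hx1 : 1 ≤ x := hx ▸ Real.one_le_rpow hN1 (by positivity)
  have hxK : x ^ K = N := hx ▸ Real.rpow_inv_natCast_pow (by positivity) hK.ne'
  have hR : 1 ≤ ⌊x⌋₊ := Nat.le_floor (by exact_mod_cast hx1)
  have hR' : (1 : ℝ) ≤ ⌊x⌋₊ := by exact_mod_cast hR
  refine ⟨⌊x⌋₊, hR, ?_, ?_⟩
  · have : (⌊x⌋₊ : ℝ) ^ K ≤ N := hxK ▸ pow_le_pow_left₀ (by positivity) (Nat.floor_le (by linarith)) K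
    exact_mod_cast this
  · have h1 : x / 2 ≤ ⌊x⌋₊ := by linarith [Nat.lt_floor_add_one x]
    rw [← hxK, Real.log_pow, mul_div_cancel_left₀ _ hK0.ne', ← Real.log_div (by positivity) two_ne_zero]
    exact Real.log_le_log (by positivity) h1

theorem two_mul_level_le {R N b M l β : ℝ} (hR : 0 ≤ R) (hM : 1 < M) (hb : 0 < b) (hβ : 0 < β) (hl : 0 < l)
    (h1 : R ^ 2 ≤ N) (h2 : N ≤ 12 * b * M) (h : l ^ 2 * (432 * b) ≤ β ^ 2 * M) :
    2 * R * (2 * M + 1) ≤ β * M ^ 2 / l := by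
  have hM0 : 0 < M := by linarith
  have h8 : (6 * R * l) ^ 2 ≤ (β * M) ^ 2 := by
    calc (6 * R * l) ^ 2 = 36 * l ^ 2 * R ^ 2 := by ring
      _ ≤ 36 * l ^ 2 * (12 * b * M) := by gcongr; exact h1.trans h2
      _ = l ^ 2 * (432 * b) * M := by ring
      _ ≤ β ^ 2 * M * M := by gcongr
      _ = _ := by ring
  have h9 := (pow_le_pow_iff_left₀ (by positivity) (by positivity) two_ne_zero).1 h8
  rw [le_div_iff₀ hl]
  calc 2 * R * (2 * M + 1) * l ≤ 2 * R * (3 * M) * l := by gcongr; linarith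
    _ = (6 * R * l) * M := by ring
    _ ≤ β * M * M := by gcongr
    _ = _ := by ring

theorem density_le {A K c C y l d β b M t : ℝ} (hK : 0 < K) (hc : 0 < c) (hβ : 0 < β) (hb : 0 < b)
    (hM : 0 < M) (hl : 0 < l) (h1 : 2 * K / c * (c * (A / K + d) + C) ≤ l) (h2 : (l - A) / K - d ≤ y)
    (ht0 : 0 ≤ t) (ht : t ≤ 12 * b * M) :
    β * c / (288 * K * b ^ 2) * t ^ 2 ≤ (c * y - C) * (β * M ^ 2 / l) := by
  have h8 : c / (2 * K) * l ≤ c * y - C := by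
    have := mul_le_mul_of_nonneg_left h1 (by positivity : 0 ≤ c / (2 * K))
    have e : c / (2 * K) * (2 * K / c * (c * (A / K + d) + C)) = c * (A / K + d) + C := by field_simp
    rw [e] at this
    have h10 := mul_le_mul_of_nonneg_left h2 hc.le
    have e' : c * ((l - A) / K - d) = 2 * (c / (2 * K) * l) - c * (A / K + d) := by
      field_simp
      ring
    linarith
  calc β * c / (288 * K * b ^ 2) * t ^ 2
      ≤ β * c / (288 * K * b ^ 2) * (12 * b * M) ^ 2 := by gcongr
    _ = c / (2 * K) * l * (β * M ^ 2 / l) := by field_simp; ring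
    _ ≤ _ := by gcongr

/-- The choice of the modulus and the sieve level for large boxes. -/
theorem eventually_exists_scale {K W B : ℕ} (r : ℕ) (hK : 2 * (r + 1) ≤ K) (hW : 0 < W) {β c c₁ : ℝ}
    (hβ : 0 < β) (hc : 0 < c) (hc₁ : 0 < c₁) (C : ℝ) (w N₀ : ℕ) :
    ∀ᶠ M : ℝ in Filter.atTop, 1 < M ∧ ∃ Q N R : ℕ, 2 * M ≤ W * Q ∧ N.Prime ∧ 2 * Q * (1 + B) < N ∧ N₀ ≤ N ∧
      1 ≤ R ∧ w ≤ R ∧ R ^ K ≤ N ∧ (R : ℝ) ^ (r + 1) < c₁ * N ∧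
      2 * R * (2 * M + 1) ≤ β * M ^ 2 / Real.log M ∧
      β * c / (288 * K * (1 + B) ^ 2) * (N * W) ^ 2 ≤ (c * Real.log R - C) * (β * M ^ 2 / Real.log M) := by
  have hK1 : 0 < K := by omega
  have hW1 : (1 : ℝ) ≤ W := by exact_mod_cast hW
  have hK0 : (0 : ℝ) < K := Nat.cast_pos.2 hK1
  have e1 := (Real.isLittleO_pow_log_id_atTop (n := 2)).bound
    (by positivity : 0 < β ^ 2 / (432 * (1 + B)))
  have e2 := Real.tendsto_log_atTop.eventually_ge_atTop
    (Real.log W + K * Real.log 2 + K * Real.log (w + 1) + 1)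
  have e3 := Real.tendsto_log_atTop.eventually_ge_atTop (2 * K / c * (c * (Real.log W / K + Real.log 2) + C))
  filter_upwards [e1, e2, e3, Filter.eventually_ge_atTop (W : ℝ), Filter.eventually_gt_atTop (1 : ℝ),
    Filter.eventually_ge_atTop (W * (N₀ : ℝ)), Filter.eventually_gt_atTop (W * (c₁ ^ 2)⁻¹)]
    with M h1 h2 h3 h4 h5 h6 h7
  refine ⟨h5, ?_⟩
  have hM : 0 < M := by linarith
  obtain ⟨l, hl⟩ : ∃ l, l = Real.log M := ⟨_, rfl⟩
  have hl0 : 0 < l := hl ▸ Real.log_pos h5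
  rw [← hl] at h1 h2 h3 ⊢
  have hQ := Nat.le_ceil (2 * M / W)
  have hQ' := Nat.ceil_lt_add_one (by positivity : 0 ≤ 2 * M / W)
  obtain ⟨Q, hQe⟩ : ∃ Q, Q = ⌈2 * M / W⌉₊ := ⟨_, rfl⟩
  rw [← hQe] at hQ hQ'
  have hWQ : 2 * M ≤ W * Q := by rwa [div_le_iff₀' (by positivity)] at hQ
  have hQ0 : Q ≠ 0 := by
    rintro rfl
    simp at hWQ
    linarith
  obtain ⟨N, hN, hN1, hN2⟩ := Nat.exists_prime_lt_and_le_two_mul (2 * Q * (1 + B)) (by positivity)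
  have hQB : (0 : ℝ) ≤ B := Nat.cast_nonneg B
  have hN1' : 2 * (Q : ℝ) * (1 + B) ≤ N := by exact_mod_cast hN1.le
  have hN2' : (N : ℝ) ≤ 2 * (2 * Q * (1 + B)) := by exact_mod_cast hN2
  have hNW : (N : ℝ) * W ≤ 12 * (1 + B) * M := by
    have : (Q : ℝ) * W ≤ 2 * M + W := by
      have := mul_le_mul_of_nonneg_right hQ'.le (by positivity : (0 : ℝ) ≤ W)
      rwa [add_mul, div_mul_cancel₀ _ (by positivity), one_mul] at this
    nlinarith
  have hMN : M ≤ W * N := by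
    have : (Q : ℝ) ≤ N := by nlinarith [Nat.cast_nonneg (α := ℝ) Q]
    nlinarith
  have hN0 : (0 : ℝ) < N := Nat.cast_pos.2 hN.pos
  obtain ⟨R, hR, hRK, hRl⟩ := exists_root_floor hK1 hN.one_lt.le
  have hR1 : (1 : ℝ) ≤ R := by exact_mod_cast hR
  have hRK' : (R : ℝ) ^ K ≤ N := by exact_mod_cast hRK
  have hlN : l - Real.log W ≤ Real.log N := by
    have := Real.log_le_log hM hMN
    rw [Real.log_mul (by positivity) hN0.ne', ← hl] at this
    linarith
  have hlR : (l - Real.log W) / K - Real.log 2 ≤ Real.log R :=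
    (sub_le_sub_right (div_le_div_of_nonneg_right hlN hK0.le) _).trans hRl
  have hRr : ((R : ℝ) ^ (r + 1)) ^ 2 ≤ N := by
    rw [← pow_mul]
    exact (pow_le_pow_right₀ hR1 (by omega)).trans hRK'
  have hRN : (R : ℝ) ^ 2 ≤ N := (pow_le_pow_left₀ (by positivity)
    (le_self_pow₀ hR1 (Nat.succ_ne_zero r)) 2).trans hRr
  refine ⟨Q, N, R, hWQ, hN, hN1, ?_, hR, ?_, hRK, ?_, ?_, ?_⟩
  · have : (N₀ : ℝ) ≤ N := le_of_mul_le_mul_left (h6.trans hMN) (by positivity)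
    exact_mod_cast this
  · have : Real.log (w + 1) ≤ Real.log R := by
      refine le_trans ?_ hlR
      rw [le_sub_iff_add_le, le_div_iff₀ hK0]
      linarith
    have := (Real.log_le_log_iff (by positivity) (by positivity)).1 this
    have h : w + 1 ≤ R := by exact_mod_cast this
    omega
  · have : (c₁ ^ 2)⁻¹ < N := lt_of_mul_lt_mul_left (h7.trans_le hMN) (by positivity)
    refine lt_of_pow_lt_pow_left₀ 2 (by positivity) (hRr.trans_lt ?_)
    rw [inv_lt_iff_one_lt_mul₀ (by positivity)] at this
    nlinarith
  · simp only [id_eq, Real.norm_eq_abs, abs_of_pos hM, abs_of_nonneg (sq_nonneg l)] at h1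
    rw [div_mul_eq_mul_div, le_div_iff₀ (by positivity)] at h1
    exact two_mul_level_le (by positivity) h5 (by positivity) hβ hl0 hRN
      ((le_mul_of_one_le_right hN0.le hW1).trans hNW) h1
  · exact density_le hK0 hc hβ (by positivity) hM hl0 h3 hlR (by positivity) hNW

theorem binQF_ne_zero {a b c : ℤ} (ha : a ≠ 0) (hD : ¬∃ m : ℤ, b ^ 2 - 4 * a * c = m ^ 2) {v : ℤ × ℤ}
    (hv : v ≠ 0) : binQF a b c v ≠ 0 := by
  intro h
  have h1 : (2 * a * v.1 + b * v.2) ^ 2 = (b ^ 2 - 4 * a * c) * v.2 ^ 2 := by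
    rw [binQF] at h
    linear_combination 4 * a * h
  by_cases hy : v.2 = 0
  · rw [hy] at h1
    have h2 : 2 * a * v.1 + b * 0 = 0 := pow_eq_zero_iff two_ne_zero |>.1 (by rw [h1]; ring)
    rw [mul_zero, add_zero] at h2
    exact hv (Prod.ext ((mul_eq_zero.1 h2).resolve_left (mul_ne_zero two_ne_zero ha)) hy)
  · obtain ⟨q, hq⟩ := (Int.pow_dvd_pow_iff two_ne_zero).1 (Dvd.intro_left _ h1.symm)
    refine hD ⟨q, mul_right_cancel₀ (pow_ne_zero 2 hy) ?_⟩
    rw [← h1, hq]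
    ring

namespace RealQuad

variable {D : ℤ} {O : Type} [CommRing O] [IsDedekindDomain O] [Module.Free ℤ O] [Module.Finite ℤ O]

theorem exists_constellation (H : RealQuad D O) {a b c : ℤ} (hD : b ^ 2 - 4 * a * c = D) (ha : 0 < a)
    (hsq : ¬∃ m : ℤ, b ^ 2 - 4 * a * c = m ^ 2) {A : Set (ℤ × ℤ)}
    (hA : A ⊆ {v : ℤ × ℤ | 0 < -binQF a b c v ∧ Prime (-binQF a b c v)}) {β : ℝ} (hβ : 0 < β)
    (hdens : ∃ᶠ M in Filter.atTop, 2 * (β * M ^ 2 / Real.log M) ≤ ((A ∩ supBox M).ncard : ℝ))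
    {B : ℕ} (hB : 1 ≤ B) :
    ∃ (v : ℤ × ℤ) (k : ℕ), 0 < k ∧ ∀ e : ℤ × ℤ, |e.1| ≤ B → |e.2| ≤ B → v + k • e ∈ A := by
  classical
  have hm : a * D ≠ 0 := mul_ne_zero ha.ne' H.pos.ne'
  have := H.rayClass_finite hm
  obtain ⟨G, hG⟩ : ∃ G : Finset (ℤ × ℤ), ∀ e, e ∈ G ↔ |e.1| ≤ B ∧ |e.2| ≤ B :=
    ⟨Finset.Icc (-B : ℤ) B ×ˢ Finset.Icc (-B : ℤ) B, fun e => by simp [abs_le]⟩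
  obtain ⟨r, hr⟩ : ∃ r, G.card = r + 1 := Nat.exists_eq_succ_of_ne_zero
    (Finset.card_pos.2 ⟨0, (hG 0).2 (by simp)⟩).ne'
  let s : Fin (r + 1) → ℤ × ℤ := fun j => ((G.equivFinOfCardEq hr).symm j : ℤ × ℤ)
  have hsG : ∀ j, |(s j).1| ≤ B ∧ |(s j).2| ≤ B := fun j => (hG _).1 ((G.equivFinOfCardEq hr).symm j).2
  obtain ⟨D', hsz⟩ := relative_szemeredi r
  obtain ⟨κ, hsieve⟩ := sieveWeight_linForms (a := a) (b := b) (c := c) (fun v => binQF_ne_zero ha.ne' hsq)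
    (Finset.univ.image fun p : Fin (r + 1) × Fin (r + 1) => s p.1 - s p.2) D'
  obtain ⟨c₀, hc₀, C, hC⟩ := H.exists_le_sum_exp_neg_len hm
  obtain ⟨K, hK⟩ : ∃ K, K = max κ (2 * (r + 1)) := ⟨_, rfl⟩
  have hK0 : 0 < K := by omega
  obtain ⟨c₁, hc₁, ε, hε, n, hsz⟩ := hsz (δ := β * c₀ / (288 * K * (1 + B) ^ 2)) (by positivity)
  obtain ⟨w₀, hsieve⟩ := hsieve ε hε
  obtain ⟨w, hw⟩ : ∃ w, w = max w₀ (max (a * D).natAbs 3) := ⟨_, rfl⟩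
  have hwa : a.natAbs ≤ w := by
    have := Nat.le_mul_of_pos_right a.natAbs (Int.natAbs_pos.2 H.pos.ne')
    rw [← Int.natAbs_mul] at this
    omega
  obtain ⟨T, hT⟩ : ∃ T, T = primesAway (a * D) w := ⟨_, rfl⟩
  obtain ⟨W, hW⟩ : ∃ W : ℕ, W = ∏ p ∈ T, (p : ℕ) := ⟨_, rfl⟩
  have hW0 : 0 < W := hW ▸ Finset.prod_pos fun p _ => p.2.pos
  obtain ⟨N₁, hsieve⟩ := hsieve w (by omega) W fun p hp hwp hd => by
    rw [Int.natCast_dvd_natCast, hW, hp.prime.dvd_finset_prod_iff] at hd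
    obtain ⟨q, hq, hpq⟩ := hd
    rw [hT, mem_primesAway] at hq
    exact absurd (Nat.le_of_dvd q.2.pos hpq) (by omega)
  obtain ⟨M, hMA, hM1, Q, N, R, hWQ, hN, hNQ, hN0, hR, hwR, hRK, hRr, hsmall, hdense⟩ :=
    (hdens.and_eventually (eventually_exists_scale (B := B) r (by omega : 2 * (r + 1) ≤ K) hW0 hβ hc₀ hc₁ C w
      (N₁ + n + 2 * B + 1))).exists
  haveI : Fact N.Prime := ⟨hN⟩
  -- the points at which the form takes large values
  obtain ⟨A', hA'⟩ : ∃ A' : Finset (ℤ × ℤ), ∀ v, v ∈ A' ↔ v ∈ A ∩ supBox M ∧ (R : ℤ) < -binQF a b c v :=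
    ⟨((supBox_finite M).subset (fun v (hv : v ∈ {v | v ∈ A ∩ supBox M ∧ (R : ℤ) < -binQF a b c v}) =>
      hv.1.2)).toFinset, fun v => by
        rw [Set.Finite.mem_toFinset, Set.mem_ofPred_eq]⟩
  have hcard : β * M ^ 2 / Real.log M ≤ A'.card := by
    have h1 : (A ∩ supBox M).ncard ≤ A'.card +
        ({v : ℤ × ℤ | 0 < -binQF a b c v ∧ -binQF a b c v ≤ R} ∩ supBox M).ncard := by
      rw [← Set.ncard_coe_finset A']
      refine (Set.ncard_le_ncard (fun v hv => ?_) (A'.finite_toSet.union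
        ((supBox_finite M).subset Set.inter_subset_right))).trans (Set.ncard_union_le _ _)
      by_cases h : (R : ℤ) < -binQF a b c v
      · exact Or.inl ((hA' v).2 ⟨hv, h⟩)
      · exact Or.inr ⟨⟨(hA hv.1).1, not_lt.1 h⟩, hv.2⟩
    have h2 : ((A ∩ supBox M).ncard : ℝ) ≤ A'.card +
        ({v : ℤ × ℤ | 0 < -binQF a b c v ∧ -binQF a b c v ≤ R} ∩ supBox M).ncard := by exact_mod_cast h1
    linarith [ncard_small_values_le (b := b) (c := c) ha.ne' R (by linarith : 0 ≤ M)]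
  have hndvd : ∀ v ∈ A', ∀ p : ℕ, p.Prime → p ≤ R → ¬ (p : ℤ) ∣ binQF a b c v := by
    intro v hv p hp hpR hd
    obtain ⟨h1, h2⟩ := (hA' v).1 hv
    have h3 := (Int.prime_iff_natAbs_prime.1 (hA h1.1).2)
    have h4 := (Nat.prime_dvd_prime_iff_eq hp h3).1 (Int.natCast_dvd.1 ((dvd_neg (α := ℤ)).2 hd))
    omega
  have hA'0 : A'.Nonempty := by
    rw [← Finset.card_pos, ← Nat.cast_pos (α := ℝ)]
    have := Real.log_pos hM1
    exact lt_of_lt_of_le (by positivity) hcard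
  obtain ⟨v₀, hv₀, hfib⟩ := exists_card_fiber_le (a := a) (b := b) (c := c) T A' hA'0 fun v hv p hp =>
    hndvd v hv p p.2 ((mem_primesAway.1 (hT ▸ hp)).1.trans hwR)
  rw [← hW] at hfib
  obtain ⟨Y, hY⟩ : ∃ Y, Y = A'.filter fun v => (W : ℤ) ∣ v.1 - v₀.1 ∧ (W : ℤ) ∣ v.2 - v₀.2 := ⟨_, rfl⟩
  rw [← hY] at hfib
  have hYmem : ∀ v ∈ Y, v ∈ A' ∧ (W : ℤ) ∣ v.1 - v₀.1 ∧ (W : ℤ) ∣ v.2 - v₀.2 := fun v hv => by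
    rwa [hY, Finset.mem_filter] at hv
  have hYA : ∀ v ∈ Y, v ∈ A' := fun v hv => (hYmem v hv).1
  have hres := card_le_card_residues (N := N) hW0 (by nlinarith) hWQ ((hA' v₀).1 hv₀).1.2 Y
    fun v hv => ⟨((hA' v).1 (hYA v hv)).1.2, (hYmem v hv).2⟩
  obtain ⟨b₀, hb₀⟩ : ∃ b₀, b₀ = v₀ - (W : ℤ) • ((Q : ℤ), (Q : ℤ)) := ⟨_, rfl⟩
  rw [← hb₀] at hres
  obtain ⟨μ, hμ⟩ : ∃ μ, μ = sieveMass a b c (sieveSupport w R) := ⟨_, rfl⟩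
  have hμ1 : 1 ≤ μ := hμ ▸ one_le_sieveMass hR
  have hμR : μ ≤ R := hμ ▸ sieveMass_le ha.ne' hwa (by omega)
  have hmass := H.sum_ball_le_sieveMass (w := w) hD ha.ne' (by omega) hR
  rw [← hμ, ← hT] at hmass
  have hmass := (hC _ (Real.log_nonneg (by exact_mod_cast hR))).trans hmass
  rw [Finset.prod_inv_distrib] at hmass
  have hP : 0 < ∏ p ∈ T, (1 - zeroDensity (ZMod p) a b c) := Finset.prod_pos fun p hp => by
    refine sub_pos.2 (zeroDensity_lt_one fun h => ?_)
    rw [ZMod.intCast_zmod_eq_zero_iff_dvd] at h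
    rw [hT, mem_primesAway] at hp
    exact hp.2 (h.mul_right D)
  obtain ⟨P, hPe⟩ : ∃ P, P = ∏ p ∈ T, (1 - zeroDensity (ZMod p) a b c) := ⟨_, rfl⟩
  rw [← hPe] at hmass hP hfib
  obtain ⟨Z, hZ⟩ : ∃ Z : Finset (ZMod N × ZMod N), Z = Finset.univ.filter fun u : ZMod N × ZMod N =>
      (u.1.val ≤ 2 * Q ∧ u.2.val ≤ 2 * Q) ∧ b₀ + (W : ℤ) • lift₂ u ∈ Y := ⟨_, rfl⟩
  rw [← hZ] at hres
  have hZmem : ∀ u, u ∈ Z ↔ (u.1.val ≤ 2 * Q ∧ u.2.val ≤ 2 * Q) ∧ b₀ + (W : ℤ) • lift₂ u ∈ Y := fun u => by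
    simp [hZ]
  have hN0' : (0 : ℝ) < N := Nat.cast_pos.2 hN.pos
  have hW0' : (0 : ℝ) < W := Nat.cast_pos.2 hW0
  let f : ZMod N × ZMod N → ℝ := fun u => if u ∈ Z then μ else 0
  have havg : β * c₀ / (288 * K * (1 + B) ^ 2) ≤ avg f := by
    have h1 : avg f = μ * Z.card / N ^ 2 := by
      simp [avg, f, ZMod.card, sq, mul_comm]
    rw [h1, le_div_iff₀ (by positivity)]
    refine le_of_mul_le_mul_right ?_ (by positivity : (0 : ℝ) < (W : ℝ) ^ 2)
    calc β * c₀ / (288 * K * (1 + B) ^ 2) * N ^ 2 * W ^ 2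
        = β * c₀ / (288 * K * (1 + B) ^ 2) * (N * W) ^ 2 := by ring
      _ ≤ (c₀ * Real.log R - C) * (β * M ^ 2 / Real.log M) := hdense
      _ ≤ (μ * P⁻¹) * (β * M ^ 2 / Real.log M) := by
        have := Real.log_pos hM1
        exact mul_le_mul_of_nonneg_right hmass (by positivity)
      _ ≤ (μ * P⁻¹) * (Z.card * (W ^ 2 * P)) := by
        refine mul_le_mul_of_nonneg_left (hcard.trans (hfib.trans ?_)) (by positivity)
        exact mul_le_mul_of_nonneg_right (Nat.cast_le.2 hres) (by positivity)
      _ = μ * Z.card * W ^ 2 := by field_simp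
  have hinj : Function.Injective fun j => cast₂ (ZMod N) (s j) := by
    intro i j hij
    have hcoord : ∀ x y : ℤ, |x| ≤ B → |y| ≤ B → (x : ZMod N) = y → x = y := by
      intro x y hx hy h
      rw [← sub_eq_zero, ← Int.cast_sub, ZMod.intCast_zmod_eq_zero_iff_dvd] at h
      refine sub_eq_zero.1 (Int.eq_zero_of_abs_lt_dvd h ?_)
      have := abs_le.1 hx
      have := abs_le.1 hy
      rw [abs_lt]
      omega
    refine (G.equivFinOfCardEq hr).symm.injective (Subtype.ext (Prod.ext ?_ ?_))
    · exact hcoord _ _ (hsG i).1 (hsG j).1 (congrArg Prod.fst hij)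
    · exact hcoord _ _ (hsG i).2 (hsG j).2 (congrArg Prod.snd hij)
  have hlin : LinForms (ZMod N) (sieveWeight a b c W w R N b₀) D' (diffSet fun j => cast₂ (ZMod N) (s j)) ε := by
    refine fun ι _ _ hι t ht => hsieve N (by omega) ⟨hN⟩ R hR
      ((Nat.pow_le_pow_right hR (by omega)).trans hRK) b₀ ι hι t fun x hx i => ?_
    obtain ⟨p, hp⟩ := ht x hx i
    rw [← hp]
    exact ⟨s p.1 - s p.2, by simp, by simp [cast₂]⟩
  have hcount := hsz (ZMod N) (ZMod N × ZMod N) (fun m hm0 hmn h => by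
      rw [ZMod.natCast_eq_zero_iff] at h
      exact absurd (Nat.le_of_dvd hm0 h) (by omega)) _ hinj _ f hlin
    (fun u => by
      dsimp only [f]
      split_ifs <;> linarith)
    (fun u => by
      dsimp only [f]
      split_ifs with hu
      · rw [sieveWeight_of_sifted hR fun p hp _ hpR => hndvd _ (hYA _ ((hZmem u).1 hu).2) p hp hpR, hμ]
      · exact div_nonneg (sq_nonneg _) (by linarith)) havg
  obtain ⟨v, k, hk, h⟩ := exists_constellation_of_avg (X := {v | v ∈ Y}) (b₀ := b₀) (s := s) (f := f) (μ := R) hB hNQ hW0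
    (fun e h1 h2 => ⟨G.equivFinOfCardEq hr ⟨e, (hG e).2 ⟨h1, h2⟩⟩, by simp [s]⟩)
    (fun u => by
      dsimp only [f]
      split_ifs <;> linarith)
    (fun u => by
      dsimp only [f]
      split_ifs <;> linarith)
    (fun u hu => (hZmem u).1 (by
      by_contra h
      exact hu (if_neg h))) hcount hRr
  exact ⟨v, k, hk, fun e h1 h2 => ((hA' _).1 (hYA _ (h e h1 h2))).1.1⟩

end RealQuad

theorem constellations_in_qform_negative_prime_values
    (a b c : ℤ) (hprim : Int.gcd a (Int.gcd b c : ℤ) = 1) (ha : 0 < a)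
    (hDpos : 0 < b ^ 2 - 4 * a * c)
    (hD : ¬∃ m : ℤ, b ^ 2 - 4 * a * c = m ^ 2)
    (A : Set (ℤ × ℤ))
    (hA : A ⊆ {v : ℤ × ℤ | 0 < -binQF a b c v ∧ Prime (-binQF a b c v)})
    (hdens : 0 <
      Filter.limsup (fun M : ℝ =>
          ((A ∩ supBox M).ncard : ℝ) /
            ((({v : ℤ × ℤ | 0 < -binQF a b c v ∧ Prime (-binQF a b c v)} ∩ supBox M)).ncard : ℝ))
        Filter.atTop)
    (S : Finset (ℤ × ℤ)) :
    ∃ (v : ℤ × ℤ) (k : ℕ), 0 < k ∧ ∀ s ∈ S, v + k • s ∈ A := by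
  obtain ⟨O, _, _, _, _, ⟨H⟩⟩ := exists_realQuad hDpos fun ⟨m, hm⟩ => hD ⟨m, hm.trans (sq m).symm⟩
  obtain ⟨κ, hκ, M₀, hcard⟩ := H.exists_card_repr hprim ha rfl hD
  obtain ⟨δ, hδ, hfreq⟩ := exists_frequently_of_limsup_pos (fun M => Nat.cast_nonneg _)
    (fun M => Nat.cast_nonneg _) hdens
  obtain ⟨v, k, hk, h⟩ := H.exists_constellation (β := δ * κ / 2) rfl ha hD hA (by positivity)
    ((hfreq.and_eventually (Filter.eventually_ge_atTop M₀)).mono fun M hM => by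
      refine le_trans (le_of_eq ?_) ((mul_le_mul_of_nonneg_left (hcard M hM.2) hδ.le).trans hM.1)
      ring)
    (B := 1 + S.sup fun s => max s.1.natAbs s.2.natAbs) (Nat.le_add_right _ _)
  refine ⟨v, k, hk, fun s hs => ?_⟩
  have := Finset.le_sup (f := fun s : ℤ × ℤ => max s.1.natAbs s.2.natAbs) hs
  obtain ⟨h1, h2⟩ := max_le_iff.1 this
  refine h s ?_ ?_ <;> rw [Int.abs_eq_natAbs]
  · exact_mod_cast h1.trans (Nat.le_add_left _ 1)
  · exact_mod_cast h2.trans (Nat.le_add_left _ 1)
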